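/- Fix an integer k ≥ 3 and λ ∈ (0,1/2). For every p ∈ (λ, 1−λ) there exists a constant C_{k,p} > 0, namely C_{k,p} = lim_{n → ∞, gcd(n,(k−1)!)=1} σ·√(n·p(1−p))/σ_k (where σ is the standard deviation of the degree-≥3 part kAP′(y) of kAP(x) under i.i.d. Bernoulli(p) coordinates, and σ_k is the standard deviation of kAP(x)), such that for every ε > 0 there is a constant C = C(k,λ,ε) with the following property. For every n with gcd(n,(k−1)!) = 1: let x = (x_i)_{i∈ℤ/nℤ} have i.i.d. Bernoulli(p) coordinates, let μ_k and σ_k be the mean and standard deviation of kAP(x), and set Z_k = (kAP(x) − μ_k)/σ_k. Then sup_{z ∈ (ℤ−μ_k)/σ_k} |σ_k·ℙ[Z_k = z] − 𝒩(z)·Σ_{m∈ℤ} C_{k,p}^{−1}·𝒩((pn + √(p(1−p))·z·√n + (1−p)(k−1)(1−z²)/2 − m)/C_{k,p})| ≤ C·n^{ε−1/4}. -/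

import Mathlib

open MeasureTheory ProbabilityTheory Filter
open scoped ENNReal NNReal

noncomputable section

/-- The standard normal density. -/
def stdNormal (z : ℝ) : ℝ := (Real.sqrt (2 * Real.pi))⁻¹ * Real.exp (-(z ^ 2) / 2)

/-- The product Bernoulli(p) measure on `ι → Bool`. -/
def bernoulliPi (ι : Type*) [Fintype ι] [DecidableEq ι] (p : ℝ) : Measure (ι → Bool) :=
  ∑ x : ι → Bool, (∏ i : ι, ENNReal.ofReal (if x i then p else 1 - p)) • Measure.dirac x

/-- The number of `k`-term arithmetic progressions (with common difference between 1 and n/2)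
contained in the subset of `ZMod n` indicated by `x`. -/
def kAPcount (k : ℕ) {n : ℕ} [NeZero n] (x : ZMod n → Bool) : ℕ :=
  ∑ a : ZMod n, ∑ d ∈ Finset.Icc 1 (n / 2), ∏ i ∈ Finset.range k,
    if x (a + ((i * d : ℕ) : ZMod n)) then 1 else 0

/-- The degree-≥3 part `kAP′(y)` of the expansion of the k-AP count in the
normalized variables `y_i = (x_i − p)/√(p(1−p))`. -/
def kAPprime (k : ℕ) (p : ℝ) {n : ℕ} [NeZero n] (x : ZMod n → Bool) : ℝ :=
  ∑ a : ZMod n, ∑ d ∈ Finset.Icc 1 (n / 2), ∑ S ∈ (Finset.range k).powerset,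
    if 3 ≤ S.card then
      p ^ (k - S.card) * Real.sqrt (p * (1 - p)) ^ S.card *
        ∏ i ∈ S,
          (((if x (a + ((i * d : ℕ) : ZMod n)) then (1 : ℝ) else 0) - p) /
            Real.sqrt (p * (1 - p)))
    else 0

/-- The standard deviation of `kAP′(y)` when the coordinates are i.i.d. Bernoulli(p). -/
def kAPprimeSigma (k : ℕ) (p : ℝ) (n : ℕ) : ℝ :=
  if h : n = 0 then 0 else
    haveI : NeZero n := ⟨h⟩
    Real.sqrt (∫ x, (kAPprime k p x - ∫ y, kAPprime k p y ∂(bernoulliPi (ZMod n) p)) ^ 2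
      ∂(bernoulliPi (ZMod n) p))

/-- The standard deviation of the k-AP count when the coordinates are i.i.d. Bernoulli(p). -/
def kAPSigma (k : ℕ) (p : ℝ) (n : ℕ) : ℝ :=
  if h : n = 0 then 0 else
    haveI : NeZero n := ⟨h⟩
    Real.sqrt (∫ x, ((kAPcount k x : ℝ) - ∫ y, (kAPcount k y : ℝ) ∂(bernoulliPi (ZMod n) p)) ^ 2
      ∂(bernoulliPi (ZMod n) p))

end

namespace KAP
local notation:max "υ" p:max => p * (1 - p)
local notation "ⅈ" => Complex.I
open Finset
open scoped Real
open Real (exp cos exp_pos exp_le_exp norm_of_nonneg exp_le_one_iff sq_sqrt norm_eq_abs exp_add add_one_le_exp pi_gt_three le_sqrt_of_sq_le exp_neg pi_lt_d2 cos_le_one)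
open Complex (norm_real norm_exp_ofReal_mul_I real_smul)
open Complex renaming exp → cexp
open Function (update update_of_ne update_self update_comm)
noncomputable section Frame
variable {ι : Type*} [Fintype ι] [DecidableEq ι]
def bw (p : ℝ) (b : Bool) : ℝ := if b then p else 1 - p
def wt (p : ℝ) (x : ι → Bool) : ℝ := ∏ i, bw p (x i)
def Ex {V : Type*} [AddCommGroup V] [Module ℝ V] (p : ℝ) (F : (ι → Bool) → V) : V :=
  ∑ x, wt p x • F x
def mix (A : Finset ι) (x y : ι → Bool) : ι → Bool := fun i => if i ∈ A then y i else x i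
theorem bw_nonneg {p : ℝ} (h0 : 0 ≤ p) (h1 : p ≤ 1) (b : Bool) : 0 ≤ bw p b := by
  cases b <;> simp [bw] <;> linarith
theorem wt_nonneg {p : ℝ} (h0 : 0 ≤ p) (h1 : p ≤ 1) (x : ι → Bool) : 0 ≤ wt p x :=
  prod_nonneg fun _ _ => bw_nonneg h0 h1 _
section gen
variable {V : Type*} [AddCommGroup V] [Module ℝ V] (p : ℝ)
theorem Ex_add (F G : (ι → Bool) → V) : Ex p (fun x => F x + G x) = Ex p F + Ex p G := by
  simp [Ex, smul_add, sum_add_distrib]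
theorem Ex_sub (F G : (ι → Bool) → V) : Ex p (fun x => F x - G x) = Ex p F - Ex p G := by
  simp [Ex, smul_sub, sum_sub_distrib]
theorem Ex_smul (c : ℝ) (F : (ι → Bool) → V) : Ex p (fun x => c • F x) = c • Ex p F := by
  simp [Ex, smul_sum, smul_comm c]
theorem Ex_sum {κ : Type*} (s : Finset κ) (F : κ → (ι → Bool) → V) :
    Ex p (fun x => ∑ j ∈ s, F j x) = ∑ j ∈ s, Ex p (F j) := by
  simp only [Ex, smul_sum]; rw [sum_comm]
theorem Ex_neg (F : (ι → Bool) → V) : Ex p (fun x => - F x) = - Ex p F := by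
  simp [Ex]
theorem Ex_mul_left {R : Type*} [CommRing R] [Algebra ℝ R] (c : R) (F : (ι → Bool) → R) :
    Ex p (fun x => c * F x) = c * Ex p F := by
  simp [Ex, mul_sum]
theorem Ex_mul_right {R : Type*} [CommRing R] [Algebra ℝ R] (c : R) (F : (ι → Bool) → R) :
    Ex p (fun x => F x * c) = Ex p F * c := by
  simp [Ex, sum_mul]
end gen
theorem Ex_prod {R : Type*} [CommRing R] [Algebra ℝ R] (p : ℝ) (h : ι → Bool → R) :
    Ex p (fun x => ∏ i, h i (x i)) = ∏ i, (p • h i true + (1 - p) • h i false) := by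
  have : ∀ i, p • h i true + (1 - p) • h i false = ∑ b : Bool, bw p b • h i b := by
    intro i; simp [bw]
  simp_rw [this]
  rw [prod_univ_sum]
  unfold Ex wt
  rw [Fintype.piFinset_univ]
  refine sum_congr rfl fun x _ => ?_
  simp only [Algebra.smul_def, map_prod, prod_mul_distrib]
theorem wt_sum (p : ℝ) : ∑ x : ι → Bool, wt p x = 1 := by
  have := Ex_prod (ι := ι) p (fun _ _ => (1 : ℝ))
  simpa [Ex] using this
theorem Ex_const {V : Type*} [AddCommGroup V] [Module ℝ V] (p : ℝ) (c : V) :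
    Ex p (fun _ : ι → Bool => c) = c := by
  rw [Ex, ← sum_smul, wt_sum, one_smul]
theorem wt_mix (p : ℝ) (A : Finset ι) (x y : ι → Bool) :
    wt p (mix A x y) * wt p (mix A y x) = wt p x * wt p y := by
  unfold wt
  rw [← prod_mul_distrib, ← prod_mul_distrib]
  refine prod_congr rfl fun i _ => ?_
  by_cases h : i ∈ A <;> simp [mix, h, mul_comm]
theorem mix_mix (A : Finset ι) (x y : ι → Bool) : mix A (mix A x y) (mix A y x) = x := by
  funext i; by_cases h : i ∈ A <;> simp [mix, h]
theorem Ex_mix {V : Type*} [AddCommGroup V] [Module ℝ V] (p : ℝ) (A : Finset ι)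
    (F : (ι → Bool) → V) : Ex p (fun x => Ex p fun y => F (mix A x y)) = Ex p F := by
  have h1 : Ex p (fun x => Ex p fun y => F (mix A x y)) =
      ∑ z : (ι → Bool) × (ι → Bool), (wt p z.1 * wt p z.2) • F (mix A z.1 z.2) := by
    simp only [Ex, smul_sum, smul_smul]
    rw [← univ_product_univ, sum_product]
  have h2 : Ex p F = ∑ z : (ι → Bool) × (ι → Bool), (wt p z.1 * wt p z.2) • F z.1 := by
    rw [← univ_product_univ, sum_product]
    refine sum_congr rfl fun x _ => ?_
    dsimp only
    rw [← sum_smul, ← mul_sum, wt_sum, mul_one]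
  rw [h1, h2]
  refine sum_bij' (fun z _ => (mix A z.1 z.2, mix A z.2 z.1))
    (fun z _ => (mix A z.1 z.2, mix A z.2 z.1)) ?_ ?_ ?_ ?_ ?_
  · simp
  · simp
  · intro z _; simp [mix_mix]
  · intro z _; simp [mix_mix]
  · intro z _; simp only [wt_mix]
theorem Ex_mono {p : ℝ} (h0 : 0 ≤ p) (h1 : p ≤ 1) {F G : (ι → Bool) → ℝ} (h : ∀ x, F x ≤ G x) :
    Ex p F ≤ Ex p G :=
  sum_le_sum fun x _ => mul_le_mul_of_nonneg_left (h x) (wt_nonneg h0 h1 x)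
theorem Ex_nonneg {p : ℝ} (h0 : 0 ≤ p) (h1 : p ≤ 1) {F : (ι → Bool) → ℝ} (h : ∀ x, 0 ≤ F x) :
    0 ≤ Ex p F :=
  sum_nonneg fun x _ => mul_nonneg (wt_nonneg h0 h1 x) (h x)
theorem Ex_norm_le {p : ℝ} (h0 : 0 ≤ p) (h1 : p ≤ 1) {V : Type*} [NormedAddCommGroup V]
    [NormedSpace ℝ V] (F : (ι → Bool) → V) : ‖Ex p F‖ ≤ Ex p (fun x => ‖F x‖) := by
  refine (norm_sum_le _ _).trans (le_of_eq (sum_congr rfl fun x _ => ?_))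
  rw [norm_smul, norm_of_nonneg (wt_nonneg h0 h1 x), smul_eq_mul]
theorem Ex_le_const {p : ℝ} (h0 : 0 ≤ p) (h1 : p ≤ 1) {F : (ι → Bool) → ℝ} {c : ℝ}
    (h : ∀ x, F x ≤ c) : Ex p F ≤ c :=
  (Ex_mono h0 h1 h).trans (le_of_eq (Ex_const p c))
theorem Ex_ofReal (p : ℝ) (F : (ι → Bool) → ℝ) : Ex p (fun x => ((F x : ℝ) : ℂ)) = ((Ex p F : ℝ) : ℂ) := by
  simp [Ex]
theorem Ex_cs {p : ℝ} (h0 : 0 ≤ p) (h1 : p ≤ 1) (F G : (ι → Bool) → ℝ) :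
    (Ex p (fun x => F x * G x)) ^ 2 ≤ Ex p (fun x => F x ^ 2) * Ex p (fun x => G x ^ 2) := by
  have := sum_mul_sq_le_sq_mul_sq univ (fun x => Real.sqrt (wt p x) * F x)
    (fun x => Real.sqrt (wt p x) * G x)
  have e1 : Ex p (fun x => F x * G x) = ∑ x, (Real.sqrt (wt p x) * F x) * (Real.sqrt (wt p x) * G x) :=
    sum_congr rfl fun x _ => by
      have := Real.mul_self_sqrt (wt_nonneg h0 h1 x)
      simp only [smul_eq_mul]
      grind
  have e2 : ∀ F : (ι → Bool) → ℝ, Ex p (fun x => F x ^ 2) = ∑ x, (Real.sqrt (wt p x) * F x) ^ 2 :=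
    fun F => sum_congr rfl fun x _ => by
      simp only [smul_eq_mul, mul_pow, sq_sqrt (wt_nonneg h0 h1 x)]
  rw [e1, e2, e2]; exact this
theorem Ex_sq_le {p : ℝ} (h0 : 0 ≤ p) (h1 : p ≤ 1) (F : (ι → Bool) → ℝ) :
    (Ex p F) ^ 2 ≤ Ex p (fun x => F x ^ 2) := by
  have := Ex_cs h0 h1 F (fun _ => 1)
  simpa [Ex_const] using this
theorem Ex_abs_le {p : ℝ} (h0 : 0 ≤ p) (h1 : p ≤ 1) (F : (ι → Bool) → ℝ) :
    Ex p (fun x => |F x|) ≤ Real.sqrt (Ex p (fun x => F x ^ 2)) := by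
  apply le_sqrt_of_sq_le
  simpa using Ex_sq_le h0 h1 (fun x => |F x|)
theorem Ex_markov {p : ℝ} (h0 : 0 ≤ p) (h1 : p ≤ 1) (F : (ι → Bool) → ℝ) (hF : ∀ x, 0 ≤ F x)
    {c : ℝ} (hc : 0 < c) (P : (ι → Bool) → Prop) [DecidablePred P] (hP : ∀ x, P x → c ≤ F x) :
    Ex p (fun x => if P x then (1 : ℝ) else 0) ≤ Ex p F / c := by
  rw [le_div_iff₀ hc, ← Ex_mul_right]
  refine Ex_mono h0 h1 fun x => ?_
  split_ifs with h
  · simpa using hP x h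
  · simpa using hF x
def Eu {V : Type*} [AddCommGroup V] [Module ℝ V] (p : ℝ) (u : ι) (F : (ι → Bool) → V) :
    (ι → Bool) → V :=
  fun x => p • F (update x u true) + (1 - p) • F (update x u false)
def Du {V : Type*} [AddCommGroup V] (u : ι) (F : (ι → Bool) → V) : (ι → Bool) → V :=
  fun x => F (update x u true) - F (update x u false)
def xi (p : ℝ) (u : ι) (x : ι → Bool) : ℝ := (if x u then 1 else 0) - p
theorem Ex_marg {V : Type*} [AddCommGroup V] [Module ℝ V] (p : ℝ) (u : ι) (h : Bool → V) :
    Ex p (fun y : ι → Bool => h (y u)) = p • h true + (1 - p) • h false := by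
  have key : ∀ b, Ex p (fun y : ι → Bool => if y u = b then (1 : ℝ) else 0) = bw p b := by
    intro b
    have := Ex_prod (ι := ι) p (fun i c => if i = u then (if c = b then (1 : ℝ) else 0) else 1)
    simp only [prod_ite_eq', mem_univ, if_true] at this
    rw [this, prod_eq_single u]
    · cases b <;> simp [bw]
    · simp_all
    · simp
  have h2 : ∀ y : ι → Bool, h (y u) = (if y u = true then (1 : ℝ) else 0) • h true +
      (if y u = false then (1 : ℝ) else 0) • h false := by
    intro y; cases y u <;> simp
  have h3 : ∀ b, Ex p (fun y : ι → Bool => (if y u = b then (1 : ℝ) else 0) • h b) = bw p b • h b := by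
    intro b; rw [← key b]; simp only [Ex, sum_smul, smul_smul, smul_eq_mul]
  simp_rw [h2]
  rw [Ex_add, h3, h3]; simp [bw]
theorem mix_single (u : ι) (x y : ι → Bool) : mix {u} x y = update x u (y u) := by
  funext i; by_cases h : i = u
  · subst h; simp [mix]
  · simp [mix, h]
theorem Ex_Eu {V : Type*} [AddCommGroup V] [Module ℝ V] (p : ℝ) (u : ι) (F : (ι → Bool) → V) :
    Ex p (Eu p u F) = Ex p F := by
  rw [← Ex_mix p {u} F]
  congr 1; funext x
  simp_rw [mix_single]
  rw [Ex_marg p u (fun b => F (update x u b))]; rfl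
theorem Eu_Du (p : ℝ) (u : ι) (F : (ι → Bool) → ℝ) (x : ι → Bool) :
    F x = Eu p u F x + xi p u x * Du u F x := by
  have hx : F x = F (update x u (x u)) := by simp
  rw [hx]
  simp only [Eu, Du, xi, smul_eq_mul]
  grind
theorem Ex_ibp (p : ℝ) (u : ι) (F : (ι → Bool) → ℂ) :
    Ex p (fun x => (xi p u x : ℂ) * F x) = ((υ p : ℝ) : ℂ) * Ex p (Du u F) := by
  rw [← Ex_mul_left, ← Ex_Eu p u]
  congr 1; funext x
  simp only [Eu, xi, Du, update_self]
  simp only [real_smul]; push_cast; simp; ring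
theorem Ex_ibp_real (p : ℝ) (u : ι) (F : (ι → Bool) → ℝ) :
    Ex p (fun x => xi p u x * F x) = υ p * Ex p (Du u F) := by
  rw [← Ex_mul_left, ← Ex_Eu p u]
  congr 1; funext x
  simp only [Eu, xi, Du, update_self, smul_eq_mul]
  simp; ring
theorem Ex_sq_decomp (p : ℝ) (u : ι) (F : (ι → Bool) → ℝ) :
    Ex p (fun x => F x ^ 2) = Ex p (fun x => Eu p u F x ^ 2)
      + υ p * Ex p (fun x => Du u F x ^ 2) := by
  rw [← Ex_mul_left, ← Ex_add, ← Ex_Eu p u (fun x => F x ^ 2)]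
  congr 1; funext x
  simp only [Eu, Du, smul_eq_mul]; ring
theorem xi_abs_le {p : ℝ} (h0 : 0 ≤ p) (h1 : p ≤ 1) (u : ι) (x : ι → Bool) : |xi p u x| ≤ 1 := by
  unfold xi; grind
def Dep {V : Type*} (F : (ι → Bool) → V) (A : Finset ι) : Prop :=
  ∀ x y, (∀ i ∈ A, x i = y i) → F x = F y
theorem Dep.mono {V : Type*} {F : (ι → Bool) → V} {A B : Finset ι} (h : Dep F A) (hAB : A ⊆ B) : Dep F B :=
  fun x y hxy => h x y fun i hi => hxy i (hAB hi)
theorem Dep.mul {R : Type*} [Mul R] {F G : (ι → Bool) → R} {A B : Finset ι} (h : Dep F A) (h' : Dep G B) :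
    Dep (fun x => F x * G x) (A ∪ B) := fun x y hxy => by
  change F x * G x = F y * G y
  rw [h x y fun i hi => hxy i (mem_union_left _ hi),
    h' x y fun i hi => hxy i (mem_union_right _ hi)]
theorem Dep.mul' {R : Type*} [Mul R] {F G : (ι → Bool) → R} {A : Finset ι} (h : Dep F A) (h' : Dep G A) :
    Dep (fun x => F x * G x) A := by simpa using h.mul h'
theorem Dep.sum {κ : Type*} {R : Type*} [AddCommMonoid R] {s : Finset κ} {F : κ → (ι → Bool) → R} {A : Finset ι}
    (h : ∀ j ∈ s, Dep (F j) A) : Dep (fun x => ∑ j ∈ s, F j x) A := fun x y hxy =>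
  sum_congr rfl fun j hj => h j hj x y hxy
theorem Dep.prod {κ : Type*} {R : Type*} [CommMonoid R] {s : Finset κ} {F : κ → (ι → Bool) → R} {A : Finset ι}
    (h : ∀ j ∈ s, Dep (F j) A) : Dep (fun x => ∏ j ∈ s, F j x) A := fun x y hxy =>
  prod_congr rfl fun j hj => h j hj x y hxy
theorem Dep.comp {V V' : Type*} {F : (ι → Bool) → V} {A : Finset ι} (h : Dep F A) (g : V → V') :
    Dep (fun x => g (F x)) A := fun x y hxy => by
  change g (F x) = g (F y); rw [h x y hxy]
theorem Dep.const {V : Type*} (c : V) (A : Finset ι) : Dep (fun _ : ι → Bool => c) A := fun _ _ _ => rfl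
theorem Dep_univ {V : Type*} (F : (ι → Bool) → V) : Dep F univ := fun x y hxy => by
  rw [show x = y from funext fun i => hxy i (mem_univ i)]
theorem Dep_xi (p : ℝ) (u : ι) : Dep (xi p u) {u} := fun x y hxy => by
  simp [xi, hxy u (by simp)]
theorem Ex_indep {R : Type*} [CommRing R] [Algebra ℝ R] (p : ℝ) {F G : (ι → Bool) → R} {A B : Finset ι}
    (hF : Dep F A) (hG : Dep G B) (hAB : Disjoint A B) :
    Ex p (fun x => F x * G x) = Ex p F * Ex p G := by
  rw [← Ex_mix p B]
  have : ∀ x y, F (mix B x y) * G (mix B x y) = F x * G y := by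
    intro x y
    rw [hF (mix B x y) x, hG (mix B x y) y]
    · intro i hi; simp [mix, hi]
    · intro i hi; simp [mix, disjoint_left.mp hAB hi]
  simp_rw [this, Ex_mul_left, Ex_mul_right]
theorem Ex_indep_prod {R : Type*} [CommRing R] [Algebra ℝ R] (p : ℝ) {κ : Type*} [DecidableEq κ] (s : Finset κ)
    (F : κ → (ι → Bool) → R) (A : κ → Finset ι) (hF : ∀ j ∈ s, Dep (F j) (A j))
    (hA : ∀ j ∈ s, ∀ j' ∈ s, j ≠ j' → Disjoint (A j) (A j')) :
    Ex p (fun x => ∏ j ∈ s, F j x) = ∏ j ∈ s, Ex p (F j) := by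
  induction s using Finset.induction_on with
  | empty => simp [Ex_const]
  | insert a s ha ih =>
    simp_rw [prod_insert ha]
    rw [← ih (fun j hj => hF j (mem_insert_of_mem hj)) (fun j hj j' hj' => hA j (mem_insert_of_mem hj) j' (mem_insert_of_mem hj'))]
    refine Ex_indep p (A := A a) (B := s.biUnion A) (hF a (mem_insert_self _ _)) ?_ ?_
    · exact Dep.prod fun j hj => (hF j (mem_insert_of_mem hj)).mono (subset_biUnion_of_mem A hj)
    · rw [disjoint_biUnion_right]
      grind
theorem efron_stein {p : ℝ} (h0 : 0 ≤ p) (h1 : p ≤ 1) (F : (ι → Bool) → ℝ) :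
    Ex p (fun x => (F x - Ex p F) ^ 2) ≤ υ p * ∑ u, Ex p (fun x => Du u F x ^ 2) := by
  have hs : 0 ≤ υ p := mul_nonneg h0 (by linarith)
  have key : ∀ (A : Finset ι) (G : (ι → Bool) → ℝ), Dep G A →
      Ex p (fun x => G x ^ 2) ≤ (Ex p G) ^ 2 + υ p * ∑ u ∈ A, Ex p (fun x => Du u G x ^ 2) := by
    intro A
    induction A using Finset.induction_on with
    | empty =>
      intro G hG
      have : G = fun _ => G (fun _ => true) := funext fun x => hG _ _ (by simp)
      rw [this]; simp [Ex_const]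
    | insert a A ha ih =>
      intro G hG
      have hd : Dep (Eu p a G) A := by
        intro x y hxy
        simp only [Eu]
        rw [hG (update x a true) (update y a true), hG (update x a false) (update y a false)]
        all_goals
          grind
      have h2 := ih _ hd
      rw [Ex_Eu] at h2
      rw [Ex_sq_decomp p a, sum_insert ha]
      have h3 : ∑ u ∈ A, Ex p (fun x => Du u (Eu p a G) x ^ 2) ≤ ∑ u ∈ A, Ex p (fun x => Du u G x ^ 2) := by
        refine sum_le_sum fun u hu => ?_
        have hua : a ≠ u := by rintro rfl; exact ha hu
        rw [← Ex_Eu p a (fun x => Du u G x ^ 2)]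
        refine Ex_mono h0 h1 fun x => ?_
        simp only [Eu, Du, smul_eq_mul]
        rw [update_comm hua, update_comm hua, update_comm hua, update_comm hua]
        nlinarith [mul_nonneg hs (sq_nonneg ((G (update (update x u true) a true) - G (update (update x u false) a true)) - (G (update (update x u true) a false) - G (update (update x u false) a false))))]
      have := mul_le_mul_of_nonneg_left h3 hs
      linarith
  have h := key univ F (Dep_univ F)
  have : Ex p (fun x => (F x - Ex p F) ^ 2) = Ex p (fun x => F x ^ 2) - (Ex p F) ^ 2 := by
    have : (fun x => (F x - Ex p F) ^ 2) = fun x => (F x ^ 2 - (2 * Ex p F) * F x) + Ex p F ^ 2 := by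
      funext x; ring
    rw [this, Ex_add, Ex_sub, Ex_const, Ex_mul_left]; ring
  linarith
def Deg (d : ℕ) (F : (ι → Bool) → ℝ) : Prop :=
  F ∈ Submodule.span ℝ {g : (ι → Bool) → ℝ | ∃ B : Finset ι, B.card ≤ d ∧ Dep g B}
theorem Deg.mono {d e : ℕ} {F : (ι → Bool) → ℝ} (h : Deg d F) (hde : d ≤ e) : Deg e F :=
  Submodule.span_mono (by grind) h
theorem Deg.add {d : ℕ} {F G : (ι → Bool) → ℝ} (h : Deg d F) (h' : Deg d G) : Deg d (fun x => F x + G x) :=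
  Submodule.add_mem _ h h'
theorem Deg.sub {d : ℕ} {F G : (ι → Bool) → ℝ} (h : Deg d F) (h' : Deg d G) : Deg d (fun x => F x - G x) :=
  Submodule.sub_mem _ h h'
theorem Deg.smul {d : ℕ} {F : (ι → Bool) → ℝ} (c : ℝ) (h : Deg d F) : Deg d (fun x => c * F x) :=
  Submodule.smul_mem _ c h
theorem Deg.of_dep {d : ℕ} {F : (ι → Bool) → ℝ} {B : Finset ι} (h : Dep F B) (hB : B.card ≤ d) : Deg d F :=
  Submodule.subset_span ⟨B, hB, h⟩
theorem Deg.const {d : ℕ} (c : ℝ) : Deg d (fun _ : ι → Bool => c) :=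
  Deg.of_dep (Dep.const c ∅) (by simp)
theorem Deg.sum {κ : Type*} {d : ℕ} {s : Finset κ} {F : κ → (ι → Bool) → ℝ} (h : ∀ j ∈ s, Deg d (F j)) :
    Deg d (fun x => ∑ j ∈ s, F j x) := by
  have : (fun x => ∑ j ∈ s, F j x) = ∑ j ∈ s, F j := by funext x; simp
  rw [this]; exact Submodule.sum_mem _ h
theorem Deg.mul {d e : ℕ} {F G : (ι → Bool) → ℝ} (h : Deg d F) (h' : Deg e G) :
    Deg (d + e) (fun x => F x * G x) := by
  refine Submodule.span_induction (p := fun F _ => Deg (d + e) (fun x => F x * G x)) ?_ ?_ ?_ ?_ h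
  · rintro F ⟨A, hA, hF⟩
    refine Submodule.span_induction (p := fun G _ => Deg (d + e) (fun x => F x * G x)) ?_ ?_ ?_ ?_ h'
    · rintro G ⟨B, hB, hG⟩
      exact Deg.of_dep (hF.mul hG) ((card_union_le _ _).trans (add_le_add hA hB))
    · simpa using Deg.const 0
    · intro G G' _ _ h1 h2
      simpa [mul_add] using h1.add h2
    · intro a G _ h1
      simpa [mul_left_comm] using h1.smul a
  · simpa using Deg.const 0
  · intro G G' _ _ h1 h2
    simpa [add_mul] using h1.add h2
  · intro a G _ h1
    simpa [mul_assoc] using h1.smul a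
theorem Deg.sq {d : ℕ} {F : (ι → Bool) → ℝ} (h : Deg d F) : Deg (2 * d) (fun x => F x ^ 2) := by
  have := h.mul h
  grind
theorem Deg.Eu {d : ℕ} {F : (ι → Bool) → ℝ} (p : ℝ) (u : ι) (h : Deg d F) : Deg d (Eu p u F) := by
  refine Submodule.span_induction (p := fun F _ => Deg d (KAP.Eu p u F)) ?_ ?_ ?_ ?_ h
  · rintro F ⟨A, hA, hF⟩
    refine Deg.of_dep (B := A) (fun x y hxy => ?_) hA
    simp only [KAP.Eu]
    rw [hF (update x u true) (update y u true), hF (update x u false) (update y u false)]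
    all_goals
      grind
  · have := Deg.const (ι := ι) (d := d) 0
    unfold KAP.Eu; simpa using this
  · intro G G' _ _ h1 h2
    have := h1.add h2
    convert this using 1
    funext x; simp [KAP.Eu]; ring
  · intro a G _ h1
    have := h1.smul a
    convert this using 1
    funext x; simp [KAP.Eu]; ring
theorem Deg.Du {d : ℕ} {F : (ι → Bool) → ℝ} (u : ι) (h : Deg (d + 1) F) : Deg d (Du u F) := by
  refine Submodule.span_induction (p := fun F _ => Deg d (KAP.Du u F)) ?_ ?_ ?_ ?_ h
  · rintro F ⟨A, hA, hF⟩
    by_cases hu : u ∈ A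
    · refine Deg.of_dep (B := A.erase u) (fun x y hxy => ?_) (by rw [card_erase_of_mem hu]; omega)
      simp only [KAP.Du]
      rw [hF (update x u true) (update y u true), hF (update x u false) (update y u false)]
      all_goals
        grind
    · have : KAP.Du u F = fun _ => 0 := by
        funext x
        simp only [KAP.Du]
        rw [hF (update x u true) (update x u false), sub_self]
        intro i hi
        have : i ≠ u := by rintro rfl; exact hu hi
        simp [update_of_ne this]
      rw [this]; exact Deg.const 0
  · have := Deg.const (ι := ι) (d := d) 0
    unfold KAP.Du; simpa using this
  · intro G G' _ _ h1 h2
    have := h1.add h2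
    convert this using 1
    funext x; simp [KAP.Du]; ring
  · intro a G _ h1
    have := h1.smul a
    convert this using 1
    funext x; simp [KAP.Du]; ring
theorem Deg.Du_zero {F : (ι → Bool) → ℝ} (u : ι) (h : Deg 0 F) : KAP.Du u F = fun _ => 0 := by
  refine Submodule.span_induction (p := fun F _ => KAP.Du u F = fun _ => 0) ?_ ?_ ?_ ?_ h
  · rintro F ⟨A, hA, hF⟩
    have : A = ∅ := by simpa using hA
    subst this
    funext x; simp only [KAP.Du]; rw [hF _ (update x u false) (by simp), sub_self]
  · funext x; simp [KAP.Du]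
  · intro G G' _ _ h1 h2
    funext x
    have h3 := congrFun h1 x; have h4 := congrFun h2 x
    simp only [KAP.Du, Pi.add_apply] at *; linarith
  · intro a G _ h1
    funext x
    have h3 := congrFun h1 x
    simp only [KAP.Du, Pi.smul_apply, smul_eq_mul] at *; grind
theorem Dep.Eu' {G : (ι → Bool) → ℝ} {a : ι} {A : Finset ι} (p : ℝ) (hG : Dep G (insert a A)) :
    Dep (KAP.Eu p a G) A ∧ Dep (KAP.Du a G) A := by
  have h : ∀ x y : ι → Bool, (∀ i ∈ A, x i = y i) → ∀ b, G (update x a b) = G (update y a b) := by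
    intro x y hxy b
    apply hG; intro i hi
    by_cases h : i = a
    · subst h; simp
    · grind
  constructor <;> intro x y hxy <;> simp only [KAP.Eu, KAP.Du, h x y hxy]
theorem bonami {p : ℝ} (h0 : 0 < p) (h1 : p < 1) (s : Finset ι) : ∀ (d : ℕ) (F : (ι → Bool) → ℝ),
    Dep F s → Deg d F →
    Ex p (fun x => F x ^ 4) ≤ (16 / υ p) ^ d * (Ex p (fun x => F x ^ 2)) ^ 2 := by
  have hs : 0 < υ p := mul_pos h0 (by linarith)
  have hs1 : υ p ≤ 1 := by nlinarith
  set s2 := υ p with hs2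
  set K := 16 / s2 with hK
  have hKp : 1 ≤ K := by rw [hK, le_div_iff₀ hs]; linarith
  have hKs : K * s2 = 16 := by rw [hK]; field_simp
  induction s using Finset.induction_on with
  | empty =>
    intro d F hF _
    have : F = fun _ => F (fun _ => true) := funext fun x => hF _ _ (by simp)
    rw [this]; simp only [Ex_const]
    have : 1 ≤ K ^ d := one_le_pow₀ hKp
    nlinarith [sq_nonneg (F (fun _ => true)^2)]
  | insert u s hu ih =>
    intro d F hF hd
    obtain ⟨hG, hD⟩ := hF.Eu' p
    have hpt : Ex p (fun x => F x ^ 4) ≤ Ex p (fun x => KAP.Eu p u F x ^ 4) +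
        (8 * s2) * Ex p (fun x => KAP.Eu p u F x ^ 2 * KAP.Du u F x ^ 2) +
        (3 * s2) * Ex p (fun x => KAP.Du u F x ^ 4) := by
      rw [← Ex_mul_left, ← Ex_mul_left, ← Ex_add, ← Ex_add, ← Ex_Eu p u (fun x => F x ^ 4)]
      refine Ex_mono h0.le h1.le fun x => ?_
      simp only [KAP.Eu, KAP.Du, smul_eq_mul]
      generalize F (update x u true) = a
      generalize F (update x u false) = b
      obtain ⟨g, hg⟩ : ∃ g, g = p * a + (1 - p) * b := ⟨_, rfl⟩
      obtain ⟨D, hD⟩ : ∃ D, D = a - b := ⟨_, rfl⟩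
      have ha : a = g + (1 - p) * D := by rw [hg, hD]; ring
      have hb : b = g - p * D := by rw [hg, hD]; ring
      rw [← hg, ← hD, ha, hb]
      have e : p * (g + (1 - p) * D) ^ 4 + (1 - p) * (g - p * D) ^ 4 =
        g ^ 4 + s2 * (6 * (g^2*D^2) + 4 * (1 - 2*p) * (g * D^3) + (1 - 3 * s2) * D^4) := by
        rw [hs2]; ring
      rw [e]
      have : 6 * (g^2*D^2) + 4 * (1 - 2*p) * (g * D^3) + (1 - 3 * s2) * D^4 ≤ 8 * (g^2*D^2) + 3 * D^4 := by
        have h4 : (1 - 2 * p)^2 ≤ 1 := by nlinarith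
        have : 4 * (1 - 2*p) * (g * D^3) ≤ 2 * (g^2*D^2) + 2 * ((1-2*p)^2 * D^4) := by
          nlinarith [sq_nonneg (g * D - (1-2*p) * D^2)]
        have h5 : 0 ≤ D^4 := by positivity
        nlinarith
      nlinarith
    have hsq := Ex_sq_decomp p u F
    rw [← hs2] at hsq
    set a := Ex p (fun x => KAP.Eu p u F x ^ 2) with ha
    set b := Ex p (fun x => KAP.Du u F x ^ 2) with hb
    have ha0 : 0 ≤ a := Ex_nonneg h0.le h1.le fun x => sq_nonneg _
    have hb0 : 0 ≤ b := Ex_nonneg h0.le h1.le fun x => sq_nonneg _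
    have hG4 := ih d _ hG (hd.Eu p u)
    rw [← ha] at hG4
    rw [hsq]
    cases d with
    | zero =>
      have hz := Deg.Du_zero u hd
      rw [hz] at hpt
      simp only [Ex_const, ne_eq, OfNat.ofNat_ne_zero, not_false_eq_true, zero_pow, mul_zero, add_zero, pow_zero, one_mul] at hpt hG4 ⊢
      nlinarith [mul_nonneg hs.le hb0, mul_nonneg ha0 (mul_nonneg hs.le hb0)]
    | succ d =>
      have hD4 := ih d _ hD (hd.Du u)
      rw [← hb] at hD4
      have hcs := Ex_cs h0.le h1.le (fun x => KAP.Eu p u F x ^ 2) (fun x => KAP.Du u F x ^ 2)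
      simp only [← pow_mul] at hcs
      norm_num at hcs
      set M := Ex p (fun x => KAP.Eu p u F x ^ 2 * KAP.Du u F x ^ 2)
      set g4 := Ex p (fun x => KAP.Eu p u F x ^ 4)
      set d4 := Ex p (fun x => KAP.Du u F x ^ 4)
      have hd40 : 0 ≤ d4 := Ex_nonneg h0.le h1.le fun x => by positivity
      have hKd : 0 < K ^ d := by positivity
      rw [pow_succ] at *
      have hM : M ≤ K ^ d * K / 4 * (a * b) := by
        have h5 : g4 * d4 ≤ (K ^ d * K * a ^ 2) * (K ^ d * b ^ 2) :=
          mul_le_mul hG4 hD4 hd40 (by positivity)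
        refine abs_le_of_sq_le_sq' ?_ (by positivity) |>.2
        have h6 : (K ^ d * K / 4 * (a * b))^2 = (K ^ d * K * a ^ 2) * (K ^ d * b ^ 2) * (K / 16) := by ring
        have h7 : 1 ≤ K / 16 := by rw [hK]; rw [div_div, le_div_iff₀ (by positivity)]; linarith
        have h8 : 0 ≤ (K ^ d * K * a ^ 2) * (K ^ d * b ^ 2) := by positivity
        rw [h6]; nlinarith
      have e1 : 8 * s2 * M ≤ K^d * K * (2 * s2 * (a * b)) := by
        have := mul_le_mul_of_nonneg_left hM (by positivity : 0 ≤ 8 * s2)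
        linarith
      have e2 : 3 * s2 * d4 ≤ K^d * K * (s2^2 * b^2) := by
        have h9 := mul_le_mul_of_nonneg_left hD4 (by positivity : 0 ≤ 3 * s2)
        have h10 : K^d * K * (s2^2 * b^2) = (K * s2) * s2 * (K^d * b^2) := by ring
        rw [h10, hKs]
        have : 0 ≤ s2 * (K^d * b^2) := by positivity
        nlinarith
      nlinarith
def hcC (p : ℝ) : ℕ → ℕ → ℝ
  | 0, _ => 1
  | j + 1, d => hcC p j (2 * d) * ((16 / υ p) ^ d) ^ (2 ^ j)
theorem hcC_pos {p : ℝ} (h0 : 0 < p) (h1 : p < 1) (j : ℕ) : ∀ d, 0 < hcC p j d := by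
  have hs : 0 < υ p := mul_pos h0 (by linarith)
  induction j with
  | zero => intro d; simp [hcC]
  | succ j ih => intro d; have := ih (2 * d); simp only [hcC]; positivity
theorem hyper {p : ℝ} (h0 : 0 < p) (h1 : p < 1) (j : ℕ) : ∀ (d : ℕ) (F : (ι → Bool) → ℝ), Deg d F →
    Ex p (fun x => F x ^ (2 ^ (j + 1))) ≤ hcC p j d * (Ex p (fun x => F x ^ 2)) ^ (2 ^ j) := by
  have hs : 0 < υ p := mul_pos h0 (by linarith)
  induction j with
  | zero => intro d F _; simp [hcC]
  | succ j ih =>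
    intro d F hF
    have h := ih (2 * d) _ hF.sq
    have hb := bonami h0 h1 univ d F (Dep_univ F) hF
    simp only [← pow_mul] at h
    have e4 : Ex p (fun x => F x ^ (2 * 2)) = Ex p (fun x => F x ^ 4) := by norm_num
    rw [show 2 * 2 ^ (j + 1) = 2 ^ (j + 1 + 1) by ring, e4] at h
    refine h.trans ?_
    have hp := hcC_pos h0 h1 j (2 * d)
    simp only [hcC]
    rw [mul_assoc]
    refine mul_le_mul_of_nonneg_left ?_ hp.le
    refine (pow_le_pow_left₀ (Ex_nonneg h0.le h1.le fun x => by positivity) hb _).trans (le_of_eq ?_)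
    rw [mul_pow, ← pow_mul (Ex p fun x => F x ^ 2)]; congr 2; ring
theorem hyper_tail {p : ℝ} (h0 : 0 < p) (h1 : p < 1) (j d : ℕ) (F : (ι → Bool) → ℝ) (hF : Deg d F)
    {v l : ℝ} (hv : 0 < v) (hl : 0 < l) (hv2 : Ex p (fun x => F x ^ 2) ≤ v ^ 2)
    (P : (ι → Bool) → Prop) [DecidablePred P] (hP : ∀ x, P x → l * v ≤ |F x|) :
    Ex p (fun x => if P x then (1 : ℝ) else 0) ≤ hcC p j d / l ^ (2 ^ (j + 1)) := by
  have hc := hcC_pos h0 h1 j d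
  have he : Even (2 ^ (j + 1)) := by simp [Nat.even_pow]
  refine (Ex_markov h0.le h1.le (fun x => F x ^ (2 ^ (j + 1))) (fun x => he.pow_nonneg _)
    (c := (l * v) ^ (2 ^ (j + 1))) (by positivity) P ?_).trans ?_
  · intro x hx
    rw [← he.pow_abs (F x)]
    exact pow_le_pow_left₀ (by positivity) (hP x hx) _
  · rw [div_le_div_iff₀ (by positivity) (by positivity)]
    have h := hyper h0 h1 j d F hF
    have h2 : (Ex p (fun x => F x ^ 2)) ^ (2 ^ j) ≤ v ^ (2 ^ (j + 1)) := by
      refine (pow_le_pow_left₀ (Ex_nonneg h0.le h1.le fun x => sq_nonneg _) hv2 _).trans (le_of_eq ?_)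
      rw [← pow_mul]; congr 1; ring
    rw [mul_pow, mul_comm (l ^ _), ← mul_assoc]
    refine mul_le_mul_of_nonneg_right (h.trans (mul_le_mul_of_nonneg_left h2 hc.le)) (by positivity)
end Frame
noncomputable section Blocks
variable {ι : Type*} [Fintype ι] [DecidableEq ι]
variable {p : ℝ} (h0 : 0 < p) (h1 : p < 1)
def xiS (p : ℝ) (B : Finset ι) (x : ι → Bool) : ℝ := ∏ i ∈ B, xi p i x
theorem xiS_abs_le {p : ℝ} (h0 : 0 ≤ p) (h1 : p ≤ 1) (B : Finset ι) (x : ι → Bool) : |xiS p B x| ≤ 1 := by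
  unfold xiS; rw [abs_prod]
  exact prod_le_one (fun _ _ => abs_nonneg _) fun i _ => xi_abs_le h0 h1 i x
theorem Dep_xiS (p : ℝ) (B : Finset ι) : Dep (xiS p B) B :=
  Dep.prod fun j hj => (Dep_xi p j).mono (by simpa using hj)
theorem Ex_xiS (p : ℝ) (A B : Finset ι) :
    Ex p (fun x => xiS p A x * xiS p B x) = if A = B then (υ p) ^ A.card else 0 := by
  have h : ∀ x : ι → Bool, xiS p A x * xiS p B x =
      ∏ i, ((if i ∈ A then (if x i then (1:ℝ) else 0) - p else 1) * (if i ∈ B then (if x i then (1:ℝ) else 0) - p else 1)) := by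
    intro x
    rw [prod_mul_distrib, prod_ite_mem, prod_ite_mem]
    simp [xiS, xi]
  simp_rw [h]
  rw [Ex_prod p (fun i b => ((if i ∈ A then (if b then (1:ℝ) else 0) - p else 1) * (if i ∈ B then (if b then (1:ℝ) else 0) - p else 1)))]
  by_cases hAB : A = B
  · subst hAB
    rw [if_pos (rfl : A = A)]
    rw [← prod_const, show ∏ _i ∈ A, υ p = ∏ i, if i ∈ A then p * (1 - p) else 1 by
      rw [prod_ite_mem]; simp]
    refine prod_congr rfl fun i _ => ?_
    by_cases hi : i ∈ A <;> simp [hi] <;> ring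
  · rw [if_neg hAB]
    obtain ⟨i, hi⟩ : ∃ i, ¬ (i ∈ A ↔ i ∈ B) := by
      grind
    refine prod_eq_zero (mem_univ i) ?_
    by_cases hA : i ∈ A <;> by_cases hB : i ∈ B <;> simp_all <;> ring
include h0 h1 in
theorem s2_bd : 0 < υ p ∧ υ p ≤ 1 :=
  ⟨mul_pos h0 (by linarith), by nlinarith⟩
theorem Ex_sq_sum {κ : Type*} (p : ℝ) (J : Finset κ) (c : κ → ℝ) (E : κ → Finset ι) :
    Ex p (fun x => (∑ j ∈ J, c j * xiS p (E j) x) ^ 2) =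
      ∑ i ∈ J, ∑ j ∈ J, c i * c j * (if E i = E j then (υ p) ^ (E i).card else 0) := by
  simp_rw [sq, sum_mul_sum, Ex_sum]
  refine sum_congr rfl fun i _ => sum_congr rfl fun j _ => ?_
  rw [← Ex_xiS, ← Ex_mul_left]
  congr 1; funext x; ring
include h0 h1 in
theorem orth {κ : Type*} (J : Finset κ) (c : κ → ℝ) (E : κ → Finset ι)
    (M : ℕ) (hc : ∀ j ∈ J, |c j| ≤ 1) (hM : ∀ i ∈ J, (J.filter fun j => E i = E j).card ≤ M) :
    Ex p (fun x => (∑ j ∈ J, c j * xiS p (E j) x) ^ 2) ≤ M * J.card := by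
  have hs := s2_bd h0 h1
  rw [Ex_sq_sum]
  calc _ ≤ ∑ i ∈ J, (M : ℝ) := by
        refine sum_le_sum fun i hi => ?_
        calc _ ≤ ∑ j ∈ J, (if E i = E j then (1 : ℝ) else 0) := by
              refine sum_le_sum fun j hj => ?_
              split_ifs
              · have h2 : |c i * c j| ≤ 1 := by
                  rw [abs_mul]; exact mul_le_one₀ (hc i hi) (abs_nonneg _) (hc j hj)
                have h3 : (υ p) ^ (E i).card ≤ 1 := pow_le_one₀ hs.1.le hs.2
                have h4 : 0 ≤ (υ p) ^ (E i).card := pow_nonneg hs.1.le _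
                nlinarith [le_abs_self (c i * c j)]
              · simp
          _ = ((J.filter fun j => E i = E j).card : ℝ) := by simp
          _ ≤ M := by exact_mod_cast hM i hi
    _ = M * J.card := by simp [mul_comm]
include h0 h1 in
theorem orth_lower {κ : Type*} [DecidableEq κ] (J : Finset κ) (c : κ → ℝ) (E : κ → Finset ι)
    (cl : ℝ) (hcl : 0 ≤ cl) (k : ℕ) (hc : ∀ j ∈ J, cl ≤ c j) (hk : ∀ j ∈ J, (E j).card ≤ k) :
    cl ^ 2 * (υ p) ^ k * J.card ≤ Ex p (fun x => (∑ j ∈ J, c j * xiS p (E j) x) ^ 2) := by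
  have hs := s2_bd h0 h1
  rw [Ex_sq_sum]
  calc _ = ∑ i ∈ J, cl ^ 2 * (υ p) ^ k := by simp [mul_comm]
    _ ≤ _ := by
        refine sum_le_sum fun i hi => ?_
        have hnn : ∀ j ∈ J, 0 ≤ c i * c j * (if E i = E j then (υ p) ^ (E i).card else 0) := by
          intro j hj
          refine mul_nonneg (mul_nonneg (hcl.trans (hc i hi)) (hcl.trans (hc j hj))) ?_
          split_ifs
          · exact pow_nonneg hs.1.le _
          · exact le_rfl
        refine le_trans ?_ (single_le_sum hnn hi)
        rw [if_pos rfl]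
        refine mul_le_mul ?_ (pow_le_pow_of_le_one hs.1.le hs.2 (hk i hi)) (pow_nonneg hs.1.le _) ?_
        · rw [sq]; exact mul_le_mul (hc i hi) (hc i hi) hcl (hcl.trans (hc i hi))
        · exact mul_nonneg (hcl.trans (hc i hi)) (hcl.trans (hc i hi))
structure Blk (ι : Type*) [Fintype ι] [DecidableEq ι] (τ : Type*) [DecidableEq τ] (k K : ℕ) (cl : ℝ) where
  I : Finset τ
  B : τ → Finset ι
  c : τ → ℝ
  card3 : ∀ t ∈ I, 3 ≤ (B t).card
  cardk : ∀ t ∈ I, (B t).card ≤ k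
  clpos : 0 < cl
  clo : ∀ t ∈ I, cl ≤ c t
  chi : ∀ t ∈ I, c t ≤ 1
  star : ∀ x y, x ≠ y → (I.filter fun t => x ∈ B t ∧ y ∈ B t).card ≤ K
  deg : ∀ x, Fintype.card ι - 1 ≤ (I.filter fun t => x ∈ B t).card
namespace Blk
variable {τ : Type*} [DecidableEq τ] {k K : ℕ} {cl : ℝ} (b : Blk ι τ k K cl)
def W (p : ℝ) (x : ι → Bool) : ℝ := ∑ t ∈ b.I, b.c t * xiS p (b.B t) x
theorem cabs {t : τ} (ht : t ∈ b.I) : |b.c t| ≤ 1 := by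
  rw [abs_of_pos (b.clpos.trans_le (b.clo t ht))]; exact b.chi t ht
theorem cntx (x : ι) : (b.I.filter fun t => x ∈ b.B t).card ≤ K * Fintype.card ι := by
  have : (b.I.filter fun t => x ∈ b.B t) ⊆ (univ.erase x).biUnion fun y => b.I.filter fun t => x ∈ b.B t ∧ y ∈ b.B t := by
    intro t ht
    rw [mem_filter] at ht
    have h3 := b.card3 t ht.1
    obtain ⟨y, hy, hxy⟩ := exists_mem_ne (by omega : 1 < (b.B t).card) x
    simp only [mem_biUnion, mem_erase, mem_univ, and_true, mem_filter]
    exact ⟨y, hxy, ht.1, ht.2, hy⟩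
  refine (card_le_card this).trans ?_
  refine (card_biUnion_le_card_mul _ _ K fun y hy => b.star x y (ne_of_mem_erase hy).symm).trans ?_
  rw [mul_comm]; exact Nat.mul_le_mul_left _ (card_le_univ _)
theorem cntI : b.I.card ≤ K * Fintype.card ι ^ 2 := by
  have : b.I ⊆ univ.biUnion fun x => b.I.filter fun t => x ∈ b.B t := by
    intro t ht
    have h3 := b.card3 t ht
    obtain ⟨x, hx⟩ : (b.B t).Nonempty := card_pos.mp (by omega)
    simp only [mem_biUnion, mem_univ, true_and, mem_filter]
    exact ⟨x, ht, hx⟩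
  refine (card_le_card this).trans ?_
  refine (card_biUnion_le_card_mul _ _ _ fun y _ => b.cntx y).trans (le_of_eq ?_)
  rw [card_univ]; ring
def sub2 (E : Finset ι) : Finset τ := b.I.filter fun t => 2 ≤ (b.B t ∩ E).card
theorem card_sub2 (E : Finset ι) : (b.sub2 E).card ≤ K * E.card ^ 2 := by
  have : b.sub2 E ⊆ E.offDiag.biUnion fun z => b.I.filter fun t => z.1 ∈ b.B t ∧ z.2 ∈ b.B t := by
    intro t ht
    rw [sub2, mem_filter] at ht
    obtain ⟨x, hx, y, hy, hxy⟩ := one_lt_card.mp ht.2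
    simp only [mem_inter] at hx hy
    simp only [mem_biUnion, mem_offDiag, mem_filter]
    exact ⟨(x, y), ⟨hx.2, hy.2, hxy⟩, ht.1, hx.1, hy.1⟩
  refine (card_le_card this).trans ?_
  refine (card_biUnion_le_card_mul _ _ K fun z hz => b.star z.1 z.2 (mem_offDiag.mp hz).2.2).trans ?_
  rw [mul_comm, offDiag_card, sq]; exact Nat.mul_le_mul_left _ (Nat.sub_le _ _)
end Blk
end Blocks
noncomputable section QL
variable {ι : Type*} [Fintype ι] [DecidableEq ι]
theorem Du_zero_of_dep {V : Type*} [AddCommGroup V] {F : (ι → Bool) → V} {A : Finset ι} (h : Dep F A) {v : ι} (hv : v ∉ A)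
    (x : ι → Bool) : Du v F x = 0 := by
  unfold Du
  rw [h (update x v true) (update x v false), sub_self]
  grind
theorem Du_sum {κ : Type*} {V : Type*} [AddCommGroup V] (s : Finset κ) (F : κ → (ι → Bool) → V) (v : ι) (x : ι → Bool) :
    Du v (fun x => ∑ j ∈ s, F j x) x = ∑ j ∈ s, Du v (F j) x := by
  simp [Du, sum_sub_distrib]
theorem Du_abs_le {F : (ι → Bool) → ℝ} {M : ℝ} (h : ∀ x, |F x| ≤ M) (v : ι) (x : ι → Bool) : |Du v F x| ≤ 2 * M := by
  unfold Du
  grind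
theorem Ex_center {p : ℝ} (h0 : 0 ≤ p) (h1 : p ≤ 1) (F : (ι → Bool) → ℝ) (a : ℝ) :
    Ex p (fun x => (F x - Ex p F) ^ 2) ≤ Ex p (fun x => (F x - a) ^ 2) := by
  have : ∀ a : ℝ, Ex p (fun x => (F x - a) ^ 2) = Ex p (fun x => F x ^ 2) - 2 * a * Ex p F + a ^ 2 := by
    intro a
    have : (fun x => (F x - a) ^ 2) = fun x => (F x ^ 2 - (2 * a) * F x) + a ^ 2 := by
      funext x; ring
    rw [this, Ex_add, Ex_sub, Ex_const, Ex_mul_left]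
  rw [this, this]; nlinarith [sq_nonneg (a - Ex p F)]
namespace Blk
variable {τ : Type*} [DecidableEq τ] {k K : ℕ} {cl : ℝ} (b : Blk ι τ k K cl)
def Qf (p : ℝ) (T : Finset ι) (w1 w2 : ι → τ → ℝ) (x : ι → Bool) : ℝ :=
  ∑ u ∈ T, (∑ t ∈ b.I.filter (fun t => u ∈ b.B t), w1 u t * xiS p ((b.B t).erase u) x) *
    (∑ t ∈ b.I.filter (fun t => u ∈ b.B t), w2 u t * xiS p ((b.B t).erase u) x)
def X (T : Finset ι) : Finset (ι × τ × τ) :=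
  (T ×ˢ b.I ×ˢ b.I).filter fun z => z.1 ∈ b.B z.2.1 ∧ z.1 ∈ b.B z.2.2
theorem mem_X {T : Finset ι} {z : ι × τ × τ} : z ∈ b.X T ↔
    z.1 ∈ T ∧ z.2.1 ∈ b.I ∧ z.2.2 ∈ b.I ∧ z.1 ∈ b.B z.2.1 ∧ z.1 ∈ b.B z.2.2 := by
  simp [X, and_assoc]
theorem Qf_eq (p : ℝ) (T : Finset ι) (w1 w2 : ι → τ → ℝ) (x : ι → Bool) :
    b.Qf p T w1 w2 x = ∑ z ∈ b.X T, w1 z.1 z.2.1 * w2 z.1 z.2.2 *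
      (xiS p ((b.B z.2.1).erase z.1) x * xiS p ((b.B z.2.2).erase z.1) x) := by
  unfold Qf X
  rw [sum_filter, sum_product]
  refine sum_congr rfl fun u _ => ?_
  rw [sum_product, sum_mul_sum, sum_filter]
  refine sum_congr rfl fun t _ => ?_
  by_cases h : u ∈ b.B t
  · simp only [h, if_true, true_and]
    rw [sum_filter]
    grind
  · simp [h]
theorem card_X (T : Finset ι) : (b.X T).card ≤ T.card * (K * Fintype.card ι) ^ 2 := by
  have : b.X T ⊆ T.biUnion fun u => ({u} : Finset ι) ×ˢ ((b.I.filter fun t => u ∈ b.B t) ×ˢ (b.I.filter fun t => u ∈ b.B t)) := by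
    intro z hz
    rw [mem_X] at hz
    simp only [mem_biUnion, mem_product, mem_singleton, mem_filter]
    exact ⟨z.1, hz.1, rfl, ⟨hz.2.1, hz.2.2.2.1⟩, hz.2.2.1, hz.2.2.2.2⟩
  refine (card_le_card this).trans (card_biUnion_le_card_mul _ _ _ fun u _ => ?_)
  rw [card_product, card_product, card_singleton, one_mul, sq]
  exact Nat.mul_le_mul (b.cntx u) (b.cntx u)
theorem mult_X1 (T : Finset ι) (E : Finset ι) :
    ((b.X T).filter fun z => E = (b.B z.2.1).erase z.1 ∪ (b.B z.2.2).erase z.1).card ≤ k * (K * (2 * k) ^ 2) ^ 2 := by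
  by_cases hE : E.card ≤ 2 * k
  · have : ((b.X T).filter fun z => E = (b.B z.2.1).erase z.1 ∪ (b.B z.2.2).erase z.1) ⊆
        (b.sub2 E ×ˢ b.sub2 E).biUnion fun s => (b.B s.1) ×ˢ ({s} : Finset (τ × τ)) := by
      intro z hz
      rw [mem_filter, mem_X] at hz
      obtain ⟨⟨hT, h1, h2, hu1, hu2⟩, hE⟩ := hz
      have key : ∀ t ∈ b.I, z.1 ∈ b.B t → (b.B t).erase z.1 ⊆ E → t ∈ b.sub2 E := by
        intro t ht hu hs
        rw [sub2, mem_filter]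
        refine ⟨ht, ?_⟩
        have h3 := b.card3 t ht
        have : (b.B t).erase z.1 ⊆ b.B t ∩ E := subset_inter (erase_subset _ _) hs
        have := card_le_card this
        rw [card_erase_of_mem hu] at this
        omega
      simp only [mem_biUnion, mem_product, mem_singleton]
      exact ⟨z.2, ⟨key _ h1 hu1 (hE ▸ subset_union_left), key _ h2 hu2 (hE ▸ subset_union_right)⟩, hu1, rfl⟩
    refine (card_le_card this).trans ?_
    refine (card_biUnion_le_card_mul _ _ k fun s hs => ?_).trans ?_
    · rw [card_product, card_singleton, mul_one]
      refine b.cardk _ ?_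
      exact (mem_filter.mp (mem_product.mp hs).1).1
    · rw [card_product, mul_comm, sq]
      have := (b.card_sub2 E).trans (Nat.mul_le_mul_left K (Nat.pow_le_pow_left hE 2))
      exact Nat.mul_le_mul_left _ (Nat.mul_le_mul this this)
  · rw [filter_eq_empty_iff.mpr]
    · simp
    · intro z hz he
      rw [mem_X] at hz
      apply hE
      rw [he]
      refine (card_union_le _ _).trans ?_
      have := card_erase_le (a := z.1) (s := b.B z.2.1)
      have := card_erase_le (a := z.1) (s := b.B z.2.2)
      have := b.cardk _ hz.2.1
      have := b.cardk _ hz.2.2.1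
      omega
theorem card_X2 (T : Finset ι) (v : ι) :
    ((b.X T).filter fun z => ¬ Disjoint ((b.B z.2.1).erase z.1) ((b.B z.2.2).erase z.1) ∧
      v ∈ (b.B z.2.1).erase z.1 ∪ (b.B z.2.2).erase z.1).card ≤ 2 * (T.card * (K * (k * K))) := by
  set Y : (τ × τ → τ × τ) → Finset (ι × τ × τ) := fun sw =>
    (T.erase v).biUnion fun u => (b.I.filter fun t => u ∈ b.B t ∧ v ∈ b.B t).biUnion fun t =>
      ((b.B t).erase u).biUnion fun w => (b.I.filter fun t' => u ∈ b.B t' ∧ w ∈ b.B t').image fun t' => (u, sw (t, t'))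
  have hY : ∀ sw, (Y sw).card ≤ T.card * (K * (k * K)) := by
    intro sw
    refine (card_biUnion_le_card_mul _ _ (K * (k * K)) fun u hu => ?_).trans
      (Nat.mul_le_mul_right _ (card_erase_le))
    refine (card_biUnion_le_card_mul _ _ (k * K) fun t ht => ?_).trans
      (Nat.mul_le_mul_right _ (b.star u v (ne_of_mem_erase hu)))
    refine (card_biUnion_le_card_mul _ _ K fun w hw => ?_).trans
      (Nat.mul_le_mul_right _ ((card_erase_le).trans (b.cardk t (mem_filter.mp ht).1)))
    exact card_image_le.trans (b.star u w (ne_of_mem_erase hw).symm)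
  have : ((b.X T).filter fun z => ¬ Disjoint ((b.B z.2.1).erase z.1) ((b.B z.2.2).erase z.1) ∧
      v ∈ (b.B z.2.1).erase z.1 ∪ (b.B z.2.2).erase z.1) ⊆ Y id ∪ Y Prod.swap := by
    intro z hz
    rw [mem_filter, mem_X, not_disjoint_iff] at hz
    obtain ⟨⟨hT, h1, h2, hu1, hu2⟩, ⟨w, hw1, hw2⟩, hv⟩ := hz
    rw [mem_union] at hv ⊢
    rw [mem_erase] at hw1 hw2
    rcases hv with hv | hv
    · left
      rw [mem_erase] at hv
      simp only [Y, mem_biUnion, mem_image, mem_filter, mem_erase]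
      grind
    · right
      rw [mem_erase] at hv
      simp only [Y, mem_biUnion, mem_image, mem_filter, mem_erase]
      grind
  refine (card_le_card this).trans ((card_union_le _ _).trans ?_)
  have := hY id; have := hY Prod.swap
  omega
def CQ (k K : ℕ) : ℝ := 2 * (k * (K * (2 * k) ^ 2) ^ 2) * K ^ 2 + 2 * (4 * (K * (k * K))) ^ 2
theorem Q_var {p : ℝ} (h0 : 0 < p) (h1 : p < 1) (T : Finset ι) (w1 w2 : ι → τ → ℝ)
    (hw1 : ∀ u, ∀ t, |w1 u t| ≤ 1) (hw2 : ∀ u, ∀ t, |w2 u t| ≤ 1) :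
    Ex p (fun x => (b.Qf p T w1 w2 x - Ex p (b.Qf p T w1 w2)) ^ 2) ≤ CQ k K * T.card * (Fintype.card ι : ℝ) ^ 2 := by
  have hs := s2_bd h0 h1
  set n : ℝ := (Fintype.card ι : ℝ) with hn
  set P : ι × τ × τ → Prop := fun z => Disjoint ((b.B z.2.1).erase z.1) ((b.B z.2.2).erase z.1) with hP
  classical
  set F : ι × τ × τ → (ι → Bool) → ℝ := fun z x => w1 z.1 z.2.1 * w2 z.1 z.2.2 *
      (xiS p ((b.B z.2.1).erase z.1) x * xiS p ((b.B z.2.2).erase z.1) x) with hF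
  have hw : ∀ z : ι × τ × τ, |w1 z.1 z.2.1 * w2 z.1 z.2.2| ≤ 1 := fun z => by
    rw [abs_mul]; exact mul_le_one₀ (hw1 _ _) (abs_nonneg _) (hw2 _ _)
  set Q1 : (ι → Bool) → ℝ := fun x => ∑ z ∈ (b.X T).filter P, F z x with hQ1
  set Q2 : (ι → Bool) → ℝ := fun x => ∑ z ∈ (b.X T).filter (fun z => ¬ P z), F z x with hQ2
  have hQ : ∀ x, b.Qf p T w1 w2 x = Q1 x + Q2 x := by
    intro x; rw [Qf_eq, hQ1, hQ2]; exact (sum_filter_add_sum_filter_not _ _ _).symm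
  have hTn : (T.card : ℝ) ≤ n := by rw [hn]; exact_mod_cast card_le_univ T
  have e1 : Ex p (fun x => Q1 x ^ 2) ≤ (k * (K * (2 * k) ^ 2) ^ 2 : ℕ) * (T.card * (K * n) ^ 2) := by
    have h := orth h0 h1 ((b.X T).filter P) (fun z => w1 z.1 z.2.1 * w2 z.1 z.2.2)
      (fun z => (b.B z.2.1).erase z.1 ∪ (b.B z.2.2).erase z.1) (k * (K * (2 * k) ^ 2) ^ 2) (fun z _ => hw z) ?_
    · have e : Q1 = fun x => ∑ z ∈ (b.X T).filter P, w1 z.1 z.2.1 * w2 z.1 z.2.2 * xiS p ((b.B z.2.1).erase z.1 ∪ (b.B z.2.2).erase z.1) x := by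
        funext x
        refine sum_congr rfl fun z hz => ?_
        rw [hF]; simp only [xiS]
        rw [prod_union (mem_filter.mp hz).2]
      rw [e]
      refine h.trans (mul_le_mul_of_nonneg_left ?_ (by positivity))
      have := (card_le_card (filter_subset P (b.X T))).trans (b.card_X T)
      rw [hn]; exact_mod_cast this
    · intro z _
      refine le_trans (card_le_card ?_) (b.mult_X1 T ((b.B z.2.1).erase z.1 ∪ (b.B z.2.2).erase z.1))
      grind
  have e2 : Ex p (fun x => (Q2 x - Ex p Q2) ^ 2) ≤ n * (4 * (T.card * (K * (k * K)))) ^ 2 := by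
    refine (efron_stein h0.le h1.le Q2).trans ?_
    have : ∀ v ∈ univ, Ex p (fun x => Du v Q2 x ^ 2) ≤ (4 * (T.card * (K * (k * K)))) ^ 2 := by
      intro v _
      refine Ex_le_const h0.le h1.le fun x => ?_
      rw [← sq_abs]
      refine pow_le_pow_left₀ (abs_nonneg _) ?_ 2
      rw [hQ2, Du_sum]
      refine (abs_sum_le_sum_abs _ _).trans ?_
      calc _ ≤ ∑ z ∈ (b.X T).filter (fun z => ¬ P z), if v ∈ (b.B z.2.1).erase z.1 ∪ (b.B z.2.2).erase z.1 then (2:ℝ) else 0 := by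
            refine sum_le_sum fun z _ => ?_
            split_ifs with hv
            · refine (Du_abs_le (M := 1) (fun x => ?_) v x).trans (by norm_num)
              rw [hF]; simp only []
              rw [abs_mul, abs_mul (xiS _ _ _)]
              exact mul_le_one₀ (hw z) (by positivity) (mul_le_one₀ (xiS_abs_le h0.le h1.le _ _) (abs_nonneg _) (xiS_abs_le h0.le h1.le _ _))
            · refine le_of_eq ?_
              rw [Du_zero_of_dep _ hv, abs_zero]
              exact ((Dep_xiS p _).mul (Dep_xiS p _)).comp (fun y => w1 z.1 z.2.1 * w2 z.1 z.2.2 * y)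
        _ = 2 * ((b.X T).filter fun z => ¬ P z ∧ v ∈ (b.B z.2.1).erase z.1 ∪ (b.B z.2.2).erase z.1).card := by
            rw [← sum_filter, filter_filter, sum_const, nsmul_eq_mul, mul_comm]
        _ ≤ _ := by
            have := b.card_X2 T v
            have h3 : ((((b.X T).filter fun z => ¬ P z ∧ v ∈ (b.B z.2.1).erase z.1 ∪ (b.B z.2.2).erase z.1).card : ℕ) : ℝ) ≤ (2 * (T.card * (K * (k * K))) : ℕ) := by
              exact_mod_cast (by convert this)
            push_cast at h3
            linarith
    have h4 := sum_le_sum this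
    rw [sum_const, card_univ, nsmul_eq_mul, ← hn] at h4
    have h5 : 0 ≤ ∑ v : ι, Ex p (fun x => Du v Q2 x ^ 2) := sum_nonneg fun v _ => Ex_nonneg h0.le h1.le fun x => sq_nonneg _
    nlinarith
  refine (Ex_center h0.le h1.le _ (Ex p Q2)).trans ?_
  have e3 : Ex p (fun x => (b.Qf p T w1 w2 x - Ex p Q2) ^ 2) ≤ 2 * Ex p (fun x => Q1 x ^ 2) + 2 * Ex p (fun x => (Q2 x - Ex p Q2) ^ 2) := by
    rw [← Ex_mul_left, ← Ex_mul_left, ← Ex_add]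
    refine Ex_mono h0.le h1.le fun x => ?_
    rw [hQ]; nlinarith [sq_nonneg (Q1 x - (Q2 x - Ex p Q2))]
  have e4 : n * (4 * (T.card * (K * (k * K)))) ^ 2 ≤ (4 * (K * (k * K)) : ℝ) ^ 2 * T.card * n ^ 2 := by
    have : n * (4 * (T.card * (K * (k * K)))) ^ 2 = ((4 * (K * (k * K)) : ℝ) ^ 2 * T.card * n) * T.card := by ring
    rw [this, show (4 * (K * (k * K)) : ℝ) ^ 2 * T.card * n ^ 2 = ((4 * (K * (k * K)) : ℝ) ^ 2 * T.card * n) * n by ring]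
    have hn0 : 0 ≤ n := by rw [hn]; positivity
    exact mul_le_mul_of_nonneg_left hTn (by positivity)
  unfold CQ
  push_cast at e1
  nlinarith
end Blk
end QL
noncomputable section Stein
variable {ι : Type*} [Fintype ι] [DecidableEq ι]
theorem xiS_erase (p : ℝ) {B : Finset ι} {u : ι} (hu : u ∈ B) (x : ι → Bool) :
    xiS p B x = xi p u x * xiS p (B.erase u) x := by
  unfold xiS; rw [mul_prod_erase B (fun i => xi p i x) hu]
theorem Du_xi (p : ℝ) (u : ι) (x : ι → Bool) : Du u (xi p u) x = 1 := by
  simp [Du, xi]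
theorem Du_mul_of_dep {R : Type*} [CommRing R] {F G : (ι → Bool) → R} {A : Finset ι} (h : Dep F A) {v : ι} (hv : v ∉ A)
    (x : ι → Bool) : Du v (fun x => F x * G x) x = F x * Du v G x := by
  have : ∀ c, F (update x v c) = F x := by
    intro c; apply h; intro i hi
    have : i ≠ v := by rintro rfl; exact hv hi
    simp [update_of_ne this]
  simp [Du, this, mul_sub]
theorem Du_xiS (p : ℝ) (B : Finset ι) (u : ι) (x : ι → Bool) :
    Du u (xiS p B) x = if u ∈ B then xiS p (B.erase u) x else 0 := by
  split_ifs with hu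
  · have : xiS p B = fun x => xiS p (B.erase u) x * xi p u x := by
      funext x; rw [xiS_erase p hu, mul_comm]
    rw [this, Du_mul_of_dep (Dep_xiS p _) (notMem_erase u B), Du_xi, mul_one]
  · exact Du_zero_of_dep (Dep_xiS p B) hu x
namespace Blk
variable {τ : Type*} [DecidableEq τ] {k K : ℕ} {cl : ℝ} (b : Blk ι τ k K cl)
variable {p : ℝ} (h0 : 0 < p) (h1 : p < 1)
def L1 (p : ℝ) (w : τ → ℝ) (u : ι) (x : ι → Bool) : ℝ :=
  ∑ t ∈ b.I.filter (fun t => u ∈ b.B t), w t * xiS p ((b.B t).erase u) x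
theorem L1_dep (p : ℝ) (w : τ → ℝ) (u : ι) : Dep (b.L1 p w u) (univ.erase u) :=
  Dep.sum fun t _ => ((Dep_xiS p _).mono (erase_subset_erase _ (subset_univ _))).comp (fun y => w t * y)
theorem Du_W (p : ℝ) (u : ι) (x : ι → Bool) : Du u (b.W p) x = b.L1 p b.c u x := by
  unfold W
  rw [Du_sum, L1, sum_filter]
  refine sum_congr rfl fun t _ => ?_
  have : Du u (fun x => b.c t * xiS p (b.B t) x) x = b.c t * Du u (xiS p (b.B t)) x := by simp [Du, mul_sub]
  rw [this, Du_xiS]; split_ifs <;> simp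
def wh (t : τ) : ℝ := b.c t / (b.B t).card
theorem W_eq (p : ℝ) (x : ι → Bool) : b.W p x = ∑ u, xi p u x * b.L1 p b.wh u x := by
  unfold W L1
  simp_rw [sum_filter, mul_sum]
  rw [sum_comm]
  refine sum_congr rfl fun t ht => ?_
  have h3 := b.card3 t ht
  have : ∀ u ∈ univ, (xi p u x * if u ∈ b.B t then b.wh t * xiS p ((b.B t).erase u) x else 0) = if u ∈ b.B t then b.wh t * xiS p (b.B t) x else 0 := by
    intro u _
    split_ifs with hu
    · rw [xiS_erase p hu]; ring
    · simp
  rw [sum_congr rfl this, ← sum_filter]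
  simp only [filter_univ_mem, sum_const, nsmul_eq_mul, wh]
  have : ((b.B t).card : ℝ) ≠ 0 := by positivity
  field_simp
theorem ibpW (p : ℝ) (G : (ι → Bool) → ℂ) : Ex p (fun x => (b.W p x : ℂ) * G x) =
    ((υ p : ℝ) : ℂ) * ∑ u, Ex p (fun x => (b.L1 p b.wh u x : ℂ) * Du u G x) := by
  have : (fun x => (b.W p x : ℂ) * G x) = fun x => ∑ u, (xi p u x : ℂ) * ((b.L1 p b.wh u x : ℂ) * G x) := by
    funext x; rw [W_eq]; push_cast; rw [sum_mul]; exact sum_congr rfl fun u _ => by ring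
  rw [this, Ex_sum, mul_sum]
  refine sum_congr rfl fun u _ => ?_
  rw [Ex_ibp]; congr 2; funext x
  exact Du_mul_of_dep ((b.L1_dep p b.wh u).comp (fun y : ℝ => (y : ℂ))) (notMem_erase u _) x
theorem ibpW_real (p : ℝ) (G : (ι → Bool) → ℝ) : Ex p (fun x => b.W p x * G x) =
    υ p * ∑ u, Ex p (fun x => b.L1 p b.wh u x * Du u G x) := by
  have : (fun x => b.W p x * G x) = fun x => ∑ u, xi p u x * (b.L1 p b.wh u x * G x) := by
    funext x; rw [W_eq]; rw [sum_mul]; exact sum_congr rfl fun u _ => by ring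
  rw [this, Ex_sum, mul_sum]
  refine sum_congr rfl fun u _ => ?_
  rw [Ex_ibp_real]; congr 2; funext x
  exact Du_mul_of_dep (b.L1_dep p b.wh u) (notMem_erase u _) x
include h0 h1 in
theorem L1_sq (w : τ → ℝ) (hw : ∀ t ∈ b.I, |w t| ≤ 1) (u : ι) :
    Ex p (fun x => b.L1 p w u x ^ 2) ≤ K ^ 2 * Fintype.card ι := by
  refine (orth h0 h1 _ _ _ K (fun t ht => hw t (mem_filter.mp ht).1) ?_).trans ?_
  · intro t ht
    rw [mem_filter] at ht
    obtain ⟨y, hy, hyu⟩ := exists_mem_ne (by have := b.card3 t ht.1; omega : 1 < (b.B t).card) u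
    refine le_trans (card_le_card ?_) (b.star u y hyu.symm)
    intro s hs
    simp only [mem_filter] at hs ⊢
    refine ⟨hs.1.1, hs.1.2, ?_⟩
    have : y ∈ (b.B t).erase u := mem_erase.mpr ⟨hyu, hy⟩
    grind
  · rw [sq, mul_assoc]
    refine mul_le_mul_of_nonneg_left ?_ (by positivity)
    exact_mod_cast b.cntx u
include h0 h1 in
theorem L1_sum_sq (w : τ → ℝ) (hw : ∀ t ∈ b.I, |w t| ≤ 1) (T : Finset ι) :
    Ex p (fun x => (∑ u ∈ T, b.L1 p w u x) ^ 2) ≤ k * K ^ 2 * T.card * Fintype.card ι := by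
  have e : (fun x => (∑ u ∈ T, b.L1 p w u x) ^ 2) = fun x => (∑ z ∈ (T ×ˢ b.I).filter (fun z => z.1 ∈ b.B z.2), w z.2 * xiS p ((b.B z.2).erase z.1) x) ^ 2 := by
    funext x
    rw [sum_filter, sum_product]
    simp only [L1, sum_filter]
  rw [e]
  refine (orth h0 h1 _ _ _ (K * k) (fun z hz => hw z.2 ?_) ?_).trans ?_
  · grind
  · intro z hz
    simp only [mem_filter, mem_product] at hz
    obtain ⟨x, hx, y, hy, hxy⟩ := one_lt_card.mp (by rw [card_erase_of_mem hz.2]; have := b.card3 _ hz.1.2; omega : 1 < ((b.B z.2).erase z.1).card)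
    have : ((T ×ˢ b.I).filter (fun z => z.1 ∈ b.B z.2)).filter (fun j => (b.B z.2).erase z.1 = (b.B j.2).erase j.1) ⊆
        (b.I.filter fun t => x ∈ b.B t ∧ y ∈ b.B t).biUnion fun t => (b.B t) ×ˢ {t} := by
      intro j hj
      simp only [mem_filter, mem_product] at hj
      rw [hj.2] at hx hy
      simp only [mem_biUnion, mem_filter, mem_product, mem_singleton]
      exact ⟨j.2, ⟨hj.1.1.2, mem_of_mem_erase hx, mem_of_mem_erase hy⟩, hj.1.2, rfl⟩
    refine (card_le_card this).trans ((card_biUnion_le_card_mul _ _ k ?_).trans (Nat.mul_le_mul_right _ (b.star x y hxy)))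
    intro t ht
    rw [card_product, card_singleton, mul_one]
    exact b.cardk t (mem_filter.mp ht).1
  · have : ((T ×ˢ b.I).filter (fun z => z.1 ∈ b.B z.2)).card ≤ T.card * (K * Fintype.card ι) := by
      have h2 : (T ×ˢ b.I).filter (fun z => z.1 ∈ b.B z.2) ⊆ T.biUnion fun u => {u} ×ˢ (b.I.filter fun t => u ∈ b.B t) := by
        intro z hz
        simp only [mem_filter, mem_product] at hz
        simp only [mem_biUnion, mem_filter, mem_product, mem_singleton]
        exact ⟨z.1, hz.1.1, rfl, hz.1.2, hz.2⟩
      refine (card_le_card h2).trans (card_biUnion_le_card_mul _ _ _ fun u _ => ?_)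
      rw [card_product, card_singleton, one_mul]; exact b.cntx u
    have h3 : (((T ×ˢ b.I).filter (fun z => z.1 ∈ b.B z.2)).card : ℝ) ≤ T.card * (K * Fintype.card ι) := by exact_mod_cast this
    push_cast
    calc _ ≤ (K * k : ℝ) * (T.card * (K * Fintype.card ι)) := mul_le_mul_of_nonneg_left h3 (by positivity)
      _ = _ := by ring
theorem L1_deg (p : ℝ) (w : τ → ℝ) (u : ι) : Deg k (b.L1 p w u) := by
  refine Deg.sum fun t ht => Deg.smul _ (Deg.of_dep (Dep_xiS p _) ?_)
  exact (card_erase_le).trans (b.cardk t (mem_filter.mp ht).1)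
include h0 h1 in
theorem L1_four (w : τ → ℝ) (hw : ∀ t ∈ b.I, |w t| ≤ 1) (u : ι) :
    Ex p (fun x => b.L1 p w u x ^ 4) ≤ (16 / υ p) ^ k * (K ^ 2 * Fintype.card ι) ^ 2 := by
  have hs := s2_bd h0 h1
  refine (bonami h0 h1 _ k _ (Dep_univ _) (b.L1_deg p w u)).trans ?_
  have := b.L1_sq h0 h1 w hw u
  have h2 : 0 ≤ Ex p (fun x => b.L1 p w u x ^ 2) := Ex_nonneg h0.le h1.le fun x => sq_nonneg _
  have hs' := hs.1
  gcongr
theorem wh_le {t : τ} (ht : t ∈ b.I) : |b.wh t| ≤ 1 := by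
  unfold wh
  have h3 : (3:ℝ) ≤ (b.B t).card := by exact_mod_cast b.card3 t ht
  rw [abs_div, abs_of_pos (by linarith : (0:ℝ) < (b.B t).card), div_le_one (by linarith)]
  linarith [b.cabs ht]
def Ns (p : ℝ) (x : ι → Bool) : ℝ := ∑ u, xi p u x
def Hf (p θ t : ℝ) (x : ι → Bool) : ℂ := cexp (((θ * Ns p x + t * b.W p x : ℝ) : ℂ) * ⅈ)
def phi (p θ t : ℝ) : ℂ := Ex p (b.Hf p θ t)
theorem Hf_norm (p θ t : ℝ) (x : ι → Bool) : ‖b.Hf p θ t x‖ = 1 := norm_exp_ofReal_mul_I _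
def QQ (p : ℝ) (x : ι → Bool) : ℝ := ∑ u, b.L1 p b.wh u x * b.L1 p b.c u x
theorem EQQ (p : ℝ) : Ex p (fun x => b.W p x ^ 2) = υ p * Ex p (b.QQ p) := by
  simp_rw [sq]; rw [ibpW_real]; unfold QQ; rw [Ex_sum]
  simp_rw [Du_W]
include h0 h1 in
theorem QQ_var :
    Ex p (fun x => (b.QQ p x - Ex p (b.QQ p)) ^ 2) ≤ CQ k K * (Fintype.card ι : ℝ) ^ 3 := by
  have := b.Q_var h0 h1 univ (fun _ t => if t ∈ b.I then b.wh t else 0) (fun _ t => if t ∈ b.I then b.c t else 0)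
    (fun u t => by split_ifs with h; exact b.wh_le h; simp) (fun u t => by split_ifs with h; exact b.cabs h; simp)
  have e : b.Qf p univ (fun _ t => if t ∈ b.I then b.wh t else 0) (fun _ t => if t ∈ b.I then b.c t else 0) = b.QQ p := by
    funext x
    unfold Qf QQ L1
    refine sum_congr rfl fun u _ => ?_
    congr 1 <;> refine sum_congr rfl fun t ht => ?_ <;> simp only [] <;> grind
  rw [e] at this
  rw [card_univ] at this
  grind
theorem exp_I_sub_one (y : ℝ) : ‖cexp ((y:ℂ) * ⅈ) - 1‖ ≤ |y| := by
  have := Real.norm_exp_I_mul_ofReal_sub_one_le (x := y); rw [mul_comm]; simpa using this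
theorem exp_aux (d : ℝ) (c : ℝ) (hc : |c| ≤ 1) :
    ‖cexp ((d:ℂ) * ⅈ) - 1 - (d:ℂ) * ⅈ * cexp (((c * d : ℝ):ℂ) * ⅈ)‖ ≤ 3 * d ^ 2 := by
  have e1 := exp_I_sub_one
  have e2 : ‖cexp ((d:ℂ) * ⅈ) - 1 - (d:ℂ) * ⅈ‖ ≤ 2 * d ^ 2 := by
    by_cases hd : |d| ≤ 1
    · have := Complex.norm_exp_sub_one_sub_id_le (x := (d:ℂ) * ⅈ) (by simpa using hd)
      have h2 : ‖(d:ℂ) * ⅈ‖ ^ 2 = d ^ 2 := by simp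
      rw [h2] at this
      nlinarith [sq_nonneg d]
    · push Not at hd
      refine (norm_sub_le _ _).trans ?_
      have h1 := e1 d
      have h2 : ‖(d:ℂ) * ⅈ‖ = |d| := by simp
      rw [h2]
      nlinarith [sq_abs d, abs_nonneg d]
  calc _ = ‖(cexp ((d:ℂ) * ⅈ) - 1 - (d:ℂ) * ⅈ) - (d:ℂ) * ⅈ * (cexp (((c * d : ℝ):ℂ) * ⅈ) - 1)‖ := by
        congr 1; ring
    _ ≤ 2 * d ^ 2 + |d| * |c * d| := by
        refine (norm_sub_le _ _).trans (add_le_add e2 ?_)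
        rw [norm_mul, norm_mul, Complex.norm_I, mul_one, norm_real, norm_eq_abs]
        exact mul_le_mul_of_nonneg_left (e1 _) (abs_nonneg _)
    _ ≤ _ := by
        rw [abs_mul]; nlinarith [sq_abs d, abs_nonneg d, sq_nonneg d]
theorem Du_eq_of_split {F : (ι → Bool) → ℝ} (u : ι) (x : ι → Bool) :
    F (update x u true) = F (update x u false) + Du u F x := by simp [Du]
theorem Du_Hf (p θ t : ℝ) (u : ι) (x : ι → Bool) :
    ‖Du u (b.Hf p θ t) x - ((θ + t * b.L1 p b.c u x : ℝ) : ℂ) * ⅈ * b.Hf p θ t x‖ ≤ 3 * (θ + t * b.L1 p b.c u x) ^ 2 := by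
  set d := θ + t * b.L1 p b.c u x with hd
  set F : (ι → Bool) → ℝ := fun x => θ * Ns p x + t * b.W p x with hF
  have hDF : Du u F x = d := by
    have h1 : Du u (Ns p) x = 1 := by
      unfold Ns; rw [Du_sum, sum_eq_single u]
      · exact Du_xi p u x
      · intro v _ hv; exact Du_zero_of_dep (Dep_xi p v) (by simpa using hv.symm) x
      · simp
    have h2 := b.Du_W p u x
    rw [hd, ← h2]
    simp only [Du, hF] at h1 ⊢
    linear_combination θ * h1
  have hF1 := Du_eq_of_split (F := F) u x
  rw [hDF] at hF1
  have hx : F x = F (update x u false) + (if x u then 1 else 0) * d := by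
    cases h : x u
    · simp [← h]
    · rw [if_pos rfl, one_mul, ← hF1, ← h]; simp
  have key : Du u (b.Hf p θ t) x - (d : ℂ) * ⅈ * b.Hf p θ t x = cexp ((F (update x u false) : ℂ) * ⅈ) *
      (cexp ((d:ℂ) * ⅈ) - 1 - (d:ℂ) * ⅈ * cexp ((((if x u then (1:ℝ) else 0) * d : ℝ):ℂ) * ⅈ)) := by
    have e0 : ∀ y, b.Hf p θ t y = cexp ((F y : ℂ) * ⅈ) := fun y => rfl
    simp only [Du, e0]
    rw [hF1, hx]
    have h0 : F (update x u false) = F (update x u false) := rfl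
    push_cast
    rw [add_mul, add_mul, Complex.exp_add, Complex.exp_add]
    ring
  rw [key, norm_mul, norm_exp_ofReal_mul_I, one_mul]
  exact exp_aux d _ (by split_ifs <;> simp)
def CS (p : ℝ) (k K : ℕ) : ℝ := 12 * (k * K ^ 2 + K + K ^ 2 + (16 / υ p) ^ k * K ^ 4 + 1 + CQ k K)
theorem CQ_nonneg : 0 ≤ CQ k K := by unfold CQ; positivity
include h0 h1 in
theorem stein (θ t : ℝ) {s : ℝ} (hs0 : 0 < s) (hs : s ^ 2 = Fintype.card ι) :
    ‖ⅈ * Ex p (fun x => (b.W p x : ℂ) * b.Hf p θ t x) + ((Ex p (fun x => b.W p x ^ 2) * t : ℝ) : ℂ) * b.phi p θ t‖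
      ≤ CS p k K * (|θ| * s ^ 2 + θ ^ 2 * s ^ 3 + |t| * s ^ 3 + t ^ 2 * s ^ 5) := by
  have hs2 := s2_bd h0 h1
  set q := υ p with hq
  set n : ℝ := (Fintype.card ι : ℝ) with hn
  set E1 : ℂ := ∑ u, Ex p (fun x => (b.L1 p b.wh u x : ℂ) * (Du u (b.Hf p θ t) x - ((θ + t * b.L1 p b.c u x : ℝ) : ℂ) * ⅈ * b.Hf p θ t x)) with hE1
  set E2 : ℂ := Ex p (fun x => ((∑ u, b.L1 p b.wh u x : ℝ) : ℂ) * b.Hf p θ t x) with hE2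
  set E3 : ℂ := Ex p (fun x => ((b.QQ p x - Ex p (b.QQ p) : ℝ) : ℂ) * b.Hf p θ t x) with hE3
  have main : ⅈ * Ex p (fun x => (b.W p x : ℂ) * b.Hf p θ t x) + ((Ex p (fun x => b.W p x ^ 2) * t : ℝ) : ℂ) * b.phi p θ t
      = (q : ℂ) * (ⅈ * E1 - (θ : ℂ) * E2 - (t : ℂ) * E3) := by
    rw [b.ibpW, b.EQQ, ← hq]
    have e3 : E3 = Ex p (fun x => (b.QQ p x : ℂ) * b.Hf p θ t x) - ((Ex p (b.QQ p) : ℝ) : ℂ) * b.phi p θ t := by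
      rw [hE3, phi, ← Ex_mul_left, ← Ex_sub]
      congr 1; funext x; push_cast; ring
    have e1 : E1 = ∑ u, Ex p (fun x => (b.L1 p b.wh u x : ℂ) * Du u (b.Hf p θ t) x) - (θ : ℂ) * ⅈ * E2
        - (t : ℂ) * ⅈ * Ex p (fun x => (b.QQ p x : ℂ) * b.Hf p θ t x) := by
      rw [hE1, hE2, ← Ex_sum, ← Ex_sum, ← Ex_mul_left, ← Ex_mul_left, ← Ex_sub, ← Ex_sub]
      congr 1; funext x
      unfold QQ
      push_cast
      rw [sum_mul, sum_mul, mul_sum, mul_sum, ← sum_sub_distrib, ← sum_sub_distrib]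
      refine sum_congr rfl fun u _ => ?_
      ring
    rw [e3, e1]
    push_cast
    linear_combination ((q:ℂ) * (θ * E2 + t * Ex p (fun x => (b.QQ p x : ℂ) * b.Hf p θ t x))) * Complex.I_sq
  have hC := CQ_nonneg (k := k) (K := K)
  have normH : ∀ (F : (ι → Bool) → ℝ) (v : ℝ), 0 ≤ v → Ex p (fun x => F x ^ 2) ≤ v ^ 2 → ‖Ex p (fun x => ((F x : ℝ) : ℂ) * b.Hf p θ t x)‖ ≤ v := by
    intro F v hv h
    refine (Ex_norm_le h0.le h1.le _).trans ?_
    have : (fun x => ‖((F x : ℝ) : ℂ) * b.Hf p θ t x‖) = fun x => |F x| := by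
      funext x; rw [norm_mul, Hf_norm, mul_one, norm_real, norm_eq_abs]
    rw [this]
    refine (Ex_abs_le h0.le h1.le F).trans ?_
    rw [Real.sqrt_le_left hv]; exact h
  have b2 : ‖E2‖ ≤ (k * K ^ 2 + 1) * s ^ 2 := by
    refine normH _ _ (by positivity) ((b.L1_sum_sq h0 h1 b.wh (fun t ht => b.wh_le ht) univ).trans ?_)
    rw [card_univ, ← hn, ← hs]
    have : (0:ℝ) ≤ k * K ^ 2 := by positivity
    have h4 : 0 ≤ s ^ 4 := by positivity
    nlinarith [mul_nonneg (mul_nonneg this this) h4, mul_nonneg this h4]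
  have b3 : ‖E3‖ ≤ (CQ k K + 1) * s ^ 3 := by
    refine normH _ _ (by positivity) ((b.QQ_var h0 h1).trans ?_)
    rw [← hn, ← hs]
    have h4 : 0 ≤ s ^ 6 := by positivity
    nlinarith [mul_nonneg (mul_nonneg hC hC) h4, mul_nonneg hC h4]
  set C4 := (16 / q) ^ k with hC4
  have hC40 : 0 ≤ C4 := by rw [hC4]; have := hs2.1; positivity
  have b1 : ‖E1‖ ≤ 6 * ((K : ℝ) * θ ^ 2 * s ^ 3 + t ^ 2 * ((K ^ 2 + C4 * K ^ 4) * s ^ 5)) := by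
    have : ∀ u ∈ univ, ‖Ex p (fun x => (b.L1 p b.wh u x : ℂ) * (Du u (b.Hf p θ t) x - ((θ + t * b.L1 p b.c u x : ℝ) : ℂ) * ⅈ * b.Hf p θ t x))‖ ≤
        6 * (K * θ ^ 2 * s + t ^ 2 * ((K ^ 2 + C4 * K ^ 4) * s ^ 3)) := by
      intro u _
      refine (Ex_norm_le h0.le h1.le _).trans ?_
      have hb1 : Ex p (fun x => |b.L1 p b.wh u x|) ≤ K * s := by
        refine (Ex_abs_le h0.le h1.le _).trans ?_
        rw [Real.sqrt_le_left (by positivity), mul_pow, hs]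
        exact b.L1_sq h0 h1 b.wh (fun t ht => b.wh_le ht) u
      have hb2 := b.L1_sq h0 h1 b.wh (fun t ht => b.wh_le ht) u
      have hb4 := b.L1_four h0 h1 b.c (fun t ht => b.cabs ht) u
      rw [← hn, ← hs] at hb2 hb4
      calc _ ≤ Ex p (fun x => 6 * (θ ^ 2 * |b.L1 p b.wh u x| + t ^ 2 * (s * b.L1 p b.wh u x ^ 2 + b.L1 p b.c u x ^ 4 / s))) := by
            refine Ex_mono h0.le h1.le fun x => ?_
            rw [norm_mul, norm_real, norm_eq_abs]
            refine (mul_le_mul_of_nonneg_left (b.Du_Hf p θ t u x) (abs_nonneg _)).trans ?_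
            set A := b.L1 p b.wh u x
            set D := b.L1 p b.c u x
            have g1 : (θ + t * D) ^ 2 ≤ 2 * (θ ^ 2 + t ^ 2 * D ^ 2) := by nlinarith [sq_nonneg (θ - t * D)]
            have g2 : |A| * D ^ 2 ≤ s * A ^ 2 + D ^ 4 / s := by
              have : s * A ^ 2 + D ^ 4 / s - |A| * D ^ 2 = ((s * |A| - D ^ 2 / 2) ^ 2 + 3 / 4 * D ^ 4) / s := by
                field_simp; rw [← sq_abs A]; ring
              have : 0 ≤ s * A ^ 2 + D ^ 4 / s - |A| * D ^ 2 := by rw [this]; positivity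
              linarith
            have g3 := mul_le_mul_of_nonneg_left g2 (sq_nonneg t)
            have g4 := mul_le_mul_of_nonneg_left g1 (abs_nonneg A)
            nlinarith
        _ ≤ _ := by
            rw [Ex_mul_left, Ex_add, Ex_mul_left, Ex_mul_left, Ex_add, Ex_mul_left]
            simp_rw [div_eq_mul_inv]
            rw [Ex_mul_right, ← div_eq_mul_inv]
            have g5 : Ex p (fun x => b.L1 p b.c u x ^ 4) / s ≤ C4 * K ^ 4 * s ^ 3 := by
              rw [div_le_iff₀ hs0]
              refine hb4.trans (le_of_eq ?_); ring
            have g6 : s * Ex p (fun x => b.L1 p b.wh u x ^ 2) ≤ K ^ 2 * s ^ 3 := by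
              refine (mul_le_mul_of_nonneg_left hb2 hs0.le).trans (le_of_eq ?_); ring
            have g7 := mul_le_mul_of_nonneg_left hb1 (sq_nonneg θ)
            have g8 := mul_le_mul_of_nonneg_left (add_le_add g6 g5) (sq_nonneg t)
            nlinarith
    rw [hE1]
    refine (norm_sum_le _ _).trans ((sum_le_sum this).trans (le_of_eq ?_))
    rw [sum_const, card_univ, nsmul_eq_mul, ← hn, ← hs]; ring
  rw [main, norm_mul, norm_real, norm_of_nonneg hs2.1.le]
  have nb : ‖ⅈ * E1 - (θ : ℂ) * E2 - (t : ℂ) * E3‖ ≤ ‖E1‖ + |θ| * ‖E2‖ + |t| * ‖E3‖ := by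
    refine (norm_sub_le _ _).trans (add_le_add ((norm_sub_le _ _).trans ?_) ?_)
    · simp
    · simp
  have nb0 : 0 ≤ ‖ⅈ * E1 - (θ : ℂ) * E2 - (t : ℂ) * E3‖ := norm_nonneg _
  calc _ ≤ ‖ⅈ * E1 - (θ : ℂ) * E2 - (t : ℂ) * E3‖ := by nlinarith [hs2.2]
    _ ≤ _ := nb
    _ ≤ 6 * ((K : ℝ) * θ ^ 2 * s ^ 3 + t ^ 2 * ((K ^ 2 + C4 * K ^ 4) * s ^ 5)) + |θ| * ((k * K ^ 2 + 1) * s ^ 2) + |t| * ((CQ k K + 1) * s ^ 3) := by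
        gcongr
    _ ≤ _ := by
        unfold CS
        rw [← hq, ← hC4]
        have x1 : 0 ≤ |θ| * s ^ 2 := by positivity
        have x2 : 0 ≤ θ ^ 2 * s ^ 3 := by positivity
        have x3 : 0 ≤ |t| * s ^ 3 := by positivity
        have x4 : 0 ≤ t ^ 2 * s ^ 5 := by positivity
        have y1 : (0:ℝ) ≤ K := by positivity
        have y2 : (0:ℝ) ≤ k * K ^ 2 := by positivity
        have y3 : (0:ℝ) ≤ C4 * K ^ 4 := by positivity
        have y4 : (0:ℝ) ≤ K ^ 2 := by positivity
        set S := k * (K:ℝ) ^ 2 + K + K ^ 2 + C4 * K ^ 4 + 1 + CQ k K with hS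
        have z1 := mul_le_mul_of_nonneg_right (by linarith : (6:ℝ) * K ≤ 12 * S) x2
        have z2 := mul_le_mul_of_nonneg_right (by linarith : 6 * ((K:ℝ) ^ 2 + C4 * K ^ 4) ≤ 12 * S) x4
        have z3 := mul_le_mul_of_nonneg_right (by linarith : k * (K:ℝ) ^ 2 + 1 ≤ 12 * S) x1
        have z4 := mul_le_mul_of_nonneg_right (by linarith : CQ k K + 1 ≤ 12 * S) x3
        linarith
theorem phi_deriv (p θ t : ℝ) : HasDerivAt (b.phi p θ) (ⅈ * Ex p (fun x => (b.W p x : ℂ) * b.Hf p θ t x)) t := by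
  rw [← Ex_mul_left]
  unfold phi Ex
  refine HasDerivAt.fun_sum fun x _ => HasDerivAt.const_smul _ ?_
  have h : HasDerivAt (fun t : ℝ => (((θ * Ns p x + t * b.W p x : ℝ) : ℂ) * ⅈ)) ((b.W p x : ℂ) * ⅈ) t := by
    refine HasDerivAt.mul_const (HasDerivAt.ofReal_comp ?_) _
    simpa using ((hasDerivAt_id t).mul_const (b.W p x)).const_add (θ * Ns p x)
  have := h.cexp
  unfold Hf
  refine this.congr_deriv ?_
  ring
include h0 h1 in
theorem stein_int (θ t : ℝ) {s : ℝ} (hs0 : 0 < s) (hs : s ^ 2 = Fintype.card ι) :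
    ‖b.phi p θ t - b.phi p θ 0 * (exp (-(Ex p (fun x => b.W p x ^ 2) * t ^ 2 / 2)) : ℂ)‖
      ≤ |t| * (CS p k K * (|θ| * s ^ 2 + θ ^ 2 * s ^ 3 + |t| * s ^ 3 + t ^ 2 * s ^ 5)) := by
  set V := Ex p (fun x => b.W p x ^ 2) with hV
  have hV0 : 0 ≤ V := Ex_nonneg h0.le h1.le fun x => sq_nonneg _
  set ψ : ℝ → ℂ := fun r => b.phi p θ r * (exp (V * r ^ 2 / 2) : ℂ) with hψ
  have hC : 0 ≤ CS p k K := by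
    unfold CS; have := CQ_nonneg (k := k) (K := K); have := (s2_bd h0 h1).1; positivity
  have hd : ∀ r : ℝ, HasDerivAt ψ ((ⅈ * Ex p (fun x => (b.W p x : ℂ) * b.Hf p θ r x) + ((V * r : ℝ) : ℂ) * b.phi p θ r) * (exp (V * r ^ 2 / 2) : ℂ)) r := by
    intro r
    have h2 : HasDerivAt (fun r : ℝ => ((exp (V * r ^ 2 / 2) : ℝ) : ℂ)) ((exp (V * r ^ 2 / 2) * (V * r) : ℝ) : ℂ) r := by
      refine HasDerivAt.ofReal_comp (HasDerivAt.exp ?_)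
      have := ((hasDerivAt_pow 2 r).const_mul V).div_const 2
      refine this.congr_deriv ?_
      push_cast; ring
    have := (b.phi_deriv p θ r).mul h2
    refine this.congr_deriv ?_
    push_cast; ring
  have hb : ∀ r ∈ Set.uIcc 0 t, ‖(ⅈ * Ex p (fun x => (b.W p x : ℂ) * b.Hf p θ r x) + ((V * r : ℝ) : ℂ) * b.phi p θ r) * (exp (V * r ^ 2 / 2) : ℂ)‖ ≤
      (CS p k K * (|θ| * s ^ 2 + θ ^ 2 * s ^ 3 + |t| * s ^ 3 + t ^ 2 * s ^ 5)) * exp (V * t ^ 2 / 2) := by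
    intro r hr
    have hrt : |r| ≤ |t| := by
      rw [Set.mem_uIcc] at hr
      rcases hr with h | h
      · grind
      · grind
    have hrt2 : r ^ 2 ≤ t ^ 2 := sq_le_sq.mpr hrt
    rw [norm_mul, norm_real, norm_of_nonneg (exp_pos _).le]
    refine mul_le_mul ((b.stein h0 h1 θ r hs0 hs).trans ?_) ?_ (exp_pos _).le (by positivity)
    · gcongr
    · apply exp_le_exp.mpr; gcongr
  have mvt := Convex.norm_image_sub_le_of_norm_hasDerivWithin_le (fun r hr => (hd r).hasDerivWithinAt) hb (convex_uIcc 0 t) Set.left_mem_uIcc Set.right_mem_uIcc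
  have e0 : ψ 0 = b.phi p θ 0 := by simp [hψ]
  have et : b.phi p θ t - b.phi p θ 0 * (exp (-(V * t ^ 2 / 2)) : ℂ) = (ψ t - ψ 0) * (exp (-(V * t ^ 2 / 2)) : ℂ) := by
    rw [e0, hψ]; simp only []
    rw [sub_mul, mul_assoc, ← Complex.ofReal_mul, ← exp_add, add_neg_cancel, Real.exp_zero]; simp
  rw [et, norm_mul, norm_real, norm_of_nonneg (exp_pos _).le]
  refine (mul_le_mul_of_nonneg_right mvt (exp_pos _).le).trans (le_of_eq ?_)
  rw [sub_zero, norm_eq_abs]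
  have : exp (V * t ^ 2 / 2) * exp (-(V * t ^ 2 / 2)) = 1 := by
    rw [← exp_add, add_neg_cancel, Real.exp_zero]
  grind
end Blk
end Stein
noncomputable section Small
variable {ι : Type*} [Fintype ι] [DecidableEq ι]
theorem taylor_I (y : ℝ) (r : ℕ) : ‖cexp ((y:ℂ) * ⅈ) - ∑ l ∈ range r, ((y:ℂ) * ⅈ) ^ l / (l.factorial : ℂ)‖ ≤ 4 * |y| ^ r := by
  have hn : ‖(y:ℂ) * ⅈ‖ = |y| := by simp
  by_cases hy : |y| ≤ 1
  · have := Complex.norm_exp_sub_sum_le_norm_mul_exp ((y:ℂ) * ⅈ) r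
    rw [hn] at this
    refine this.trans ?_
    rw [mul_comm]
    refine mul_le_mul_of_nonneg_right ?_ (by positivity)
    have := exp_le_exp.mpr hy
    have := Real.exp_one_lt_d9
    linarith
  · push Not at hy
    have h1 : (1:ℝ) ≤ |y| ^ r := one_le_pow₀ hy.le
    refine (norm_sub_le _ _).trans ?_
    rw [norm_exp_ofReal_mul_I]
    have : ‖∑ l ∈ range r, ((y:ℂ) * ⅈ) ^ l / (l.factorial : ℂ)‖ ≤ 3 * |y| ^ r := by
      refine (norm_sum_le _ _).trans ?_
      calc _ ≤ ∑ l ∈ range r, (1:ℝ) ^ l / l.factorial * |y| ^ r := by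
            refine sum_le_sum fun l hl => ?_
            rw [norm_div, norm_pow, hn, Complex.norm_natCast, one_pow, div_mul_eq_mul_div, one_mul]
            gcongr
            · exact hy.le
            grind
        _ ≤ exp 1 * |y| ^ r := by
            rw [← sum_mul]
            exact mul_le_mul_of_nonneg_right (Real.sum_le_exp_of_nonneg zero_le_one r) (by positivity)
        _ ≤ _ := by
            have := Real.exp_one_lt_d9
            refine mul_le_mul_of_nonneg_right (by linarith) (by positivity)
    linarith
def om (p φ : ℝ) : ℂ := p • cexp (((1 - p) * φ : ℝ) * ⅈ) + (1 - p) • cexp ((-p * φ : ℝ) * ⅈ)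
theorem om_norm {p : ℝ} (h0 : 0 < p) (h1 : p < 1) (φ : ℝ) : ‖om p φ‖ ≤ exp (-(υ p * (1 - cos φ))) := by
  have e : om p φ = cexp ((-p * φ : ℝ) * ⅈ) * ((p * cos φ + (1 - p) : ℝ) + (p * Real.sin φ : ℝ) * ⅈ) := by
    have : cexp (((1 - p) * φ : ℝ) * ⅈ) = cexp ((-p * φ : ℝ) * ⅈ) * (Complex.cos φ + Complex.sin φ * ⅈ) := by
      rw [← Complex.exp_mul_I, ← Complex.exp_add]; congr 1; push_cast; ring
    unfold om; rw [this, real_smul, real_smul]; push_cast; ring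
  have h2 : ‖om p φ‖ ^ 2 = 1 - 2 * (υ p * (1 - cos φ)) := by
    rw [e, norm_mul, norm_exp_ofReal_mul_I, one_mul, ← Complex.normSq_eq_norm_sq, Complex.normSq_add_mul_I]
    linear_combination p ^ 2 * (Real.sin_sq_add_cos_sq φ)
  have h3 : ‖om p φ‖ ^ 2 ≤ exp (-(υ p * (1 - cos φ))) ^ 2 := by
    rw [h2, ← Real.exp_nat_mul]
    have := add_one_le_exp (((2:ℕ):ℝ) * -(υ p * (1 - cos φ)))
    push_cast at this ⊢; linarith
  exact (sq_le_sq₀ (norm_nonneg _) (exp_pos _).le).mp h3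
theorem cond_bound {p : ℝ} (h0 : 0 < p) (h1 : p < 1) (T : Finset ι) (a : (ι → Bool) → ℂ) (ha : Dep a Tᶜ) (ha1 : ∀ x, ‖a x‖ ≤ 1)
    (β : ι → (ι → Bool) → ℝ) (hβ : ∀ j ∈ T, Dep (β j) Tᶜ) :
    ‖Ex p (fun x => a x * ∏ j ∈ T, cexp (((xi p j x * β j x : ℝ) : ℂ) * ⅈ))‖ ≤
      Ex p (fun x => exp (-(υ p * ∑ j ∈ T, (1 - cos (β j x))))) := by
  rw [← Ex_mix p T]
  refine (Ex_norm_le h0.le h1.le _).trans (Ex_mono h0.le h1.le fun x => ?_)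
  have hm : ∀ y, ∀ i ∈ Tᶜ, mix T x y i = x i := by
    intro y i hi; simp only [Finset.mem_compl] at hi; simp [mix, hi]
  have e : (fun y => a (mix T x y) * ∏ j ∈ T, cexp (((xi p j (mix T x y) * β j (mix T x y) : ℝ) : ℂ) * ⅈ)) =
      fun y => a x * ∏ j, (if j ∈ T then cexp (((((if y j then 1 else 0) - p) * β j x : ℝ) : ℂ) * ⅈ) else 1) := by
    funext y
    rw [ha _ _ (hm y), prod_ite_mem, univ_inter]
    congr 1
    refine prod_congr rfl fun j hj => ?_
    rw [hβ j hj _ _ (hm y)]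
    simp [xi, mix, hj]
  rw [e, Ex_mul_left, Ex_prod p (fun j c => if j ∈ T then cexp (((((if c then 1 else 0) - p) * β j x : ℝ) : ℂ) * ⅈ) else 1), norm_mul]
  refine (mul_le_of_le_one_left (norm_nonneg _) (ha1 x)).trans ?_
  rw [norm_prod]
  rw [mul_sum, ← sum_neg_distrib, Real.exp_sum]
  have e2 : ∏ j ∈ T, exp (-(υ p * (1 - cos (β j x)))) = ∏ j, if j ∈ T then exp (-(υ p * (1 - cos (β j x)))) else 1 := by
    rw [prod_ite_mem, univ_inter]
  rw [e2]
  refine prod_le_prod (fun _ _ => norm_nonneg _) fun j _ => ?_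
  by_cases hj : j ∈ T
  · simp only [hj, if_true]
    have := om_norm h0 h1 (β j x)
    refine le_trans (le_of_eq ?_) this
    unfold om; simp
  simp_all
theorem one_sub_cos_ge {φ : ℝ} (h : |φ| ≤ π + 1 / 2) : φ ^ 2 / 50 ≤ 1 - cos φ := by
  have hp := pi_gt_three
  have hp4 := pi_lt_d2
  by_cases h2 : |φ| ≤ π
  · have := Real.cos_le_one_sub_mul_cos_sq h2
    have h3 : (1:ℝ) / 50 ≤ 2 / π ^ 2 := by
      rw [div_le_div_iff₀ (by norm_num) (by positivity)]; nlinarith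
    nlinarith [sq_nonneg φ]
  · push Not at h2
    have : cos φ ≤ 0 := by
      rw [← Real.cos_abs]
      exact Real.cos_nonpos_of_pi_div_two_le_of_le (by linarith) (by linarith)
    rw [← sq_abs]; nlinarith [abs_nonneg φ]
namespace Blk
variable {τ : Type*} [DecidableEq τ] {k K : ℕ} {cl : ℝ} (b : Blk ι τ k K cl)
def w1 (T : Finset ι) (t : τ) : ℝ := if (b.B t ∩ T).card = 1 then b.c t else 0
def be (p : ℝ) (T : Finset ι) (j : ι) : (ι → Bool) → ℝ := b.L1 p (b.w1 T) j
def R2 (p : ℝ) (T : Finset ι) (x : ι → Bool) : ℝ := ∑ t ∈ b.sub2 T, b.c t * xiS p (b.B t) x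
def A0 (p θ t : ℝ) (T : Finset ι) (x : ι → Bool) : ℂ :=
  cexp (((θ * ∑ u ∈ Tᶜ, xi p u x + t * ∑ s ∈ b.I.filter (fun s => b.B s ∩ T = ∅), b.c s * xiS p (b.B s) x : ℝ) : ℂ) * ⅈ)
theorem w1_le (T : Finset ι) {t : τ} (ht : t ∈ b.I) : |b.w1 T t| ≤ 1 := by
  unfold w1; split_ifs
  · exact b.cabs ht
  · simp
theorem inter_eq_single {B T : Finset ι} {j : ι} (hB : j ∈ B) (hj : j ∈ T) (h : (B ∩ T).card = 1) : B ∩ T = {j} := by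
  obtain ⟨i, hi⟩ := card_eq_one.mp h
  have : j ∈ B ∩ T := mem_inter.mpr ⟨hB, hj⟩
  grind
theorem be_dep (p : ℝ) (T : Finset ι) {j : ι} (hj : j ∈ T) : Dep (b.be p T j) Tᶜ := by
  refine Dep.sum fun t ht => ?_
  unfold w1
  split_ifs with h
  · refine ((Dep_xiS p _).mono ?_).comp (fun y => b.c t * y)
    intro i hi
    rw [Finset.mem_compl]; intro hiT
    have h2 := inter_eq_single (mem_filter.mp ht).2 hj h
    have h3 : i ∈ b.B t ∩ T := mem_inter.mpr ⟨mem_of_mem_erase hi, hiT⟩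
    grind
  · simp_rw [zero_mul]; exact Dep.const _ _
theorem A0_dep (p θ t : ℝ) (T : Finset ι) : Dep (b.A0 p θ t T) Tᶜ := by
  have h1 : Dep (fun x => ∑ u ∈ Tᶜ, xi p u x) Tᶜ := Dep.sum fun u hu => (Dep_xi p u).mono (by simpa using hu)
  have h2 : Dep (fun x => ∑ s ∈ b.I.filter (fun s => b.B s ∩ T = ∅), b.c s * xiS p (b.B s) x) Tᶜ := by
    refine Dep.sum fun s hs => ((Dep_xiS p _).mono ?_).comp (fun y => b.c s * y)
    intro i hi
    rw [Finset.mem_compl]; intro hiT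
    have h3 : i ∈ b.B s ∩ T := mem_inter.mpr ⟨hi, hiT⟩
    rw [(mem_filter.mp hs).2] at h3; simp at h3
  intro x y hxy
  unfold A0
  have e1 := h1 x y hxy
  have e2 := h2 x y hxy
  grind
theorem A0_norm (p θ t : ℝ) (T : Finset ι) (x : ι → Bool) : ‖b.A0 p θ t T x‖ = 1 := norm_exp_ofReal_mul_I _
theorem W_split (p : ℝ) (T : Finset ι) (x : ι → Bool) : b.W p x =
    ∑ s ∈ b.I.filter (fun s => b.B s ∩ T = ∅), b.c s * xiS p (b.B s) x + ∑ j ∈ T, xi p j x * b.be p T j x + b.R2 p T x := by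
  have h1 : ∑ j ∈ T, xi p j x * b.be p T j x = ∑ s ∈ b.I, if (b.B s ∩ T).card = 1 then b.c s * xiS p (b.B s) x else 0 := by
    unfold be L1 w1
    simp_rw [sum_filter, mul_sum]
    rw [sum_comm]
    refine sum_congr rfl fun s _ => ?_
    split_ifs with h
    · obtain ⟨j, hj⟩ := card_eq_one.mp h
      have hj' : j ∈ b.B s ∩ T := by rw [hj]; simp
      rw [mem_inter] at hj'
      rw [sum_eq_single_of_mem j hj'.2]
      · rw [if_pos hj'.1, xiS_erase p hj'.1]; ring
      · intro i hi hij
        rw [if_neg, mul_zero]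
        intro hB
        have : i ∈ b.B s ∩ T := mem_inter.mpr ⟨hB, hi⟩
        grind
    · simp
  rw [h1]
  unfold W R2 sub2
  rw [sum_filter, sum_filter, ← sum_add_distrib, ← sum_add_distrib]
  grind
theorem Hf_split (p θ t : ℝ) (T : Finset ι) (x : ι → Bool) : b.Hf p θ t x =
    (b.A0 p θ t T x * ∏ j ∈ T, cexp (((xi p j x * (θ + t * b.be p T j x) : ℝ) : ℂ) * ⅈ)) * cexp (((t * b.R2 p T x : ℝ) : ℂ) * ⅈ) := by
  unfold Hf A0
  rw [← Complex.exp_sum, ← Complex.exp_add, ← Complex.exp_add]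
  congr 1
  rw [← sum_mul, ← add_mul, ← add_mul]
  congr 1
  rw [← Complex.ofReal_sum, ← Complex.ofReal_add, ← Complex.ofReal_add]
  congr 1
  rw [b.W_split p T, Ns, ← sum_add_sum_compl T]
  simp_rw [mul_add, sum_add_distrib, mul_sum]
  grind
theorem term_bound {p : ℝ} (h0 : 0 < p) (h1 : p < 1) (θ t : ℝ) (T : Finset ι) (l : ℕ) (M : ℝ)
    (hM : ∀ E ⊆ T, E.card ≤ l * k → Ex p (fun x => exp (-(υ p * ∑ j ∈ T \ E, (1 - cos (θ + t * b.be p T j x))))) ≤ M) :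
    ‖Ex p (fun x => (b.A0 p θ t T x * ∏ j ∈ T, cexp (((xi p j x * (θ + t * b.be p T j x) : ℝ) : ℂ) * ⅈ)) * ((b.R2 p T x : ℝ) : ℂ) ^ l)‖
      ≤ ((b.sub2 T).card : ℝ) ^ l * M := by
  have e : ∀ x, ((b.R2 p T x : ℝ) : ℂ) ^ l = ∑ f ∈ Fintype.piFinset (fun _ : Fin l => b.sub2 T), ∏ i, ((b.c (f i) * xiS p (b.B (f i)) x : ℝ) : ℂ) := by
    intro x; unfold R2; push_cast; rw [sum_pow']
  simp_rw [e, mul_sum]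
  rw [Ex_sum]
  refine (norm_sum_le _ _).trans ?_
  have hc : ((b.sub2 T).card : ℝ) ^ l = ((Fintype.piFinset (fun _ : Fin l => b.sub2 T)).card : ℝ) := by
    rw [Fintype.card_piFinset]; simp
  rw [hc, ← nsmul_eq_mul]
  refine sum_le_card_nsmul _ _ _ fun f hf => ?_
  rw [Fintype.mem_piFinset] at hf
  have hfI : ∀ i, f i ∈ b.I := fun i => (mem_filter.mp (hf i)).1
  set E : Finset ι := T ∩ univ.biUnion (fun i => b.B (f i)) with hE
  have hEk : E.card ≤ l * k := by
    refine (card_le_card inter_subset_right).trans ((card_biUnion_le_card_mul _ _ k fun i _ => b.cardk _ (hfI i)).trans (by simp))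
  refine le_trans ?_ (hM E inter_subset_left hEk)
  have hdisj : ∀ j ∈ T, Dep (fun x => cexp (((xi p j x * (θ + t * b.be p T j x) : ℝ) : ℂ) * ⅈ)) (insert j Tᶜ) := by
    intro j hj x y hxy
    have e1 := (Dep_xi p j) x y (fun i hi => hxy i (by simp at hi; simp [hi]))
    have e2 := (b.be_dep p T hj) x y (fun i hi => hxy i (mem_insert_of_mem hi))
    simp only [] at e1 e2 ⊢
    rw [e1, e2]
  have := cond_bound h0 h1 (T \ E) (fun x => (b.A0 p θ t T x * ∏ j ∈ E, cexp (((xi p j x * (θ + t * b.be p T j x) : ℝ) : ℂ) * ⅈ)) *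
    ∏ i, ((b.c (f i) * xiS p (b.B (f i)) x : ℝ) : ℂ)) ?_ ?_ (fun j x => θ + t * b.be p T j x) ?_
  · refine le_trans (le_of_eq ?_) this
    congr 2; funext x
    rw [← prod_sdiff (inter_subset_left : E ⊆ T)]
    ring
  · refine Dep.mul' (Dep.mul' ((b.A0_dep p θ t T).mono ?_) (Dep.prod fun j hj => (hdisj j (mem_inter.mp hj).1).mono ?_))
      (Dep.prod fun i _ => ((Dep_xiS p _).comp (fun y : ℝ => ((b.c (f i) * y : ℝ) : ℂ))).mono ?_)
    · exact compl_subset_compl.mpr sdiff_subset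
    · refine insert_subset ?_ (compl_subset_compl.mpr sdiff_subset)
      simp [hj]
    · intro u hu
      simp only [Finset.mem_compl, Finset.mem_sdiff, not_and, not_not, hE, mem_inter, mem_biUnion, mem_univ, true_and]
      grind
  · intro x
    rw [norm_mul, norm_mul, A0_norm, one_mul, norm_prod, norm_prod]
    refine mul_le_one₀ (le_of_eq (prod_eq_one fun j _ => norm_exp_ofReal_mul_I _)) (prod_nonneg fun _ _ => norm_nonneg _) ?_
    refine prod_le_one (fun _ _ => norm_nonneg _) fun i _ => ?_
    rw [norm_real, norm_eq_abs, abs_mul]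
    exact mul_le_one₀ (b.cabs (hfI i)) (abs_nonneg _) (xiS_abs_le h0.le h1.le _ _)
  · intro j hj
    exact ((b.be_dep p T (Finset.mem_sdiff.mp hj).1).mono (compl_subset_compl.mpr sdiff_subset)).comp (fun y => θ + t * y)
theorem R2_sq {p : ℝ} (h0 : 0 < p) (h1 : p < 1) (T : Finset ι) :
    Ex p (fun x => b.R2 p T x ^ 2) ≤ (K * T.card) ^ 2 := by
  refine (orth h0 h1 _ _ _ K (fun t ht => b.cabs (mem_filter.mp ht).1) ?_).trans ?_
  · intro t ht
    obtain ⟨x, hx, y, hy, hxy⟩ := one_lt_card.mp (by have := b.card3 t (mem_filter.mp ht).1; omega : 1 < (b.B t).card)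
    refine le_trans (card_le_card ?_) (b.star x y hxy)
    grind
  · have : ((b.sub2 T).card : ℝ) ≤ K * T.card ^ 2 := by exact_mod_cast b.card_sub2 T
    calc (K:ℝ) * (b.sub2 T).card ≤ K * (K * T.card ^ 2) := mul_le_mul_of_nonneg_left this (by positivity)
      _ = _ := by ring
theorem R2_deg (p : ℝ) (T : Finset ι) : Deg k (b.R2 p T) :=
  Deg.sum fun t ht => Deg.smul _ (Deg.of_dep (Dep_xiS p _) (b.cardk t (mem_filter.mp ht).1))
theorem small_split {p : ℝ} (h0 : 0 < p) (h1 : p < 1) (θ t : ℝ) (T : Finset ι) (j : ℕ) (M D : ℝ) (hM0 : 0 ≤ M)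
    (hD : 1 ≤ D) (hD2 : |t| * (b.sub2 T).card ≤ D)
    (hM : ∀ E ⊆ T, E.card ≤ 2 ^ (j + 1) * k → Ex p (fun x => exp (-(υ p * ∑ j ∈ T \ E, (1 - cos (θ + t * b.be p T j x))))) ≤ M) :
    ‖b.phi p θ t‖ ≤ 4 * (hcC p j k * (|t| * (K * T.card)) ^ (2 ^ (j + 1))) + 2 ^ (j + 1) * (D ^ (2 ^ (j + 1)) * M) := by
  set r := 2 ^ (j + 1) with hr
  set G : (ι → Bool) → ℂ := fun x => b.A0 p θ t T x * ∏ j ∈ T, cexp (((xi p j x * (θ + t * b.be p T j x) : ℝ) : ℂ) * ⅈ) with hG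
  have hGn : ∀ x, ‖G x‖ = 1 := by
    intro x; rw [hG]; simp only []
    rw [norm_mul, A0_norm, one_mul, norm_prod]; exact prod_eq_one fun j _ => norm_exp_ofReal_mul_I _
  have e : b.phi p θ t = Ex p (fun x => G x * (cexp (((t * b.R2 p T x : ℝ) : ℂ) * ⅈ) - ∑ l ∈ range r, (((t * b.R2 p T x : ℝ) : ℂ) * ⅈ) ^ l / (l.factorial : ℂ)))
      + ∑ l ∈ range r, ((t : ℂ) * ⅈ) ^ l / (l.factorial : ℂ) * Ex p (fun x => G x * ((b.R2 p T x : ℝ) : ℂ) ^ l) := by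
    unfold phi
    simp_rw [← Ex_mul_left]
    rw [← Ex_sum, ← Ex_add]
    congr 1; funext x
    rw [b.Hf_split p θ t T x, mul_sub, mul_sum]
    have : ∀ l ∈ range r, ((t : ℂ) * ⅈ) ^ l / (l.factorial : ℂ) * (G x * ((b.R2 p T x : ℝ) : ℂ) ^ l) = G x * ((((t * b.R2 p T x : ℝ) : ℂ) * ⅈ) ^ l / (l.factorial : ℂ)) := by
      intro l _; push_cast; ring
    rw [sum_congr rfl this]; ring
  rw [e]
  refine (norm_add_le _ _).trans (add_le_add ?_ ?_)
  · refine (Ex_norm_le h0.le h1.le _).trans ?_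
    calc _ ≤ Ex p (fun x => 4 * (|t| ^ r * b.R2 p T x ^ r)) := by
          refine Ex_mono h0.le h1.le fun x => ?_
          rw [norm_mul, hGn, one_mul]
          refine (taylor_I _ r).trans (le_of_eq ?_)
          have hev : Even r := by rw [hr, pow_succ]; simp
          rw [abs_mul, mul_pow, hev.pow_abs (b.R2 p T x)]
      _ ≤ _ := by
          rw [Ex_mul_left, Ex_mul_left]
          have h3 := hyper h0 h1 j k _ (b.R2_deg p T)
          have h4 : (Ex p (fun x => b.R2 p T x ^ 2)) ^ 2 ^ j ≤ (((K:ℝ) * T.card) ^ 2) ^ 2 ^ j :=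
            pow_le_pow_left₀ (Ex_nonneg h0.le h1.le fun x => sq_nonneg _) (b.R2_sq h0 h1 T) _
          rw [← pow_mul, ← pow_succ' 2 j, ← hr] at h4
          have h5 := h3.trans (mul_le_mul_of_nonneg_left h4 (hcC_pos h0 h1 j k).le)
          rw [mul_pow |t|]
          have h6 := mul_le_mul_of_nonneg_left h5 (by positivity : 0 ≤ |t| ^ r)
          linarith
  · refine (norm_sum_le _ _).trans ?_
    have : ((2:ℝ) ^ (j + 1)) * (D ^ r * M) = (range r).card • (D ^ r * M) := by
      rw [card_range, nsmul_eq_mul, hr]; push_cast; ring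
    rw [this]
    refine sum_le_card_nsmul _ _ _ fun l hl => ?_
    have hl' := (mem_range.mp hl).le
    have h3 := b.term_bound h0 h1 θ t T l M (fun E hE hEk => hM E hE (hEk.trans (Nat.mul_le_mul_right k hl')))
    rw [norm_mul, norm_div, norm_pow, norm_mul, Complex.norm_I, mul_one, norm_real, Complex.norm_natCast, norm_eq_abs]
    have hf : (1:ℝ) ≤ l.factorial := by exact_mod_cast Nat.one_le_iff_ne_zero.mpr (Nat.factorial_ne_zero l)
    calc _ ≤ |t| ^ l * (((b.sub2 T).card : ℝ) ^ l * M) := by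
          refine mul_le_mul (div_le_self (by positivity) hf) h3 (norm_nonneg _) (by positivity)
      _ = (|t| * (b.sub2 T).card) ^ l * M := by rw [mul_pow]; ring
      _ ≤ D ^ l * M := by gcongr
      _ ≤ D ^ r * M := by gcongr
end Blk
end Small
noncomputable section Small2
variable {ι : Type*} [Fintype ι] [DecidableEq ι]
namespace Blk
variable {τ : Type*} [DecidableEq τ] {k K : ℕ} {cl : ℝ} (b : Blk ι τ k K cl)
variable {p : ℝ} (h0 : 0 < p) (h1 : p < 1)
theorem be_mean (p : ℝ) (T : Finset ι) (j : ι) : Ex p (b.be p T j) = 0 := by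
  unfold be L1
  rw [Ex_sum]
  refine sum_eq_zero fun t ht => ?_
  rw [mem_filter] at ht
  rw [Ex_mul_left]
  have := Ex_xiS p ((b.B t).erase j) ∅
  simp only [xiS, prod_empty, mul_one] at this
  rw [if_neg] at this
  · unfold xiS; rw [this, mul_zero]
  · intro h
    have h2 := card_erase_of_mem ht.2
    rw [h, card_empty] at h2
    have := b.card3 t ht.1; omega
include h0 h1 in
theorem be_lower (T : Finset ι) {j : ι} (hj : j ∈ T) :
    cl ^ 2 * (υ p) ^ k * ((Fintype.card ι : ℝ) - 1 - K * T.card) ≤ Ex p (fun x => b.be p T j x ^ 2) := by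
  have e : b.be p T j = fun x => ∑ t ∈ b.I.filter (fun t => j ∈ b.B t ∧ (b.B t ∩ T).card = 1), b.c t * xiS p ((b.B t).erase j) x := by
    funext x
    unfold be L1 w1
    rw [← filter_filter, sum_filter (fun t => (b.B t ∩ T).card = 1)]
    refine sum_congr rfl fun t _ => ?_
    split_ifs <;> simp
  rw [e]
  have hs := s2_bd h0 h1
  have hcl := b.clpos
  refine le_trans (mul_le_mul_of_nonneg_left ?_ (by have := hs.1; positivity)) (orth_lower h0 h1 _ _ _ cl b.clpos.le k (fun t ht => b.clo t (mem_filter.mp ht).1)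
    (fun t ht => (card_erase_le).trans (b.cardk t (mem_filter.mp ht).1)))
  have hsub : b.I.filter (fun t => j ∈ b.B t) ⊆ b.I.filter (fun t => j ∈ b.B t ∧ (b.B t ∩ T).card = 1) ∪
      (T.erase j).biUnion fun i => b.I.filter fun t => j ∈ b.B t ∧ i ∈ b.B t := by
    intro t ht
    rw [mem_filter] at ht
    rw [mem_union, mem_filter]
    by_cases h : (b.B t ∩ T).card = 1
    · grind
    · right
      have hjm : j ∈ b.B t ∩ T := mem_inter.mpr ⟨ht.2, hj⟩
      have : 1 < (b.B t ∩ T).card := by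
        have := card_pos.mpr ⟨j, hjm⟩; omega
      obtain ⟨i, hi, hij⟩ := exists_mem_ne this j
      rw [mem_inter] at hi
      simp only [mem_biUnion, mem_erase, mem_filter]
      grind
  have h1 := (b.deg j).trans ((card_le_card hsub).trans (card_union_le _ _))
  have h2 := card_biUnion_le_card_mul (T.erase j) (fun i => b.I.filter fun t => j ∈ b.B t ∧ i ∈ b.B t) K
    (fun i hi => b.star j i (ne_of_mem_erase hi).symm)
  have h3 : (T.erase j).card * K ≤ K * T.card := by rw [mul_comm]; exact Nat.mul_le_mul_left _ card_erase_le
  have h4 : Fintype.card ι ≤ (b.I.filter (fun t => j ∈ b.B t ∧ (b.B t ∩ T).card = 1)).card + K * T.card + 1 := by omega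
  have h5 : (Fintype.card ι : ℝ) ≤ (b.I.filter (fun t => j ∈ b.B t ∧ (b.B t ∩ T).card = 1)).card + K * T.card + 1 := by exact_mod_cast h4
  linarith
def FF (p θ t : ℝ) (T : Finset ι) (x : ι → Bool) : ℝ := ∑ j ∈ T, (θ + t * b.be p T j x) ^ 2
theorem be_deg (p : ℝ) (T : Finset ι) (j : ι) : Deg k (b.be p T j) := b.L1_deg p _ j
theorem FF_deg (p θ t : ℝ) (T : Finset ι) : Deg (2 * k) (b.FF p θ t T) :=
  Deg.sum fun j _ => ((Deg.const θ).add ((b.be_deg p T j).smul t)).sq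
theorem FF_eq (p θ t : ℝ) (T : Finset ι) (x : ι → Bool) : b.FF p θ t T x =
    T.card * θ ^ 2 + 2 * θ * t * ∑ j ∈ T, b.be p T j x + t ^ 2 * ∑ j ∈ T, b.be p T j x ^ 2 := by
  unfold FF
  rw [mul_sum, mul_sum, ← nsmul_eq_mul, ← sum_const, ← sum_add_distrib, ← sum_add_distrib]
  grind
theorem FF_mean (p θ t : ℝ) (T : Finset ι) : Ex p (b.FF p θ t T) =
    T.card * θ ^ 2 + t ^ 2 * Ex p (fun x => ∑ j ∈ T, b.be p T j x ^ 2) := by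
  have : b.FF p θ t T = fun x => T.card * θ ^ 2 + 2 * θ * t * ∑ j ∈ T, b.be p T j x + t ^ 2 * ∑ j ∈ T, b.be p T j x ^ 2 := funext (b.FF_eq p θ t T)
  rw [this, Ex_add, Ex_add, Ex_const, Ex_mul_left p (2 * θ * t), Ex_mul_left p (t ^ 2), Ex_sum p T, sum_eq_zero fun j _ => b.be_mean p T j]
  ring
def C5 (k K : ℕ) : ℝ := 8 * (k * K ^ 2) + 2 * CQ k K + 1
theorem C5_pos (k K : ℕ) : 0 < C5 k K := by have := CQ_nonneg (k := k) (K := K); unfold C5; positivity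
include h0 h1 in
theorem FF_var (θ t : ℝ) (T : Finset ι) :
    Ex p (fun x => (b.FF p θ t T x - Ex p (b.FF p θ t T)) ^ 2) ≤ C5 k K * T.card * (θ ^ 2 + t ^ 2 * Fintype.card ι) ^ 2 := by
  set n : ℝ := (Fintype.card ι : ℝ) with hn
  have hn0 : 0 ≤ n := by rw [hn]; positivity
  set S : (ι → Bool) → ℝ := fun x => ∑ j ∈ T, b.be p T j x with hS
  set Q : (ι → Bool) → ℝ := fun x => ∑ j ∈ T, b.be p T j x ^ 2 with hQ
  have v1 : Ex p (fun x => S x ^ 2) ≤ k * K ^ 2 * T.card * n := b.L1_sum_sq h0 h1 _ (fun t ht => b.w1_le T ht) T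
  have v2 : Ex p (fun x => (Q x - Ex p Q) ^ 2) ≤ CQ k K * T.card * n ^ 2 := by
    have := b.Q_var h0 h1 T (fun _ t => if t ∈ b.I then b.w1 T t else 0) (fun _ t => if t ∈ b.I then b.w1 T t else 0)
      (fun u t => by split_ifs with h; exact b.w1_le T h; simp) (fun u t => by split_ifs with h; exact b.w1_le T h; simp)
    have e : b.Qf p T (fun _ t => if t ∈ b.I then b.w1 T t else 0) (fun _ t => if t ∈ b.I then b.w1 T t else 0) = Q := by
      funext x
      unfold Qf
      rw [hQ]; unfold be L1
      refine sum_congr rfl fun u _ => ?_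
      rw [sq]
      congr 1 <;> refine sum_congr rfl fun t ht => ?_ <;> simp only [] <;> grind
    rwa [e] at this
  have e : ∀ x, (b.FF p θ t T x - Ex p (b.FF p θ t T)) ^ 2 ≤ 8 * (θ * t) ^ 2 * S x ^ 2 + 2 * t ^ 4 * (Q x - Ex p Q) ^ 2 := by
    intro x
    rw [b.FF_mean, b.FF_eq]
    change (T.card * θ ^ 2 + 2 * θ * t * S x + t ^ 2 * Q x - (T.card * θ ^ 2 + t ^ 2 * Ex p Q)) ^ 2 ≤ _
    nlinarith [sq_nonneg (2 * θ * t * S x - t ^ 2 * (Q x - Ex p Q))]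
  refine (Ex_mono h0.le h1.le e).trans ?_
  rw [Ex_add, Ex_mul_left, Ex_mul_left]
  have hC := CQ_nonneg (k := k) (K := K)
  have w1 := mul_le_mul_of_nonneg_left v1 (by positivity : 0 ≤ 8 * (θ * t) ^ 2)
  have w2 := mul_le_mul_of_nonneg_left v2 (by positivity : 0 ≤ 2 * t ^ 4)
  have hm : (0:ℝ) ≤ T.card := by positivity
  have hX : 0 ≤ θ ^ 2 := by positivity
  have hY : 0 ≤ t ^ 2 * n := by positivity
  have g1 : θ ^ 2 * (t ^ 2 * n) ≤ (θ ^ 2 + t ^ 2 * n) ^ 2 := by nlinarith [mul_nonneg hX hY]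
  have g2 : (t ^ 2 * n) ^ 2 ≤ (θ ^ 2 + t ^ 2 * n) ^ 2 := by nlinarith [mul_nonneg hX hY]
  have g3 := mul_le_mul_of_nonneg_left g1 (by positivity : (0:ℝ) ≤ 8 * (k * K ^ 2) * T.card)
  have g4 := mul_le_mul_of_nonneg_left g2 (by positivity : (0:ℝ) ≤ 2 * CQ k K * T.card)
  have g5 : 0 ≤ T.card * (θ ^ 2 + t ^ 2 * n) ^ 2 := by positivity
  unfold C5
  linarith
def c5 (p cl : ℝ) (k : ℕ) : ℝ := min 1 (cl ^ 2 * (υ p) ^ k / 2)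
include h0 h1 in
theorem c5_pos (hcl : 0 < cl) : 0 < c5 p cl k := by
  have := (s2_bd h0 h1).1; unfold c5; exact lt_min one_pos (by positivity)
include h0 h1 in
theorem FF_lower (θ t : ℝ) (T : Finset ι) (hT : 2 + 2 * ((K:ℝ) * T.card) ≤ Fintype.card ι) :
    c5 p cl k * T.card * (θ ^ 2 + t ^ 2 * Fintype.card ι) ≤ Ex p (b.FF p θ t T) := by
  rw [FF_mean, Ex_sum]
  have hs := (s2_bd h0 h1).1
  have hcl := b.clpos
  have h2 : ∑ j ∈ T, c5 p cl k * Fintype.card ι ≤ ∑ j ∈ T, Ex p (fun x => b.be p T j x ^ 2) := by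
    refine sum_le_sum fun j hj => le_trans ?_ (b.be_lower h0 h1 T hj)
    calc _ ≤ cl ^ 2 * (υ p) ^ k / 2 * Fintype.card ι := mul_le_mul_of_nonneg_right (min_le_right _ _) (by positivity)
      _ = cl ^ 2 * (υ p) ^ k * ((Fintype.card ι : ℝ) / 2) := by ring
      _ ≤ _ := mul_le_mul_of_nonneg_left (by linarith) (by positivity)
  rw [sum_const, nsmul_eq_mul] at h2
  have h3 := mul_le_mul_of_nonneg_left h2 (sq_nonneg t)
  have h4 : c5 p cl k ≤ 1 := min_le_left _ _
  have h5 := mul_le_mul_of_nonneg_right h4 (by positivity : (0:ℝ) ≤ T.card * θ ^ 2)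
  linarith
include h0 h1 in
theorem small_conc (θ t : ℝ) (T : Finset ι) (hT : 2 + 2 * ((K:ℝ) * T.card) ≤ Fintype.card ι)
    (hθ : |θ| ≤ π) {g : ℝ} (hg : 0 < g) (htg : t ^ 2 * Fintype.card ι * g ^ 2 ≤ 1) (hpos : 0 < θ ^ 2 + t ^ 2 * Fintype.card ι) (hT0 : 0 < T.card)
    (J R : ℕ) (E : Finset ι) (hE : E ⊆ T) (hER : E.card ≤ R) :
    Ex p (fun x => exp (-(υ p * ∑ j ∈ T \ E, (1 - cos (θ + t * b.be p T j x))))) ≤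
      exp R * exp (-(υ p * (c5 p cl k * T.card * (θ ^ 2 + t ^ 2 * Fintype.card ι)) / 100)) +
      T.card * (hcC p J k / (g / (2 * (K + 1))) ^ (2 ^ (J + 1))) +
      hcC p J (2 * k) / (c5 p cl k * Real.sqrt T.card / (2 * Real.sqrt (C5 k K))) ^ (2 ^ (J + 1)) := by
  classical
  have hs := s2_bd h0 h1
  set a := Ex p (b.FF p θ t T) with ha
  have hal := b.FF_lower h0 h1 θ t T hT
  rw [← ha] at hal
  set X := θ ^ 2 + t ^ 2 * Fintype.card ι with hX
  have hTr : (0:ℝ) < T.card := by exact_mod_cast hT0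
  have hc5 := c5_pos (k := k) h0 h1 b.clpos
  have hC5 := C5_pos k K
  have p1 : ∀ j ∈ T, Ex p (fun x => if 1 / 2 < |t * b.be p T j x| then (1:ℝ) else 0) ≤ hcC p J k / (g / (2 * (K + 1))) ^ (2 ^ (J + 1)) := by
    intro j _
    refine hyper_tail h0 h1 J k (fun x => t * b.be p T j x) ((b.be_deg p T j).smul t) (v := (K + 1) / g) (by positivity) (by positivity) ?_ _ ?_
    · have := b.L1_sq h0 h1 _ (fun t ht => b.w1_le T ht) j
      simp_rw [mul_pow]; rw [Ex_mul_left, div_pow, le_div_iff₀ (by positivity)]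
      calc _ ≤ t ^ 2 * (K ^ 2 * Fintype.card ι) * g ^ 2 := by
            refine mul_le_mul_of_nonneg_right (mul_le_mul_of_nonneg_left this (sq_nonneg t)) (sq_nonneg _)
        _ = K ^ 2 * (t ^ 2 * Fintype.card ι * g ^ 2) := by ring
        _ ≤ K ^ 2 * 1 := mul_le_mul_of_nonneg_left htg (by positivity)
        _ ≤ _ := by grind
    · intro x hx
      refine le_trans (le_of_eq ?_) hx.le
      field_simp
  have p2 : Ex p (fun x => if b.FF p θ t T x < a / 2 then (1:ℝ) else 0) ≤ hcC p J (2 * k) / (c5 p cl k * Real.sqrt T.card / (2 * Real.sqrt (C5 k K))) ^ (2 ^ (J + 1)) := by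
    refine hyper_tail h0 h1 J (2 * k) (fun x => b.FF p θ t T x - a) ((b.FF_deg p θ t T).sub (Deg.const a)) (v := Real.sqrt (C5 k K) * Real.sqrt T.card * X) (by positivity) (by positivity) ?_ _ ?_
    · rw [mul_pow, mul_pow, sq_sqrt hC5.le, sq_sqrt hTr.le]
      exact b.FF_var h0 h1 θ t T
    · intro x hx
      have : c5 p cl k * Real.sqrt T.card / (2 * Real.sqrt (C5 k K)) * (Real.sqrt (C5 k K) * Real.sqrt T.card * X) = c5 p cl k * T.card * X / 2 := by
        have h9 : Real.sqrt T.card * Real.sqrt T.card = T.card := Real.mul_self_sqrt hTr.le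
        have : Real.sqrt (C5 k K) ≠ 0 := by positivity
        field_simp
        rw [sq_sqrt hTr.le]
      grind
  have pw : ∀ x, exp (-(υ p * ∑ j ∈ T \ E, (1 - cos (θ + t * b.be p T j x)))) ≤
      exp R * exp (-(υ p * (c5 p cl k * T.card * X) / 100)) +
      ∑ j ∈ T, (if 1 / 2 < |t * b.be p T j x| then (1:ℝ) else 0) + (if b.FF p θ t T x < a / 2 then (1:ℝ) else 0) := by
    intro x
    have hsum0 : 0 ≤ ∑ j ∈ T, (if 1 / 2 < |t * b.be p T j x| then (1:ℝ) else 0) := sum_nonneg fun j _ => by split_ifs <;> norm_num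
    have hle1 : exp (-(υ p * ∑ j ∈ T \ E, (1 - cos (θ + t * b.be p T j x)))) ≤ 1 := by
      rw [exp_le_one_iff, neg_nonpos]
      exact mul_nonneg hs.1.le (sum_nonneg fun j _ => by linarith [cos_le_one (θ + t * b.be p T j x)])
    have hpos1 : 0 < exp R * exp (-(υ p * (c5 p cl k * T.card * X) / 100)) := by positivity
    by_cases c1 : ∃ j ∈ T, 1 / 2 < |t * b.be p T j x|
    · obtain ⟨j, hj, hj2⟩ := c1
      have : (1:ℝ) ≤ ∑ j ∈ T, (if 1 / 2 < |t * b.be p T j x| then (1:ℝ) else 0) := by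
        refine le_trans ?_ (single_le_sum (fun i _ => by split_ifs <;> norm_num) hj)
        rw [if_pos hj2]
      grind
    by_cases c2 : b.FF p θ t T x < a / 2
    · rw [if_pos c2]; linarith
    rw [if_neg c2]
    push Not at c1 c2
    have hb : ∀ j ∈ T, |θ + t * b.be p T j x| ≤ π + 1 / 2 := fun j hj => (abs_add_le _ _).trans (add_le_add hθ (c1 j hj))
    have h16 : ∀ j ∈ T, (θ + t * b.be p T j x) ^ 2 ≤ 16 := by
      intro j hj
      have := hb j hj; have := pi_lt_d2
      rw [← sq_abs]; nlinarith [abs_nonneg (θ + t * b.be p T j x)]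
    have hF : b.FF p θ t T x ≤ 50 * ∑ j ∈ T \ E, (1 - cos (θ + t * b.be p T j x)) + 16 * R := by
      unfold FF
      rw [← sum_sdiff hE]
      refine add_le_add ?_ ?_
      · rw [mul_sum]
        refine sum_le_sum fun j hj => ?_
        have := one_sub_cos_ge (hb j (Finset.mem_sdiff.mp hj).1)
        linarith
      · refine (sum_le_sum fun j hj => h16 j (hE hj)).trans ?_
        rw [sum_const, nsmul_eq_mul]
        have : (E.card : ℝ) ≤ R := by exact_mod_cast hER
        linarith
    have : exp (-(υ p * ∑ j ∈ T \ E, (1 - cos (θ + t * b.be p T j x)))) ≤ exp R * exp (-(υ p * (c5 p cl k * T.card * X) / 100)) := by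
      rw [← exp_add]
      apply exp_le_exp.mpr
      have h8 : c5 p cl k * T.card * X / 100 - 16 * R / 50 ≤ ∑ j ∈ T \ E, (1 - cos (θ + t * b.be p T j x)) := by linarith
      have h9 := mul_le_mul_of_nonneg_left h8 hs.1.le
      have h10 : υ p * (16 * R / 50) ≤ R := by
        have : (0:ℝ) ≤ R := by positivity
        nlinarith [mul_le_mul_of_nonneg_right hs.2 this]
      linarith
    linarith
  refine (Ex_mono h0.le h1.le pw).trans ?_
  rw [Ex_add, Ex_add, Ex_const, Ex_sum]
  refine add_le_add (add_le_add le_rfl ?_) p2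
  refine (sum_le_sum p1).trans (le_of_eq ?_)
  rw [sum_const, nsmul_eq_mul]
end Blk
end Small2
noncomputable section Small3
theorem exp_pow {c : ℝ} (hc : 0 < c) (A : ℕ) {r : ℝ} (hr : 0 < r) : exp (-(c * r)) ≤ A.factorial / c ^ A / r ^ A := by
  have h := Real.pow_div_factorial_le_exp (c * r) (by positivity) A
  rw [exp_neg, div_div, ← mul_pow, inv_le_comm₀ (exp_pos _) (by positivity), inv_div]; exact h
theorem small_y {rho θ t : ℝ} (hr2 : 2 ≤ rho) (ht : |t| * rho ^ 102 ≤ 1) (hor : 1 ≤ |t| * rho ^ 198 ∨ 1 ≤ |θ| * rho ^ 98) :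
    ∃ y : ℝ, rho ^ 101 ≤ y ∧ y ≤ rho ^ 199 ∧ |t| * y * rho ≤ 1 ∧ rho ≤ y * (θ ^ 2 + t ^ 2 * rho ^ 200) := by
  have hr1 : 1 ≤ rho := by linarith
  have hr0 : 0 < rho := by linarith
  by_cases h : |t| * rho ^ 200 ≤ 1
  · refine ⟨rho ^ 199, pow_le_pow_right₀ hr1 (by norm_num), le_rfl, by grind, ?_⟩
    have h2 : 1 ≤ |θ| * rho ^ 98 := by
      rcases hor with h3 | h3
      · have : |t| * rho ^ 198 * rho ^ 2 ≤ 1 := by rw [mul_assoc, ← pow_add]; exact h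
        nlinarith [mul_self_nonneg (rho - 2)]
      · exact h3
    have h4 : 1 ≤ θ ^ 2 * rho ^ 196 := by
      rw [← sq_abs]; calc (1:ℝ) ≤ (|θ| * rho ^ 98) ^ 2 := one_le_pow₀ h2
        _ = _ := by ring
    calc rho ≤ rho ^ 3 * 1 := by rw [mul_one]; exact le_self_pow₀ hr1 (by norm_num)
      _ ≤ rho ^ 3 * (θ ^ 2 * rho ^ 196) := by gcongr
      _ = rho ^ 199 * (θ ^ 2 + 0) := by ring
      _ ≤ _ := by gcongr; positivity
  · push Not at h
    have ht0 : 0 < |t| := by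
        rcases (abs_nonneg t).eq_or_lt with h9 | h9
        · rw [← h9, zero_mul] at h; linarith
        · exact h9
    refine ⟨1 / (|t| * rho), ?_, ?_, ?_, ?_⟩
    · rw [le_div_iff₀ (by positivity)]; grind
    · rw [div_le_iff₀ (by positivity)]; grind
    · apply le_of_eq; field_simp
    · rw [one_div_mul_eq_div, le_div_iff₀ (by positivity)]
      by_cases h3 : 1 ≤ |t| * rho ^ 198
      · have : |t| * rho ^ 2 * 1 ≤ |t| * rho ^ 2 * (|t| * rho ^ 198) := by gcongr
        have e : |t| * rho ^ 2 * (|t| * rho ^ 198) = t ^ 2 * rho ^ 200 := by rw [← sq_abs t]; ring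
        nlinarith [sq_nonneg θ]
      · have h5 := hor.resolve_left h3
        push Not at h3
        have h4 : 1 ≤ θ ^ 2 * rho ^ 196 := by
          rw [← sq_abs]; calc (1:ℝ) ≤ (|θ| * rho ^ 98) ^ 2 := one_le_pow₀ h5
            _ = _ := by ring
        have h6 : |t| * rho ^ 2 * rho ^ 196 ≤ θ ^ 2 * rho ^ 196 := by
          calc _ = |t| * rho ^ 198 := by ring
            _ ≤ _ := h3.le.trans h4
        have h7 := le_of_mul_le_mul_right h6 (by positivity)
        have : 0 ≤ t ^ 2 * rho ^ 200 := by positivity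
        grind
namespace Blk
set_option maxHeartbeats 1000000 in
theorem small_main {p : ℝ} (h0 : 0 < p) (h1 : p < 1) (k K : ℕ) {cl : ℝ} (hcl : 0 < cl) : ∃ C : ℝ, 0 < C ∧
    ∀ (ι : Type) [Fintype ι] [DecidableEq ι] (τ : Type) [DecidableEq τ] (b : Blk ι τ k K cl) (rho : ℝ), 2 * K + 2 ≤ rho →
    (Fintype.card ι : ℝ) = rho ^ 200 → ∀ θ t : ℝ, |θ| ≤ π → |t| * rho ^ 102 ≤ 1 → (1 ≤ |t| * rho ^ 198 ∨ 1 ≤ |θ| * rho ^ 98) →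
    ‖b.phi p θ t‖ ≤ C / rho ^ 400 := by
  have hs := (s2_bd h0 h1).1
  have hc5 := c5_pos (k := k) h0 h1 hcl
  have hC5 := C5_pos k K
  obtain ⟨r, hr⟩ : ∃ r, r = 2 ^ (8 + 1) := ⟨_, rfl⟩
  obtain ⟨L, hL⟩ : ∃ L, L = 2 ^ (15 + 1) := ⟨_, rfl⟩
  obtain ⟨A, hA⟩ : ∃ A, A = 198 * r + 400 := ⟨_, rfl⟩
  have hAL : A + 199 ≤ 2 * L := by rw [hA, hr, hL]; norm_num
  have hr4 : 400 ≤ r := by rw [hr]; norm_num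
  have hrp : 0 < r := by omega
  set c := υ p * c5 p cl k / 200 with hc
  have hc0 : 0 < c := by positivity
  have hK0 : (0:ℝ) ≤ K := by positivity
  set M1 : ℝ := exp ((r * k : ℕ) : ℝ) * (A.factorial / c ^ A) + hcC p 15 k * (2 * (K + 1)) ^ L + hcC p 15 (2 * k) * (2 * Real.sqrt (C5 k K) / c5 p cl k) ^ L with hM1
  have hh1 := hcC_pos h0 h1 15 k
  have hh2 := hcC_pos h0 h1 15 (2 * k)
  have hh3 := hcC_pos h0 h1 8 k
  have hM10 : 0 < M1 := by positivity
  refine ⟨4 * (hcC p 8 k * K ^ r) + r * ((K + 1) ^ r * M1), by positivity, ?_⟩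
  intro ι _ _ τ _ b rho hrho hn θ t hθ ht hor
  have hr1 : 1 ≤ rho := by linarith
  have hr0 : 0 < rho := by linarith
  obtain ⟨y, hy1, hy2, hty, hyX⟩ := small_y (by linarith) ht hor
  have hy0 : 0 < y := lt_of_lt_of_le (by positivity) hy1
  have hy4 : rho ^ 4 * 2 ≤ y := by
    calc rho ^ 4 * 2 ≤ rho ^ 4 * rho := by gcongr; linarith
      _ = rho ^ 5 := by ring
      _ ≤ rho ^ 101 := pow_le_pow_right₀ hr1 (by norm_num)
      _ ≤ y := hy1
  have hr4' : 1 ≤ rho ^ 4 := one_le_pow₀ hr1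
  obtain ⟨T, -, hT⟩ := exists_subset_card_eq (s := (univ : Finset ι)) (n := ⌊y⌋₊) (by
    rw [card_univ]
    have : (⌊y⌋₊ : ℝ) ≤ Fintype.card ι := (Nat.floor_le hy0.le).trans (hy2.trans (by rw [hn]; exact pow_le_pow_right₀ hr1 (by norm_num)))
    exact_mod_cast this)
  have hT1 : (T.card : ℝ) ≤ y := by rw [hT]; exact Nat.floor_le hy0.le
  have hT2 : y / 2 ≤ T.card := by rw [hT]; have := Nat.lt_floor_add_one y; linarith
  have hTpos : (0:ℝ) < T.card := by linarith
  set X := θ ^ 2 + t ^ 2 * Fintype.card ι with hX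
  rw [← hn, ← hX] at hyX
  have hXpos : 0 < X := by by_contra h9; push Not at h9; linarith [mul_nonpos_of_nonneg_of_nonpos hy0.le h9]
  have hT4 : rho ^ 4 ≤ T.card := by linarith
  have hTK : |t| * T.card ≤ 1 / rho := by
    rw [le_div_iff₀ hr0]; refine le_trans ?_ hty; gcongr
  have hrr : (1:ℝ) ≤ rho ^ 198 := one_le_pow₀ hr1
  have key := b.small_split h0 h1 θ t T 8 (M1 / rho ^ A) ((K + 1) * rho ^ 198) (by positivity) (one_le_mul_of_one_le_of_one_le (by linarith) hrr) ?_ ?_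
  · rw [← hr] at key
    refine key.trans ((add_le_add (b := 4 * (hcC p 8 k * K ^ r) / rho ^ 400) (d := r * ((K + 1) ^ r * M1) / rho ^ 400) ?_ ?_).trans (le_of_eq (add_div _ _ _).symm))
    · calc 4 * (hcC p 8 k * (|t| * (K * T.card)) ^ r) = 4 * (hcC p 8 k * (K * (|t| * T.card)) ^ r) := by ring
        _ ≤ 4 * (hcC p 8 k * (K * (1 / rho)) ^ r) := by gcongr
        _ = 4 * (hcC p 8 k * K ^ r) / rho ^ r := by rw [mul_pow, div_pow, one_pow]; ring
        _ ≤ _ := by gcongr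
    · apply le_of_eq
      have e2 : (2:ℝ) ^ (8 + 1) = (r : ℝ) := by rw [hr]; push_cast; norm_num
      rw [e2, mul_pow, ← pow_mul, hA, pow_add]; field_simp
  · calc |t| * (b.sub2 T).card ≤ |t| * (K * T.card ^ 2) := by gcongr; exact_mod_cast b.card_sub2 T
      _ = K * ((|t| * T.card) * T.card) := by ring
      _ ≤ K * ((1 / rho) * rho ^ 199) := by gcongr; exact hT1.trans hy2
      _ = K * rho ^ 198 := by field_simp
      _ ≤ _ := by gcongr; linarith
  · intro E hE hEc
    rw [← hr] at hEc
    refine (b.small_conc h0 h1 θ t T ?_ hθ (g := rho ^ 2) (by positivity) ?_ hXpos (by exact_mod_cast hTpos) 15 (r * k) E hE hEc).trans ?_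
    · rw [hn]
      have h199 : (1:ℝ) ≤ rho ^ 199 := one_le_pow₀ hr1
      calc 2 + 2 * ((K:ℝ) * T.card) ≤ 2 * rho ^ 199 + 2 * (K * rho ^ 199) := by gcongr; linarith; exact hT1.trans hy2
        _ = (2 * K + 2) * rho ^ 199 := by ring
        _ ≤ rho * rho ^ 199 := by gcongr
        _ = _ := by ring
    · rw [hn]; calc _ = (|t| * rho ^ 102) ^ 2 := by rw [← sq_abs t]; ring
        _ ≤ 1 := pow_le_one₀ (by positivity) ht
    · rw [← hL, hM1, add_div, add_div, ← hX]
      refine add_le_add (add_le_add ?_ ?_) ?_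
      · rw [mul_div_assoc (exp _)]
        refine mul_le_mul_of_nonneg_left (le_trans (exp_le_exp.mpr ?_) (exp_pow hc0 A hr0)) (exp_pos _).le
        have : rho / 2 ≤ T.card * X := by linarith [mul_le_mul_of_nonneg_right hT2 hXpos.le]
        have h7 := mul_le_mul_of_nonneg_left this (by positivity : 0 ≤ υ p * c5 p cl k / 100)
        rw [hc]; linarith
      · rw [div_pow, div_div_eq_mul_div, ← mul_div_assoc, ← pow_mul, div_le_div_iff₀ (by positivity) (by positivity)]
        calc T.card * (hcC p 15 k * (2 * (K + 1)) ^ L) * rho ^ A ≤ rho ^ 199 * (hcC p 15 k * (2 * (K + 1)) ^ L) * rho ^ A := by gcongr; exact hT1.trans hy2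
          _ = hcC p 15 k * (2 * (K + 1)) ^ L * rho ^ (A + 199) := by rw [pow_add]; ring
          _ ≤ _ := by gcongr
      · have hsq : rho ^ 2 ≤ Real.sqrt T.card := le_sqrt_of_sq_le (by rw [← pow_mul]; exact hT4)
        calc hcC p 15 (2 * k) / (c5 p cl k * Real.sqrt T.card / (2 * Real.sqrt (C5 k K))) ^ L
            ≤ hcC p 15 (2 * k) / (c5 p cl k * rho ^ 2 / (2 * Real.sqrt (C5 k K))) ^ L := by gcongr
          _ = hcC p 15 (2 * k) * (2 * Real.sqrt (C5 k K) / c5 p cl k) ^ L / rho ^ (2 * L) := by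
              rw [div_pow, div_pow, mul_pow, pow_mul]; field_simp
          _ ≤ _ := by gcongr; omega
end Blk
end Small3
noncomputable section Big
variable {ι : Type*} [Fintype ι] [DecidableEq ι]
variable {p : ℝ} (h0 : 0 < p) (h1 : p < 1)
theorem color (Δ : ℕ) (r : ι → ι → Prop) [DecidableRel r] (hr : ∀ i j, r i j → r j i) (J : Finset ι) :
    (∀ j ∈ J, (J.filter fun i => i ≠ j ∧ r j i).card ≤ Δ) → ∃ f : ι → Fin (Δ + 1), ∀ i ∈ J, ∀ j ∈ J, i ≠ j → r i j → f i ≠ f j := by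
  induction J using Finset.induction_on with
  | empty => simp_all
  | insert a J ha ih =>
    intro h
    obtain ⟨f, hf⟩ := ih fun j hj => (card_le_card (filter_subset_filter _ (subset_insert _ _))).trans (h j (mem_insert_of_mem hj))
    have hc : (((insert a J).filter fun i => i ≠ a ∧ r a i).image f).card < (univ : Finset (Fin (Δ + 1))).card := by
      rw [card_univ, Fintype.card_fin]
      exact Nat.lt_succ_of_le (card_image_le.trans (h a (mem_insert_self _ _)))
    obtain ⟨c, -, hc⟩ := exists_mem_notMem_of_card_lt_card hc
    simp only [mem_image, mem_filter, not_exists, not_and] at hc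
    refine ⟨update f a c, ?_⟩
    grind
theorem exp_neg_le {u : ℝ} (h0 : 0 ≤ u) (h1 : u ≤ 1) : exp (-u) ≤ 1 - u / 2 := by
  rw [exp_neg, inv_le_iff_one_le_mul₀ (exp_pos u)]
  have := add_one_le_exp u
  nlinarith
include h0 h1 in
theorem jensen_bound (J : Finset ι) (h : ι → (ι → Bool) → ℝ) (A : ι → Finset ι)
    (hA : ∀ j ∈ J, Dep (h j) (A j)) {M e lam : ℝ} (hn : ∀ j x, 0 ≤ h j x) (hM : ∀ j x, h j x ≤ M) (he : ∀ j ∈ J, e ≤ Ex p (h j))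
    (Δ : ℕ) (hΔ : ∀ j ∈ J, (J.filter fun i => i ≠ j ∧ ¬ Disjoint (A j) (A i)).card ≤ Δ) (hl : 0 ≤ lam) (hlM : lam * (Δ + 1) * M ≤ 1) :
    Ex p (fun x => exp (-(lam * ∑ j ∈ J, h j x))) ≤ exp (-(lam * J.card * e / 2)) := by
  obtain ⟨f, hf⟩ := color Δ (fun i j => ¬ Disjoint (A i) (A j)) (fun i j h => by rwa [disjoint_comm]) J hΔ
  set y := lam * (Δ + 1) with hy
  have hy0 : 0 ≤ y := by positivity
  have hD : (0:ℝ) < Δ + 1 := by positivity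
  have fac : ∀ j ∈ J, Ex p (fun x => exp (y * (e / 2 - h j x))) ≤ 1 := by
    intro j hj
    have e1 : ∀ x, exp (y * (e / 2 - h j x)) ≤ exp (y * e / 2) * (1 - y / 2 * h j x) := by
      intro x
      have h3 : y * h j x ≤ 1 := (mul_le_mul_of_nonneg_left (hM j x) hy0).trans hlM
      have h2 := exp_neg_le (mul_nonneg hy0 (hn j x)) h3
      calc _ = exp (y * e / 2) * exp (-(y * h j x)) := by rw [← exp_add]; ring_nf
        _ ≤ _ := by refine mul_le_mul_of_nonneg_left (h2.trans (le_of_eq (by ring))) (exp_pos _).le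
    refine (Ex_mono h0.le h1.le e1).trans ?_
    rw [Ex_mul_left, Ex_sub, Ex_const, Ex_mul_left]
    have h4 : 1 - y / 2 * Ex p (h j) ≤ exp (-(y * e / 2)) := by
      have := add_one_le_exp (-(y * e / 2))
      have := mul_le_mul_of_nonneg_left (he j hj) hy0
      linarith
    calc _ ≤ exp (y * e / 2) * exp (-(y * e / 2)) := mul_le_mul_of_nonneg_left h4 (exp_pos _).le
      _ = 1 := by rw [← exp_add]; simp
  have pw : ∀ x, exp (-(lam * ∑ j ∈ J, h j x)) ≤ exp (-(lam * J.card * e / 2)) *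
      ∑ c : Fin (Δ + 1), (1 / (Δ + 1 : ℝ)) * ∏ j ∈ J.filter (fun j => f j = c), exp (y * (e / 2 - h j x)) := by
    intro x
    have jn := convexOn_exp.map_sum_le (t := (univ : Finset (Fin (Δ + 1)))) (w := fun _ => 1 / (Δ + 1 : ℝ))
      (p := fun c => ∑ j ∈ J.filter (fun j => f j = c), y * (e / 2 - h j x)) (fun _ _ => by positivity) (by simp; field_simp) (fun _ _ => Set.mem_univ _)
    simp only [smul_eq_mul, Real.exp_sum] at jn
    refine le_trans (le_of_eq ?_) (mul_le_mul_of_nonneg_left jn (exp_pos _).le)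
    rw [← Real.exp_sum, ← mul_sum, sum_fiberwise, ← mul_sum, sum_sub_distrib, sum_const, nsmul_eq_mul, ← exp_add]
    congr 1
    rw [hy]; field_simp; ring
  refine (Ex_mono h0.le h1.le pw).trans ?_
  rw [Ex_mul_left, Ex_sum]
  refine mul_le_of_le_one_right (exp_pos _).le ?_
  calc _ ≤ ∑ c : Fin (Δ + 1), 1 / (Δ + 1 : ℝ) := by
        refine sum_le_sum fun c _ => ?_
        rw [Ex_mul_left]
        refine mul_le_of_le_one_right (by positivity) ?_
        rw [Ex_indep_prod p _ (fun j x => exp (y * (e / 2 - h j x))) A]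
        · exact prod_le_one (fun j _ => Ex_nonneg h0.le h1.le fun x => (exp_pos _).le) fun j hj => fac j (mem_filter.mp hj).1
        · exact fun j hj => (hA j (mem_filter.mp hj).1).comp fun s => exp (y * (e / 2 - s))
        grind
    _ = 1 := by simp; field_simp
theorem Ex_comm (p : ℝ) {V : Type*} [AddCommGroup V] [Module ℝ V] (F : (ι → Bool) → (ι → Bool) → V) :
    Ex p (fun x => Ex p (F x)) = Ex p (fun y => Ex p fun x => F x y) := by
  simp only [Ex, smul_sum]; rw [sum_comm]
  refine sum_congr rfl fun x _ => sum_congr rfl fun y _ => smul_comm _ _ _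
include h0 h1 in
theorem cs_bound (V : Finset ι) (F : (ι → Bool) → ℂ) :
    ‖Ex p F‖ ^ 2 ≤ Ex p (fun x' => Ex p fun x'' => ‖Ex p fun y => F (mix V y x') * (starRingEnd ℂ) (F (mix V y x''))‖) := by
  have hst : ∀ G : (ι → Bool) → ℂ, (starRingEnd ℂ) (Ex p G) = Ex p fun x => (starRingEnd ℂ) (G x) := by
    intro G; simp [Ex]
  have key : Ex p (fun y => ‖Ex p fun x => F (mix V y x)‖ ^ 2) = (Ex p fun x' => Ex p fun x'' => Ex p fun y => F (mix V y x') * (starRingEnd ℂ) (F (mix V y x''))).re := by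
    have : ((Ex p (fun y => ‖Ex p fun x => F (mix V y x)‖ ^ 2) : ℝ) : ℂ) = Ex p fun x' => Ex p fun x'' => Ex p fun y => F (mix V y x') * (starRingEnd ℂ) (F (mix V y x'')) := by
      rw [← Ex_ofReal]
      have e : ∀ x', Ex p (fun x'' => Ex p fun y => F (mix V y x') * (starRingEnd ℂ) (F (mix V y x''))) = Ex p fun y => Ex p fun x'' => F (mix V y x') * (starRingEnd ℂ) (F (mix V y x'')) :=
        fun x' => Ex_comm p _
      simp_rw [e]
      rw [Ex_comm p]
      congr 1; funext y
      simp_rw [Ex_mul_left]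
      rw [Ex_mul_right, ← hst, Complex.mul_conj, Complex.normSq_eq_norm_sq]
    rw [← this, Complex.ofReal_re]
  calc ‖Ex p F‖ ^ 2 = ‖Ex p fun y => Ex p fun x => F (mix V y x)‖ ^ 2 := by rw [Ex_mix]
    _ ≤ (Ex p fun y => ‖Ex p fun x => F (mix V y x)‖) ^ 2 := by gcongr; exact Ex_norm_le h0.le h1.le _
    _ ≤ Ex p (fun y => ‖Ex p fun x => F (mix V y x)‖ ^ 2) := Ex_sq_le h0.le h1.le _
    _ ≤ _ := by
      rw [key]
      refine (Complex.re_le_norm _).trans ((Ex_norm_le h0.le h1.le _).trans (Ex_mono h0.le h1.le fun x' => Ex_norm_le h0.le h1.le _))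
include h0 h1 in
theorem zz_bound (V : Finset ι) (x' : ι → Bool) :
    Ex p (fun x'' => exp (-∑ v ∈ V, (xi p v x' - xi p v x'') ^ 2)) ≤ exp (-(υ p / 2 * V.card)) := by
  have hs := s2_bd h0 h1
  have e : ∀ x'' : ι → Bool, exp (-∑ v ∈ V, (xi p v x' - xi p v x'') ^ 2) = ∏ v ∈ V, exp (-(xi p v x' - xi p v x'') ^ 2) := by
    intro x''; rw [← Real.exp_sum, sum_neg_distrib]
  simp_rw [e]
  rw [Ex_indep_prod p V (fun v x'' => exp (-(xi p v x' - xi p v x'') ^ 2)) (fun v => {v}) (fun v _ => (Dep_xi p v).comp fun s => exp (-(xi p v x' - s) ^ 2))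
    (fun v _ w _ h => by simpa using h), mul_comm (υ p / 2), neg_mul_eq_mul_neg, Real.exp_nat_mul]
  rw [← prod_const]
  refine prod_le_prod (fun v _ => Ex_nonneg h0.le h1.le fun x => (exp_pos _).le) fun v _ => ?_
  have := Ex_marg (ι := ι) p v (fun c => exp (-(xi p v x' - ((if c then 1 else 0) - p)) ^ 2))
  unfold xi at this ⊢
  rw [this]
  have h3 := exp_neg_le zero_le_one le_rfl
  have h4 := add_one_le_exp (-(υ p / 2))
  by_cases hx : x' v
  · simp [hx]; nlinarith
  · simp [hx]; rw [show (-p - (1 - p)) ^ 2 = 1 by ring]; norm_num at h3 ⊢; nlinarith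
end Big
noncomputable section Big2
variable {ι : Type*} [Fintype ι] [DecidableEq ι]
namespace Blk
variable {τ : Type*} [DecidableEq τ] {k K : ℕ} {cl : ℝ} (b : Blk ι τ k K cl)
def tvj (v j : ι) : Finset τ := b.I.filter fun t => v ∈ b.B t ∧ j ∈ b.B t
def ga (p : ℝ) (v j : ι) (x : ι → Bool) : ℝ := ∑ t ∈ b.tvj v j, b.c t * xiS p (((b.B t).erase v).erase j) x
def av (v j : ι) : Finset ι := (b.tvj v j).biUnion fun t => ((b.B t).erase v).erase j
theorem ga_dep (p : ℝ) (v j : ι) : Dep (b.ga p v j) (b.av v j) :=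
  Dep.sum fun t ht => ((Dep_xiS p _).mono (subset_biUnion_of_mem (fun t => ((b.B t).erase v).erase j) ht)).comp (fun y => b.c t * y)
theorem ga_abs {p : ℝ} (h0 : 0 < p) (h1 : p < 1) {v j : ι} (hvj : v ≠ j) (x : ι → Bool) : |b.ga p v j x| ≤ K := by
  refine (abs_sum_le_sum_abs _ _).trans ?_
  calc _ ≤ ∑ t ∈ b.tvj v j, (1:ℝ) := sum_le_sum fun t ht => by
        rw [abs_mul]
        exact mul_le_one₀ (b.cabs (mem_filter.mp ht).1) (abs_nonneg _) (xiS_abs_le h0.le h1.le _ _)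
    _ = ((b.tvj v j).card : ℝ) := by simp
    _ ≤ K := by exact_mod_cast b.star v j hvj
structure Cfg (p c1 : ℝ) (J V : Finset ι) : Prop where
  dj : Disjoint J V
  one : ∀ t ∈ b.I, (b.B t ∩ V).Nonempty → (b.B t ∩ J).Nonempty → (b.B t ∩ (J ∪ V)).card ≤ 2
  two : ∀ j ∈ J, ∀ v ∈ V, ∀ v' ∈ V, v ≠ v' → Disjoint (b.av v j) (b.av v' j)
  three : ∀ j ∈ J, ∀ v ∈ V, ∀ s : ℝ, |s| ≤ π → ‖Ex p (fun x => cexp (((s * b.ga p v j x : ℝ) : ℂ) * ⅈ))‖ ≤ exp (-(c1 * s ^ 2))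
variable {p c1 : ℝ} {J V : Finset ι}
theorem Cfg.pair {b : Blk ι τ k K cl} (h : b.Cfg p c1 J V) {t : τ} (ht : t ∈ b.I) {v j : ι} (hv : v ∈ V) (hj : j ∈ J) (hvt : v ∈ b.B t) (hjt : j ∈ b.B t)
    {i : ι} (hi : i ∈ b.B t) (hiJ : i ∈ J ∪ V) : i = v ∨ i = j := by
  by_contra hc
  push Not at hc
  have hne : v ≠ j := fun e => disjoint_left.mp h.dj hj (e ▸ hv)
  have h2 := h.one t ht ⟨v, mem_inter.mpr ⟨hvt, hv⟩⟩ ⟨j, mem_inter.mpr ⟨hjt, hj⟩⟩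
  have h3 : ({v, j, i} : Finset ι) ⊆ b.B t ∩ (J ∪ V) := by
    intro a ha
    simp only [mem_insert, mem_singleton] at ha
    rcases ha with rfl | rfl | rfl <;> simp_all
  have h4 := card_le_card h3
  grind
theorem Cfg.av_sub {b : Blk ι τ k K cl} (h : b.Cfg p c1 J V) {v j : ι} (hv : v ∈ V) (hj : j ∈ J) : b.av v j ⊆ Jᶜ ∩ Vᶜ := by
  intro i hi
  simp only [av, tvj, mem_biUnion, mem_filter, mem_erase] at hi
  obtain ⟨t, ⟨ht, h1, h2⟩, h3, h4, h5⟩ := hi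
  have : i ∉ J ∪ V := fun hc => (h.pair ht hv hj h1 h2 h5 hc).elim h4 h3
  simpa [mem_union] using this
def al (p : ℝ) (V : Finset ι) (x' x'' : ι → Bool) (j : ι) (y : ι → Bool) : ℝ := ∑ v ∈ V, (xi p v x' - xi p v x'') * b.ga p v j y
def aJ (V : Finset ι) (j : ι) : Finset ι := V.biUnion fun v => b.av v j
theorem al_dep (x' x'' : ι → Bool) (j : ι) : Dep (b.al p V x' x'' j) (b.aJ V j) :=
  Dep.sum fun v hv => ((b.ga_dep p v j).mono (subset_biUnion_of_mem (fun v => b.av v j) hv)).comp fun s => (xi p v x' - xi p v x'') * s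
theorem xi_diff (p : ℝ) (v : ι) (x' x'' : ι → Bool) : (xi p v x' - xi p v x'') ^ 2 ≤ 1 := by
  unfold xi; split_ifs <;> ring_nf <;> norm_num
theorem aJ_card (j : ι) (hj : j ∉ V) : (b.aJ V j).card ≤ V.card * K * k := by
  refine (card_biUnion_le_card_mul _ _ (K * k) fun v hv => ?_).trans (le_of_eq (by ring))
  refine (card_biUnion_le_card_mul _ _ k fun t ht => ?_).trans (Nat.mul_le_mul_right _ (b.star v j fun e => hj (e ▸ hv)))
  exact (card_erase_le.trans card_erase_le).trans (b.cardk t (mem_filter.mp ht).1)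
theorem aJ_deg {b : Blk ι τ k K cl} (h : b.Cfg p c1 J V) {j : ι} (hj : j ∈ J) :
    (J.filter fun i => i ≠ j ∧ ¬ Disjoint (b.aJ V j) (b.aJ V i)).card ≤ (V.card * K * k) ^ 2 := by
  have hs : (J.filter fun i => i ≠ j ∧ ¬ Disjoint (b.aJ V j) (b.aJ V i)) ⊆ (b.aJ V j).biUnion fun u => (V.erase u).biUnion fun v => (b.tvj v u).biUnion b.B := by
    intro i hi
    rw [mem_filter, not_disjoint_iff] at hi
    obtain ⟨-, -, u, hu, hu2⟩ := hi
    simp only [aJ, av, tvj, mem_biUnion, mem_filter, mem_erase] at hu2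
    obtain ⟨v, hv, t, ⟨ht, h1, h2⟩, h3, h4, h5⟩ := hu2
    rw [mem_biUnion]
    refine ⟨u, hu, ?_⟩
    simp only [tvj, mem_biUnion, mem_filter, mem_erase]
    exact ⟨v, ⟨fun e => h4 e.symm, hv⟩, t, ⟨ht, h1, h5⟩, h2⟩
  refine (card_le_card hs).trans ?_
  refine (card_biUnion_le_card_mul _ _ (V.card * K * k) fun u hu => ?_).trans ?_
  · refine (card_biUnion_le_card_mul _ _ (K * k) fun v hv => ?_).trans ?_
    · refine (card_biUnion_le_card_mul _ _ k fun t ht => b.cardk t (mem_filter.mp ht).1).trans (Nat.mul_le_mul_right _ (b.star v u (ne_of_mem_erase hv)))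
    · rw [mul_assoc]; exact Nat.mul_le_mul_right _ card_erase_le
  · rw [sq]; exact Nat.mul_le_mul_right _ (b.aJ_card j (disjoint_left.mp h.dj hj))
theorem diff_eq {b : Blk ι τ k K cl} (h : b.Cfg p c1 J V) (x' x'' y : ι → Bool) : b.W p (mix V y x') - b.W p (mix V y x'') =
    ∑ t ∈ b.I.filter (fun t => b.B t ∩ J = ∅), b.c t * (xiS p (b.B t) (mix V y x') - xiS p (b.B t) (mix V y x'')) +
    ∑ j ∈ J, xi p j y * b.al p V x' x'' j y := by
  have e2 : ∑ j ∈ J, xi p j y * b.al p V x' x'' j y = ∑ t ∈ b.I, ∑ j ∈ J, ∑ v ∈ V, if v ∈ b.B t ∧ j ∈ b.B t then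
      xi p j y * ((xi p v x' - xi p v x'') * (b.c t * xiS p (((b.B t).erase v).erase j) y)) else 0 := by
    rw [sum_comm]
    refine sum_congr rfl fun j _ => ?_
    rw [sum_comm]
    unfold al ga tvj
    rw [mul_sum]
    refine sum_congr rfl fun v _ => ?_
    rw [mul_sum, mul_sum, sum_filter]
  have hin : ∀ i ∈ V, ∀ x, xi p i (mix V y x) = xi p i x := fun i hi x => by simp [xi, mix, hi]
  have hout : ∀ i ∉ V, ∀ x, xi p i (mix V y x) = xi p i y := fun i hi x => by simp [xi, mix, hi]
  rw [e2, sum_filter, ← sum_add_distrib]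
  unfold W
  rw [← sum_sub_distrib]
  refine sum_congr rfl fun t ht => ?_
  by_cases hJ : b.B t ∩ J = ∅
  · rw [if_pos hJ, sum_eq_zero, mul_sub, add_zero]
    intro j hj
    refine sum_eq_zero fun v _ => if_neg fun hc => ?_
    exact notMem_empty j (hJ ▸ mem_inter.mpr ⟨hc.2, hj⟩)
  · rw [if_neg hJ, zero_add]
    obtain ⟨j, hj⟩ := nonempty_iff_ne_empty.mpr hJ
    rw [mem_inter] at hj
    by_cases hV : (b.B t ∩ V).Nonempty
    · obtain ⟨v, hv⟩ := hV
      rw [mem_inter] at hv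
      have hne : v ≠ j := fun e => disjoint_left.mp h.dj hj.2 (e ▸ hv.2)
      have hpr := fun i hi hi2 => h.pair (i := i) ht hv.2 hj.2 hv.1 hj.1 hi hi2
      rw [sum_eq_single_of_mem j hj.2, sum_eq_single_of_mem v hv.2, if_pos ⟨hv.1, hj.1⟩]
      · have hx : ∀ x, xiS p (b.B t) (mix V y x) = xi p v x * (xi p j y * xiS p (((b.B t).erase v).erase j) y) := by
          intro x
          rw [xiS_erase p hv.1, xiS_erase p (mem_erase.mpr ⟨hne.symm, hj.1⟩), hin v hv.2, hout j (disjoint_left.mp h.dj hj.2)]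
          congr 2
          unfold xiS
          refine prod_congr rfl fun i hi => hout i (fun hiV => ?_) x
          simp only [mem_erase] at hi
          exact (hpr i hi.2.2 (mem_union_right _ hiV)).elim hi.2.1 hi.1
        rw [hx, hx]; ring
      · intro v' hv' hvv'
        refine if_neg fun hc => ?_
        rcases hpr v' hc.1 (mem_union_right _ hv') with e | e
        · exact hvv' e
        · exact disjoint_left.mp h.dj hj.2 (e ▸ hv')
      · intro j' hj' hjj'
        refine sum_eq_zero fun v' _ => if_neg fun hc => ?_
        rcases hpr j' hc.2 (mem_union_left _ hj') with e | e
        · exact disjoint_left.mp h.dj hj' (e ▸ hv.2)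
        · exact hjj' e
    · rw [not_nonempty_iff_eq_empty] at hV
      have hx : ∀ x, xiS p (b.B t) (mix V y x) = xiS p (b.B t) y := fun x =>
        prod_congr rfl fun i hi => hout i (fun hiV => notMem_empty i (hV ▸ mem_inter.mpr ⟨hi, hiV⟩)) x
      rw [hx, hx, sub_self, sum_eq_zero]
      intro j' _
      refine sum_eq_zero fun v' hv' => if_neg fun hc => ?_
      exact notMem_empty v' (hV ▸ mem_inter.mpr ⟨hc.1, hv'⟩)
theorem big_cs {b : Blk ι τ k K cl} (h0 : 0 < p) (h1 : p < 1) (h : b.Cfg p c1 J V) (θ t : ℝ) : ‖b.phi p θ t‖ ^ 2 ≤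
    Ex p (fun x' => Ex p fun x'' => Ex p fun y => exp (-(υ p * ∑ j ∈ J, (1 - cos (t * b.al p V x' x'' j y))))) := by
  refine (cs_bound h0 h1 V _).trans (Ex_mono h0.le h1.le fun x' => Ex_mono h0.le h1.le fun x'' => ?_)
  set a : (ι → Bool) → ℂ := fun y => cexp (((θ * ∑ v ∈ V, (xi p v x' - xi p v x'') + t * ∑ s ∈ b.I.filter (fun s => b.B s ∩ J = ∅), b.c s * (xiS p (b.B s) (mix V y x') - xiS p (b.B s) (mix V y x'')) : ℝ) : ℂ) * ⅈ) with ha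
  have e : ∀ y, b.Hf p θ t (mix V y x') * (starRingEnd ℂ) (b.Hf p θ t (mix V y x'')) = a y * ∏ j ∈ J, cexp (((xi p j y * (t * b.al p V x' x'' j y) : ℝ) : ℂ) * ⅈ) := by
    intro y
    have hN : Ns p (mix V y x') - Ns p (mix V y x'') = ∑ v ∈ V, (xi p v x' - xi p v x'') := by
      unfold Ns
      rw [← sum_sub_distrib, ← sum_subset (subset_univ V)]
      · exact sum_congr rfl fun v hv => by simp [xi, mix, hv]
      · exact fun v _ hv => by simp [xi, mix, hv]
    have hW := diff_eq h x' x'' y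
    unfold Hf
    rw [← Complex.exp_conj, map_mul, Complex.conj_ofReal, Complex.conj_I, ha, ← Complex.exp_add, ← Complex.exp_sum, ← Complex.exp_add, ← sum_mul,
      mul_neg, ← sub_eq_add_neg, ← sub_mul, ← add_mul, ← hN]
    congr 2
    rw [← Complex.ofReal_sum, ← Complex.ofReal_sub, ← Complex.ofReal_add]
    congr 1
    have e3 : ∑ j ∈ J, xi p j y * (t * b.al p V x' x'' j y) = t * ∑ j ∈ J, xi p j y * b.al p V x' x'' j y := by
      rw [mul_sum]; exact sum_congr rfl fun j _ => by ring
    rw [e3]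
    linear_combination t * hW
  simp_rw [e]
  refine cond_bound h0 h1 J a ?_ (fun y => le_of_eq (norm_exp_ofReal_mul_I _)) (fun j y => t * b.al p V x' x'' j y) ?_
  · intro y y' hyy
    rw [ha]
    simp only []
    congr 4
    congr 1
    refine sum_congr rfl fun s hs => ?_
    have hs2 := (mem_filter.mp hs).2
    have : ∀ x, xiS p (b.B s) (mix V y x) = xiS p (b.B s) (mix V y' x) := by
      intro x
      refine Dep_xiS p _ _ _ fun i hi => ?_
      have : i ∈ Jᶜ := by rw [Finset.mem_compl]; exact fun hiJ => notMem_empty i (hs2 ▸ mem_inter.mpr ⟨hi, hiJ⟩)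
      simp [mix, hyy i this]
    rw [this, this]
  · intro j hj
    refine ((b.al_dep x' x'' j).mono ?_).comp fun s => t * s
    exact biUnion_subset.mpr fun v hv => (h.av_sub hv hj).trans inter_subset_left
theorem big_in {b : Blk ι τ k K cl} (h0 : 0 < p) (h1 : p < 1) (h : b.Cfg p c1 J V) {t : ℝ} (ht : |t| ≤ π) (x' x'' : ι → Bool)
    {lam : ℝ} (hl0 : 0 ≤ lam) (hl1 : lam ≤ υ p) (hl2 : lam * ((V.card * K * k) ^ 2 + 1) * (t ^ 2 * (V.card * K) ^ 2 / 2) ≤ 1) :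
    Ex p (fun y => exp (-(υ p * ∑ j ∈ J, (1 - cos (t * b.al p V x' x'' j y))))) ≤
      exp (-(lam * J.card * (1 - exp (-(c1 * t ^ 2 * ∑ v ∈ V, (xi p v x' - xi p v x'') ^ 2))) / 2)) := by
  have hab : ∀ v (x : ι → Bool) (x2 : ι → Bool), |xi p v x - xi p v x2| ≤ 1 := fun v x x2 => by
    rw [← sq_le_one_iff_abs_le_one]; exact xi_diff p v x x2
  have hcos : ∀ s : ℝ, 0 ≤ 1 - cos s := fun s => by linarith [cos_le_one s]
  refine (Ex_mono h0.le h1.le fun y => exp_le_exp.mpr (neg_le_neg (mul_le_mul_of_nonneg_right hl1 (sum_nonneg fun j _ => hcos _)))).trans ?_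
  have hal : ∀ j ∈ J, ∀ y, |b.al p V x' x'' j y| ≤ V.card * K := by
    intro j hj y
    refine (abs_sum_le_sum_abs _ _).trans ((sum_le_card_nsmul _ _ (K : ℝ) fun v hv => ?_).trans (le_of_eq (nsmul_eq_mul _ _)))
    rw [abs_mul]
    have hne : v ≠ j := fun e => disjoint_left.mp h.dj hj (e ▸ hv)
    exact (mul_le_of_le_one_left (abs_nonneg _) (hab _ _ _)).trans (b.ga_abs h0 h1 hne y)
  have e1 : ∀ y, ∑ j ∈ J, (1 - cos (t * b.al p V x' x'' j y)) = ∑ j ∈ J, (if j ∈ J then 1 - cos (t * b.al p V x' x'' j y) else 0) :=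
    fun y => sum_congr rfl fun j hj => (if_pos hj).symm
  simp_rw [e1]
  refine jensen_bound h0 h1 J (fun j y => if j ∈ J then 1 - cos (t * b.al p V x' x'' j y) else 0) (fun j => b.aJ V j)
    (fun j hj => (b.al_dep x' x'' j).comp fun s => if j ∈ J then 1 - cos (t * s) else 0) (M := t ^ 2 * (V.card * K) ^ 2 / 2) ?_ ?_ ?_ _
    (fun j hj => aJ_deg h hj) hl0 (by push_cast; exact hl2)
  · grind
  · intro j y; split_ifs with hj
    · have := Real.one_sub_sq_div_two_le_cos (x := t * b.al p V x' x'' j y)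
      have h5 : b.al p V x' x'' j y ^ 2 ≤ (V.card * K : ℝ) ^ 2 := by rw [← sq_abs]; exact pow_le_pow_left₀ (abs_nonneg _) (hal j hj y) 2
      have := mul_le_mul_of_nonneg_left h5 (sq_nonneg t)
      grind
    · positivity
  · intro j hj
    simp only [hj, if_true]
    rw [Ex_sub, Ex_const]
    refine sub_le_sub_left ?_ _
    have e2 : Ex p (fun y => cos (t * b.al p V x' x'' j y)) = (Ex p (fun y => cexp (((t * b.al p V x' x'' j y : ℝ) : ℂ) * ⅈ))).re := by
      unfold Ex
      rw [Complex.re_sum]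
      refine sum_congr rfl fun y _ => ?_
      rw [Complex.smul_re, Complex.exp_ofReal_mul_I_re]
    rw [e2]
    refine (Complex.re_le_norm _).trans ?_
    have e3 : ∀ y, cexp (((t * b.al p V x' x'' j y : ℝ) : ℂ) * ⅈ) = ∏ v ∈ V, cexp (((t * (xi p v x' - xi p v x'') * b.ga p v j y : ℝ) : ℂ) * ⅈ) := by
      intro y
      rw [← Complex.exp_sum, ← sum_mul, ← Complex.ofReal_sum]
      unfold al; rw [mul_sum]; simp_rw [mul_assoc]
    simp_rw [e3]
    rw [Ex_indep_prod p V (fun v y => cexp (((t * (xi p v x' - xi p v x'') * b.ga p v j y : ℝ) : ℂ) * ⅈ)) (fun v => b.av v j)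
      (fun v _ => (b.ga_dep p v j).comp fun s => cexp (((t * (xi p v x' - xi p v x'') * s : ℝ) : ℂ) * ⅈ))
      (fun v hv v' hv' hne => h.two j hj v hv v' hv' hne), norm_prod, mul_sum, ← sum_neg_distrib, Real.exp_sum]
    refine prod_le_prod (fun _ _ => norm_nonneg _) fun v hv => (h.three j hj v hv _ ?_).trans (le_of_eq (by ring_nf))
    rw [abs_mul]; exact (mul_le_of_le_one_right (abs_nonneg _) (hab _ _ _)).trans ht
end Blk
end Big2
noncomputable section Big3
theorem one_sub_exp_ge {y : ℝ} (hy : 0 ≤ y) : y / (1 + y) ≤ 1 - exp (-y) := by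
  have h := add_one_le_exp y
  rw [exp_neg]
  have : (exp y)⁻¹ ≤ (1 + y)⁻¹ := inv_anti₀ (by linarith) (by linarith)
  grind
theorem big_num {rho T G' a : ℝ} (hr : 1 ≤ rho) (hG : 0 ≤ G') (ha : 0 ≤ a) (hT0 : 0 ≤ T) (hT : T ≤ 10) (h : 1 ≤ T * rho ^ 204) :
    (1 + G' * T * rho ^ 24) * (1 + a * T * rho ^ 6) * rho ≤ (1 + G' + a + 10 * (a * G')) * (T * rho ^ 206) := by
  have h0 : (0:ℝ) ≤ rho := by linarith
  have hp : ∀ m ≤ 206, rho ^ m ≤ rho ^ 206 := fun m hm => pow_le_pow_right₀ hr hm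
  have e1 : rho ≤ T * rho ^ 206 := by
    calc rho = 1 * rho := by ring
      _ ≤ (T * rho ^ 204) * rho ^ 2 := mul_le_mul h (by nlinarith) h0 (by positivity)
      _ = _ := by ring
  have e2 : G' * T * rho ^ 25 ≤ G' * T * rho ^ 206 := mul_le_mul_of_nonneg_left (hp _ (by norm_num)) (by positivity)
  have e3 : a * T * rho ^ 7 ≤ a * T * rho ^ 206 := mul_le_mul_of_nonneg_left (hp _ (by norm_num)) (by positivity)
  have e4 : a * G' * (T * T) * rho ^ 31 ≤ a * G' * (10 * T) * rho ^ 206 :=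
    mul_le_mul (mul_le_mul_of_nonneg_left (mul_le_mul_of_nonneg_right hT hT0) (by positivity)) (hp _ (by norm_num)) (by positivity) (by positivity)
  grind
theorem two_exp {a b : ℝ} (ha : 0 < a) (hb : 0 < b) (A : ℕ) : ∃ B : ℝ, 0 < B ∧ ∀ r : ℝ, 0 < r → exp (-(a * r)) + exp (-(b * r)) ≤ B / r ^ A := by
  refine ⟨A.factorial / a ^ A + A.factorial / b ^ A, by positivity, fun r hr => ?_⟩
  rw [add_div]; exact add_le_add (exp_pow ha A hr) (exp_pow hb A hr)
namespace Blk
set_option maxHeartbeats 800000 in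
theorem big_main {p : ℝ} (h0 : 0 < p) (h1 : p < 1) (k K : ℕ) {cl c1 c2 : ℝ} (hc1 : 0 < c1) (hc2 : 0 < c2) : ∃ C : ℝ, 0 < C ∧
    ∀ (ι : Type) [Fintype ι] [DecidableEq ι] (τ : Type) [DecidableEq τ] (b : Blk ι τ k K cl) (J V : Finset ι) (rho : ℝ), b.Cfg p c1 J V → 1 ≤ rho →
    c2 * rho ^ 200 ≤ J.card → rho ^ 6 ≤ V.card → V.card ≤ 2 * rho ^ 6 →
    ∀ θ t : ℝ, |t| ≤ π → 1 ≤ |t| * rho ^ 102 → ‖b.phi p θ t‖ ≤ C / rho ^ 400 := by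
  have hs := (s2_bd h0 h1).1
  have hs1 := (s2_bd h0 h1).2
  set s := υ p with hsd
  set a := c1 * s / 4 with ha
  set G' : ℝ := (4 * (K * k) ^ 2 + 1) * (2 * K ^ 2) with hG'
  set C' := 1 + G' + a + 10 * (a * G') with hC'
  have ha0 : 0 < a := by positivity
  have hG0 : 0 ≤ G' := by positivity
  have hC0 : 0 < C' := by positivity
  set e0 := s * c2 * a / (2 * C') with he0
  have he00 : 0 < e0 := by positivity
  obtain ⟨B, hB0, hB⟩ := two_exp he00 (by positivity : 0 < s / 4) 800
  refine ⟨1 + B, by positivity, ?_⟩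
  intro ι _ _ τ _ b J V rho h hr hJ hV1 hV2 θ t ht1 ht2
  have hr0 : (0:ℝ) < rho := by linarith
  have hT2 : 1 ≤ t ^ 2 * rho ^ 204 := by
    have := one_le_pow₀ ht2 (n := 2)
    rw [mul_pow, sq_abs, ← pow_mul] at this; exact this
  have hT1 : t ^ 2 ≤ 10 := by
    rw [← sq_abs]
    have : |t| ≤ 3.15 := ht1.trans pi_lt_d2.le
    nlinarith [abs_nonneg t]
  have hnum := big_num hr hG0 ha0.le (sq_nonneg t) hT1 hT2
  rw [← hC'] at hnum
  set L : ℝ := (V.card : ℝ) with hL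
  have hL0 : 0 < L := lt_of_lt_of_le (by positivity) hV1
  set G := ((L * K * k) ^ 2 + 1) * (t ^ 2 * (L * K) ^ 2 / 2) with hG
  have hG1 : 0 ≤ G := by positivity
  have hGG : G ≤ G' * t ^ 2 * rho ^ 24 := by
    have l2 : L ^ 2 ≤ 4 * rho ^ 12 := by
      calc L ^ 2 ≤ (2 * rho ^ 6) ^ 2 := pow_le_pow_left₀ hL0.le hV2 2
        _ = _ := by ring
    have l3 : (L * K * k) ^ 2 + 1 ≤ (4 * (K * k) ^ 2 + 1) * rho ^ 12 := by
      have : L ^ 2 * (K * k : ℝ) ^ 2 ≤ 4 * rho ^ 12 * (K * k : ℝ) ^ 2 := mul_le_mul_of_nonneg_right l2 (by positivity)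
      have h12 : 1 ≤ rho ^ 12 := one_le_pow₀ hr
      calc _ = L ^ 2 * (K * k : ℝ) ^ 2 + 1 := by ring
        _ ≤ 4 * rho ^ 12 * (K * k : ℝ) ^ 2 + rho ^ 12 := by linarith
        _ = _ := by ring
    have l4 : t ^ 2 * (L * K) ^ 2 / 2 ≤ t ^ 2 * (2 * K ^ 2) * rho ^ 12 := by
      have : (t ^ 2 * K ^ 2 / 2) * L ^ 2 ≤ (t ^ 2 * K ^ 2 / 2) * (4 * rho ^ 12) := mul_le_mul_of_nonneg_left l2 (by positivity)
      calc _ = (t ^ 2 * K ^ 2 / 2) * L ^ 2 := by ring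
        _ ≤ _ := this
        _ = _ := by ring
    calc G ≤ ((4 * (K * k) ^ 2 + 1) * rho ^ 12) * (t ^ 2 * (2 * K ^ 2) * rho ^ 12) := mul_le_mul l3 l4 (by positivity) (by positivity)
      _ = _ := by rw [hG']; ring
  set lam := s / (1 + G) with hlam
  have hl0 : 0 ≤ lam := by positivity
  have hl1 : lam ≤ s := div_le_self hs.le (by linarith)
  have hl2 : lam * ((L * K * k) ^ 2 + 1) * (t ^ 2 * (L * K) ^ 2 / 2) ≤ 1 := by
    rw [mul_assoc, ← hG, hlam, div_mul_eq_mul_div, div_le_one (by positivity)]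
    nlinarith
  have hin := fun x' x'' => big_in h0 h1 h ht1 x' x'' hl0 hl1 hl2
  set m0 := s * L / 4 with hm0
  have hm00 : 0 < m0 := by positivity
  have hpt : ∀ x' x'' : ι → Bool, Ex p (fun y => exp (-(s * ∑ j ∈ J, (1 - cos (t * b.al p V x' x'' j y))))) ≤
      exp (-(e0 * rho)) + exp m0 * exp (-∑ v ∈ V, (xi p v x' - xi p v x'') ^ 2) := by
    intro x' x''
    refine (hin x' x'').trans ?_
    set m := ∑ v ∈ V, (xi p v x' - xi p v x'') ^ 2 with hm
    have hm_0 : 0 ≤ m := sum_nonneg fun _ _ => sq_nonneg _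
    by_cases hmm : m0 ≤ m
    · refine le_add_of_le_of_nonneg (exp_le_exp.mpr (neg_le_neg ?_)) (by positivity)
      set z := a * t ^ 2 * rho ^ 6 with hz
      have hz0 : 0 ≤ z := by positivity
      have q1 : z / (1 + z) ≤ 1 - exp (-(c1 * t ^ 2 * m)) := by
        refine (one_sub_exp_ge hz0).trans ?_
        have : z ≤ c1 * t ^ 2 * m := by
          calc z = c1 * t ^ 2 * (s * rho ^ 6 / 4) := by rw [hz, ha]; ring
            _ ≤ c1 * t ^ 2 * m := mul_le_mul_of_nonneg_left (le_trans (by rw [hm0]; gcongr) hmm) (by positivity)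
        have := exp_le_exp.mpr (neg_le_neg this)
        linarith
      have q2 : s / (1 + G' * t ^ 2 * rho ^ 24) ≤ lam := div_le_div_of_nonneg_left hs.le (by positivity) (by linarith)
      have q3 : 0 ≤ z / (1 + z) := by positivity
      calc e0 * rho ≤ (s / (1 + G' * t ^ 2 * rho ^ 24)) * (c2 * rho ^ 200) * (z / (1 + z)) / 2 := by
            rw [he0, hz]
            have d1 : 0 < 1 + G' * t ^ 2 * rho ^ 24 := by positivity
            have d2 : 0 < 1 + a * t ^ 2 * rho ^ 6 := by positivity
            rw [div_mul_eq_mul_div, div_mul_eq_mul_div, div_mul_div_comm, div_div, div_le_div_iff₀ (by positivity) (by positivity)]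
            have := mul_le_mul_of_nonneg_left hnum (show 0 ≤ 2 * s * c2 * a by positivity)
            grind
        _ ≤ lam * J.card * (1 - exp (-(c1 * t ^ 2 * m))) / 2 := by
            refine div_le_div_of_nonneg_right ?_ (by norm_num)
            exact mul_le_mul (mul_le_mul q2 hJ (by positivity) hl0) q1 q3 (by positivity)
    · push Not at hmm
      refine le_add_of_nonneg_of_le (by positivity) ?_
      rw [← exp_add]
      refine exp_le_exp.mpr ?_
      have hc0 : 0 ≤ c1 * t ^ 2 * m := by positivity
      have : exp (-(c1 * t ^ 2 * m)) ≤ 1 := exp_le_one_iff.mpr (by linarith)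
      have : 0 ≤ lam * J.card * (1 - exp (-(c1 * t ^ 2 * m))) / 2 := by
        have : 0 ≤ 1 - exp (-(c1 * t ^ 2 * m)) := by linarith
        positivity
      linarith
  have hsq : ‖b.phi p θ t‖ ^ 2 ≤ exp (-(e0 * rho)) + exp (-(s / 4 * rho)) := by
    refine (big_cs h0 h1 h θ t).trans ?_
    refine (Ex_mono h0.le h1.le (G := fun _ => exp (-(e0 * rho)) + exp (-(s / 4 * rho))) fun x' => ?_).trans (le_of_eq (Ex_const _ _))
    refine (Ex_mono h0.le h1.le fun x'' => hpt x' x'').trans ?_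
    rw [Ex_add, Ex_const, Ex_mul_left]
    refine add_le_add_right ?_ _
    refine (mul_le_mul_of_nonneg_left (zz_bound h0 h1 V x') (exp_pos _).le).trans ?_
    rw [← exp_add]
    refine exp_le_exp.mpr ?_
    have : rho ≤ L := le_trans (le_self_pow₀ hr (by norm_num)) hV1
    have := mul_le_mul_of_nonneg_left this hs.le
    rw [hm0, ← hsd, ← hL]; linarith
  have hfin : ‖b.phi p θ t‖ ^ 2 ≤ ((1 + B) / rho ^ 400) ^ 2 := by
    refine (hsq.trans (hB rho hr0)).trans ?_
    rw [div_pow, ← pow_mul]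
    refine div_le_div_of_nonneg_right ?_ (by positivity)
    nlinarith
  exact (pow_le_pow_iff_left₀ (norm_nonneg _) (by positivity) two_ne_zero).mp hfin
end Blk
end Big3
noncomputable section Zm
variable {k n : ℕ} [NeZero n]
def pt (a : ZMod n) (d i : ℕ) : ZMod n := a + ((i * d : ℕ) : ZMod n)
theorem unit_nat (hg : n.gcd (k - 1).factorial = 1) {m : ℕ} (h0 : 0 < m) (hm : m < k) : IsUnit (m : ZMod n) := by
  rw [ZMod.isUnit_iff_coprime]
  exact (Nat.Coprime.coprime_dvd_right (Nat.dvd_factorial h0 (by omega)) hg).symm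
theorem unit_int (hg : n.gcd (k - 1).factorial = 1) {e : ℤ} (h0 : e ≠ 0) (hm : |e| < k) : IsUnit (e : ZMod n) := by
  have h := unit_nat (n := n) hg (m := e.natAbs) (Int.natAbs_pos.mpr h0) (by zify; exact hm)
  rcases Int.natAbs_eq e with he | he
  · rw [he, Int.cast_natCast]; exact h
  · rw [he, Int.cast_neg, Int.cast_natCast]; exact h.neg
theorem sub_lt {i j : ℕ} (hi : i < k) (hj : j < k) : |(i : ℤ) - j| < k := by rw [abs_lt]; omega
theorem unit_sub (hg : n.gcd (k - 1).factorial = 1) {i j : ℕ} (hi : i < k) (hj : j < k) (hij : i ≠ j) : IsUnit ((i : ZMod n) - j) := by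
  have := unit_int (n := n) hg (e := (i : ℤ) - j) (by omega) (sub_lt hi hj)
  push_cast at this; exact this
theorem d_inj {d d' : ℕ} (h : d ∈ Icc 1 (n / 2)) (h' : d' ∈ Icc 1 (n / 2)) (e : (d : ZMod n) = d') : d = d' := by
  rw [mem_Icc] at h h'
  rw [ZMod.natCast_eq_natCast_iff'] at e
  rwa [Nat.mod_eq_of_lt (by omega), Nat.mod_eq_of_lt (by omega)] at e
theorem d_ne {d : ℕ} (h : d ∈ Icc 1 (n / 2)) : (d : ZMod n) ≠ 0 := by
  rw [mem_Icc] at h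
  intro e
  rw [ZMod.natCast_eq_zero_iff] at e
  have := Nat.le_of_dvd (by omega) e
  omega
theorem pt_sub (a : ZMod n) (d i j : ℕ) : pt a d i - pt a d j = ((i : ZMod n) - j) * d := by
  unfold pt; push_cast; ring
theorem pt_inj (hg : n.gcd (k - 1).factorial = 1) {a : ZMod n} {d : ℕ} (h : d ∈ Icc 1 (n / 2)) {i j : ℕ} (hi : i < k) (hj : j < k)
    (e : pt a d i = pt a d j) : i = j := by
  by_contra hij
  have h1 := pt_sub a d i j
  rw [e, sub_self] at h1
  exact d_ne h (((unit_sub hg hi hj hij).mul_right_eq_zero).mp h1.symm)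
def Ix (k n : ℕ) [NeZero n] : Finset (ZMod n × ℕ × Finset ℕ) :=
  univ ×ˢ (Icc 1 (n / 2) ×ˢ ((range k).powerset.filter fun S => 3 ≤ S.card))
theorem mem_Ix {t : ZMod n × ℕ × Finset ℕ} : t ∈ Ix k n ↔ t.2.1 ∈ Icc 1 (n / 2) ∧ t.2.2 ⊆ range k ∧ 3 ≤ t.2.2.card := by
  unfold Ix; grind
def bB (t : ZMod n × ℕ × Finset ℕ) : Finset (ZMod n) := t.2.2.image (pt t.1 t.2.1)
theorem inj_on (hg : n.gcd (k - 1).factorial = 1) {a : ZMod n} {d : ℕ} (h : d ∈ Icc 1 (n / 2)) {S : Finset ℕ} (hS : S ⊆ range k) :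
    Set.InjOn (pt a d) S := fun i hi j hj e => pt_inj hg h (mem_range.mp (hS hi)) (mem_range.mp (hS hj)) e
theorem bB_card (hg : n.gcd (k - 1).factorial = 1) {t : ZMod n × ℕ × Finset ℕ} (ht : t ∈ Ix k n) : (bB t).card = t.2.2.card := by
  rw [mem_Ix] at ht
  exact card_image_of_injOn (inj_on hg ht.1 ht.2.1)
theorem two_pts (hg : n.gcd (k - 1).factorial = 1) {a a' : ZMod n} {d d' i j : ℕ} (h : d ∈ Icc 1 (n / 2)) (h' : d' ∈ Icc 1 (n / 2))
    (hi : i < k) (hj : j < k) (hij : i ≠ j) (e1 : pt a d i = pt a' d' i) (e2 : pt a d j = pt a' d' j) : a = a' ∧ d = d' := by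
  have h1 := pt_sub a d i j
  rw [e1, e2, pt_sub] at h1
  have hd := d_inj h' h ((unit_sub hg hi hj hij).mul_left_cancel h1)
  subst hd
  exact ⟨add_right_cancel e1, rfl⟩
theorem star_bd (hg : n.gcd (k - 1).factorial = 1) (x y : ZMod n) (hxy : x ≠ y) :
    ((Ix k n).filter fun t => x ∈ bB t ∧ y ∈ bB t).card ≤ k * k * 2 ^ k := by
  classical
  have hc : ((range k ×ˢ range k) ×ˢ (range k).powerset).card = k * k * 2 ^ k := by simp
  rw [← hc]
  have hex : ∀ t ∈ (Ix k n).filter fun t => x ∈ bB t ∧ y ∈ bB t, ∃ q : ℕ × ℕ, q.1 < k ∧ q.2 < k ∧ pt t.1 t.2.1 q.1 = x ∧ pt t.1 t.2.1 q.2 = y := by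
    intro t ht
    simp only [mem_filter, mem_Ix, bB, mem_image] at ht
    obtain ⟨⟨h1, h2, h3⟩, ⟨i, hi, hx⟩, ⟨j, hj, hy⟩⟩ := ht
    exact ⟨(i, j), mem_range.mp (h2 hi), mem_range.mp (h2 hj), hx, hy⟩
  choose! q hq using hex
  refine card_le_card_of_injOn (fun t => (q t, t.2.2)) ?_ ?_
  · intro t ht
    have h1 := hq t ht
    have h2 := (mem_Ix.mp (mem_filter.mp ht).1).2.1
    grind
  · intro t ht t' ht' e
    have h1 := hq t ht
    have h1' := hq t' ht'
    simp only [Prod.mk.injEq] at e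
    rw [← e.1] at h1'
    have hne : (q t).1 ≠ (q t).2 := fun hh => hxy (by grind)
    have := two_pts hg (mem_Ix.mp (mem_filter.mp ht).1).1 (mem_Ix.mp (mem_filter.mp ht').1).1 h1.1 h1.2.1 hne
      (h1.2.2.1.trans h1'.2.2.1.symm) (h1.2.2.2.trans h1'.2.2.2.symm)
    grind
theorem deg_bd (hk : 3 ≤ k) (x : ZMod n) : Fintype.card (ZMod n) - 1 ≤ ((Ix k n).filter fun t => x ∈ bB t).card := by
  classical
  rw [ZMod.card]
  have hc : (range 2 ×ˢ Icc 1 (n / 2)).card = 2 * (n / 2) := by simp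
  refine le_trans (by omega : n - 1 ≤ 2 * (n / 2)) ?_
  rw [← hc]
  refine card_le_card_of_injOn (fun q => (x - ((q.1 * q.2 : ℕ) : ZMod n), q.2, range 3)) ?_ ?_
  · intro q hq
    simp only [coe_product, Set.mem_prod, mem_coe, mem_range] at hq
    simp only [coe_filter, Set.mem_setOf_eq, mem_Ix, bB, mem_image]
    exact ⟨⟨hq.2, range_subset_range.mpr hk, by simp⟩, q.1, by simp; omega, by simp [pt]⟩
  · intro q hq q' hq' e
    simp only [coe_product, Set.mem_prod, mem_coe, mem_range] at hq hq'
    simp only [Prod.mk.injEq] at e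
    obtain ⟨e1, e2, -⟩ := e
    rw [← e2] at e1
    have h := d_ne hq.2
    refine Prod.ext ?_ e2
    push_cast at e1
    have h3 : (q.1 : ZMod n) * q.2 = q'.1 * q.2 := by
      have := congrArg (fun z => x - z) e1; simpa using this
    have hq1 : q.1 = 0 ∨ q.1 = 1 := by omega
    have hq2 : q'.1 = 0 ∨ q'.1 = 1 := by omega
    rcases hq1 with a | a <;> rcases hq2 with b | b <;> rw [a, b] at h3 ⊢ <;> simp at h3 <;> exact absurd h3 (by first | exact h | exact h.symm)
def KK (k : ℕ) : ℕ := k * k * 2 ^ k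
def zb (p : ℝ) (h0 : 0 < p) (h1 : p < 1) (hk : 3 ≤ k) (hg : n.gcd (k - 1).factorial = 1) : Blk (ZMod n) (ZMod n × ℕ × Finset ℕ) k (KK k) (p ^ k) where
  I := Ix k n
  B := bB
  c := fun t => p ^ (k - t.2.2.card)
  card3 := fun t ht => by rw [bB_card hg ht]; exact (mem_Ix.mp ht).2.2
  cardk := fun t ht => by rw [bB_card hg ht]; simpa using card_le_card (mem_Ix.mp ht).2.1
  clpos := by positivity
  clo := fun t ht => pow_le_pow_of_le_one h0.le h1.le (by omega)
  chi := fun t ht => pow_le_one₀ h0.le h1.le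
  star := star_bd hg
  deg := deg_bd hk
/-! decomposition -/
theorem expand (p : ℝ) (R : Finset ℕ) (y : ℕ → ℝ) : ∏ i ∈ R, y i = ∑ S ∈ R.powerset, p ^ (R.card - S.card) * ∏ i ∈ S, (y i - p) := by
  have := prod_add (fun i => y i - p) (fun _ => p) R
  simp only [sub_add_cancel, prod_const] at this
  rw [this]
  refine sum_congr rfl fun S hS => ?_
  grind
def x01 (x : ZMod n → Bool) (i : ZMod n) : ℝ := if x i then 1 else 0
theorem count_eq (k : ℕ) (x : ZMod n → Bool) : (kAPcount k x : ℝ) = ∑ a : ZMod n, ∑ d ∈ Icc 1 (n / 2), ∏ i ∈ range k, x01 x (pt a d i) := by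
  unfold kAPcount x01 pt; push_cast; rfl
theorem prime_eq {p : ℝ} (h0 : 0 < p) (h1 : p < 1) (hk : 3 ≤ k) (hg : n.gcd (k - 1).factorial = 1) (x : ZMod n → Bool) :
    kAPprime k p x = (zb p h0 h1 hk hg).W p x := by
  have hs := (s2_bd h0 h1).1
  unfold kAPprime Blk.W
  show _ = ∑ t ∈ Ix k n, p ^ (k - t.2.2.card) * xiS p (bB t) x
  unfold Ix
  rw [sum_product]
  refine sum_congr rfl fun a _ => ?_
  rw [sum_product]
  refine sum_congr rfl fun d hd => ?_
  rw [sum_filter]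
  refine sum_congr rfl fun S hS => ?_
  split_ifs with h3
  · unfold bB xiS
    rw [prod_image (inj_on hg hd (mem_powerset.mp hS)), mul_assoc, prod_div_distrib, prod_const,
      mul_div_cancel₀ _ (by positivity)]
    rfl
  · rfl
theorem Ns_shift (p : ℝ) (x : ZMod n → Bool) (e : ZMod n) : ∑ a, xi p (a + e) x = Blk.Ns p x :=
  Equiv.sum_comp (Equiv.addRight e) fun b => xi p b x
theorem odd_n (hk : 3 ≤ k) (hg : n.gcd (k - 1).factorial = 1) : n % 2 = 1 := by
  by_contra h
  have h2 : 2 ∣ n := by omega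
  have h3 : 2 ∣ n.gcd (k - 1).factorial := Nat.dvd_gcd h2 (Nat.dvd_factorial (by norm_num) (by omega))
  rw [hg] at h3; omega
theorem sum_half (hn : n % 2 = 1) (g : ZMod n → ℝ) (hs : ∀ e, g (-e) = g e) :
    2 * ∑ d ∈ Icc 1 (n / 2), g (d : ZMod n) = (∑ e, g e) - g 0 := by
  have h1 : ∑ e, g e = ∑ d ∈ range n, g (d : ZMod n) := by
    symm
    refine sum_bij (fun d _ => (d : ZMod n)) ?_ ?_ ?_ ?_
    · intros; simp
    · intro a ha b hb e
      rw [ZMod.natCast_eq_natCast_iff', Nat.mod_eq_of_lt (mem_range.mp ha), Nat.mod_eq_of_lt (mem_range.mp hb)] at e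
      exact e
    · intro b _; exact ⟨b.val, mem_range.mpr (ZMod.val_lt b), ZMod.natCast_zmod_val b⟩
    · intros; rfl
  have h2 : range n = insert 0 (Icc 1 (n / 2) ∪ Icc (n / 2 + 1) (n - 1)) := by
    ext a; simp only [mem_range, mem_insert, mem_union, mem_Icc]; omega
  have h3 : ∑ d ∈ Icc (n / 2 + 1) (n - 1), g (d : ZMod n) = ∑ d ∈ Icc 1 (n / 2), g (d : ZMod n) := by
    refine sum_bij' (fun d _ => n - d) (fun d _ => n - d) ?_ ?_ ?_ ?_ ?_
    · grind
    · grind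
    · grind
    · grind
    · intro a ha; rw [mem_Icc] at ha
      rw [Nat.cast_sub (by omega), ZMod.natCast_self, zero_sub, hs]
  rw [h1, h2, sum_insert, sum_union, h3]
  · push_cast; ring
  · rw [disjoint_left]; grind
  · simp
theorem Ns_sq (p : ℝ) (x : ZMod n → Bool) : ∑ e, ∑ b, xi p b x * xi p (b + e) x = Blk.Ns p x ^ 2 := by
  rw [sum_comm]
  simp_rw [← mul_sum]
  have : ∀ b, ∑ e, xi p (b + e) x = Blk.Ns p x := fun b => Equiv.sum_comp (Equiv.addLeft b) fun c => xi p c x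
  simp_rw [this]
  rw [← sum_mul, sq]; rfl
theorem xi_sq {ι : Type*} [Fintype ι] [DecidableEq ι] (p : ℝ) (u : ι) (x : ι → Bool) : xi p u x * xi p u x = (1 - 2 * p) * xi p u x + υ p := by
  unfold xi; split_ifs <;> ring
theorem pair_sum (hk : 3 ≤ k) (hg : n.gcd (k - 1).factorial = 1) (p : ℝ) (x : ZMod n → Bool) {i j : ℕ} (hi : i < k) (hj : j < k) (hij : i ≠ j) :
    2 * ∑ a : ZMod n, ∑ d ∈ Icc 1 (n / 2), xi p (pt a d i) x * xi p (pt a d j) x =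
      Blk.Ns p x ^ 2 - (1 - 2 * p) * Blk.Ns p x - n * υ p := by
  set g : ZMod n → ℝ := fun e => ∑ b, xi p b x * xi p (b + e) x with hgd
  have hgs : ∀ e, g (-e) = g e := by
    intro e
    rw [hgd]
    show ∑ b, xi p b x * xi p (b + -e) x = ∑ b, xi p b x * xi p (b + e) x
    rw [← Equiv.sum_comp (Equiv.addRight e)]
    refine sum_congr rfl fun b _ => ?_
    simp [mul_comm]
  have hu := unit_sub (n := n) hg hj hi hij.symm
  obtain ⟨u, hu⟩ := hu
  have h1 : ∀ d : ℕ, ∑ a : ZMod n, xi p (pt a d i) x * xi p (pt a d j) x = g (u * d) := by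
    intro d
    rw [hgd]
    show _ = ∑ b, xi p b x * xi p (b + u * d) x
    rw [← Equiv.sum_comp (Equiv.addRight (((i * d : ℕ)) : ZMod n)) fun b => xi p b x * xi p (b + u * d) x]
    refine sum_congr rfl fun a _ => ?_
    have : pt a d j = (a + ((i * d : ℕ) : ZMod n)) + u * d := by rw [hu]; unfold pt; push_cast; ring
    rw [this]; rfl
  rw [sum_comm]
  simp_rw [h1]
  rw [sum_half (odd_n hk hg) (fun e => g (u * e)) (fun e => by simp_all)]
  have h2 : ∑ e, g (u * e) = ∑ e, g e := Equiv.sum_comp (Units.mulLeft u) g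
  simp only [h2, mul_zero]
  rw [Ns_sq]
  have h3 : g 0 = (1 - 2 * p) * Blk.Ns p x + n * υ p := by
    rw [hgd]; simp only [add_zero, xi_sq, sum_add_distrib, ← mul_sum]
    simp [Blk.Ns, ZMod.card]; ring
  rw [h3]; ring
def ff (k n : ℕ) (p h : ℝ) : ℝ := p ^ k * (n * (n - 1) / 2) + (n - 1) * k * p ^ (k - 1) / 2 * h +
  k * (k - 1) * p ^ (k - 2) / 4 * (h ^ 2 - (1 - 2 * p) * h - n * υ p)
theorem half_cast (hn : n % 2 = 1) : ((n / 2 : ℕ) : ℝ) = ((n : ℝ) - 1) / 2 := by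
  have : n = 2 * (n / 2) + 1 := by omega
  have h2 : (n : ℝ) = 2 * ((n / 2 : ℕ) : ℝ) + 1 := by exact_mod_cast this
  linarith
theorem count_decomp {p : ℝ} (h0 : 0 < p) (h1 : p < 1) (hk : 3 ≤ k) (hg : n.gcd (k - 1).factorial = 1) (x : ZMod n → Bool) :
    (kAPcount k x : ℝ) = ff k n p (Blk.Ns p x) + (zb p h0 h1 hk hg).W p x := by
  have hodd := odd_n hk hg
  set N := Blk.Ns p x with hN
  set g : ℕ → ℝ := fun m => if m = 0 then n * ((n - 1) / 2) else if m = 1 then (n - 1) / 2 * N else if m = 2 then (N ^ 2 - (1 - 2 * p) * N - n * υ p) / 2 else 0 with hgd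
  have hG : ∀ S ∈ (range k).powerset, ∑ a : ZMod n, ∑ d ∈ Icc 1 (n / 2), p ^ (k - S.card) * ∏ i ∈ S, xi p (pt a d i) x =
      p ^ (k - S.card) * g S.card + if 3 ≤ S.card then ∑ a : ZMod n, ∑ d ∈ Icc 1 (n / 2), p ^ (k - S.card) * ∏ i ∈ S, xi p (pt a d i) x else 0 := by
    intro S hS
    split_ifs with h3
    · grind
    · simp_rw [← mul_sum]
      rw [add_zero]; congr 1
      have hc : S.card = 0 ∨ S.card = 1 ∨ S.card = 2 := by omega
      rcases hc with hc | hc | hc <;> rw [hc]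
      · rw [card_eq_zero] at hc
        simp [hgd, hc, ZMod.card, half_cast hodd]
      · obtain ⟨i, rfl⟩ := card_eq_one.mp hc
        simp only [prod_singleton]
        rw [sum_comm]
        unfold pt
        simp_rw [Ns_shift, ← hN]
        simp [hgd, half_cast hodd]
      · obtain ⟨i, j, hij, rfl⟩ := card_eq_two.mp hc
        simp only [prod_pair hij]
        rw [mem_powerset] at hS
        have := pair_sum hk hg p x (mem_range.mp (hS (by simp : i ∈ ({i, j} : Finset ℕ)))) (mem_range.mp (hS (by simp : j ∈ ({i, j} : Finset ℕ)))) hij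
        grind
  have hW : (zb p h0 h1 hk hg).W p x = ∑ S ∈ (range k).powerset, if 3 ≤ S.card then ∑ a : ZMod n, ∑ d ∈ Icc 1 (n / 2), p ^ (k - S.card) * ∏ i ∈ S, xi p (pt a d i) x else 0 := by
    show ∑ t ∈ Ix k n, p ^ (k - t.2.2.card) * xiS p (bB t) x = _
    unfold Ix
    rw [sum_product, ← sum_filter]
    conv_rhs => rw [sum_comm]
    refine sum_congr rfl fun a _ => ?_
    rw [sum_product, sum_comm]
    refine sum_congr rfl fun S hS => sum_congr rfl fun d hd => ?_
    unfold bB xiS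
    rw [prod_image (inj_on hg hd (mem_powerset.mp (mem_filter.mp hS).1))]
  have hlow : ∑ S ∈ (range k).powerset, p ^ (k - S.card) * g S.card = ff k n p N := by
    rw [sum_powerset_apply_card (fun m => p ^ (k - m) * g m), card_range]
    rw [← sum_subset (s₁ := range 3) (range_subset_range.mpr (by omega))]
    · rw [sum_range_succ, sum_range_succ, sum_range_one]
      simp only [hgd, nsmul_eq_mul, Nat.choose_zero_right, Nat.choose_one_right, Nat.cast_choose_two]
      unfold ff
      norm_num
      ring
    · grind
  rw [count_eq, hW, ← hlow, ← sum_add_distrib, ← sum_congr rfl hG]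
  conv_rhs => rw [sum_comm]
  refine sum_congr rfl fun a _ => ?_
  conv_rhs => rw [sum_comm]
  refine sum_congr rfl fun d _ => ?_
  rw [expand p, card_range]; rfl
end Zm
noncomputable section Cfg1
variable {ι : Type*} [Fintype ι] [DecidableEq ι]
variable {p : ℝ} (h0 : 0 < p) (h1 : p < 1)
theorem Du_eq {V : Type*} [AddCommGroup V] (u : ι) (F : (ι → Bool) → V) (x : ι → Bool) : Du u F x = F (update x u true) - F (update x u false) := rfl
include h0 h1 in
theorem Ex_agree (P : Finset ι) (y : ι → Bool) {M : ℕ} (hM : P.card ≤ M) :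
    (υ p) ^ M ≤ Ex p (fun x => if ∀ i ∈ P, x i = y i then (1:ℝ) else 0) := by
  have e : ∀ x : ι → Bool, (if ∀ i ∈ P, x i = y i then (1:ℝ) else 0) = ∏ i, (fun i b => if i ∈ P then (if b = y i then (1:ℝ) else 0) else 1) i (x i) := by
    intro x
    show _ = ∏ i, (if i ∈ P then (if x i = y i then (1:ℝ) else 0) else 1)
    rw [prod_ite_mem, univ_inter]
    split_ifs with h
    · simp_all
    · push Not at h
      obtain ⟨i, hi, h⟩ := h
      rw [prod_eq_zero hi (if_neg h)]
  simp_rw [e]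
  rw [Ex_prod p (fun i b => if i ∈ P then (if b = y i then (1:ℝ) else 0) else 1)]
  have hs := s2_bd h0 h1
  refine (pow_le_pow_of_le_one hs.1.le hs.2 hM).trans ?_
  rw [← prod_const, ← univ_inter P, ← prod_ite_mem]
  refine prod_le_prod (fun i _ => ?_) fun i _ => ?_
  · grind
  · rw [univ_inter]
    by_cases hi : i ∈ P
    · simp only [hi, if_true]
      cases y i <;> simp <;> nlinarith
    · simp [hi]
include h0 h1 in
theorem three_gen (F : (ι → Bool) → ℝ) (u : ι) (P : Finset ι) (y : ι → Bool) {M : ℕ} (hM : P.card ≤ M)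
    (hD : ∀ x, (∀ i ∈ P, x i = y i) → Du u F x = 1) {s : ℝ} (hs : |s| ≤ π) :
    ‖Ex p (fun x => cexp (((s * F x : ℝ) : ℂ) * ⅈ))‖ ≤ exp (-((υ p) ^ (M + 1) / 100 * s ^ 2)) := by
  have hss := s2_bd h0 h1
  have hDep : Dep (Du u F) ({u}ᶜ : Finset ι) := (Dep.Eu' p ((Dep_univ F).mono (by simp_all))).2
  have ha : Dep (fun x => cexp (((s * (F x - xi p u x * Du u F x) : ℝ) : ℂ) * ⅈ)) ({u}ᶜ : Finset ι) := by
    have key : ∀ x, F x - xi p u x * Du u F x = F (update x u false) + p * Du u F x := by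
      intro x
      rw [Du_eq]; unfold xi
      have : F x = F (update x u (x u)) := by rw [Function.update_eq_self]
      rw [this]
      grind
    intro x z hxz
    have h2 : update x u false = update z u false := by
      funext i; by_cases h : i = u
      · subst h; simp
      · simp_all
    show cexp _ = cexp _
    rw [key x, key z, hDep x z hxz, h2]
  have hc := cond_bound h0 h1 {u} _ ha (fun x => le_of_eq (norm_exp_ofReal_mul_I _)) (fun _ x => s * Du u F x) (fun j _ => hDep.comp fun r => s * r)
  have e : ∀ x, cexp (((s * F x : ℝ) : ℂ) * ⅈ) = cexp (((s * (F x - xi p u x * Du u F x) : ℝ) : ℂ) * ⅈ) *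
      ∏ j ∈ ({u} : Finset ι), cexp (((xi p j x * (s * Du u F x) : ℝ) : ℂ) * ⅈ) := by
    intro x; rw [prod_singleton, ← Complex.exp_add]; congr 1; push_cast; ring
  simp_rw [e]
  refine hc.trans ?_
  simp only [sum_singleton]
  set v := υ p * (s ^ 2 / 50) with hv
  have hcs := one_sub_cos_ge (show |s| ≤ π + 1 / 2 by linarith)
  have hs2 : s ^ 2 ≤ 10 := by
    rw [← sq_abs]
    have : |s| ≤ 3.15 := hs.trans pi_lt_d2.le
    nlinarith [abs_nonneg s]
  have hv0 : 0 ≤ v := by have := hss.1; positivity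
  have hv1 : v ≤ 1 := by rw [hv]; nlinarith
  have hpt : ∀ x, exp (-(υ p * (1 - cos (s * Du u F x)))) ≤ 1 - v / 2 * (if ∀ i ∈ P, x i = y i then (1:ℝ) else 0) := by
    intro x
    split_ifs with h
    · rw [hD x h, mul_one, mul_one]
      refine le_trans (exp_le_exp.mpr (neg_le_neg ?_)) (exp_neg_le hv0 hv1)
      exact mul_le_mul_of_nonneg_left hcs hss.1.le
    · rw [mul_zero, sub_zero, exp_le_one_iff]
      have := mul_nonneg hss.1.le (sub_nonneg.mpr (cos_le_one (s * Du u F x)))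
      linarith
  refine (Ex_mono h0.le h1.le hpt).trans ?_
  rw [Ex_sub, Ex_const, Ex_mul_left]
  have h3 := mul_le_mul_of_nonneg_left (Ex_agree h0 h1 P y hM) (by positivity : 0 ≤ v / 2)
  have h4 : v / 2 * (υ p) ^ M = (υ p) ^ (M + 1) / 100 * s ^ 2 := by rw [hv]; ring
  have h5 := add_one_le_exp (-((υ p) ^ (M + 1) / 100 * s ^ 2))
  linarith
end Cfg1
noncomputable section Cfg2
variable {k n : ℕ} [NeZero n]
variable {p : ℝ} (h0 : 0 < p) (h1 : p < 1) (hk : 3 ≤ k) (hg : n.gcd (k - 1).factorial = 1)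
def GJV (R : ℤ) (J V : Finset (ZMod n)) : Prop := ∀ v ∈ V, ∀ v' ∈ V, ∀ j ∈ J, ∀ j' ∈ J, ∀ a b : ℤ, |a| ≤ R → |b| ≤ R →
  (a : ZMod n) * (v - j) = b * (v' - j') → a = b
def AP (k : ℕ) (a : ZMod n) (d : ℕ) : Finset (ZMod n) := (range k).image (pt a d)
include h0 h1 hk hg in
theorem ga_formula {v j : ZMod n} (hvj : v ≠ j) (x : ZMod n → Bool) :
    (zb p h0 h1 hk hg).ga p v j x = ∑ a : ZMod n, ∑ d ∈ Icc 1 (n / 2), if v ∈ AP k a d ∧ j ∈ AP k a d then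
      (∏ i ∈ (range k).filter (fun i => pt a d i ≠ v ∧ pt a d i ≠ j), x01 x (pt a d i)) - p ^ (k - 2) else 0 := by
  unfold Blk.ga Blk.tvj
  show ∑ t ∈ (Ix k n).filter (fun t => v ∈ bB t ∧ j ∈ bB t), p ^ (k - t.2.2.card) * xiS p (((bB t).erase v).erase j) x = _
  rw [sum_filter]
  unfold Ix
  rw [sum_product]
  refine sum_congr rfl fun a _ => ?_
  rw [sum_product]
  refine sum_congr rfl fun d hd => ?_
  rw [sum_filter]
  split_ifs with h
  · obtain ⟨hv, hj⟩ := h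
    simp only [AP, mem_image, mem_range] at hv hj
    obtain ⟨i0, hi0, rfl⟩ := hv
    obtain ⟨i1, hi1, rfl⟩ := hj
    have hne : i0 ≠ i1 := fun e => hvj (by rw [e])
    have hinj := fun {i j : ℕ} => pt_inj (i := i) (j := j) hg (a := a) hd
    set Rr := ((range k).erase i0).erase i1 with hRr
    have hR : (range k).filter (fun i => pt a d i ≠ pt a d i0 ∧ pt a d i ≠ pt a d i1) = Rr := by
      ext i
      simp only [hRr, mem_filter, mem_range, mem_erase]
      constructor
      · rintro ⟨h1, h2, h3⟩; exact ⟨fun e => h3 (by rw [e]), fun e => h2 (by rw [e]), h1⟩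
      · rintro ⟨h1, h2, h3⟩; exact ⟨h3, fun e => h2 (hinj h3 hi0 e), fun e => h1 (hinj h3 hi1 e)⟩
    have hRc : Rr.card = k - 2 := by
      rw [hRr, card_erase_of_mem (by simp [hne.symm, hi1]), card_erase_of_mem (by simp [hi0]), card_range]; omega
    rw [hR, expand p Rr, hRc]
    have hRsub : Rr ⊆ range k := (erase_subset _ _).trans (erase_subset _ _)
    have hz : ∅ ∈ Rr.powerset := by simp
    rw [← add_sum_erase _ _ hz]
    simp only [card_empty, Nat.sub_zero, prod_empty, mul_one, add_sub_cancel_left]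
    rw [← sum_filter, ← sum_filter]
    have i0R : i0 ∉ Rr := by simp [hRr]
    have i1R : i1 ∉ Rr := by simp [hRr]
    refine sum_bij' (fun S _ => (S.erase i0).erase i1) (fun S _ => insert i0 (insert i1 S)) ?_ ?_ ?_ ?_ ?_
    · intro S hS
      simp only [mem_filter, mem_powerset] at hS
      simp only [mem_erase, mem_powerset]
      constructor
      · intro e
        have h6 := card_le_card (s := S) (t := {i0, i1}) (by
          intro i hi; by_contra hc
          simp only [mem_insert, mem_singleton, not_or] at hc
          have : i ∈ (S.erase i0).erase i1 := by simp [hc, hi]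
          rw [e] at this; simp at this)
        grind
      grind
    · intro S hS
      simp only [mem_erase, mem_powerset] at hS
      obtain ⟨hS1, hS2⟩ := hS
      have a0 : i0 ∉ S := fun h => i0R (hS2 h)
      have a1 : i1 ∉ S := fun h => i1R (hS2 h)
      simp only [mem_filter, mem_powerset, bB, mem_image]
      grind
    · intro S hS
      simp only [mem_filter, mem_powerset, bB, mem_image] at hS
      grind
    · grind
    · intro S hS
      simp only [mem_filter, mem_powerset, bB, mem_image] at hS
      obtain ⟨⟨hS1, hS3⟩, ⟨i, hi, e⟩, ⟨i', hi', e'⟩⟩ := hS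
      have := hinj (mem_range.mp (hS1 hi)) hi0 e
      subst this
      have := hinj (mem_range.mp (hS1 hi')) hi1 e'
      subst this
      have hio := inj_on (a := a) hg hd hS1
      rw [card_erase_of_mem (by grind), card_erase_of_mem hi]
      have hk' : S.card ≤ k := by simpa using card_le_card hS1
      have hexp : k - S.card = k - 2 - (S.card - 1 - 1) := by omega
      rw [hexp]
      congr 1
      · have hB : ((bB (a, d, S)).erase (pt a d i)).erase (pt a d i') = ((S.erase i).erase i').image (pt a d) := by
          ext z
          simp only [bB, mem_erase, mem_image]
          constructor
          · grind
          · grind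
        unfold xiS
        rw [hB, prod_image (hio.mono (by grind))]
        rfl
  · refine sum_eq_zero fun S hS => ?_
    split_ifs with h3 h4
    · exfalso; apply h
      have : bB (a, d, S) ⊆ AP k a d := image_subset_image (mem_powerset.mp hS)
      grind
    · rfl
    · rfl
theorem ap_uniq (hk : 3 ≤ k) (hg : n.gcd (k - 1).factorial = 1) {a a0 : ZMod n} {d e : ℕ} (hd : d ∈ Icc 1 (n / 2)) (he : e ∈ Icc 1 (n / 2))
    (hz : ∀ c : ℤ, |c| ≤ 4 * k ^ 2 → (c : ZMod n) * e = 0 → c = 0) (hsub : AP k a d ⊆ AP k a0 e) : a = a0 ∧ d = e := by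
  have hm : ∀ i < k, ∃ l < k, pt a d i = pt a0 e l := by
    intro i hi
    have := hsub (mem_image_of_mem (pt a d) (mem_range.mpr hi))
    simp only [AP, mem_image, mem_range] at this
    obtain ⟨l, hl, h⟩ := this
    exact ⟨l, hl, h.symm⟩
  obtain ⟨l0, hl0, e0⟩ := hm 0 (by omega)
  obtain ⟨l1, hl1, e1⟩ := hm 1 (by omega)
  obtain ⟨l2, hl2, e2⟩ := hm (k - 1) (by omega)
  have ha : a = a0 + (l0 : ZMod n) * e := by simpa [pt] using e0
  have hdd : (d : ZMod n) = ((l1 : ZMod n) - l0) * e := by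
    have : a + (d : ZMod n) = a0 + (l1 : ZMod n) * e := by simpa [pt] using e1
    rw [ha] at this; linear_combination this
  have hke : (((l0 : ℤ) + (k - 1 : ℕ) * ((l1 : ℤ) - l0) - l2 : ℤ) : ZMod n) * e = 0 := by
    have h3 : a + ((k - 1 : ℕ) : ZMod n) * d = a0 + (l2 : ZMod n) * e := by
      have := e2; unfold pt at this; push_cast at this; exact this
    rw [ha, hdd] at h3
    push_cast
    linear_combination h3
  set m : ℤ := (l1 : ℤ) - l0 with hmd
  have hmb := sub_lt (k := k) hl1 hl0
  have hkz : ((k - 1 : ℕ) : ℤ) = (k : ℤ) - 1 := by omega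
  have hc := hz _ (by
    rw [hkz]
    have hk3 : (3:ℤ) ≤ k := by exact_mod_cast hk
    have q0 : (l0 : ℤ) < k := by exact_mod_cast hl0
    have q2 : (l2 : ℤ) < k := by exact_mod_cast hl2
    have q3 : |((k:ℤ) - 1) * m| ≤ (k:ℤ) * k := by
      rw [abs_mul, abs_of_nonneg (by omega : (0:ℤ) ≤ (k:ℤ) - 1)]
      exact mul_le_mul (by omega) hmb.le (abs_nonneg _) (by omega)
    rw [abs_le] at q3 ⊢
    constructor <;> nlinarith) hke
  rw [hkz] at hc
  have hm0 : m ≠ 0 := by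
    intro h
    apply d_ne hd
    have : ((l1 : ZMod n) - l0) = ((m : ℤ) : ZMod n) := by rw [hmd]; push_cast; rfl
    rw [hdd, this, h]; simp
  have hm1 : m = 1 ∨ m = -1 := by
    have hk3 : (3:ℤ) ≤ k := by exact_mod_cast hk
    have q0 : (l0 : ℤ) < k := by exact_mod_cast hl0
    have q2 : (l2 : ℤ) < k := by exact_mod_cast hl2
    by_contra hcc
    push Not at hcc
    rcases lt_trichotomy m 0 with h | h | h
    · have : m ≤ -2 := by omega
      nlinarith
    · exact hm0 h
    · have : 2 ≤ m := by omega
      nlinarith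
  have hdm : (d : ZMod n) = ((m : ℤ) : ZMod n) * e := by rw [hdd, hmd]; push_cast; rfl
  rcases hm1 with h | h
  · rw [h] at hdm hc
    have h5 : d = e := d_inj hd he (by simpa using hdm)
    have : l0 = 0 := by omega
    refine ⟨?_, h5⟩
    rw [ha, this]; simp
  · rw [h] at hdm
    have h6 : ((d + e : ℕ) : ZMod n) = 0 := by push_cast; rw [hdm]; push_cast; ring
    rw [ZMod.natCast_eq_zero_iff] at h6
    rw [mem_Icc] at hd he
    have := Nat.le_of_dvd (by omega) h6
    have := odd_n hk hg
    omega
include h0 h1 hk hg in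
theorem three_z {v j a0 : ZMod n} {e : ℕ} (hvj : v ≠ j)
    (he : e ∈ Icc 1 (n / 2)) (hend : (v = pt a0 e 0 ∧ j = pt a0 e (k - 1)) ∨ (j = pt a0 e 0 ∧ v = pt a0 e (k - 1)))
    (hz : ∀ c : ℤ, |c| ≤ 4 * k ^ 2 → (c : ZMod n) * e = 0 → c = 0) {s : ℝ} (hs : |s| ≤ π) :
    ‖Ex p (fun x => cexp (((s * (zb p h0 h1 hk hg).ga p v j x : ℝ) : ℂ) * ⅈ))‖ ≤ exp (-((υ p) ^ (KK k * k + 1) / 100 * s ^ 2)) := by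
  classical
  set b := zb p h0 h1 hk hg with hb
  set P := (b.tvj v j).biUnion b.B with hP
  have hcard : P.card ≤ KK k * k :=
    (card_biUnion_le_card_mul _ _ k fun t ht => b.cardk t (mem_filter.mp ht).1).trans (Nat.mul_le_mul_right _ (b.star v j hvj))
  have hPm : ∀ a d, d ∈ Icc 1 (n / 2) → v ∈ AP k a d → j ∈ AP k a d → AP k a d ⊆ P := by
    intro a d hd hv hj
    have hmem : (a, d, range k) ∈ b.tvj v j := by
      refine mem_filter.mpr ⟨mem_Ix.mpr ⟨hd, le_rfl, by simpa using hk⟩, hv, hj⟩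
    exact subset_biUnion_of_mem b.B hmem
  have hv0 : v ∈ AP k a0 e := by
    rcases hend with h | h
    · rw [h.1]; exact mem_image_of_mem _ (by simp; omega)
    · rw [h.2]; exact mem_image_of_mem _ (by simp; omega)
  have hj0 : j ∈ AP k a0 e := by
    rcases hend with h | h
    · rw [h.2]; exact mem_image_of_mem _ (by simp; omega)
    · rw [h.1]; exact mem_image_of_mem _ (by simp; omega)
  set u := pt a0 e 1 with hu
  have huv : u ≠ v ∧ u ≠ j := by
    have q1 : u ≠ pt a0 e 0 := fun h => by have := pt_inj hg he (by omega) (by omega) h; omega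
    have q2 : u ≠ pt a0 e (k - 1) := fun h => by have := pt_inj hg he (by omega) (by omega) h; omega
    rcases hend with h | h <;> rw [h.1, h.2]
    · exact ⟨q1, q2⟩
    · exact ⟨q2, q1⟩
  have hu0 : u ∈ AP k a0 e := mem_image_of_mem _ (by simp; omega)
  refine three_gen h0 h1 _ u P (fun i => decide (i ∈ AP k a0 e)) hcard ?_ hs
  intro x hx
  rw [Du_eq, ga_formula h0 h1 hk hg hvj, ga_formula h0 h1 hk hg hvj, ← sum_sub_distrib]
  simp_rw [← sum_sub_distrib]
  rw [sum_eq_single_of_mem a0 (mem_univ _), sum_eq_single_of_mem e he]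
  · rw [if_pos ⟨hv0, hj0⟩, if_pos ⟨hv0, hj0⟩, prod_eq_one, prod_eq_zero (i := 1)]
    · ring
    · grind
    · simp [x01, ← hu]
    · intro i hi
      have hmem : pt a0 e i ∈ AP k a0 e := mem_image_of_mem _ (mem_filter.mp hi).1
      by_cases h : pt a0 e i = u
      · rw [h]; simp [x01]
      · have := hx _ (hPm a0 e he hv0 hj0 hmem)
        simp [x01, h, this, hmem]
  all_goals
    skip
  · intro d hd hne
    by_cases hh : v ∈ AP k a0 d ∧ j ∈ AP k a0 d
    · have hns : ¬ AP k a0 d ⊆ AP k a0 e := fun hc => hne (ap_uniq hk hg hd he hz hc).2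
      rw [not_subset] at hns
      obtain ⟨w, hw, hw2⟩ := hns
      have hw' := hw
      simp only [AP, mem_image] at hw'
      obtain ⟨i, hi, rfl⟩ := hw'
      have hmf : i ∈ (range k).filter (fun i => pt a0 d i ≠ v ∧ pt a0 d i ≠ j) :=
        mem_filter.mpr ⟨hi, fun h => hw2 (h ▸ hv0), fun h => hw2 (h ▸ hj0)⟩
      have hxx := hx _ (hPm a0 d hd hh.1 hh.2 hw)
      have hnu : pt a0 d i ≠ u := fun h => hw2 (h ▸ hu0)
      rw [prod_eq_zero hmf (by simp [x01, hnu, hxx, hw2]), prod_eq_zero hmf (by simp [x01, hnu, hxx, hw2]), sub_self]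
    grind
  · intro a _ hne
    refine sum_eq_zero fun d hd => ?_
    by_cases hh : v ∈ AP k a d ∧ j ∈ AP k a d
    · have hns : ¬ AP k a d ⊆ AP k a0 e := fun hc => hne (ap_uniq hk hg hd he hz hc).1
      rw [not_subset] at hns
      obtain ⟨w, hw, hw2⟩ := hns
      have hw' := hw
      simp only [AP, mem_image] at hw'
      obtain ⟨i, hi, rfl⟩ := hw'
      have hmf : i ∈ (range k).filter (fun i => pt a d i ≠ v ∧ pt a d i ≠ j) :=
        mem_filter.mpr ⟨hi, fun h => hw2 (h ▸ hv0), fun h => hw2 (h ▸ hj0)⟩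
      have hxx := hx _ (hPm a d hd hh.1 hh.2 hw)
      have hnu : pt a d i ≠ u := fun h => hw2 (h ▸ hu0)
      rw [prod_eq_zero hmf (by simp [x01, hnu, hxx, hw2]), prod_eq_zero hmf (by simp [x01, hnu, hxx, hw2]), sub_self]
    grind
theorem rep_half (hn : n % 2 = 1) {w : ZMod n} (hw : w ≠ 0) : ∃ e ∈ Icc 1 (n / 2), w = e ∨ w = -(e : ZMod n) := by
  have h1 := ZMod.val_lt w
  have h2 : w.val ≠ 0 := by rwa [Ne, ZMod.val_eq_zero]
  by_cases h : w.val ≤ n / 2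
  · exact ⟨w.val, by rw [mem_Icc]; omega, Or.inl (ZMod.natCast_zmod_val w).symm⟩
  · refine ⟨n - w.val, by rw [mem_Icc]; omega, Or.inr ?_⟩
    rw [Nat.cast_sub h1.le, ZMod.natCast_zmod_val]; simp
include h0 h1 hk hg in
theorem cfg_z {J V : Finset (ZMod n)} (hJV : GJV (4 * (k : ℤ) ^ 2) J V) :
    (zb p h0 h1 hk hg).Cfg p ((υ p) ^ (KK k * k + 1) / 100) J V := by
  have hkz : (3:ℤ) ≤ k := by exact_mod_cast hk
  have hkb : ∀ c : ℤ, |c| < k → |c| ≤ 4 * (k:ℤ) ^ 2 := fun c hc => by nlinarith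
  have hne : ∀ v ∈ V, ∀ j ∈ J, v ≠ j := by
    intro v hv j hj e
    have := hJV v hv v hv j hj j hj 1 0 (by rw [abs_one]; nlinarith) (by rw [abs_zero]; nlinarith) (by rw [e]; simp)
    omega
  refine ⟨disjoint_left.mpr fun i hi hi' => hne i hi' i hi rfl, ?_, ?_, ?_⟩
  · intro t ht hV hJ
    obtain ⟨v, hv⟩ := hV
    obtain ⟨j, hj⟩ := hJ
    rw [mem_inter] at hv hj
    have hvj := hne v hv.2 j hj.2
    rw [← card_pair hvj]
    refine card_le_card fun w hw => ?_
    rw [mem_inter, mem_union] at hw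
    obtain ⟨hd, hS, -⟩ := mem_Ix.mp ht
    obtain ⟨⟨iv, hiv, ev⟩, -⟩ := And.intro (mem_image.mp hv.1) trivial
    obtain ⟨ij, hij, ej⟩ := mem_image.mp hj.1
    obtain ⟨iw, hiw, ew⟩ := mem_image.mp hw.1
    have lv := mem_range.mp (hS hiv)
    have lj := mem_range.mp (hS hij)
    have lw := mem_range.mp (hS hiw)
    rw [mem_insert, mem_singleton]
    rcases hw.2 with h | h
    · right
      have := hJV v hv.2 v hv.2 j hj.2 w h ((iv : ℤ) - iw) ((iv : ℤ) - ij) (hkb _ (sub_lt lv lw)) (hkb _ (sub_lt lv lj)) (by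
        rw [← ev, ← ej, ← ew, pt_sub, pt_sub]; push_cast; ring)
      grind
    · left
      have := hJV v hv.2 w h j hj.2 j hj.2 ((iw : ℤ) - ij) ((iv : ℤ) - ij) (hkb _ (sub_lt lw lj)) (hkb _ (sub_lt lv lj)) (by
        rw [← ev, ← ej, ← ew, pt_sub, pt_sub]; push_cast; ring)
      grind
  · intro j hj v hv v' hv' hvv
    rw [disjoint_left]
    intro u hu hu'
    simp only [Blk.av, Blk.tvj, mem_biUnion, mem_filter, mem_erase] at hu hu'
    obtain ⟨t, ⟨ht, hvt, hjt⟩, huj, huv, hut⟩ := hu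
    obtain ⟨t', ⟨ht', hvt', hjt'⟩, -, huv', hut'⟩ := hu'
    have key : ∀ (t : ZMod n × ℕ × Finset ℕ), t ∈ Ix k n → ∀ w, w ≠ j → w ∈ bB t → j ∈ bB t → u ∈ bB t → ∃ α β : ℤ, α ≠ 0 ∧ β ≠ 0 ∧ |α| < k ∧ |β| < k ∧ (α : ZMod n) * (w - j) = β * (u - j) := by
      intro t ht w hwj hw hj hu
      obtain ⟨hd, hS, -⟩ := mem_Ix.mp ht
      obtain ⟨iv, hiv, ev⟩ := mem_image.mp hw
      obtain ⟨ij, hij, ej⟩ := mem_image.mp hj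
      obtain ⟨iu, hiu, eu⟩ := mem_image.mp hu
      have lv := mem_range.mp (hS hiv)
      have lj := mem_range.mp (hS hij)
      have lw := mem_range.mp (hS hiu)
      refine ⟨(iu : ℤ) - ij, (iv : ℤ) - ij, ?_, ?_, sub_lt lw lj, sub_lt lv lj, ?_⟩
      · grind
      · grind
      · rw [← ev, ← ej, ← eu, pt_sub, pt_sub]; push_cast; ring
    obtain ⟨α, β, hα, hβ, lα, lβ, E⟩ := key t ht v (hne v hv j hj) hvt hjt hut
    obtain ⟨α', β', hα', hβ', lα', lβ', E'⟩ := key t' ht' v' (hne v' hv' j hj) hvt' hjt' hut'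
    have hpb : ∀ a b : ℤ, |a| < k → |b| < k → |a * b| ≤ 4 * (k:ℤ) ^ 2 := fun a b ha hb => by
      rw [abs_mul]; nlinarith [abs_nonneg a, abs_nonneg b, mul_le_mul ha.le hb.le (abs_nonneg b) (by omega : (0:ℤ) ≤ k)]
    have E3 : ((α * β' : ℤ) : ZMod n) * (v - j) = ((β * α' : ℤ) : ZMod n) * (v' - j) := by
      push_cast; linear_combination (β' : ZMod n) * E - (β : ZMod n) * E'
    have E4 := hJV v hv v' hv' j hj j hj _ _ (hpb _ _ lα lβ') (hpb _ _ lβ lα') E3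
    rw [E4, Int.cast_mul] at E3
    have hun := (unit_int (n := n) hg hβ lβ).mul (unit_int hg hα' lα')
    exact hvv (sub_left_injective (hun.mul_left_cancel E3))
  · intro j hj v hv s hs
    have hvj := hne v hv j hj
    obtain ⟨g, hgu⟩ := unit_nat (n := n) hg (m := k - 1) (by omega) (by omega)
    set w := (↑g⁻¹ : ZMod n) * (v - j) with hw
    have hgw : ((k - 1 : ℕ) : ZMod n) * w = v - j := by rw [hw, ← hgu, ← mul_assoc, Units.mul_inv, one_mul]
    have hw0 : w ≠ 0 := fun h => hvj (sub_eq_zero.mp (by grind))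
    have hzw : ∀ c : ℤ, |c| ≤ 4 * k ^ 2 → (c : ZMod n) * w = 0 → c = 0 := by
      intro c hc h
      refine hJV v hv v hv j hj j hj c 0 hc (by rw [abs_zero]; positivity) ?_
      rw [← hgw, mul_left_comm, h]; simp
    obtain ⟨e, he, h | h⟩ := rep_half (odd_n hk hg) hw0
    · refine three_z h0 h1 hk hg hvj he (a0 := j) (Or.inr ⟨by simp [pt], ?_⟩) (fun c hc hh => hzw c hc (by rw [h]; exact hh)) hs
      rw [h] at hgw; unfold pt; grind
    · refine three_z h0 h1 hk hg hvj he (a0 := v) (Or.inl ⟨by simp [pt], ?_⟩) (fun c hc hh => hzw c hc (by grind)) hs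
      rw [h] at hgw; unfold pt; grind
theorem exists_JV {R : ℕ} (hR : 1 ≤ R) {q L : ℕ} (hq : 64 * R ^ 2 * q ≤ n) (hL : L ≤ q) (hn : 0 < n) : ∃ J V : Finset (ZMod n), J.card = q ∧ V.card = L ∧ GJV (R : ℤ) J V := by
  have hq1 : 17 * R * q < n ∨ q = 0 := by
    rcases Nat.eq_zero_or_pos q with h | h
    · right; exact h
    · left; nlinarith [Nat.mul_pos hR h, Nat.mul_le_mul_right (R * q) hR]
  have hinj : ∀ a < n, ∀ b < n, ((a : ℕ) : ZMod n) = b → a = b := by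
    intro a ha b hb e
    rwa [ZMod.natCast_eq_natCast_iff', Nat.mod_eq_of_lt ha, Nat.mod_eq_of_lt hb] at e
  refine ⟨(range q).image fun a => ((a : ℕ) : ZMod n), (range L).image fun a => ((16 * R * q + a : ℕ) : ZMod n), ?_, ?_, ?_⟩
  · rw [card_image_of_injOn, card_range]
    intro a ha b hb e
    simp at ha hb
    refine hinj a ?_ b ?_ e <;> rcases hq1 with h | h <;> nlinarith
  · rw [card_image_of_injOn, card_range]
    intro a ha b hb e
    simp only [coe_range, Set.mem_Iio] at ha hb
    have := hinj (16 * R * q + a) (by rcases hq1 with h | h <;> nlinarith) (16 * R * q + b) (by rcases hq1 with h | h <;> nlinarith) e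
    omega
  · intro v hv v' hv' j hj j' hj' a b ha hb h
    simp only [mem_image, mem_range] at hv hv' hj hj'
    obtain ⟨y, hy, rfl⟩ := hv
    obtain ⟨y', hy', rfl⟩ := hv'
    obtain ⟨w, hw, rfl⟩ := hj
    obtain ⟨w', hw', rfl⟩ := hj'
    set s : ℤ := 16 * R * q + y - w with hs
    set s' : ℤ := 16 * R * q + y' - w' with hs'
    have hdvd : (n : ℤ) ∣ a * s - b * s' := by
      rw [← ZMod.intCast_zmod_eq_zero_iff_dvd, hs, hs']
      push_cast at h ⊢
      linear_combination h
    zify at hy hy' hw hw' hL hR hq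
    have y0 : (0:ℤ) ≤ y := Int.natCast_nonneg _
    have y0' : (0:ℤ) ≤ y' := Int.natCast_nonneg _
    have w0 : (0:ℤ) ≤ w := Int.natCast_nonneg _
    have w0' : (0:ℤ) ≤ w' := Int.natCast_nonneg _
    have hqp : (1:ℤ) ≤ q := by omega
    have hRq : (q:ℤ) ≤ R * q := by nlinarith
    have s1 : 15 * (R * q) ≤ s := by rw [hs]; nlinarith
    have s1' : 15 * (R * q) ≤ s' := by rw [hs']; nlinarith
    have s2 : s ≤ 17 * (R * q) := by rw [hs]; nlinarith
    have s2' : s' ≤ 17 * (R * q) := by rw [hs']; nlinarith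
    have sp : 0 ≤ s := by linarith
    have sp' : 0 ≤ s' := by linarith
    have hd : |s' - s| ≤ 2 * q := by rw [abs_le, hs, hs']; constructor <;> linarith
    have habs : |a * s - b * s'| < n := by
      have t1 : |a * s| ≤ R * (17 * (R * q)) := by
        rw [abs_mul]; exact mul_le_mul ha (by rw [abs_of_nonneg sp]; exact s2) (abs_nonneg _) (by linarith)
      have t2 : |b * s'| ≤ R * (17 * (R * q)) := by
        rw [abs_mul]; exact mul_le_mul hb (by grind) (abs_nonneg _) (by linarith)
      have t3 := abs_sub (a * s) (b * s')
      have t4 : (R:ℤ) * (17 * (R * q)) = 17 * (R ^ 2 * q) := by ring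
      have t5 : 1 ≤ (R:ℤ) ^ 2 * q := one_le_mul_of_one_le_of_one_le (one_le_pow₀ hR) hqp
      linarith
    have hz := Int.eq_zero_of_abs_lt_dvd hdvd habs
    by_contra hab
    have e1 : (a - b) * s = b * (s' - s) := by linear_combination hz
    have e2 := congrArg abs e1
    rw [abs_mul, abs_mul, abs_of_nonneg sp] at e2
    have e3 : 1 ≤ |a - b| := Int.one_le_abs (sub_ne_zero.mpr hab)
    have e4 : |b| * |s' - s| ≤ R * (2 * q) := mul_le_mul hb hd (abs_nonneg _) (by linarith)
    have e5 := le_mul_of_one_le_left sp e3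
    grind
end Cfg2
noncomputable section Var
variable {k n : ℕ} [NeZero n]
variable {p : ℝ} (h0 : 0 < p) (h1 : p < 1) (hk : 3 ≤ k) (hg : n.gcd (k - 1).factorial = 1)
def Pz (a e : ZMod n) (i : ℕ) : ZMod n := a + (i : ZMod n) * e
def Sk (k : ℕ) : Finset (Finset ℕ) := (range k).powerset.filter fun S => 3 ≤ S.card
theorem mem_Sk {S : Finset ℕ} : S ∈ Sk k ↔ S ⊆ range k ∧ 3 ≤ S.card := by simp [Sk]
theorem Pz_inj (hg : n.gcd (k - 1).factorial = 1) {a e : ZMod n} (he : e ≠ 0) {S : Finset ℕ} (hS : S ⊆ range k) : Set.InjOn (Pz a e) S := by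
  intro i hi j hj h
  by_contra hij
  have h1 : ((i : ZMod n) - j) * e = 0 := by unfold Pz at h; linear_combination h
  exact he (((unit_sub hg (mem_range.mp (hS hi)) (mem_range.mp (hS hj)) hij).mul_right_eq_zero).mp h1)
theorem pr_ex {S : Finset ℕ} (h : 3 ≤ S.card) : ∃ q : ℕ × ℕ, q.1 ∈ S ∧ q.2 ∈ S ∧ q.1 ≠ q.2 := by
  obtain ⟨a, ha, b, hb, hab⟩ := one_lt_card.mp (by omega : 1 < S.card)
  exact ⟨(a, b), ha, hb, hab⟩
def pr (S : Finset ℕ) : ℕ × ℕ := if h : 3 ≤ S.card then (pr_ex h).choose else (0, 0)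
theorem pr_spec {S : Finset ℕ} (h : 3 ≤ S.card) : (pr S).1 ∈ S ∧ (pr S).2 ∈ S ∧ (pr S).1 ≠ (pr S).2 := by
  unfold pr; grind
def df (S' : Finset ℕ) (q : ℕ × ℕ) (s i : ℕ) : ℤ :=
  ((pr S').2 - (pr S').1 : ℤ) * q.1 + ((s : ℤ) - (pr S').1) * ((q.2 : ℤ) - q.1) - ((pr S').2 - (pr S').1 : ℤ) * i
def NN (S S' : Finset ℕ) : ℕ := ((S ×ˢ S).filter fun q => q.1 ≠ q.2 ∧ ∀ s ∈ S', ∃ i ∈ S, df S' q s i = 0).card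
def Nz (e : ZMod n) (S S' : Finset ℕ) : ℕ := ((S ×ˢ S).filter fun q => q.1 ≠ q.2 ∧ ∀ s ∈ S', ∃ i ∈ S, (df S' q s i : ZMod n) * e = 0).card
theorem m_eq (hg : n.gcd (k - 1).factorial = 1) {a e : ZMod n} (he : e ≠ 0) {S S' : Finset ℕ} (hS : S ∈ Sk k) (hS' : S' ∈ Sk k) (hc : S.card = S'.card) :
    ((univ ×ˢ univ.erase 0).filter fun t : ZMod n × ZMod n => S.image (Pz a e) = S'.image (Pz t.1 t.2)).card = Nz e S S' := by
  classical
  rw [mem_Sk] at hS hS'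
  obtain ⟨p1, p2, p3⟩ := pr_spec hS'.2
  set s0 := (pr S').1 with hs0
  set s1 := (pr S').2 with hs1
  have hlt : ∀ {i}, i ∈ S → i < k := fun h => mem_range.mp (hS.1 h)
  have hlt' : ∀ {i}, i ∈ S' → i < k := fun h => mem_range.mp (hS'.1 h)
  obtain ⟨D, hD⟩ := unit_sub (n := n) hg (hlt' p2) (hlt' p1) p3.symm
  have hDi : (D : ZMod n) * ((D⁻¹ : (ZMod n)ˣ) : ZMod n) = 1 := by simp
  set Di : ZMod n := ((D⁻¹ : (ZMod n)ˣ) : ZMod n)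
  symm
  unfold Nz
  have key : ∀ (q : ℕ × ℕ) (s i : ℕ), ((df S' q s i : ℤ) : ZMod n) = D * q.1 + ((s:ZMod n) - s0) * ((q.2:ZMod n) - q.1) - D * i := by
    intro q s i; unfold df; rw [hD]; push_cast; ring
  refine card_bij (fun q _ => (a + (q.1 : ZMod n) * e - s0 * (e * ((q.2 : ZMod n) - q.1) * Di), e * ((q.2 : ZMod n) - q.1) * Di)) ?_ ?_ ?_
  · intro q hq
    simp only [mem_filter, mem_product] at hq
    obtain ⟨⟨q1, q2⟩, q3, q4⟩ := hq
    have he' : e * ((q.2 : ZMod n) - q.1) * Di ≠ 0 := by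
      intro h
      have h1 : e * ((q.2 : ZMod n) - q.1) = 0 := by
        have := congrArg (· * (D : ZMod n)) h
        simp only [zero_mul] at this
        linear_combination this - e * ((q.2 : ZMod n) - q.1) * hDi
      exact he (((unit_sub hg (hlt q2) (hlt q1) q3.symm).mul_left_eq_zero).mp h1)
    simp only [mem_filter, mem_product, mem_univ, mem_erase, true_and, and_true]
    refine ⟨he', ?_⟩
    symm
    refine eq_of_subset_of_card_le ?_ ?_
    · intro z hz
      rw [mem_image] at hz
      obtain ⟨s, hs, rfl⟩ := hz
      obtain ⟨i, hi, h⟩ := q4 s hs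
      rw [key] at h
      rw [mem_image]
      refine ⟨i, hi, ?_⟩
      unfold Pz
      grind
    · rw [card_image_of_injOn (Pz_inj hg he hS.1), card_image_of_injOn (Pz_inj hg he' hS'.1), hc]
  · intro q hq q' hq' h
    simp only [mem_filter, mem_product] at hq hq'
    simp only [Prod.mk.injEq] at h
    obtain ⟨h1, h2⟩ := h
    have e1 : Pz a e q.1 = Pz a e q'.1 := by unfold Pz; linear_combination h1 + s0 * h2
    have e2 : Pz a e q.2 = Pz a e q'.2 := by
      unfold Pz
      linear_combination h1 + (s0 + D) * h2 - e * ((q.2 : ZMod n) - q.1 - q'.2 + q'.1) * hDi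
    exact Prod.ext (Pz_inj hg he hS.1 hq.1.1 hq'.1.1 e1) (Pz_inj hg he hS.1 hq.1.2 hq'.1.2 e2)
  · rintro ⟨a', e'⟩ ht
    simp only [mem_filter, mem_product, mem_univ, mem_erase, true_and, and_true] at ht
    obtain ⟨he', ht⟩ := ht
    have hm : ∀ s ∈ S', ∃ i ∈ S, Pz a e i = Pz a' e' s := by
      intro s hs
      have : Pz a' e' s ∈ S.image (Pz a e) := by rw [ht]; exact mem_image_of_mem _ hs
      rwa [mem_image] at this
    obtain ⟨i0, hi0, e0⟩ := hm s0 p1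
    obtain ⟨i1, hi1, e1⟩ := hm s1 p2
    unfold Pz at e0 e1
    have hee : e * ((i1 : ZMod n) - i0) = D * e' := by rw [hD]; linear_combination e1 - e0
    have hee2 : e * ((i1 : ZMod n) - i0) * Di = e' := by rw [hee]; linear_combination e' * hDi
    refine ⟨(i0, i1), ?_, ?_⟩
    · simp only [mem_filter, mem_product]
      refine ⟨⟨hi0, hi1⟩, ?_, ?_⟩
      · grind
      · intro s hs
        obtain ⟨i, hi, h⟩ := hm s hs
        refine ⟨i, hi, ?_⟩
        rw [key]
        unfold Pz at h
        grind
    grind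
theorem Nz_le (e : ZMod n) {S S' : Finset ℕ} (hS : S ∈ Sk k) : Nz e S S' ≤ k ^ 2 := by
  classical
  rw [mem_Sk] at hS
  have : S.card ≤ k := by simpa using card_le_card hS.1
  refine (card_filter_le _ _).trans ?_
  rw [card_product, sq]; exact Nat.mul_le_mul this this
theorem NN_le {S S' : Finset ℕ} (hS : S ∈ Sk k) : NN S S' ≤ k ^ 2 := by
  classical
  rw [mem_Sk] at hS
  have : S.card ≤ k := by simpa using card_le_card hS.1
  refine (card_filter_le _ _).trans ?_
  rw [card_product, sq]; exact Nat.mul_le_mul this this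
def Bad (k n : ℕ) [NeZero n] : Finset (ZMod n) := (Icc 1 (3 * k ^ 2)).biUnion fun c => univ.filter fun e : ZMod n => c • e = 0
theorem Bad_card : (Bad k n).card ≤ 9 * k ^ 4 := by
  unfold Bad
  refine card_biUnion_le.trans ?_
  calc _ ≤ ∑ c ∈ Icc 1 (3 * k ^ 2), 3 * k ^ 2 := by
        refine sum_le_sum fun c hc => ?_
        rw [mem_Icc] at hc
        exact (IsAddCyclic.card_nsmul_eq_zero_le (by omega)).trans hc.2
    _ = 9 * k ^ 4 := by simp; ring
theorem Nz_eq {e : ZMod n} (he : e ∉ Bad k n) {S S' : Finset ℕ} (hS : S ∈ Sk k) (hS' : S' ∈ Sk k) : Nz e S S' = NN S S' := by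
  classical
  rw [mem_Sk] at hS hS'
  obtain ⟨p1, p2, p3⟩ := pr_spec hS'.2
  have hlt : ∀ {i}, i ∈ S → i < k := fun h => mem_range.mp (hS.1 h)
  have hlt' : ∀ {i}, i ∈ S' → i < k := fun h => mem_range.mp (hS'.1 h)
  have hz : ∀ c : ℤ, |c| ≤ 3 * k ^ 2 → (c : ZMod n) * e = 0 → c = 0 := by
    intro c hc h
    by_contra h0
    apply he
    unfold Bad
    rw [mem_biUnion]
    refine ⟨c.natAbs, mem_Icc.mpr ⟨Int.natAbs_pos.mpr h0, by zify; exact hc⟩, ?_⟩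
    simp only [mem_filter, mem_univ, true_and, nsmul_eq_mul]
    rcases Int.natAbs_eq c with hh | hh
    · rw [hh, Int.cast_natCast] at h; exact h
    · rw [hh, Int.cast_neg, Int.cast_natCast, neg_mul, neg_eq_zero] at h; exact h
  unfold Nz NN
  congr 1
  refine filter_congr fun q hq => ?_
  rw [mem_product] at hq
  refine and_congr_right fun _ => forall₂_congr fun s hs => exists_congr fun i => and_congr_right fun hi => ?_
  constructor
  · refine hz _ ?_
    unfold df
    have k0 : (0:ℤ) ≤ k := by positivity
    have b1 : ∀ {x y : ℕ}, x < k → y < k → |(x:ℤ) - y| ≤ k := fun hx hy => (sub_lt hx hy).le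
    have b2 : ∀ {x : ℕ}, x < k → |(x:ℤ)| ≤ k := fun hx => by rw [abs_of_nonneg (by positivity)]; exact_mod_cast hx.le
    have t1 : |((pr S').2 - (pr S').1 : ℤ) * q.1| ≤ k * k := by
      rw [abs_mul]; exact mul_le_mul (b1 (hlt' p2) (hlt' p1)) (b2 (hlt hq.1)) (abs_nonneg _) k0
    have t2 : |((pr S').2 - (pr S').1 : ℤ) * i| ≤ k * k := by
      rw [abs_mul]; exact mul_le_mul (b1 (hlt' p2) (hlt' p1)) (b2 (hlt hi)) (abs_nonneg _) k0
    have t3 : |((s : ℤ) - (pr S').1) * ((q.2 : ℤ) - q.1)| ≤ k * k := by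
      rw [abs_mul]; exact mul_le_mul (b1 (hlt' hs) (hlt' p1)) (b1 (hlt hq.2) (hlt hq.1)) (abs_nonneg _) k0
    rw [abs_le] at *
    constructor <;> nlinarith
  · intro h; rw [h]; simp
def wS (p : ℝ) (k : ℕ) (S S' : Finset ℕ) : ℝ := if S.card = S'.card then p ^ (k - S.card) * p ^ (k - S'.card) * (υ p) ^ S.card else 0
def kap (p : ℝ) (k : ℕ) : ℝ := (∑ S ∈ Sk k, ∑ S' ∈ Sk k, wS p k S S' * NN S S') / 4
include h0 h1 in
theorem wS_bd (S S' : Finset ℕ) : 0 ≤ wS p k S S' ∧ wS p k S S' ≤ 1 := by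
  have := s2_bd h0 h1
  unfold wS; split_ifs
  · have a1 : p ^ (k - S.card) ≤ 1 := pow_le_one₀ h0.le h1.le
    have a2 : p ^ (k - S'.card) ≤ 1 := pow_le_one₀ h0.le h1.le
    have a3 : (υ p) ^ S.card ≤ 1 := pow_le_one₀ this.1.le this.2
    have a4 : 0 ≤ (υ p) ^ S.card := pow_nonneg this.1.le _
    exact ⟨by positivity, mul_le_one₀ (mul_le_one₀ a1 (by positivity) a2) a4 a3⟩
  · simp
include h0 h1 hk in
theorem kap_pos : 0 < kap p k := by
  classical
  unfold kap
  have hm : range k ∈ Sk k := by rw [mem_Sk]; simp [hk]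
  have hn : ∀ S ∈ Sk k, ∀ S' ∈ Sk k, 0 ≤ wS p k S S' * NN S S' := fun S _ S' _ => mul_nonneg (wS_bd h0 h1 _ _).1 (by positivity)
  refine div_pos ?_ (by norm_num)
  refine sum_pos' (fun S hS => sum_nonneg (hn S hS)) ⟨_, hm, ?_⟩
  refine sum_pos' (hn _ hm) ⟨_, hm, ?_⟩
  have h3 := (s2_bd h0 h1).1
  unfold wS
  rw [if_pos rfl]
  refine mul_pos (by positivity) ?_
  rw [Nat.cast_pos]
  unfold NN
  rw [card_pos]
  obtain ⟨p1, p2, p3⟩ := pr_spec (mem_Sk.mp hm).2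
  refine ⟨pr (range k), ?_⟩
  rw [mem_filter, mem_product]
  refine ⟨⟨p1, p2⟩, p3, fun s hs => ⟨s, hs, ?_⟩⟩
  unfold df; ring
include h0 h1 hk hg in
theorem two_W (x : ZMod n → Bool) :
    2 * (zb p h0 h1 hk hg).W p x = ∑ t ∈ ((univ : Finset (ZMod n)) ×ˢ (univ : Finset (ZMod n)).erase 0) ×ˢ Sk k,
      p ^ (k - t.2.card) * xiS p (t.2.image (Pz t.1.1 t.1.2)) x := by
  set g : ZMod n → ℝ := fun e => ∑ a, ∑ S ∈ Sk k, p ^ (k - S.card) * xiS p (S.image (Pz a e)) x with hgd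
  have hgs : ∀ e, g (-e) = g e := by
    intro e
    simp only [hgd]
    rw [sum_comm, sum_comm (s := univ)]
    have hr : ∀ S ∈ Sk k, S.image (fun i => k - 1 - i) ∈ Sk k ∧ (S.image (fun i => k - 1 - i)).card = S.card ∧ (S.image (fun i => k - 1 - i)).image (fun i => k - 1 - i) = S := by
      intro S hS
      rw [mem_Sk] at hS
      have hc : (S.image (fun i => k - 1 - i)).card = S.card := by
        refine card_image_of_injOn ?_
        intro i hi j hj h
        have := mem_range.mp (hS.1 hi)
        have := mem_range.mp (hS.1 hj)
        simp only at h; omega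
      refine ⟨mem_Sk.mpr ⟨?_, by omega⟩, hc, ?_⟩
      · grind
      · rw [image_image]
        grind
    refine sum_bij' (fun S _ => S.image fun i => k - 1 - i) (fun S _ => S.image fun i => k - 1 - i) (fun S hS => (hr S hS).1) (fun S hS => (hr S hS).1)
      (fun S hS => (hr S hS).2.2) (fun S hS => (hr S hS).2.2) ?_
    intro S hS
    rw [(hr S hS).2.1]
    rw [← Equiv.sum_comp (Equiv.addRight ((k - 1 : ℕ) * e : ZMod n)) (fun a => p ^ (k - S.card) * xiS p (S.image (Pz a (-e))) x)]
    refine sum_congr rfl fun a _ => ?_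
    congr 2
    rw [image_image]
    refine image_congr ?_
    intro i hi
    have := mem_range.mp ((mem_Sk.mp hS).1 hi)
    simp only [Function.comp, Pz, Equiv.coe_addRight]
    rw [Nat.cast_sub (by omega : i ≤ k - 1)]; ring
  have h1' := sum_half (odd_n hk hg) g hgs
  have h2 : (zb p h0 h1 hk hg).W p x = ∑ d ∈ Icc 1 (n / 2), g (d : ZMod n) := by
    show ∑ t ∈ Ix k n, p ^ (k - t.2.2.card) * xiS p (bB t) x = _
    unfold Ix
    rw [sum_product]
    simp only [hgd]
    conv_rhs => rw [sum_comm]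
    refine sum_congr rfl fun a _ => ?_
    rw [sum_product]
    refine sum_congr rfl fun d _ => sum_congr rfl fun S _ => ?_
    unfold bB pt Pz
    push_cast; rfl
  rw [h2, h1', ← sum_erase_eq_sub (mem_univ _), sum_product, sum_product, sum_comm]
include h0 h1 hk hg in
theorem Ex_W_sq :
    4 * Ex p (fun x => (zb (n := n) p h0 h1 hk hg).W p x ^ 2) = n * ∑ e ∈ (univ : Finset (ZMod n)).erase 0, ∑ S ∈ Sk k, ∑ S' ∈ Sk k, wS p k S S' * Nz e S S' := by
  classical
  rw [← Ex_mul_left]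
  have : (fun x => 4 * (zb (n := n) p h0 h1 hk hg).W p x ^ 2) = fun x => (2 * (zb (n := n) p h0 h1 hk hg).W p x) ^ 2 := by funext x; ring
  rw [this]
  simp_rw [two_W]
  rw [Ex_sq_sum p (((univ : Finset (ZMod n)) ×ˢ (univ : Finset (ZMod n)).erase 0) ×ˢ Sk k) (fun t => p ^ (k - t.2.card)) (fun t => t.2.image (Pz t.1.1 t.1.2))]
  rw [sum_product, sum_product]
  have hin : ∀ a : ZMod n, ∀ e ∈ (univ : Finset (ZMod n)).erase 0, ∀ S ∈ Sk k,
      (∑ j ∈ ((univ : Finset (ZMod n)) ×ˢ (univ : Finset (ZMod n)).erase 0) ×ˢ Sk k, p ^ (k - S.card) * p ^ (k - j.2.card) *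
        (if S.image (Pz a e) = j.2.image (Pz j.1.1 j.1.2) then (υ p) ^ (S.image (Pz a e)).card else 0)) =
      ∑ S' ∈ Sk k, wS p k S S' * Nz e S S' := by
    intro a e he S hS
    rw [mem_erase] at he
    rw [sum_product, sum_comm]
    refine sum_congr rfl fun S' hS' => ?_
    have hSc : (S.image (Pz a e)).card = S.card := card_image_of_injOn (Pz_inj hg he.1 (mem_Sk.mp hS).1)
    rw [hSc]
    unfold wS
    split_ifs with hc
    · rw [← m_eq hg (a := a) he.1 hS hS' hc, card_filter, Nat.cast_sum, mul_sum]
      refine sum_congr rfl fun t _ => ?_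
      split_ifs <;> simp
    · rw [zero_mul]
      refine sum_eq_zero fun t ht => ?_
      rw [if_neg, mul_zero]
      intro h
      apply hc
      rw [mem_product, mem_erase] at ht
      rw [← hSc, h, card_image_of_injOn (Pz_inj hg ht.2.1 (mem_Sk.mp hS').1)]
  rw [sum_congr rfl fun a _ => sum_congr rfl fun e he => sum_congr rfl fun S hS => hin a e he S hS]
  rw [sum_const, card_univ, ZMod.card, nsmul_eq_mul]
def CV (k : ℕ) : ℝ := 5 * k ^ 6 * 4 ^ k
include h0 h1 hk hg in
theorem var_W :
    |Ex p (fun x => (zb (n := n) p h0 h1 hk hg).W p x ^ 2) - kap p k * n ^ 2| ≤ CV k * n := by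
  classical
  have hE := Ex_W_sq (n := n) h0 h1 hk hg
  set E := Ex p (fun x => (zb (n := n) p h0 h1 hk hg).W p x ^ 2)
  set T : ZMod n → ℝ := fun e => ∑ S ∈ Sk k, ∑ S' ∈ Sk k, wS p k S S' * Nz e S S' with hT
  set T0 : ℝ := ∑ S ∈ Sk k, ∑ S' ∈ Sk k, wS p k S S' * NN S S' with hT0
  have hSk : ((Sk k).card : ℝ) ≤ 2 ^ k := by
    have : (Sk k).card ≤ 2 ^ k := (card_filter_le _ _).trans (by simp)
    exact_mod_cast this
  have bd : ∀ f : Finset ℕ → Finset ℕ → ℕ, (∀ S ∈ Sk k, ∀ S', f S S' ≤ k ^ 2) → 0 ≤ ∑ S ∈ Sk k, ∑ S' ∈ Sk k, wS p k S S' * f S S' ∧ ∑ S ∈ Sk k, ∑ S' ∈ Sk k, wS p k S S' * f S S' ≤ k ^ 2 * 4 ^ k := by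
    intro f hf
    constructor
    · exact sum_nonneg fun S _ => sum_nonneg fun S' _ => mul_nonneg (wS_bd h0 h1 _ _).1 (by positivity)
    · calc _ ≤ ∑ S ∈ Sk k, ∑ S' ∈ Sk k, (k : ℝ) ^ 2 := by
            refine sum_le_sum fun S hS => sum_le_sum fun S' _ => ?_
            have : (f S S' : ℝ) ≤ k ^ 2 := by exact_mod_cast hf S hS S'
            have h3 := wS_bd (k := k) h0 h1 S S'
            nlinarith [(Nat.cast_nonneg (f S S') : (0:ℝ) ≤ _)]
        _ = ((Sk k).card : ℝ) * (Sk k).card * k ^ 2 := by simp; ring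
        _ ≤ 2 ^ k * 2 ^ k * k ^ 2 := by gcongr
        _ = k ^ 2 * 4 ^ k := by rw [← mul_pow]; norm_num; ring
  have b0 := bd (fun S S' => NN S S') (fun S hS S' => NN_le hS)
  have bz : ∀ e : ZMod n, 0 ≤ T e ∧ T e ≤ k ^ 2 * 4 ^ k := fun e => bd (fun S S' => Nz e S S') (fun S hS S' => Nz_le e hS)
  rw [← hT0] at b0
  have hkap : kap p k = T0 / 4 := rfl
  have hn1 : (1:ℝ) ≤ n := by exact_mod_cast NeZero.one_le
  have hk1 : (1:ℝ) ≤ k := by exact_mod_cast (by omega : 1 ≤ k)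
  have hsum : |∑ e ∈ (univ : Finset (ZMod n)).erase 0, T e - (n - 1) * T0| ≤ 9 * k ^ 6 * 4 ^ k := by
    have : ((n:ℝ) - 1) * T0 = ∑ e ∈ (univ : Finset (ZMod n)).erase 0, T0 := by
      rw [sum_const, card_erase_of_mem (mem_univ _), card_univ, ZMod.card, nsmul_eq_mul, Nat.cast_sub NeZero.one_le]; simp
    rw [this, ← sum_sub_distrib]
    refine (abs_sum_le_sum_abs _ _).trans ?_
    calc _ ≤ ∑ e ∈ (univ : Finset (ZMod n)).erase 0, (if e ∈ Bad k n then (k:ℝ) ^ 2 * 4 ^ k else 0) := by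
          refine sum_le_sum fun e _ => ?_
          split_ifs with hb
          · have := bz e
            rw [abs_le]; constructor <;> linarith
          · have : T e = T0 := sum_congr rfl fun S hS => sum_congr rfl fun S' hS' => by rw [Nz_eq hb hS hS']
            rw [this]; simp
      _ ≤ ∑ e : ZMod n, (if e ∈ Bad k n then (k:ℝ) ^ 2 * 4 ^ k else 0) := by
          refine sum_le_sum_of_subset_of_nonneg (erase_subset _ _) fun e _ _ => ?_
          split_ifs <;> positivity
      _ = (Bad k n).card * (k ^ 2 * 4 ^ k) := by simp
      _ ≤ (9 * k ^ 4) * (k ^ 2 * 4 ^ k) := by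
          have : ((Bad k n).card : ℝ) ≤ 9 * k ^ 4 := by exact_mod_cast Bad_card (k := k) (n := n)
          gcongr
      _ = _ := by ring
  have hfin : 4 * (E - kap p k * n ^ 2) = n * ((∑ e ∈ (univ : Finset (ZMod n)).erase 0, T e - (n - 1) * T0) - T0) := by
    rw [hkap]; linear_combination hE
  have h6 : (k:ℝ) ^ 2 * 4 ^ k ≤ k ^ 6 * 4 ^ k := by
    gcongr
    norm_num
  have : |4 * (E - kap p k * n ^ 2)| ≤ (n:ℝ) * (10 * k ^ 6 * 4 ^ k) := by
    rw [hfin, abs_mul, abs_of_nonneg (by positivity : (0:ℝ) ≤ n)]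
    gcongr
    rw [abs_le] at *; constructor <;> linarith
  rw [abs_mul, abs_of_pos (by norm_num : (0:ℝ) < 4)] at this
  unfold CV
  grind
end Var
noncomputable section Mom
theorem bridge_int {ι : Type*} [Fintype ι] [DecidableEq ι] {p : ℝ} (h0 : 0 < p) (h1 : p < 1) (F : (ι → Bool) → ℝ) :
    ∫ x, F x ∂(bernoulliPi ι p) = Ex p F := by
  unfold bernoulliPi
  rw [integral_finsetSum_measure]
  · unfold Ex
    refine sum_congr rfl fun x _ => ?_
    rw [integral_smul_measure, integral_dirac, ENNReal.toReal_prod]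
    congr 1
    unfold wt bw
    refine prod_congr rfl fun i _ => ENNReal.toReal_ofReal ?_
    split_ifs <;> linarith
  · intro x _
    refine Integrable.smul_measure (Integrable.of_finite) ?_
    exact ENNReal.prod_ne_top fun i _ => ENNReal.ofReal_ne_top
theorem bridge_set {ι : Type*} [Fintype ι] [DecidableEq ι] {p : ℝ} (h0 : 0 < p) (h1 : p < 1) (P : (ι → Bool) → Prop) [DecidablePred P] :
    ((bernoulliPi ι p) {x | P x}).toReal = Ex p (fun x => if P x then (1 : ℝ) else 0) := by
  rw [← bridge_int h0 h1]
  have : (fun x : ι → Bool => if P x then (1:ℝ) else 0) = Set.indicator {x | P x} 1 := by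
    funext x; simp [Set.indicator]
  rw [this, integral_indicator_one (Set.toFinite _).measurableSet]; rfl
theorem Ex_cross {ι : Type*} [Fintype ι] [DecidableEq ι] {κ κ' : Type*} (p : ℝ) (J : Finset κ) (J' : Finset κ') (c : κ → ℝ) (c' : κ' → ℝ) (E : κ → Finset ι) (E' : κ' → Finset ι)
    (h : ∀ j ∈ J, ∀ j' ∈ J', (E j).card ≠ (E' j').card) :
    Ex p (fun x => (∑ j ∈ J, c j * xiS p (E j) x) * ∑ j' ∈ J', c' j' * xiS p (E' j') x) = 0 := by
  simp_rw [sum_mul_sum, Ex_sum]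
  refine sum_eq_zero fun j hj => sum_eq_zero fun j' hj' => ?_
  have : (fun x => c j * xiS p (E j) x * (c' j' * xiS p (E' j') x)) = fun x => (c j * c' j') * (xiS p (E j) x * xiS p (E' j') x) := by funext x; ring
  rw [this, Ex_mul_left, Ex_xiS, if_neg, mul_zero]
  grind
theorem Ns_eq {ι : Type*} [Fintype ι] [DecidableEq ι] (p : ℝ) (x : ι → Bool) : Blk.Ns p x = ∑ u : ι, 1 * xiS p {u} x := by
  unfold Blk.Ns xiS; simp
theorem quad_eq {ι : Type*} [Fintype ι] [DecidableEq ι] (p : ℝ) (x : ι → Bool) :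
    Blk.Ns p x ^ 2 - (1 - 2 * p) * Blk.Ns p x - Fintype.card ι * υ p = ∑ q ∈ (univ : Finset ι).offDiag, 1 * xiS p {q.1, q.2} x := by
  have h1 : Blk.Ns p x ^ 2 = ∑ q ∈ (univ : Finset ι).diag, xi p q.1 x * xi p q.2 x + ∑ q ∈ (univ : Finset ι).offDiag, xi p q.1 x * xi p q.2 x := by
    rw [← sum_union (disjoint_diag_offDiag _), diag_union_offDiag, sq, sum_product]
    unfold Blk.Ns; rw [sum_mul_sum]
  rw [h1]
  have h2 : ∑ q ∈ (univ : Finset ι).diag, xi p q.1 x * xi p q.2 x = (1 - 2 * p) * Blk.Ns p x + Fintype.card ι * υ p := by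
    rw [sum_diag]
    simp only [xi_sq, sum_add_distrib, ← mul_sum]
    simp [Blk.Ns]; ring
  rw [h2]
  have h3 : ∀ q ∈ (univ : Finset ι).offDiag, xi p q.1 x * xi p q.2 x = 1 * xiS p {q.1, q.2} x := by
    intro q hq
    rw [mem_offDiag] at hq
    unfold xiS; grind
  rw [sum_congr rfl h3]; ring
variable {k n : ℕ} [NeZero n] {p : ℝ}
variable (h0 : 0 < p) (h1 : p < 1) (hk : 3 ≤ k) (hg : n.gcd (k - 1).factorial = 1)
theorem Ex_Ns (p : ℝ) : Ex p (fun x : ZMod n → Bool => Blk.Ns p x) = 0 := by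
  have := Ex_cross (ι := ZMod n) p (univ) {()} (fun _ => 1) (fun _ => 1) (fun u => {u}) (fun _ => ∅) (by simp)
  simp_rw [← Ns_eq] at this
  simpa [xiS] using this
theorem Ex_Ns_sq (p : ℝ) : Ex p (fun x : ZMod n → Bool => Blk.Ns p x ^ 2) = n * υ p := by
  simp_rw [Ns_eq]
  rw [Ex_sq_sum]
  simp [ZMod.card]
theorem Ex_quad (p : ℝ) : Ex p (fun x : ZMod n → Bool => Blk.Ns p x ^ 2 - (1 - 2 * p) * Blk.Ns p x - n * υ p) = 0 := by
  rw [Ex_sub, Ex_sub, Ex_mul_left, Ex_Ns, Ex_Ns_sq, Ex_const]; ring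
include h0 h1 hk hg in
theorem Ex_W0 : Ex p (fun x => (zb (n := n) p h0 h1 hk hg).W p x) = 0 := by
  have := Ex_cross (ι := ZMod n) p (zb (n := n) p h0 h1 hk hg).I {()} (zb (n := n) p h0 h1 hk hg).c (fun _ => 1) (zb (n := n) p h0 h1 hk hg).B (fun _ => ∅)
    (by intro j hj _ _; have := (zb (n := n) p h0 h1 hk hg).card3 j hj; simp only [card_empty]; omega)
  simpa [xiS, Blk.W] using this
def mu (k n : ℕ) (p : ℝ) : ℝ := p ^ k * (n * (n - 1) / 2)
def AA (k n : ℕ) (p : ℝ) : ℝ := (n - 1) * k * p ^ (k - 1) / 2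
def BB (k : ℕ) (p : ℝ) : ℝ := k * (k - 1) * p ^ (k - 2) / 4
theorem ff_eq (h : ℝ) : ff k n p h = mu k n p + AA k n p * h + BB k p * (h ^ 2 - (1 - 2 * p) * h - n * υ p) := rfl
include h0 h1 hk hg in
theorem Ex_count : Ex p (fun x : ZMod n → Bool => (kAPcount k x : ℝ)) = mu k n p := by
  simp_rw [count_decomp h0 h1 hk hg, ff_eq]
  rw [Ex_add, Ex_W0, Ex_add, Ex_add, Ex_const, Ex_mul_left, Ex_mul_left, Ex_quad, Ex_Ns]; ring
def CR (p : ℝ) (k : ℕ) : ℝ := 2 * BB k p ^ 2 + kap p k + CV k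
theorem CV_pos (hk : 3 ≤ k) : 0 < CV k := by
  unfold CV; positivity
include h0 h1 hk in
theorem CR_pos : 0 < CR p k := by
  have := kap_pos h0 h1 hk; have := CV_pos hk; unfold CR; positivity
include h0 h1 hk hg in
theorem W_sq_le : Ex p (fun x => (zb (n := n) p h0 h1 hk hg).W p x ^ 2) ≤ (kap p k + CV k) * n ^ 2 := by
  have h := (abs_le.mp (var_W (n := n) h0 h1 hk hg)).2
  have hn1 : (1:ℝ) ≤ n := by exact_mod_cast NeZero.one_le
  have := CV_pos hk
  nlinarith [mul_le_mul_of_nonneg_left hn1 (mul_nonneg this.le (by linarith : (0:ℝ) ≤ n))]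
include h0 h1 hk hg in
theorem var_count :
    ∃ R : ℝ, 0 ≤ R ∧ R ≤ CR p k * n ^ 2 ∧ Ex p (fun x : ZMod n → Bool => ((kAPcount k x : ℝ) - mu k n p) ^ 2) = AA k n p ^ 2 * (n * υ p) + R := by
  set b := zb (n := n) p h0 h1 hk hg with hb
  set qd : (ZMod n → Bool) → ℝ := fun x => Blk.Ns p x ^ 2 - (1 - 2 * p) * Blk.Ns p x - n * υ p with hqd
  have hqe : ∀ x, qd x = ∑ q ∈ (univ : Finset (ZMod n)).offDiag, 1 * xiS p {q.1, q.2} x := by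
    intro x; rw [← quad_eq, ZMod.card]
  have c1 : Ex p (fun x => Blk.Ns p x * qd x) = 0 := by
    simp_rw [hqe, Ns_eq]
    refine Ex_cross p _ _ _ _ _ _ ?_
    intro j _ j' hj'
    rw [mem_offDiag] at hj'
    rw [card_pair hj'.2.2, card_singleton]; norm_num
  have c2 : Ex p (fun x => Blk.Ns p x * b.W p x) = 0 := by
    simp_rw [Ns_eq]; unfold Blk.W
    refine Ex_cross p _ _ _ _ _ _ ?_
    intro j _ j' hj'
    have := b.card3 j' hj'
    rw [card_singleton]; omega
  have c3 : Ex p (fun x => qd x * b.W p x) = 0 := by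
    simp_rw [hqe]; unfold Blk.W
    refine Ex_cross p _ _ _ _ _ _ ?_
    intro j hj j' hj'
    have := b.card3 j' hj'
    rw [mem_offDiag] at hj
    rw [card_pair hj.2.2]; omega
  refine ⟨BB k p ^ 2 * Ex p (fun x => qd x ^ 2) + Ex p (fun x => b.W p x ^ 2), ?_, ?_, ?_⟩
  · exact add_nonneg (mul_nonneg (sq_nonneg _) (Ex_nonneg h0.le h1.le fun x => sq_nonneg _)) (Ex_nonneg h0.le h1.le fun x => sq_nonneg _)
  · have e1 : Ex p (fun x => qd x ^ 2) ≤ 2 * n ^ 2 := by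
      simp_rw [hqe]
      refine (orth h0 h1 _ (fun _ => 1) (fun q : ZMod n × ZMod n => ({q.1, q.2} : Finset (ZMod n))) 2 (by simp) ?_).trans ?_
      · intro q hq
        refine (card_le_card (t := {(q.1, q.2), (q.2, q.1)}) ?_).trans card_le_two
        intro q' hq'
        rw [mem_filter, mem_offDiag] at hq'
        obtain ⟨⟨-, -, h3⟩, h4⟩ := hq'
        have a1 : q'.1 ∈ ({q.1, q.2} : Finset (ZMod n)) := by rw [h4]; simp
        have a2 : q'.2 ∈ ({q.1, q.2} : Finset (ZMod n)) := by rw [h4]; simp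
        grind
      · have : ((univ : Finset (ZMod n)).offDiag.card : ℝ) ≤ n ^ 2 := by
          have : (univ : Finset (ZMod n)).offDiag.card ≤ n ^ 2 := by
            rw [offDiag_card, card_univ, ZMod.card, sq]; omega
          exact_mod_cast this
        push_cast; linarith
    have e2 := W_sq_le (n := n) h0 h1 hk hg
    have e3 := mul_le_mul_of_nonneg_left e1 (sq_nonneg (BB k p))
    unfold CR; linarith
  · have : (fun x : ZMod n → Bool => ((kAPcount k x : ℝ) - mu k n p) ^ 2) = fun x =>
        ((AA k n p ^ 2 * Blk.Ns p x ^ 2 + BB k p ^ 2 * qd x ^ 2) + b.W p x ^ 2) + ((2 * AA k n p * BB k p) * (Blk.Ns p x * qd x) + (2 * AA k n p) * (Blk.Ns p x * b.W p x) + (2 * BB k p) * (qd x * b.W p x)) := by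
      funext x; rw [count_decomp h0 h1 hk hg, ff_eq]; simp only [hqd]; ring
    rw [this, Ex_add, Ex_add, Ex_add, Ex_add, Ex_add, Ex_mul_left, Ex_mul_left, Ex_mul_left, Ex_mul_left, Ex_mul_left, c1, c2, c3, Ex_Ns_sq]
    ring
theorem Deg_Ns (p : ℝ) : Deg 1 (fun x : ZMod n → Bool => Blk.Ns p x) := by
  unfold Blk.Ns
  exact Deg.sum fun u _ => Deg.of_dep (Dep_xi p u) (by simp)
include h0 h1 hk hg in
theorem Deg_W : Deg k (fun x => (zb (n := n) p h0 h1 hk hg).W p x) := by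
  unfold Blk.W
  exact Deg.sum fun t ht => Deg.smul _ (Deg.of_dep (Dep_xiS p _) ((zb (n := n) p h0 h1 hk hg).cardk t ht))
include h0 h1 hk hg in
theorem Deg_count : Deg k (fun x : ZMod n → Bool => (kAPcount k x : ℝ) - mu k n p) := by
  have d1 := (Deg_Ns (n := n) p)
  have d2 := d1.sq
  have : (fun x : ZMod n → Bool => (kAPcount k x : ℝ) - mu k n p) = fun x =>
      ((AA k n p * Blk.Ns p x + BB k p * ((Blk.Ns p x ^ 2 - (1 - 2 * p) * Blk.Ns p x) - n * υ p)) + (zb (n := n) p h0 h1 hk hg).W p x) := by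
    funext x; rw [count_decomp h0 h1 hk hg, ff_eq]; ring
  rw [this]
  exact (((d1.mono (by omega)).smul _).add ((((d2.mono (by omega)).sub ((d1.mono (by omega)).smul _)).sub (Deg.const _)).smul _)).add (Deg_W h0 h1 hk hg)
include h0 h1 hk hg in
theorem sig_prime :
    kAPprimeSigma k p n = √(Ex p (fun x => (zb (n := n) p h0 h1 hk hg).W p x ^ 2)) := by
  unfold kAPprimeSigma
  rw [dif_neg (NeZero.ne n)]
  simp only [bridge_int h0 h1]
  have e : (kAPprime k p : (ZMod n → Bool) → ℝ) = fun x => (zb (n := n) p h0 h1 hk hg).W p x := funext fun x => prime_eq h0 h1 hk hg x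
  rw [e, Ex_W0]; simp
include h0 h1 hk hg in
theorem sig_count :
    kAPSigma k p n = √(Ex p (fun x : ZMod n → Bool => ((kAPcount k x : ℝ) - mu k n p) ^ 2)) := by
  unfold kAPSigma
  rw [dif_neg (NeZero.ne n)]
  simp only [bridge_int h0 h1]
  rw [Ex_count h0 h1 hk hg]
end Mom
noncomputable section Fou
theorem pow_diff {a b : ℂ} (ha : ‖a‖ ≤ 1) (hb : ‖b‖ ≤ 1) (n : ℕ) : ‖a ^ n - b ^ n‖ ≤ n * ‖a - b‖ := by
  induction n with
  | zero => simp
  | succ m ih =>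
    have e : a ^ (m + 1) - b ^ (m + 1) = a ^ m * (a - b) + (a ^ m - b ^ m) * b := by ring
    rw [e]
    refine (norm_add_le _ _).trans ?_
    rw [norm_mul, norm_mul, norm_pow]
    have h1 : ‖a‖ ^ m ≤ 1 := pow_le_one₀ (norm_nonneg _) ha
    have h2 : ‖a ^ m - b ^ m‖ * ‖b‖ ≤ m * ‖a - b‖ := by
      nlinarith [norm_nonneg (a ^ m - b ^ m), norm_nonneg b]
    push_cast
    nlinarith [norm_nonneg (a - b)]
theorem om_base {p : ℝ} (h0 : 0 < p) (h1 : p < 1) {θ : ℝ} (hθ : |θ| ≤ 1) :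
    ‖om p θ - (exp (-(υ p * θ ^ 2 / 2)) : ℂ)‖ ≤ 9 * |θ| ^ 3 := by
  have hs := s2_bd h0 h1
  have t1 := taylor_I ((1 - p) * θ) 3
  have t2 := taylor_I (-p * θ) 3
  simp only [sum_range_succ, sum_range_zero, Nat.factorial] at t1 t2
  have hθ2 : |θ| ^ 2 = θ ^ 2 := sq_abs θ
  have hu : |-(υ p * θ ^ 2 / 2)| ≤ 1 := by
    rw [abs_neg, abs_of_nonneg (by positivity)]
    nlinarith [sq_nonneg θ, hs.1, hs.2, abs_nonneg θ]
  have t3 := Real.abs_exp_sub_one_sub_id_le hu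
  have e : om p θ - (exp (-(υ p * θ ^ 2 / 2)) : ℂ) =
      p * (cexp (((1 - p) * θ : ℝ) * ⅈ) - (0 + (((1 - p) * θ : ℝ) * ⅈ) ^ 0 / ((1:ℕ):ℂ) + (((1 - p) * θ : ℝ) * ⅈ) ^ 1 / (((0 + 1) * 1 : ℕ):ℂ) + (((1 - p) * θ : ℝ) * ⅈ) ^ 2 / (((1 + 1) * ((0 + 1) * 1) : ℕ):ℂ)))
      + (1 - p) * (cexp ((-p * θ : ℝ) * ⅈ) - (0 + ((-p * θ : ℝ) * ⅈ) ^ 0 / ((1:ℕ):ℂ) + ((-p * θ : ℝ) * ⅈ) ^ 1 / (((0 + 1) * 1 : ℕ):ℂ) + ((-p * θ : ℝ) * ⅈ) ^ 2 / (((1 + 1) * ((0 + 1) * 1) : ℕ):ℂ)))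
      - ((exp (-(υ p * θ ^ 2 / 2)) - 1 - (-(υ p * θ ^ 2 / 2)) : ℝ) : ℂ) := by
    unfold om; rw [real_smul, real_smul]; push_cast; ring_nf; rw [Complex.I_sq]; ring
  rw [e]
  refine (norm_sub_le _ _).trans ?_
  have n1 : ‖(p:ℂ)‖ = p := by rw [norm_real, norm_of_nonneg h0.le]
  have n2 : ‖(1 - p:ℂ)‖ = 1 - p := by
    have : (1 - p : ℂ) = ((1 - p : ℝ) : ℂ) := by push_cast; ring
    rw [this, norm_real, norm_of_nonneg (by linarith)]
  rw [norm_real, norm_eq_abs]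
  have A : ‖(p:ℂ) * (cexp (((1 - p) * θ : ℝ) * ⅈ) - (0 + (((1 - p) * θ : ℝ) * ⅈ) ^ 0 / ((1:ℕ):ℂ) + (((1 - p) * θ : ℝ) * ⅈ) ^ 1 / (((0 + 1) * 1 : ℕ):ℂ) + (((1 - p) * θ : ℝ) * ⅈ) ^ 2 / (((1 + 1) * ((0 + 1) * 1) : ℕ):ℂ)))
      + (1 - p) * (cexp ((-p * θ : ℝ) * ⅈ) - (0 + ((-p * θ : ℝ) * ⅈ) ^ 0 / ((1:ℕ):ℂ) + ((-p * θ : ℝ) * ⅈ) ^ 1 / (((0 + 1) * 1 : ℕ):ℂ) + ((-p * θ : ℝ) * ⅈ) ^ 2 / (((1 + 1) * ((0 + 1) * 1) : ℕ):ℂ)))‖ ≤ p * (4 * |(1 - p) * θ| ^ 3) + (1 - p) * (4 * |-p * θ| ^ 3) := by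
    refine (norm_add_le _ _).trans ?_
    rw [norm_mul, norm_mul, n1, n2]
    exact add_le_add (mul_le_mul_of_nonneg_left t1 h0.le) (mul_le_mul_of_nonneg_left t2 (by linarith))
  have b1 : |(1 - p) * θ| ^ 3 ≤ |θ| ^ 3 := by
    refine pow_le_pow_left₀ (abs_nonneg _) ?_ 3; rw [abs_mul, abs_of_pos (by linarith)]; nlinarith [abs_nonneg θ]
  have b2 : |-p * θ| ^ 3 ≤ |θ| ^ 3 := by
    refine pow_le_pow_left₀ (abs_nonneg _) ?_ 3; rw [abs_mul, abs_neg, abs_of_pos h0]; nlinarith [abs_nonneg θ]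
  have b3 : (-(υ p * θ ^ 2 / 2)) ^ 2 ≤ |θ| ^ 3 := by
    have e4 : (-(υ p * θ ^ 2 / 2)) ^ 2 = (υ p / 2) ^ 2 * (|θ| * |θ| ^ 3) := by rw [← hθ2]; ring
    rw [e4]
    have c1 : (υ p / 2) ^ 2 ≤ 1 := by nlinarith [hs.1, hs.2]
    have c2 : |θ| * |θ| ^ 3 ≤ |θ| ^ 3 := by nlinarith [pow_nonneg (abs_nonneg θ) 3]
    calc _ ≤ 1 * (|θ| * |θ| ^ 3) := mul_le_mul_of_nonneg_right c1 (by positivity)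
      _ ≤ _ := by linarith
  have d1 := mul_le_mul_of_nonneg_left b1 h0.le
  have d2 := mul_le_mul_of_nonneg_left b2 (by linarith : 0 ≤ 1 - p)
  nlinarith [A, t3]
variable {ι τ : Type} [Fintype ι] [DecidableEq ι] [DecidableEq τ] {k K : ℕ} {cl : ℝ}
theorem phi_base (b : Blk ι τ k K cl) (p θ : ℝ) : b.phi p θ 0 = om p θ ^ Fintype.card ι := by
  have := Ex_prod (ι := ι) p (fun _ c => cexp (((θ * ((if c then 1 else 0) - p) : ℝ) : ℂ) * ⅈ))
  unfold Blk.phi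
  have e : b.Hf p θ 0 = fun x => ∏ i, cexp (((θ * ((if x i then 1 else 0) - p) : ℝ) : ℂ) * ⅈ) := by
    funext x
    rw [← Complex.exp_sum, ← sum_mul]
    unfold Blk.Hf Blk.Ns xi
    congr 2
    rw [mul_sum, zero_mul, add_zero]; push_cast; rfl
  rw [e, this, prod_const, card_univ]
  congr 1
  unfold om
  congr 4 <;> simp <;> ring
def GG (p V : ℝ) (n : ℕ) (θ t : ℝ) : ℂ := ((exp (-(n * υ p * θ ^ 2 / 2)) * exp (-(V * t ^ 2 / 2)) : ℝ) : ℂ)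
theorem phi_main {p : ℝ} (h0 : 0 < p) (h1 : p < 1) (b : Blk ι τ k K cl) {rho : ℝ} (hr : 1 ≤ rho) (hn : (Fintype.card ι : ℝ) = rho ^ 200)
    {θ t : ℝ} (hθ : |θ| * rho ^ 98 ≤ 1) (ht : |t| * rho ^ 198 ≤ 1) :
    ‖b.phi p θ t - GG p (Ex p (fun x => b.W p x ^ 2)) (Fintype.card ι) θ t‖ ≤ (9 + 4 * Blk.CS p k K) / rho ^ 94 := by
  have hs := s2_bd h0 h1
  set V := Ex p (fun x => b.W p x ^ 2) with hV
  have hV0 : 0 ≤ V := Ex_nonneg h0.le h1.le fun x => sq_nonneg _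
  have hr0 : 0 < rho := by linarith
  have hst := b.stein_int h0 h1 θ t (s := rho ^ 100) (by positivity) (by rw [hn]; ring)
  rw [phi_base] at hst
  have hCS : 0 ≤ Blk.CS p k K := by
    unfold Blk.CS; have := hs.1; have := Blk.CQ_nonneg (k := k) (K := K); positivity
  set q := rho⁻¹ with hq
  have hq0 : 0 < q := by positivity
  have hq1 : q ≤ 1 := inv_le_one_of_one_le₀ hr
  have hqr : q * rho = 1 := inv_mul_cancel₀ hr0.ne'
  have hθ' : |θ| ≤ q ^ 98 := by
    rw [hq, inv_pow, ← one_div, le_div_iff₀ (by positivity)]; exact hθ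
  have ht' : |t| ≤ q ^ 198 := by
    rw [hq, inv_pow, ← one_div, le_div_iff₀ (by positivity)]; exact ht
  have m1 : q ^ 96 ≤ q ^ 94 := pow_le_pow_of_le_one hq0.le hq1 (by norm_num)
  have k1 : |t| * (|θ| * (rho ^ 100) ^ 2) ≤ q ^ 94 := by
    calc _ ≤ q ^ 198 * (q ^ 98 * (rho ^ 100) ^ 2) := by gcongr
      _ = q ^ 96 * (q * rho) ^ 200 := by ring
      _ ≤ _ := by rw [hqr]; simpa using m1
  have k2 : |t| * (|θ| ^ 2 * (rho ^ 100) ^ 3) ≤ q ^ 94 := by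
    calc _ ≤ q ^ 198 * ((q ^ 98) ^ 2 * (rho ^ 100) ^ 3) := by gcongr
      _ = q ^ 94 * (q * rho) ^ 300 := by ring
      _ ≤ _ := by rw [hqr]; simp
  have k3 : |t| * (|t| * (rho ^ 100) ^ 3) ≤ q ^ 94 := by
    calc _ ≤ q ^ 198 * (q ^ 198 * (rho ^ 100) ^ 3) := by gcongr
      _ = q ^ 96 * (q * rho) ^ 300 := by ring
      _ ≤ _ := by rw [hqr]; simpa using m1
  have k4 : |t| * (|t| ^ 2 * (rho ^ 100) ^ 5) ≤ q ^ 94 := by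
    calc _ ≤ q ^ 198 * ((q ^ 198) ^ 2 * (rho ^ 100) ^ 5) := by gcongr
      _ = q ^ 94 * (q * rho) ^ 500 := by ring
      _ ≤ _ := by rw [hqr]; simp
  rw [sq_abs] at k2 k4
  have S1 : |t| * (Blk.CS p k K * (|θ| * (rho ^ 100) ^ 2 + θ ^ 2 * (rho ^ 100) ^ 3 + |t| * (rho ^ 100) ^ 3 + t ^ 2 * (rho ^ 100) ^ 5)) ≤ Blk.CS p k K * (4 * q ^ 94) := by
    calc _ = Blk.CS p k K * (|t| * (|θ| * (rho ^ 100) ^ 2) + |t| * (θ ^ 2 * (rho ^ 100) ^ 3) + |t| * (|t| * (rho ^ 100) ^ 3) + |t| * (t ^ 2 * (rho ^ 100) ^ 5)) := by ring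
      _ ≤ _ := by gcongr; linarith
  have hθ1 : |θ| ≤ 1 := hθ'.trans (pow_le_one₀ hq0.le hq1)
  have ho : ‖om p θ‖ ≤ 1 := (om_norm h0 h1 θ).trans (by rw [exp_le_one_iff]; nlinarith [hs.1, cos_le_one θ])
  have hb1 : ‖((exp (-(υ p * θ ^ 2 / 2)) : ℝ) : ℂ)‖ ≤ 1 := by
    rw [norm_real, norm_of_nonneg (exp_pos _).le, exp_le_one_iff]; nlinarith [hs.1, sq_nonneg θ]
  have hpd := pow_diff ho hb1 (Fintype.card ι)
  have S2 : (Fintype.card ι : ℝ) * ‖om p θ - (exp (-(υ p * θ ^ 2 / 2)) : ℂ)‖ ≤ 9 * q ^ 94 := by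
    rw [hn]
    calc _ ≤ rho ^ 200 * (9 * |θ| ^ 3) := by gcongr; exact om_base h0 h1 hθ1
      _ ≤ rho ^ 200 * (9 * (q ^ 98) ^ 3) := by gcongr
      _ = 9 * q ^ 94 * (q * rho) ^ 200 := by ring
      _ = _ := by rw [hqr]; simp
  have e : (GG p V (Fintype.card ι) θ t) = ((exp (-(υ p * θ ^ 2 / 2)) : ℝ) : ℂ) ^ (Fintype.card ι) * (exp (-(V * t ^ 2 / 2)) : ℂ) := by
    unfold GG; rw [← Complex.ofReal_pow, ← Real.exp_nat_mul, ← Complex.ofReal_mul]; congr 4; ring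
  rw [e]
  have hg1 : ‖((exp (-(V * t ^ 2 / 2)) : ℝ) : ℂ)‖ ≤ 1 := by
    rw [norm_real, norm_of_nonneg (exp_pos _).le, exp_le_one_iff]; nlinarith [mul_nonneg hV0 (sq_nonneg t)]
  have tri := norm_sub_le_norm_sub_add_norm_sub (b.phi p θ t) (om p θ ^ Fintype.card ι * ((exp (-(V * t ^ 2 / 2)) : ℝ) : ℂ)) (((exp (-(υ p * θ ^ 2 / 2)) : ℝ) : ℂ) ^ (Fintype.card ι) * (exp (-(V * t ^ 2 / 2)) : ℂ))
  rw [← sub_mul, norm_mul] at tri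
  have S3 : ‖om p θ ^ Fintype.card ι - ((exp (-(υ p * θ ^ 2 / 2)) : ℝ) : ℂ) ^ (Fintype.card ι)‖ * ‖((exp (-(V * t ^ 2 / 2)) : ℝ) : ℂ)‖ ≤ 9 * q ^ 94 :=
    (mul_le_of_le_one_right (norm_nonneg _) hg1).trans (hpd.trans S2)
  have : (9 + 4 * Blk.CS p k K) / rho ^ 94 = (9 + 4 * Blk.CS p k K) * q ^ 94 := by rw [hq, inv_pow, div_eq_mul_inv]
  rw [this]
  linarith
end Fou
noncomputable section Inv
def ee (y t : ℝ) : ℂ := cexp (((t * y : ℝ) : ℂ) * ⅈ)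
theorem ee_norm (y t : ℝ) : ‖ee y t‖ = 1 := norm_exp_ofReal_mul_I _
theorem ee_cont (y : ℝ) : Continuous (ee y) := by unfold ee; fun_prop
abbrev Tq : Set ℝ := Set.Icc (-π) π
theorem int_ee (j : ℤ) : ∫ θ in Tq, ee j θ = if j = 0 then ((2 * π : ℝ) : ℂ) else 0 := by
  rw [integral_Icc_eq_integral_Ioc, ← intervalIntegral.integral_of_le (by linarith [Real.pi_pos])]
  unfold ee
  split_ifs with h
  · subst h; simp; ring
  · have hc : (j : ℂ) * ⅈ ≠ 0 := mul_ne_zero (by exact_mod_cast h) Complex.I_ne_zero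
    have := integral_exp_mul_complex (a := -π) (b := π) hc
    have e : ∀ x : ℝ, cexp (((x * (j:ℝ) : ℝ) : ℂ) * ⅈ) = cexp ((j : ℂ) * ⅈ * x) := by
      intro x; congr 1; push_cast; ring
    simp_rw [e, this]
    have e2 : cexp ((j : ℂ) * ⅈ * (π : ℝ)) = cexp ((j : ℂ) * ⅈ * ((-π : ℝ) : ℂ)) := by
      rw [Complex.exp_eq_exp_iff_exists_int]; exact ⟨j, by push_cast; ring⟩
    rw [e2]; simp
theorem gauss_trunc {a : ℝ} (ha : 1 ≤ a) (y : ℝ) :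
    ‖(∫ t in Tq, ee y t * ((exp (-(a * t ^ 2 / 2)) : ℝ) : ℂ)) - ((2 * π * ((√a)⁻¹ * stdNormal (y / √a)) : ℝ) : ℂ)‖ ≤ 4 * exp (-a) := by
  have ha0 : 0 < a := by linarith
  have hpi := pi_gt_three
  have hpi4 := Real.pi_lt_four
  have hF := fourierIntegral_gaussian (b := ((a / 2 : ℝ) : ℂ)) (by rw [Complex.ofReal_re]; positivity) (y : ℂ)
  have e1 : ∀ x : ℝ, cexp (ⅈ * y * x) * cexp (-((a / 2 : ℝ) : ℂ) * x ^ 2) = ee y x * ((exp (-(a * x ^ 2 / 2)) : ℝ) : ℂ) := by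
    intro x; unfold ee; rw [Complex.ofReal_exp]; congr 2 <;> (push_cast; ring)
  have e2 : ((π : ℂ) / ((a / 2 : ℝ) : ℂ)) ^ (1 / 2 : ℂ) * cexp (-(y : ℂ) ^ 2 / (4 * ((a / 2 : ℝ) : ℂ))) = ((2 * π * ((√a)⁻¹ * stdNormal (y / √a)) : ℝ) : ℂ) := by
    have c1 : ((π : ℂ) / ((a / 2 : ℝ) : ℂ)) ^ (1 / 2 : ℂ) = ((√(π / (a / 2)) : ℝ) : ℂ) := by
      rw [Real.sqrt_eq_rpow, Complex.ofReal_cpow (by positivity)]; push_cast; rfl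
    have c2 : cexp (-(y : ℂ) ^ 2 / (4 * ((a / 2 : ℝ) : ℂ))) = ((exp (-((y / √a) ^ 2) / 2) : ℝ) : ℂ) := by
      rw [Complex.ofReal_exp, div_pow, sq_sqrt ha0.le]; congr 1; push_cast; field_simp; norm_num
    have c3 : √(π / (a / 2)) = 2 * π * ((√a)⁻¹ * (√(2 * π))⁻¹) := by
      rw [show π / (a / 2) = 2 * π / a by field_simp, Real.sqrt_div (by positivity)]
      have := Real.mul_self_sqrt (show (0:ℝ) ≤ 2 * π by positivity)
      have h3 : √(2 * π) ≠ 0 := by positivity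
      field_simp
      nlinarith
    rw [c1, c2, c3, ← Complex.ofReal_mul]; unfold stdNormal; congr 1; ring
  simp_rw [e1] at hF
  rw [e2] at hF
  rw [← hF]
  have hi0 := integrable_exp_neg_mul_sq (show (0:ℝ) < a / 4 by positivity)
  have hi : Integrable fun t : ℝ => ee y t * ((exp (-(a * t ^ 2 / 2)) : ℝ) : ℂ) := by
    refine Integrable.mono' (integrable_exp_neg_mul_sq (show (0:ℝ) < a / 2 by positivity)) ((ee_cont y).mul (by fun_prop)).aestronglyMeasurable (Eventually.of_forall fun t => ?_)
    rw [norm_mul, ee_norm, one_mul, norm_real, norm_of_nonneg (exp_pos _).le]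
    exact le_of_eq (by congr 1; ring)
  rw [← integral_add_compl (measurableSet_Icc : MeasurableSet Tq) hi, sub_add_cancel_left, norm_neg]
  have hb : ∀ t ∈ Tqᶜ, ‖ee y t * ((exp (-(a * t ^ 2 / 2)) : ℝ) : ℂ)‖ ≤ exp (-a) * exp (-(a / 4) * t ^ 2) := by
    intro t ht
    rw [norm_mul, ee_norm, one_mul, norm_real, norm_of_nonneg (exp_pos _).le, ← exp_add, exp_le_exp]
    have : π < |t| := by
      by_contra hc; push Not at hc; exact ht (abs_le.mp hc)
    have : 9 ≤ t ^ 2 := by rw [← sq_abs]; nlinarith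
    nlinarith
  refine (norm_integral_le_integral_norm _).trans ?_
  refine (setIntegral_mono_on hi.norm.integrableOn (hi0.const_mul _).integrableOn measurableSet_Icc.compl hb).trans ?_
  refine (setIntegral_le_integral (hi0.const_mul _) (Eventually.of_forall fun t => by positivity)).trans ?_
  rw [integral_const_mul, integral_gaussian, mul_comm]
  gcongr
  rw [Real.sqrt_le_left (by norm_num), div_le_iff₀ (by positivity)]
  nlinarith
theorem stdN_nonneg (z : ℝ) : 0 ≤ stdNormal z := by unfold stdNormal; positivity
theorem stdN_le (z : ℝ) : stdNormal z ≤ 2⁻¹ := by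
  unfold stdNormal
  have h : (√(2 * π))⁻¹ ≤ 2⁻¹ := by
    gcongr; apply le_sqrt_of_sq_le; nlinarith [pi_gt_three]
  have : exp (-z ^ 2 / 2) ≤ 1 := exp_le_one_iff.mpr (by nlinarith [sq_nonneg z])
  calc _ ≤ (2⁻¹ : ℝ) * 1 := by gcongr
    _ = _ := by ring
theorem gauss_two {a a' e : ℝ} (ha : 1 ≤ a) (ha' : 1 ≤ a') (y y' : ℝ) (he : exp (-a) ≤ e) (he' : exp (-a') ≤ e) :
    ‖(∫ t in Tq, ee y t * ((exp (-(a * t ^ 2 / 2)) : ℝ) : ℂ)) * (∫ t in Tq, ee y' t * ((exp (-(a' * t ^ 2 / 2)) : ℝ) : ℂ))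
      - (((2 * π) ^ 2 * ((√a)⁻¹ * stdNormal (y / √a) * ((√a')⁻¹ * stdNormal (y' / √a'))) : ℝ) : ℂ)‖ ≤ 48 * e := by
  have g1 := gauss_trunc ha y
  have g2 := gauss_trunc ha' y'
  have hpi4 := Real.pi_lt_four
  have hJ : ∀ {c : ℝ}, 1 ≤ c → ∀ u, ‖((2 * π * ((√c)⁻¹ * stdNormal (u / √c)) : ℝ) : ℂ)‖ ≤ 4 := by
    intro c hc u
    rw [norm_real, norm_of_nonneg (by have := stdN_nonneg (u / √c); positivity)]
    have : (√c)⁻¹ ≤ 1 := inv_le_one_of_one_le₀ (Real.one_le_sqrt.mpr hc)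
    have h2 := stdN_le (u / √c)
    calc _ ≤ 2 * 4 * (1 * (2⁻¹ : ℝ)) := by have := stdN_nonneg (u / √c); gcongr
      _ = _ := by norm_num
  set I1 := ∫ t in Tq, ee y t * ((exp (-(a * t ^ 2 / 2)) : ℝ) : ℂ)
  set I2 := ∫ t in Tq, ee y' t * ((exp (-(a' * t ^ 2 / 2)) : ℝ) : ℂ)
  have j1 := hJ ha y
  have j2 := hJ ha' y'
  set J1 := ((2 * π * ((√a)⁻¹ * stdNormal (y / √a)) : ℝ) : ℂ) with hJ1
  set J2 := ((2 * π * ((√a')⁻¹ * stdNormal (y' / √a')) : ℝ) : ℂ) with hJ2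
  have e3 : (((2 * π) ^ 2 * ((√a)⁻¹ * stdNormal (y / √a) * ((√a')⁻¹ * stdNormal (y' / √a'))) : ℝ) : ℂ) = J1 * J2 := by
    rw [hJ1, hJ2, ← Complex.ofReal_mul]; congr 1; ring
  rw [e3, show I1 * I2 - J1 * J2 = (I1 - J1) * (I2 - J2) + (I1 - J1) * J2 + J1 * (I2 - J2) by ring]
  have x1 : exp (-a') ≤ 1 := exp_le_one_iff.mpr (by linarith)
  refine (norm_add₃_le).trans ?_
  simp only [norm_mul]
  have y1 : ‖I1 - J1‖ ≤ 4 * e := by linarith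
  have y2 : ‖I2 - J2‖ ≤ 4 * e := by linarith
  have y3 : ‖I2 - J2‖ ≤ 4 := by linarith
  have e0 : 0 ≤ e := (exp_pos _).le.trans he
  have z1 := mul_le_mul y1 y3 (norm_nonneg _) (by positivity)
  have z2 := mul_le_mul y1 j2 (norm_nonneg _) (by positivity)
  have z3 := mul_le_mul j1 y2 (norm_nonneg _) (by positivity)
  linarith
end Inv
noncomputable section Loc
variable {n k : ℕ} [NeZero n] {p : ℝ}
variable (h0 : 0 < p) (h1 : p < 1) (hk : 3 ≤ k)
abbrev VV (n : ℕ) [NeZero n] (h0 : 0 < p) (h1 : p < 1) (hk : 3 ≤ k) (hg : n.gcd (k - 1).factorial = 1) : ℝ := Ex p (fun x => (zb (n := n) p h0 h1 hk hg).W p x ^ 2)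
include h0 h1 hk in
theorem inv_id (hg : n.gcd (k - 1).factorial = 1) (m z : ℤ) :
    ∫ w in Tq ×ˢ Tq, (zb (n := n) p h0 h1 hk hg).phi p w.1 w.2 * (ee (-(m - p * n)) w.1 * ee (ff k n p (m - p * n) - z) w.2) =
      (((2 * π) ^ 2 * Ex p (fun x : ZMod n → Bool => if Blk.Ns p x = m - p * n ∧ (kAPcount k x : ℝ) = z then (1 : ℝ) else 0) : ℝ) : ℂ) := by
  set b := zb (n := n) p h0 h1 hk hg with hb
  set h : ℝ := m - p * n with hh
  set c : ℝ := ff k n p h - z with hc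
  have e1 : ∀ w : ℝ × ℝ, b.phi p w.1 w.2 * (ee (-h) w.1 * ee c w.2) = ∑ x : ZMod n → Bool, (wt p x : ℂ) * (ee (Blk.Ns p x - h) w.1 * ee (b.W p x + c) w.2) := by
    intro w
    simp only [Blk.phi, Ex, sum_mul]
    refine sum_congr rfl fun x _ => ?_
    rw [real_smul, mul_assoc]
    congr 1
    unfold ee Blk.Hf
    rw [← Complex.exp_add, ← Complex.exp_add, ← Complex.exp_add]
    congr 1; push_cast; ring
  simp_rw [e1]
  rw [integral_finset_sum]
  · simp_rw [integral_const_mul]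
    rw [show (Ex p (fun x : ZMod n → Bool => if Blk.Ns p x = h ∧ (kAPcount k x : ℝ) = z then (1 : ℝ) else 0)) = ∑ x : ZMod n → Bool, wt p x * (if Blk.Ns p x = h ∧ (kAPcount k x : ℝ) = z then (1 : ℝ) else 0) from rfl, mul_sum, Complex.ofReal_sum]
    refine sum_congr rfl fun x _ => ?_
    have hsp : ∫ w in Tq ×ˢ Tq, ee (Blk.Ns p x - h) w.1 * ee (b.W p x + c) w.2 = (∫ w in Tq, ee (Blk.Ns p x - h) w) * ∫ w in Tq, ee (b.W p x + c) w :=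
      setIntegral_prod_mul (ee (Blk.Ns p x - h)) (ee (b.W p x + c)) Tq Tq
    rw [hsp]
    set N : ℤ := ((univ.filter fun u => x u = true).card : ℤ) with hN
    have hNs : Blk.Ns p x - h = ((N - m : ℤ) : ℝ) := by
      unfold Blk.Ns xi
      rw [sum_sub_distrib, sum_const, card_univ, ZMod.card, hh, hN, sum_boole]
      push_cast; rw [nsmul_eq_mul]; ring
    rw [hNs, int_ee]
    by_cases hNm : N - m = 0
    · have hNh : Blk.Ns p x = h := by rw [hNm] at hNs; push_cast at hNs; linarith
      have hW : b.W p x + c = (((kAPcount k x : ℤ) - z : ℤ) : ℝ) := by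
        have := count_decomp h0 h1 hk hg x
        rw [hNh] at this
        push_cast; rw [this, hc]; ring
      rw [hW, int_ee, if_pos hNm]
      by_cases hz : (kAPcount k x : ℤ) - z = 0
      · have : (kAPcount k x : ℝ) = z := by exact_mod_cast (sub_eq_zero.mp hz : (kAPcount k x : ℤ) = z)
        rw [if_pos hz, if_pos ⟨hNh, this⟩]; push_cast; ring
      · rw [if_neg hz, if_neg]; · simp
        rintro ⟨-, h2⟩; apply hz
        have : (kAPcount k x : ℤ) = z := by exact_mod_cast h2
        linarith
    · rw [if_neg hNm, if_neg]; · simp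
      rintro ⟨h2, -⟩; apply hNm
      rw [h2, sub_self] at hNs; exact_mod_cast hNs.symm
  · intro x _
    refine ContinuousOn.integrableOn_compact (isCompact_Icc.prod isCompact_Icc) (Continuous.continuousOn ?_)
    exact continuous_const.mul (((ee_cont _).comp continuous_fst).mul ((ee_cont _).comp continuous_snd))
theorem exp_tail {c : ℝ} (hc : 0 < c) (A : ℕ) : ∃ C : ℝ, 0 < C ∧ ∀ r : ℝ, 0 < r → exp (-(c * r)) ≤ C / r ^ A :=
  ⟨A.factorial / c ^ A, by positivity, fun r hr => exp_pow hc A hr⟩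
set_option maxHeartbeats 1000000 in
include h0 h1 hk in
theorem phi_rest : ∃ C : ℝ, 0 < C ∧ ∃ rho0 : ℝ, 1 ≤ rho0 ∧ ∀ (n : ℕ) [NeZero n] (hg : n.gcd (k - 1).factorial = 1) (rho : ℝ), rho0 ≤ rho →
    (n : ℝ) = rho ^ 200 → kap p k / 2 * n ^ 2 ≤ VV n h0 h1 hk hg ∧ ∀ θ t : ℝ, |θ| ≤ π → |t| ≤ π → (1 ≤ |θ| * rho ^ 98 ∨ 1 ≤ |t| * rho ^ 198) →
    ‖(zb (n := n) p h0 h1 hk hg).phi p θ t - GG p (VV n h0 h1 hk hg) n θ t‖ ≤ C / rho ^ 400 := by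
  have hs := (s2_bd h0 h1).1
  have hkp := kap_pos h0 h1 hk
  have hCV := CV_pos hk
  obtain ⟨C1, hC1, H1⟩ := Blk.small_main h0 h1 k (KK k) (cl := p ^ k) (by positivity)
  set R : ℕ := 4 * k ^ 2 with hR
  have hR1 : 1 ≤ R := by rw [hR]; nlinarith
  have hRr : (1:ℝ) ≤ R := by exact_mod_cast hR1
  obtain ⟨C2, hC2, H2⟩ := Blk.big_main h0 h1 k (KK k) (cl := p ^ k) (c1 := (υ p) ^ (KK k * k + 1) / 100) (c2 := 1 / (128 * (R:ℝ) ^ 2)) (by positivity) (by positivity)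
  obtain ⟨C3, hC3, H3⟩ := exp_tail (show 0 < υ p / 2 by positivity) 100
  obtain ⟨C4, hC4, H4⟩ := exp_tail (show 0 < kap p k / 4 by positivity) 100
  refine ⟨C1 + C2 + C3 + C4, by positivity, 1 + (2 * KK k + 2) + 256 * R ^ 2 + 2 * CV k / kap p k, by
    have : 0 ≤ 2 * CV k / kap p k := by positivity
    nlinarith [sq_nonneg (R:ℝ), (Nat.cast_nonneg (KK k) : (0:ℝ) ≤ KK k)], ?_⟩
  intro n _ hg rho hrho hn
  have hA : 0 ≤ 2 * CV k / kap p k := by positivity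
  have hKK := (Nat.cast_nonneg (KK k) : (0:ℝ) ≤ KK k)
  have hRR : 0 ≤ (R:ℝ) ^ 2 := by positivity
  have r1 : 1 ≤ rho := by linarith
  have r2 : 2 * (KK k : ℝ) + 2 ≤ rho := by linarith
  have r3 : 256 * (R:ℝ) ^ 2 ≤ rho := by linarith
  have r4 : 2 * CV k / kap p k ≤ rho := by linarith
  have r0 : 0 < rho := by linarith
  have hrn : rho ≤ rho ^ 200 := le_self_pow₀ r1 (by norm_num)
  have hnpos : 0 < n := Nat.pos_of_ne_zero (NeZero.ne n)
  have hV : kap p k / 2 * (n:ℝ) ^ 2 ≤ VV n h0 h1 hk hg := by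
    have hv := (abs_le.mp (var_W (n := n) h0 h1 hk hg)).1
    have : 2 * CV k ≤ n * kap p k := by
      rw [div_le_iff₀ hkp] at r4; rw [hn]; nlinarith
    have hn0 : (0:ℝ) ≤ n := Nat.cast_nonneg n
    have := mul_le_mul_of_nonneg_right this hn0
    linear_combination hv + this / 2
  refine ⟨hV, ?_⟩
  intro θ t hθ ht hc
  set V := VV n h0 h1 hk hg
  have hq : rho ^ 4 * rho ^ 196 = rho ^ 200 := by ring
  have hGn : ‖GG p V n θ t‖ ≤ C3 / rho ^ 400 + C4 / rho ^ 400 := by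
    have hG0 : ‖GG p V n θ t‖ = exp (-(n * υ p * θ ^ 2 / 2)) * exp (-(V * t ^ 2 / 2)) := by
      unfold GG; rw [norm_real, norm_of_nonneg (by positivity)]
    have hV0 : 0 ≤ V := le_trans (by positivity) hV
    have p3 : 0 ≤ C3 / rho ^ 400 := by positivity
    have p4 : 0 ≤ C4 / rho ^ 400 := by positivity
    rw [hG0]
    have q1 : exp (-(n * υ p * θ ^ 2 / 2)) ≤ 1 := exp_le_one_iff.mpr (neg_nonpos.mpr (by positivity))
    have q2 : exp (-(V * t ^ 2 / 2)) ≤ 1 := exp_le_one_iff.mpr (neg_nonpos.mpr (by positivity))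
    have hr4 : rho ^ 400 = (rho ^ 4) ^ 100 := by ring
    rcases hc with hc | hc
    · have : rho ^ 4 ≤ n * θ ^ 2 := by
        rw [hn, ← sq_abs θ]
        calc rho ^ 4 = rho ^ 4 * 1 ^ 2 := by ring
          _ ≤ rho ^ 4 * (|θ| * rho ^ 98) ^ 2 := by gcongr
          _ = _ := by ring
      have h5 : exp (-(n * υ p * θ ^ 2 / 2)) ≤ C3 / rho ^ 400 := by
        rw [hr4]
        refine le_trans ?_ (H3 (rho ^ 4) (by positivity))
        rw [exp_le_exp]; nlinarith
      nlinarith [exp_pos (-(n * υ p * θ ^ 2 / 2))]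
    · have : rho ^ 4 ≤ (n:ℝ) ^ 2 * t ^ 2 := by
        rw [hn, ← sq_abs t]
        calc rho ^ 4 = rho ^ 4 * 1 ^ 2 := by ring
          _ ≤ rho ^ 4 * (|t| * rho ^ 198) ^ 2 := by gcongr
          _ = _ := by ring
      have h5 : exp (-(V * t ^ 2 / 2)) ≤ C4 / rho ^ 400 := by
        rw [hr4]
        refine le_trans ?_ (H4 (rho ^ 4) (by positivity))
        rw [exp_le_exp]
        have g1 := mul_le_mul_of_nonneg_right hV (sq_nonneg t)
        have g2 := mul_le_mul_of_nonneg_left this (show 0 ≤ kap p k / 4 by positivity)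
        linear_combination g1 / 2 + g2
      nlinarith [exp_pos (-(V * t ^ 2 / 2))]
  have hph : ‖(zb (n := n) p h0 h1 hk hg).phi p θ t‖ ≤ C1 / rho ^ 400 + C2 / rho ^ 400 := by
    have p1 : 0 ≤ C1 / rho ^ 400 := by positivity
    have p2 : 0 ≤ C2 / rho ^ 400 := by positivity
    by_cases hb : 1 ≤ |t| * rho ^ 102
    · set q : ℕ := n / (64 * R ^ 2) with hqd
      have hq1 : 64 * R ^ 2 * q ≤ n := Nat.mul_div_le n _
      have hq2 : n < 64 * R ^ 2 * q + 64 * R ^ 2 := by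
        have := Nat.lt_div_mul_add (a := n) (b := 64 * R ^ 2) (by positivity)
        rw [← hqd] at this; linarith [mul_comm q (64 * R ^ 2)]
      have hq2' : (n:ℝ) < 64 * R ^ 2 * q + 64 * R ^ 2 := by exact_mod_cast hq2
      have hbig : 256 * (R:ℝ) ^ 2 * rho ^ 6 ≤ n := by
        rw [hn]
        calc _ ≤ rho * rho ^ 6 := by gcongr
          _ = rho ^ 7 := by ring
          _ ≤ _ := pow_le_pow_right₀ r1 (by norm_num)
      have h6 : 1 ≤ rho ^ 6 := one_le_pow₀ r1
      have hqq : 1 / (128 * (R:ℝ) ^ 2) * rho ^ 200 ≤ q := by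
        rw [← hn, one_div, inv_mul_le_iff₀ (by positivity)]
        have h8 := mul_le_mul_of_nonneg_left h6 hRR
        have h9 : 0 ≤ (R:ℝ) ^ 2 * q := by positivity
        linarith
      have hL : ⌈rho ^ 6⌉₊ ≤ q := by
        have h7 : ((⌈rho ^ 6⌉₊ : ℕ) : ℝ) < rho ^ 6 + 1 := Nat.ceil_lt_add_one (by positivity)
        have : 2 * rho ^ 6 ≤ (q:ℝ) := by
          rw [← hn, one_div, inv_mul_le_iff₀ (by positivity)] at hqq
          have : 128 * (R:ℝ) ^ 2 * (2 * rho ^ 6) ≤ 128 * R ^ 2 * q := by linarith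
          exact le_of_mul_le_mul_left this (by positivity)
        have : ((⌈rho ^ 6⌉₊ : ℕ) : ℝ) ≤ q := by linarith
        exact_mod_cast this
      obtain ⟨J, W, hJ, hW, hJV⟩ := exists_JV (n := n) hR1 hq1 hL hnpos
      have hcfg := cfg_z h0 h1 hk hg (J := J) (V := W) (by rw [hR] at hJV; push_cast at hJV; exact hJV)
      have := H2 (ZMod n) (ZMod n × ℕ × Finset ℕ) (zb p h0 h1 hk hg) J W rho hcfg r1 (by rw [hJ]; exact hqq) (by rw [hW]; exact Nat.le_ceil _)
        (by rw [hW]; have := Nat.ceil_lt_add_one (show 0 ≤ rho ^ 6 by positivity); linarith) θ t ht hb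
      linarith
    · have := H1 (ZMod n) (ZMod n × ℕ × Finset ℕ) (zb p h0 h1 hk hg) rho r2 (by rw [ZMod.card, hn]) θ t hθ (by linarith) hc.symm
      linarith
  refine (norm_sub_le _ _).trans ((add_le_add hph hGn).trans (le_of_eq (by ring)))
end Loc
noncomputable section Loc2
variable {n k : ℕ} [NeZero n] {p : ℝ}
theorem sq_bound {F : ℝ × ℝ → ℂ} (hF : Continuous F) {a b c1 c2 : ℝ} (ha : 0 ≤ a) (hb : 0 ≤ b) (hc2 : 0 ≤ c2)
    (h : ∀ w ∈ Tq ×ˢ Tq, ‖F w‖ ≤ c1 + Set.indicator (Set.Icc (-a) a ×ˢ Set.Icc (-b) b) (fun _ => c2) w) :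
    ‖∫ w in Tq ×ˢ Tq, F w‖ ≤ (2 * π) ^ 2 * c1 + c2 * (4 * (a * b)) := by
  have hpi := Real.pi_pos
  have hc : IsCompact (Tq ×ˢ Tq : Set (ℝ × ℝ)) := isCompact_Icc.prod isCompact_Icc
  have hm : MeasurableSet (Set.Icc (-a) a ×ˢ Set.Icc (-b) b : Set (ℝ × ℝ)) := measurableSet_Icc.prod measurableSet_Icc
  have hvol : ∀ {u v : ℝ}, 0 ≤ u → 0 ≤ v → (volume : Measure (ℝ × ℝ)).real (Set.Icc (-u) u ×ˢ Set.Icc (-v) v) = 4 * (u * v) := by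
    intro u v hu hv
    rw [Measure.real, Measure.volume_eq_prod, Measure.prod_prod, Real.volume_Icc, Real.volume_Icc, ENNReal.toReal_mul, ENNReal.toReal_ofReal (by linarith), ENNReal.toReal_ofReal (by linarith)]; ring
  have hfin : (volume : Measure (ℝ × ℝ)) (Set.Icc (-a) a ×ˢ Set.Icc (-b) b) ≠ ⊤ := (isCompact_Icc.prod isCompact_Icc).measure_lt_top.ne
  have hi : Integrable (Set.indicator (Set.Icc (-a) a ×ˢ Set.Icc (-b) b : Set (ℝ × ℝ)) (fun _ => c2)) := by
    rw [integrable_indicator_iff hm]; exact integrableOn_const hfin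
  have hi1 : IntegrableOn (fun _ : ℝ × ℝ => c1) (Tq ×ˢ Tq) := integrableOn_const hc.measure_lt_top.ne
  refine (norm_integral_le_integral_norm _).trans ?_
  refine (setIntegral_mono_on (hF.continuousOn.integrableOn_compact hc).norm (hi1.add hi.integrableOn) hc.measurableSet h).trans ?_
  have := integral_add hi1 (hi.integrableOn (s := Tq ×ˢ Tq))
  simp only [Pi.add_apply]
  refine (le_of_eq this).trans ?_
  refine add_le_add (le_of_eq ?_) ?_
  · rw [setIntegral_const, hvol hpi.le hpi.le, smul_eq_mul]; ring
  · refine (setIntegral_le_integral hi (Eventually.of_forall fun w => Set.indicator_nonneg (fun _ _ => hc2) w)).trans (le_of_eq ?_)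
    rw [integral_indicator hm, setIntegral_const, hvol ha hb, smul_eq_mul, mul_comm]
set_option maxHeartbeats 800000 in
theorem loc_lim (h0 : 0 < p) (h1 : p < 1) (hk : 3 ≤ k) : ∃ C : ℝ, 0 < C ∧ ∃ rho0 : ℝ, 1 ≤ rho0 ∧ ∀ (n : ℕ) [NeZero n] (hg : n.gcd (k - 1).factorial = 1) (rho : ℝ), rho0 ≤ rho →
    (n : ℝ) = rho ^ 200 → kap p k / 2 * n ^ 2 ≤ VV n h0 h1 hk hg ∧ ∀ m z : ℤ,
    |Ex p (fun x : ZMod n → Bool => if Blk.Ns p x = m - p * n ∧ (kAPcount k x : ℝ) = z then (1 : ℝ) else 0)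
      - (√(n * υ p))⁻¹ * stdNormal (-(m - p * n) / √(n * υ p)) * ((√(VV n h0 h1 hk hg))⁻¹ * stdNormal ((ff k n p (m - p * n) - z) / √(VV n h0 h1 hk hg)))| ≤ C / rho ^ 390 := by
  have hs := (s2_bd h0 h1).1
  have hkp := kap_pos h0 h1 hk
  have hpi := pi_gt_three
  obtain ⟨C1, hC1, r1, hr1, H1⟩ := phi_rest h0 h1 hk
  set c3 := min υ p (kap p k / 2) with hc3
  have hc3p : 0 < c3 := lt_min hs (by positivity)
  obtain ⟨C3, hC3, H3⟩ := exp_tail hc3p 2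
  set C2 := 9 + 4 * Blk.CS p k (KK k) with hC2
  have hC2p : 0 < C2 := by
    have := Blk.CQ_nonneg (k := k) (K := KK k); rw [hC2]; unfold Blk.CS; positivity
  refine ⟨C1 + C2 * 4 + 48 * C3, by positivity, r1 + c3⁻¹, by have := inv_pos.mpr hc3p; linarith, ?_⟩
  intro n _ hg rho hrho hn
  have hci := inv_pos.mpr hc3p
  have hrho1 : r1 ≤ rho := by linarith
  have hr : 1 ≤ rho := by linarith
  have hr0 : 0 < rho := by linarith
  obtain ⟨hV, HP⟩ := H1 n hg rho hrho1 hn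
  refine ⟨hV, ?_⟩
  intro m z
  set V := VV n h0 h1 hk hg with hVd
  set h : ℝ := m - p * n with hh
  set y' : ℝ := ff k n p h - z with hy'
  have hnr : rho ≤ n := by rw [hn]; exact le_self_pow₀ hr (by norm_num)
  have hn1 : (1:ℝ) ≤ n := by linarith
  have hcn : 1 ≤ c3 * n := by
    have : c3⁻¹ ≤ n := by linarith
    rwa [inv_le_iff_one_le_mul₀' hc3p] at this
  have a1 : c3 * n ≤ n * υ p := by rw [mul_comm]; gcongr; exact min_le_left _ _
  have a2 : c3 * n ≤ V := by
    refine le_trans ?_ hV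
    have := min_le_right υ p (kap p k / 2)
    calc c3 * n ≤ kap p k / 2 * n := by gcongr
      _ ≤ _ := by gcongr; nlinarith
  have he := H3 n (by linarith)
  have hn2 : (n:ℝ) ^ 2 = rho ^ 400 := by rw [hn]; ring
  rw [hn2] at he
  have G2 := gauss_two (hcn.trans a1) (hcn.trans a2) (-h) y' (e := C3 / rho ^ 400) (le_trans (exp_le_exp.mpr (by linarith)) he) (le_trans (exp_le_exp.mpr (by linarith)) he)
  have hI := inv_id h0 h1 hk hg m z
  set b := zb (n := n) p h0 h1 hk hg with hb
  set P := Ex p (fun x : ZMod n → Bool => if Blk.Ns p x = h ∧ (kAPcount k x : ℝ) = z then (1 : ℝ) else 0) with hP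
  set g : ℝ := (√(n * υ p))⁻¹ * stdNormal (-h / √(n * υ p)) * ((√V)⁻¹ * stdNormal (y' / √V)) with hgd
  have hcee : Continuous fun w : ℝ × ℝ => ee (-h) w.1 * ee y' w.2 := ((ee_cont _).comp continuous_fst).mul ((ee_cont _).comp continuous_snd)
  have hcphi : Continuous fun w : ℝ × ℝ => b.phi p w.1 w.2 := by
    unfold Blk.phi Ex Blk.Hf; fun_prop
  have hcG : Continuous fun w : ℝ × ℝ => GG p V n w.1 w.2 := by unfold GG; fun_prop
  have hc : IsCompact (Tq ×ˢ Tq : Set (ℝ × ℝ)) := isCompact_Icc.prod isCompact_Icc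
  have hGi : ∫ w in Tq ×ˢ Tq, GG p V n w.1 w.2 * (ee (-h) w.1 * ee y' w.2) = (∫ t in Tq, ee (-h) t * ((exp (-(n * υ p * t ^ 2 / 2)) : ℝ) : ℂ)) * ∫ t in Tq, ee y' t * ((exp (-(V * t ^ 2 / 2)) : ℝ) : ℂ) := by
    have := setIntegral_prod_mul (μ := (volume : Measure ℝ)) (ν := (volume : Measure ℝ)) (fun t => ee (-h) t * ((exp (-(n * υ p * t ^ 2 / 2)) : ℝ) : ℂ)) (fun t => ee y' t * ((exp (-(V * t ^ 2 / 2)) : ℝ) : ℂ)) Tq Tq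
    rw [← this, ← Measure.volume_eq_prod]
    congr 1; funext w; unfold GG; push_cast; ring
  have hB := sq_bound (F := fun w => (b.phi p w.1 w.2 - GG p V n w.1 w.2) * (ee (-h) w.1 * ee y' w.2)) ((hcphi.sub hcG).mul hcee) (a := (rho ^ 98)⁻¹) (b := (rho ^ 198)⁻¹) (c1 := C1 / rho ^ 400) (c2 := C2 / rho ^ 94) (by positivity) (by positivity) (by positivity) (by
    intro w hw
    have hw1 : |w.1| ≤ π := abs_le.mpr hw.1
    have hw2 : |w.2| ≤ π := abs_le.mpr hw.2
    rw [norm_mul, norm_mul, ee_norm, ee_norm, mul_one, mul_one]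
    have p1 : 0 ≤ C1 / rho ^ 400 := by positivity
    have p2 : 0 ≤ C2 / rho ^ 94 := by positivity
    by_cases hmm : w ∈ Set.Icc (-(rho ^ 98)⁻¹) (rho ^ 98)⁻¹ ×ˢ Set.Icc (-(rho ^ 198)⁻¹) (rho ^ 198)⁻¹
    · rw [Set.indicator_of_mem hmm]
      have u1 : |w.1| ≤ (rho ^ 98)⁻¹ := abs_le.mpr hmm.1
      have u2 : |w.2| ≤ (rho ^ 198)⁻¹ := abs_le.mpr hmm.2
      have hpm := phi_main h0 h1 b hr (by rw [ZMod.card, hn]) (θ := w.1) (t := w.2) (by rwa [← le_div_iff₀ (by positivity), one_div]) (by rwa [← le_div_iff₀ (by positivity), one_div])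
      rw [ZMod.card] at hpm
      exact hpm.trans (by linarith)
    · rw [Set.indicator_of_notMem hmm, add_zero]
      refine HP w.1 w.2 hw1 hw2 ?_
      by_contra hcon
      push Not at hcon
      refine hmm ⟨abs_le.mp ?_, abs_le.mp ?_⟩
      · rw [← one_div, le_div_iff₀ (by positivity)]; exact hcon.1.le
      · rw [← one_div, le_div_iff₀ (by positivity)]; exact hcon.2.le)
  have hsub : ∫ w in Tq ×ˢ Tq, (b.phi p w.1 w.2 - GG p V n w.1 w.2) * (ee (-h) w.1 * ee y' w.2) = (∫ w in Tq ×ˢ Tq, b.phi p w.1 w.2 * (ee (-h) w.1 * ee y' w.2)) - ∫ w in Tq ×ˢ Tq, GG p V n w.1 w.2 * (ee (-h) w.1 * ee y' w.2) := by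
    have i1 : IntegrableOn (fun w : ℝ × ℝ => b.phi p w.1 w.2 * (ee (-h) w.1 * ee y' w.2)) (Tq ×ˢ Tq) := (hcphi.mul hcee).continuousOn.integrableOn_compact hc
    have i2 : IntegrableOn (fun w : ℝ × ℝ => GG p V n w.1 w.2 * (ee (-h) w.1 * ee y' w.2)) (Tq ×ˢ Tq) := (hcG.mul hcee).continuousOn.integrableOn_compact hc
    rw [← integral_sub i1 i2]
    congr 1; funext w; ring
  rw [hsub, hI, hGi] at hB
  have tri := (norm_sub_le_norm_sub_add_norm_sub _ _ _).trans (add_le_add hB G2)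
  rw [← Complex.ofReal_sub, norm_real, norm_eq_abs, ← mul_sub, abs_mul, abs_of_nonneg (by positivity)] at tri
  have e1 : C2 / rho ^ 94 * (4 * ((rho ^ 98)⁻¹ * (rho ^ 198)⁻¹)) = C2 * 4 / rho ^ 390 := by
    rw [show rho ^ 390 = rho ^ 94 * (rho ^ 98 * rho ^ 198) * rho ^ 0 by ring]; field_simp
  have hr390 : rho ^ 390 ≤ rho ^ 400 := pow_le_pow_right₀ hr (by norm_num)
  have f1 : C1 / rho ^ 400 ≤ C1 / rho ^ 390 := by gcongr
  have f3 : C3 / rho ^ 400 ≤ C3 / rho ^ 390 := by gcongr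
  rw [e1] at tri
  have hp1 : 1 ≤ (2 * π) ^ 2 := by nlinarith
  have g1 : 0 < C2 * 4 / rho ^ 390 := by positivity
  have g3 : 0 < C3 / rho ^ 390 := by positivity
  have : (2 * π) ^ 2 * |P - g| ≤ (2 * π) ^ 2 * (C1 / rho ^ 390 + C2 * 4 / rho ^ 390 + 48 * (C3 / rho ^ 390)) := by
    refine tri.trans ?_
    have := mul_le_mul_of_nonneg_left f1 (show 0 ≤ (2 * π) ^ 2 by positivity)
    have q2 := mul_le_mul_of_nonneg_right hp1 g1.le
    have q3 := mul_le_mul_of_nonneg_right hp1 g3.le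
    linarith
  have := le_of_mul_le_mul_left this (by positivity)
  grind
end Loc2
noncomputable section Asm1
theorem stdN_tail (x : ℝ) : stdNormal x ≤ 2 * exp (-(x ^ 2 / 4)) / (1 + x ^ 2) := by
  have h : (√(2 * π))⁻¹ ≤ 2⁻¹ := by
    gcongr; apply le_sqrt_of_sq_le; nlinarith [pi_gt_three]
  have h2 : exp (-(x ^ 2 / 4)) ≤ 4 / (1 + x ^ 2) := by
    rw [exp_neg, inv_le_comm₀ (exp_pos _) (by positivity), inv_div]
    have := add_one_le_exp (x ^ 2 / 4); linarith
  have e : exp (-(x ^ 2) / 2) = exp (-(x ^ 2 / 4)) * exp (-(x ^ 2 / 4)) := by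
    rw [← exp_add]; congr 1; ring
  have hp := exp_pos (-(x ^ 2 / 4))
  unfold stdNormal
  calc _ ≤ 2⁻¹ * (exp (-(x ^ 2 / 4)) * (4 / (1 + x ^ 2))) := by rw [e]; gcongr
    _ = _ := by ring
theorem stdN_lip (x y : ℝ) : |stdNormal x - stdNormal y| ≤ |x - y| := by
  have hd : ∀ z : ℝ, HasDerivAt stdNormal ((√(2 * π))⁻¹ * (exp (-(z ^ 2) / 2) * (-z))) z := by
    intro z
    have h : HasDerivAt (fun z : ℝ => -(z ^ 2) / 2) (-z) z := by
      have := ((hasDerivAt_pow 2 z).neg).div_const 2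
      exact this.congr_deriv (by norm_num; ring)
    exact (h.exp).const_mul _
  have hb : ∀ z : ℝ, ‖(√(2 * π))⁻¹ * (exp (-(z ^ 2) / 2) * (-z))‖ ≤ 1 := by
    intro z
    have h : (√(2 * π))⁻¹ ≤ 1 := by
      rw [inv_le_one₀ (by positivity)]; apply le_sqrt_of_sq_le; nlinarith [pi_gt_three]
    rw [norm_mul, norm_mul, norm_neg, norm_eq_abs, norm_eq_abs, norm_eq_abs, abs_of_nonneg (by positivity), abs_of_pos (exp_pos _)]
    have h2 : exp (-(z ^ 2) / 2) * |z| ≤ 1 := by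
      rw [neg_div, exp_neg, inv_mul_le_one₀ (exp_pos _)]
      have := add_one_le_exp (z ^ 2 / 2)
      nlinarith [sq_abs z, sq_nonneg (|z| - 1)]
    exact mul_le_one₀ h (by positivity) h2
  have := Convex.norm_image_sub_le_of_norm_hasDerivWithin_le (C := 1) (s := Set.univ) (fun z _ => (hd z).hasDerivWithinAt) (fun z _ => hb z) convex_univ (Set.mem_univ y) (Set.mem_univ x)
  simpa using this
theorem sum_inv_sq : ∃ S : ℝ, 0 < S ∧ ∀ y : ℝ, Summable (fun m : ℤ => 1 / (1 + (y - m) ^ 2)) ∧ ∑' m : ℤ, 1 / (1 + (y - m) ^ 2) ≤ S := by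
  have h0 : Summable (fun m : ℤ => 3 / (1 + (m:ℝ) ^ 2)) := by
    have := (Real.summable_one_div_int_pow (p := 2)).mpr (by norm_num)
    refine Summable.of_norm_bounded_eventually (this.mul_left 3) ?_
    refine (Set.finite_singleton (0:ℤ)).subset ?_
    intro m hm
    by_contra hm0
    apply hm
    have : (m:ℝ) ≠ 0 := by exact_mod_cast hm0
    show ‖3 / (1 + (m:ℝ) ^ 2)‖ ≤ 3 * (1 / (m:ℝ) ^ 2)
    rw [norm_of_nonneg (by positivity), mul_one_div]
    gcongr; linarith
  have key : ∀ y : ℝ, ∀ m : ℤ, 1 / (1 + (y - ((m + ⌊y⌋ : ℤ) : ℝ)) ^ 2) ≤ 3 / (1 + (m:ℝ) ^ 2) := by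
    intro y m
    have a := Int.fract_nonneg y
    have b := Int.fract_lt_one y
    have c := Int.floor_add_fract y
    push_cast
    rw [div_le_div_iff₀ (by positivity) (by positivity)]
    set f := Int.fract y
    have : y - (m + ⌊y⌋) = f - m := by linarith
    rw [this]
    nlinarith [sq_nonneg ((m:ℝ) - 2 * f)]
  refine ⟨∑' m : ℤ, 3 / (1 + (m:ℝ) ^ 2) + 1, by positivity, ?_⟩
  intro y
  have hs : Summable (fun m : ℤ => 1 / (1 + (y - ((m + ⌊y⌋ : ℤ) : ℝ)) ^ 2)) := Summable.of_nonneg_of_le (fun m => by positivity) (key y) h0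
  refine ⟨((Equiv.addRight ⌊y⌋).summable_iff (f := fun m : ℤ => 1 / (1 + (y - (m:ℝ)) ^ 2))).mp hs, ?_⟩
  rw [← (Equiv.addRight ⌊y⌋).tsum_eq (fun m : ℤ => 1 / (1 + (y - (m:ℝ)) ^ 2))]
  have := Summable.tsum_le_tsum (key y) hs h0
  simp only [Equiv.coe_addRight]
  linarith
theorem theta {c : ℝ} (hc : 0 < c) : ∃ S : ℝ, 0 < S ∧ ∀ y : ℝ, Summable (fun m : ℤ => c⁻¹ * stdNormal ((y - m) / c)) ∧
    ∀ (M : Finset ℤ) (e : ℝ), (∀ m ∉ M, exp (-(1 / (4 * c ^ 2) * (y - m) ^ 2)) ≤ e) →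
      |∑' m : ℤ, c⁻¹ * stdNormal ((y - m) / c) - ∑ m ∈ M, c⁻¹ * stdNormal ((y - m) / c)| ≤ S * e := by
  obtain ⟨S, hS, H⟩ := sum_inv_sq
  refine ⟨c⁻¹ * (2 * (1 + c ^ 2)) * S, by positivity, fun y => ?_⟩
  obtain ⟨Hs, Hb⟩ := H y
  have bd : ∀ m : ℤ, c⁻¹ * stdNormal ((y - m) / c) ≤ c⁻¹ * (2 * (1 + c ^ 2)) * exp (-(1 / (4 * c ^ 2) * (y - m) ^ 2)) * (1 / (1 + (y - m) ^ 2)) := by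
    intro m
    have h := stdN_tail ((y - m) / c)
    have e1 : ((y - m) / c) ^ 2 / 4 = 1 / (4 * c ^ 2) * (y - m) ^ 2 := by field_simp
    rw [e1] at h
    have e2 : 1 / (1 + ((y - m) / c) ^ 2) ≤ (1 + c ^ 2) * (1 / (1 + (y - m) ^ 2)) := by
      rw [mul_one_div, div_le_div_iff₀ (by positivity) (by positivity)]
      have : (y - m) ^ 2 = c ^ 2 * ((y - m) / c) ^ 2 := by field_simp
      rw [this]
      nlinarith [sq_nonneg ((y - m) / c), sq_nonneg c]
    calc _ ≤ c⁻¹ * (2 * exp (-(1 / (4 * c ^ 2) * (y - m) ^ 2)) * (1 / (1 + ((y - m) / c) ^ 2))) := by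
          rw [mul_one_div]; gcongr
      _ ≤ c⁻¹ * (2 * exp (-(1 / (4 * c ^ 2) * (y - m) ^ 2)) * ((1 + c ^ 2) * (1 / (1 + (y - m) ^ 2)))) := by gcongr
      _ = _ := by ring
  have nn : ∀ m : ℤ, 0 ≤ c⁻¹ * stdNormal ((y - m) / c) := fun m => mul_nonneg (by positivity) (stdN_nonneg _)
  have hsum : Summable (fun m : ℤ => c⁻¹ * stdNormal ((y - m) / c)) := by
    refine Summable.of_nonneg_of_le nn (fun m => (bd m).trans ?_) (Hs.mul_left (c⁻¹ * (2 * (1 + c ^ 2)) * 1))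
    gcongr; apply exp_le_one_iff.mpr
    have : 0 ≤ 1 / (4 * c ^ 2) * (y - m) ^ 2 := by positivity
    linarith
  refine ⟨hsum, fun M e he => ?_⟩
  rw [← hsum.sum_add_tsum_compl (s := M), add_sub_cancel_left, abs_of_nonneg (tsum_nonneg fun m => nn _)]
  have hs2 : Summable fun m : ((M : Set ℤ)ᶜ : Set ℤ) => c⁻¹ * (2 * (1 + c ^ 2)) * e * (1 / (1 + (y - (m:ℤ)) ^ 2)) := (Hs.mul_left _).subtype _
  have hs3 : Summable fun m : ((M : Set ℤ)ᶜ : Set ℤ) => c⁻¹ * stdNormal ((y - (m:ℤ)) / c) := hsum.subtype _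
  have hle : ∀ m : ((M : Set ℤ)ᶜ : Set ℤ), c⁻¹ * stdNormal ((y - (m:ℤ)) / c) ≤ c⁻¹ * (2 * (1 + c ^ 2)) * e * (1 / (1 + (y - (m:ℤ)) ^ 2)) :=
    fun m => (bd m).trans (by gcongr; exact he m m.2)
  refine (Summable.tsum_le_tsum hle hs3 hs2).trans ?_
  · rw [tsum_mul_left]
    by_cases hne : ∃ m, m ∉ M
    · obtain ⟨m, hm⟩ := hne
      have he0 : 0 ≤ e := (exp_pos _).le.trans (he m hm)
      have := Hs.tsum_subtype_le (fun m : ℤ => 1 / (1 + (y - m) ^ 2)) ((M : Set ℤ)ᶜ) (fun m => by positivity)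
      calc _ ≤ c⁻¹ * (2 * (1 + c ^ 2)) * e * S := by gcongr; exact this.trans Hb
        _ = _ := by ring
    · push Not at hne
      exact absurd (M.finite_toSet.subset (fun m _ => hne m)) Set.infinite_univ
end Asm1
noncomputable section Asm2
variable {n k : ℕ} [NeZero n] {p : ℝ}
variable (h0 : 0 < p) (h1 : p < 1) (hk : 3 ≤ k)
def cK (p : ℝ) (k : ℕ) : ℝ := √(kap p k) / (k * p ^ (k - 1) / 2)
def Sg (k n : ℕ) [NeZero n] (p : ℝ) : ℝ := √(Ex p (fun x : ZMod n → Bool => ((kAPcount k x : ℝ) - mu k n p) ^ 2))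
include h0 h1 hk in
theorem cK_pos : 0 < cK p k := by
  have := kap_pos h0 h1 hk
  have : (0:ℝ) < k := by exact_mod_cast (by omega)
  unfold cK; positivity
theorem facts0 {v K n D a s A S R E CR0 CV0 : ℝ} (hK : 0 < K) (ha : 0 < a) (hs : 0 < s) (hn : 2 ≤ n) (hv : 0 ≤ v) (hS : 0 ≤ S)
    (hV : |v ^ 2 - K ^ 2 * n ^ 2| ≤ CV0 * n) (hCV : 2 * CV0 ≤ K ^ 2 * n) (hD : D = CV0 / K) (hA : A = (n - 1) * a) (hR : 0 ≤ R) (hR2 : R ≤ CR0 * n ^ 2)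
    (hS2 : S ^ 2 = A ^ 2 * (n * s ^ 2) + R) (hE : E = 2 * CR0 / (a * s)) :
    K / 2 * n ≤ v ∧ v ≤ (K + D) * n ∧ a / 2 * n ≤ A ∧ A ≤ a * n ∧ A * s * √n ≤ S ∧ S - A * s * √n ≤ E * √n ∧
    |A / v - a / K| ≤ 2 * a * (K + D) / K ^ 2 / n ∧ |S / (s * √n * v) - a / K| ≤ (2 * a * (K + D) / K ^ 2 + 2 * E / (s * K)) / n := by
  have hn0 : 0 < n := by linarith
  have hq : 0 < √n := Real.sqrt_pos.mpr hn0
  have hqq : √n * √n = n := Real.mul_self_sqrt hn0.le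
  have hVl := abs_le.mp hV
  have f1 : K / 2 * n ≤ v := by
    apply le_of_sq_le_sq _ hv
    have := mul_le_mul_of_nonneg_right hCV hn0.le
    nlinarith [sq_nonneg (K * n)]
  have hvp : 0 < v := lt_of_lt_of_le (by positivity) f1
  have hCV0 : 0 ≤ CV0 := by
    have := (abs_nonneg _).trans hV
    exact nonneg_of_mul_nonneg_left this hn0
  have hCR0 : 0 ≤ CR0 := by
    have := hR.trans hR2
    exact nonneg_of_mul_nonneg_left this (by positivity)
  have hD0 : 0 ≤ D := by rw [hD]; positivity
  have hE0 : 0 ≤ E := by rw [hE]; positivity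
  have fD : |v - K * n| ≤ D := by
    rw [hD, le_div_iff₀ hK]
    have e : |v ^ 2 - K ^ 2 * n ^ 2| = |v - K * n| * (v + K * n) := by
      rw [show v ^ 2 - K ^ 2 * n ^ 2 = (v - K * n) * (v + K * n) by ring, abs_mul, abs_of_pos (show 0 < v + K * n by positivity)]
    rw [e] at hV
    have : |v - K * n| * (K * n) ≤ CV0 * n := le_trans (by gcongr; linarith) hV
    exact le_of_mul_le_mul_right (by linarith) hn0
  have fDl := abs_le.mp fD
  have f2 : v ≤ (K + D) * n := by nlinarith
  have f3 : a / 2 * n ≤ A := by rw [hA]; nlinarith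
  have f4 : A ≤ a * n := by rw [hA]; nlinarith
  have hAp : 0 < A := lt_of_lt_of_le (by positivity) f3
  set T := A * s * √n with hT
  have hTp : 0 < T := by positivity
  have hT2 : T ^ 2 = A ^ 2 * (n * s ^ 2) := by rw [hT, mul_pow, mul_pow, sq (√n), hqq]; ring
  have f5 : T ≤ S := by apply le_of_sq_le_sq _ hS; rw [hT2, hS2]; linarith
  have f6 : S - T ≤ E * √n := by
    by_contra hcon
    push Not at hcon
    have l1 : (S - T) * T ≤ CR0 * n ^ 2 := by
      have := mul_nonneg (sub_nonneg.mpr f5) hTp.le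
      nlinarith [mul_nonneg (sub_nonneg.mpr f5) hS]
    have l2 : a / 2 * n * s * √n ≤ T := by rw [hT]; gcongr
    have l3 : E * √n * (a / 2 * n * s * √n) = CR0 * n ^ 2 := by
      rw [hE]; field_simp; rw [sq, hqq]
    have l4 : (0:ℝ) < a / 2 * n * s * √n := by positivity
    have : E * √n * (a / 2 * n * s * √n) < (S - T) * T := mul_lt_mul hcon l2 l4 (by linarith)
    linarith
  have f7 : |A / v - a / K| ≤ 2 * a * (K + D) / K ^ 2 / n := by
    have e : A / v - a / K = a / K * (((n - 1) * K - v) / v) := by rw [hA]; field_simp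
    rw [e, abs_mul, abs_of_pos (by positivity), abs_div, abs_of_pos hvp]
    have : |(n - 1) * K - v| ≤ K + D := by
      rw [show (n - 1) * K - v = -(v - K * n) - K by ring, abs_le]; constructor <;> linarith [fDl.1, fDl.2]
    calc _ ≤ a / K * ((K + D) / (K / 2 * n)) := by gcongr
      _ = _ := by field_simp
  refine ⟨f1, f2, f3, f4, f5, f6, f7, ?_⟩
  have e : S / (s * √n * v) - a / K = (S - T) / (s * √n * v) + (A / v - a / K) := by rw [hT]; field_simp; ring
  have f8 : |(S - T) / (s * √n * v)| ≤ 2 * E / (s * K) / n := by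
    rw [abs_of_nonneg (div_nonneg (by linarith) (by positivity))]
    calc _ ≤ E * √n / (s * √n * (K / 2 * n)) := by gcongr
      _ = _ := by field_simp
  rw [e, add_div]
  exact (abs_add_le _ _).trans (by linarith)
include h0 h1 hk in
theorem facts : ∃ C : ℝ, 1 ≤ C ∧ ∃ n0 : ℝ, 2 ≤ n0 ∧ ∀ (n : ℕ) [NeZero n] (hg : n.gcd (k - 1).factorial = 1), n0 ≤ n →
    (n:ℝ) ≤ C * √(VV n h0 h1 hk hg) ∧ (n:ℝ) ≤ C * AA k n p ∧ Sg k n p ≤ C * (n * √n) ∧ 0 < Sg k n p ∧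
    0 ≤ Sg k n p - AA k n p * √(υ p) * √n ∧ Sg k n p - AA k n p * √(υ p) * √n ≤ C * √n ∧
    |AA k n p / √(VV n h0 h1 hk hg) - (cK p k)⁻¹| ≤ C / n ∧ |Sg k n p / (√(υ p) * √n * √(VV n h0 h1 hk hg)) - (cK p k)⁻¹| ≤ C / n := by
  have hkap := kap_pos h0 h1 hk
  have hs2 := (s2_bd h0 h1)
  have hk0 : (0:ℝ) < k := by exact_mod_cast (by omega)
  have hCV := CV_pos hk
  have hCR := CR_pos h0 h1 hk
  set K := √(kap p k) with hKd
  set a : ℝ := k * p ^ (k - 1) / 2 with had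
  set s := √(υ p) with hsd
  have hK : 0 < K := Real.sqrt_pos.mpr hkap
  have ha : 0 < a := by positivity
  have hs : 0 < s := Real.sqrt_pos.mpr hs2.1
  have hKK : K ^ 2 = kap p k := sq_sqrt hkap.le
  have hss : s ^ 2 = υ p := sq_sqrt hs2.1.le
  have hs1 : s ≤ 1 := Real.sqrt_le_one.mpr hs2.2
  have hc : (cK p k)⁻¹ = a / K := by rw [cK, inv_div]
  set D := CV k / K with hD
  set E := 2 * CR p k / (a * s) with hE
  have hD0 : 0 < D := by positivity
  have hE0 : 0 < E := by positivity
  set X1 := 2 * a * (K + D) / K ^ 2 with hX1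
  set X2 := 2 * E / (s * K) with hX2
  have hX10 : 0 < X1 := by positivity
  have hX20 : 0 < X2 := by positivity
  refine ⟨1 + 2 / K + 2 / a + (a + E) + X1 + X2, by have : 0 < 2 / K := by positivity
                                                    have : 0 < 2 / a := by positivity
                                                    linarith, 2 + 2 * CV k / K ^ 2, by have : 0 < 2 * CV k / K ^ 2 := by positivity
                                                                                       linarith, ?_⟩
  intro n _ hg hn
  have hx : 0 < 2 * CV k / K ^ 2 := by positivity
  have hn2 : (2:ℝ) ≤ n := by linarith
  have hn0 : (0:ℝ) < n := by linarith
  have hq : 0 < √(n:ℝ) := Real.sqrt_pos.mpr hn0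
  have hqn : √(n:ℝ) ≤ n * √n := by nlinarith
  obtain ⟨R, hR0, hR1, hR2⟩ := var_count (n := n) h0 h1 hk hg
  have hV := var_W (n := n) h0 h1 hk hg
  have vnn : 0 ≤ VV n h0 h1 hk hg := Ex_nonneg h0.le h1.le fun x => sq_nonneg _
  have snn : 0 ≤ Ex p (fun x : ZMod n → Bool => ((kAPcount k x : ℝ) - mu k n p) ^ 2) := Ex_nonneg h0.le h1.le fun x => sq_nonneg _
  obtain ⟨f1, f2, f3, f4, f5, f6, f7, f8⟩ := facts0 (v := √(VV n h0 h1 hk hg)) (S := Sg k n p) (n := n) (A := AA k n p) (R := R) (CR0 := CR p k) (CV0 := CV k) (D := D) (E := E) hK ha hs hn2 (Real.sqrt_nonneg _) (Real.sqrt_nonneg _)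
    (by grind) (by have : 2 * CV k / K ^ 2 ≤ n := (by linarith); rw [div_le_iff₀ (by positivity)] at this; linarith) hD (by unfold AA; rw [had]; ring) hR0 hR1 (by rw [Sg, sq_sqrt snn, hR2, hss]) hE
  set C := 1 + 2 / K + 2 / a + (a + E) + X1 + X2 with hC
  have q1 : 0 < 2 / K := by positivity
  have q2 : 0 < 2 / a := by positivity
  have c1 : 2 / K ≤ C := by linarith
  have c2 : 2 / a ≤ C := by linarith
  have c3 : a + E ≤ C := by linarith
  have c4 : X1 ≤ C := by linarith
  have c5 : X1 + X2 ≤ C := by linarith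
  have hvp : 0 < √(VV n h0 h1 hk hg) := lt_of_lt_of_le (by positivity) f1
  have hAp : 0 < AA k n p := lt_of_lt_of_le (by positivity) f3
  rw [hc]
  refine ⟨?_, ?_, ?_, lt_of_lt_of_le (by positivity) f5, by linarith, f6.trans (by gcongr; linarith), f7.trans (by gcongr), f8.trans (by gcongr)⟩
  · calc (n:ℝ) = 2 / K * (K / 2 * n) := by field_simp
      _ ≤ C * _ := by gcongr
  · calc (n:ℝ) = 2 / a * (a / 2 * n) := by field_simp
      _ ≤ C * _ := by gcongr
  · calc Sg k n p ≤ AA k n p * s * √n + E * √n := by linarith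
      _ ≤ a * n * 1 * √n + E * (n * √n) := by gcongr
      _ = (a + E) * (n * √n) := by ring
      _ ≤ _ := by gcongr
end Asm2
noncomputable section Asm3
theorem stdN_neg (z : ℝ) : stdNormal (-z) = stdNormal z := by unfold stdNormal; rw [neg_sq]
theorem err_bd {C s S A B n p kk Z r rho q h : ℝ} (hC : 1 ≤ C) (hs : 0 < s) (hs1 : s ≤ 1) (hB : 0 ≤ B) (hr1 : 1 ≤ rho)
    (hq : q = rho ^ 100) (hn : n = q ^ 2) (h1 : 0 ≤ S - A * s * q) (h2 : S - A * s * q ≤ C * q) (hZ : |Z| ≤ rho) (hr : |r| ≤ rho ^ 3)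
    (hp0 : 0 < p) (hp1 : p < 1) (hid : A * ((1 - p) * (kk - 1) / 2) = (n - 1) * (B * s ^ 2)) (hh : h = s * Z * q + r) :
    |A * h + B * (h ^ 2 - (1 - 2 * p) * h - n * s ^ 2) - S * Z - A * (r + (1 - p) * (kk - 1) * (Z ^ 2 - 1) / 2)| ≤ (C + 7 * B) * rho ^ 104 := by
  have hr0 : 0 < rho := by linarith
  have hq0 : 0 < q := by rw [hq]; positivity
  have e : A * h + B * (h ^ 2 - (1 - 2 * p) * h - n * s ^ 2) - S * Z - A * (r + (1 - p) * (kk - 1) * (Z ^ 2 - 1) / 2) =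
      -((S - A * s * q) * Z) + B * (s ^ 2 * (Z ^ 2 - 1) + 2 * s * Z * q * r + r ^ 2 - (1 - 2 * p) * h) := by
    have : A * ((1 - p) * (kk - 1) * (Z ^ 2 - 1) / 2) = (n - 1) * (B * s ^ 2) * (Z ^ 2 - 1) := by rw [← hid]; ring
    rw [mul_add, this, hh, hn]; ring
  have P : ∀ {i : ℕ}, i ≤ 104 → rho ^ i ≤ rho ^ 104 := fun hi => pow_le_pow_right₀ hr1 hi
  have t1 : |(S - A * s * q) * Z| ≤ C * rho ^ 104 := by
    rw [abs_mul, abs_of_nonneg h1]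
    calc _ ≤ C * q * rho := by gcongr
      _ = C * rho ^ 101 := by rw [hq]; ring
      _ ≤ _ := by have := P (i := 101) (by norm_num); gcongr
  have hs2 : s ^ 2 ≤ 1 := pow_le_one₀ hs.le hs1
  have u1 : |s ^ 2 * (Z ^ 2 - 1)| ≤ rho ^ 104 := by
    rw [abs_mul, abs_of_nonneg (sq_nonneg s)]
    have : |Z ^ 2 - 1| ≤ rho ^ 2 := by
      have := sq_le_sq' (abs_le.mp hZ).1 (abs_le.mp hZ).2
      rw [abs_le]; constructor <;> nlinarith [sq_nonneg Z]
    calc _ ≤ 1 * rho ^ 2 := by gcongr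
      _ ≤ _ := by grind
  have u2 : |2 * s * Z * q * r| ≤ 2 * rho ^ 104 := by
    rw [abs_mul, abs_mul, abs_mul, abs_of_pos (by positivity : 0 < 2 * s), abs_of_pos hq0]
    calc _ ≤ 2 * 1 * rho * q * rho ^ 3 := by gcongr
      _ = _ := by rw [hq]; ring
  have u3 : |r ^ 2| ≤ rho ^ 104 := by
    rw [abs_pow]
    calc _ ≤ (rho ^ 3) ^ 2 := by gcongr
      _ = rho ^ 6 := by ring
      _ ≤ _ := P (by norm_num)
  have u4 : |(1 - 2 * p) * h| ≤ 2 * rho ^ 104 := by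
    have a1 : |1 - 2 * p| ≤ 1 := by rw [abs_le]; constructor <;> linarith
    have a2 : |h| ≤ rho ^ 101 + rho ^ 3 := by
      rw [hh]; refine (abs_add_le _ _).trans (add_le_add ?_ hr)
      rw [abs_mul, abs_mul, abs_of_pos hs, abs_of_pos hq0]
      calc _ ≤ 1 * rho * q := by gcongr
        _ = _ := by rw [hq]; ring
    rw [abs_mul]
    calc _ ≤ 1 * (rho ^ 101 + rho ^ 3) := by gcongr
      _ ≤ _ := by grind
  have t2 : |s ^ 2 * (Z ^ 2 - 1) + 2 * s * Z * q * r + r ^ 2 - (1 - 2 * p) * h| ≤ 7 * rho ^ 104 := by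
    have := P (i := 0) (by norm_num)
    rw [abs_le] at *; grind
  rw [e]
  refine (abs_add_le _ _).trans ?_
  rw [abs_neg, abs_mul B, abs_of_nonneg hB]
  have := mul_le_mul_of_nonneg_left t2 hB
  linarith
theorem prod3 {a b c a' b' c' e1 e2 e3 : ℝ} (hb : |b| ≤ 1) (hc : |c| ≤ 1) (hb' : |b'| ≤ 1) (ha' : 0 ≤ a')
    (h1 : |a - a'| ≤ e1) (h2 : |b - b'| ≤ e2) (h3 : |c - c'| ≤ e3) : |a * (b * c) - a' * (b' * c')| ≤ e1 + a' * e2 + a' * e3 := by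
  have e : a * (b * c) - a' * (b' * c') = (a - a') * (b * c) + a' * ((b - b') * c) + a' * (b' * (c - c')) := by ring
  rw [e]
  refine (abs_add_le _ _).trans (add_le_add ((abs_add_le _ _).trans (add_le_add ?_ ?_)) ?_)
  · rw [abs_mul, abs_mul]
    calc _ ≤ |a - a'| * (1 * 1) := by gcongr
      _ ≤ _ := by linarith
  · rw [abs_mul, abs_mul, abs_of_nonneg ha']
    gcongr
    calc _ ≤ |b - b'| * 1 := by gcongr
      _ ≤ _ := by linarith
  · rw [abs_mul, abs_mul, abs_of_nonneg ha']
    gcongr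
    calc _ ≤ 1 * |c - c'| := by gcongr
      _ ≤ _ := by linarith
theorem stdN_abs (z : ℝ) : |stdNormal z| ≤ 1 := by
  rw [abs_of_nonneg (stdN_nonneg z)]; have := stdN_le z; linarith
theorem term_approx {C c s S A B v n p kk Z r rho q h : ℝ} (hC : 1 ≤ C) (hc : 0 < c) (hs : 0 < s) (hs1 : s ≤ 1) (hB : 0 ≤ B) (hr1 : 1 ≤ rho)
    (hq : q = rho ^ 100) (hn : n = q ^ 2) (h1 : 0 ≤ S - A * s * q) (h2 : S - A * s * q ≤ C * q) (hZ : |Z| ≤ rho) (hr : |r| ≤ rho ^ 3)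
    (hp0 : 0 < p) (hp1 : p < 1) (hid : A * ((1 - p) * (kk - 1) / 2) = (n - 1) * (B * s ^ 2)) (hh : h = s * Z * q + r)
    (hkk : 1 ≤ kk) (hv : n ≤ C * v) (h3 : |A / v - c⁻¹| ≤ C / n) (h4 : |S / (s * q * v) - c⁻¹| ≤ C / n) :
    |S * ((s * q)⁻¹ * stdNormal (-h / (s * q)) * (v⁻¹ * stdNormal ((A * h + B * (h ^ 2 - (1 - 2 * p) * h - n * s ^ 2) - S * Z) / v)))
      - stdNormal Z * (c⁻¹ * stdNormal (-(r + (1 - p) * (kk - 1) * (Z ^ 2 - 1) / 2) / c))| ≤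
      (C + c⁻¹ * s⁻¹ + c⁻¹ * ((C + 7 * B) * C + (1 + kk) * C)) / rho ^ 96 := by
  have hE := err_bd hC hs hs1 hB hr1 hq hn h1 h2 hZ hr hp0 hp1 hid hh
  set F := A * h + B * (h ^ 2 - (1 - 2 * p) * h - n * s ^ 2) - S * Z with hF
  set u := r + (1 - p) * (kk - 1) * (Z ^ 2 - 1) / 2 with hu
  have hr0 : 0 < rho := by linarith
  have hq0 : 0 < q := by rw [hq]; positivity
  have hn0 : 0 < n := by rw [hn]; positivity
  have hv0 : 0 < v := by
    by_contra hcon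
    push Not at hcon
    have := mul_nonpos_of_nonneg_of_nonpos (by linarith : 0 ≤ C) hcon
    linarith
  have hci : 0 < c⁻¹ := by positivity
  have hn2 : n = rho ^ 200 := by rw [hn, hq]; ring
  have P : ∀ {i : ℕ}, i ≤ 104 → rho ^ i ≤ rho ^ 104 := fun hi => pow_le_pow_right₀ hr1 hi
  have hub : |u| ≤ (1 + kk) * rho ^ 104 := by
    have a1 : |Z ^ 2 - 1| ≤ rho ^ 2 := by
      have := sq_le_sq' (abs_le.mp hZ).1 (abs_le.mp hZ).2
      rw [abs_le]; constructor <;> nlinarith [sq_nonneg Z]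
    have a2 : |(1 - p) * (kk - 1) * (Z ^ 2 - 1) / 2| ≤ kk * rho ^ 2 := by
      rw [abs_div, abs_mul, abs_of_nonneg (mul_nonneg (by linarith) (by linarith)), abs_of_pos (by norm_num : (0:ℝ) < 2)]
      rw [div_le_iff₀ (by norm_num)]
      calc _ ≤ (1 * kk) * rho ^ 2 := by gcongr <;> linarith
        _ ≤ _ := by nlinarith [mul_nonneg (by linarith : 0 ≤ kk) (sq_nonneg rho)]
    have p3 := P (i := 3) (by norm_num)
    have p2 := mul_le_mul_of_nonneg_left (P (i := 2) (by norm_num)) (by linarith : 0 ≤ kk)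
    exact (abs_add_le _ _).trans (by linarith)
  have d1 : |F / v - u / c| ≤ ((C + 7 * B) * C + (1 + kk) * C) / rho ^ 96 := by
    have e : F / v - u / c = (F - A * u) / v + u * (A / v - c⁻¹) := by field_simp; ring
    have ev : v⁻¹ ≤ C / n := by
      rw [← one_div, div_le_div_iff₀ hv0 hn0]; linarith
    rw [e]
    refine (abs_add_le _ _).trans ?_
    rw [abs_mul, abs_div, abs_of_pos hv0, div_eq_mul_inv]
    calc _ ≤ (C + 7 * B) * rho ^ 104 * (C / n) + (1 + kk) * rho ^ 104 * (C / n) := by gcongr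
      _ = _ := by rw [hn2, show rho ^ 200 = rho ^ 104 * rho ^ 96 by ring]; field_simp
  have d2 : |h / (s * q) - Z| ≤ s⁻¹ / rho ^ 96 := by
    have e : h / (s * q) - Z = r / (s * q) := by rw [hh]; field_simp; ring
    rw [e, abs_div, abs_of_pos (by positivity : 0 < s * q)]
    calc _ ≤ rho ^ 4 / (s * q) := by gcongr; exact hr.trans (pow_le_pow_right₀ hr1 (by norm_num))
      _ = _ := by rw [hq, show rho ^ 100 = rho ^ 96 * rho ^ 4 by ring]; field_simp
  have d3 : |S / (s * q * v) - c⁻¹| ≤ C / rho ^ 96 := h4.trans (by rw [hn2]; gcongr <;> norm_num [hr1])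
  have := prod3 (stdN_abs (h / (s * q))) (stdN_abs (F / v)) (stdN_abs Z) hci.le d3 ((stdN_lip _ _).trans d2) ((stdN_lip _ (u / c)).trans d1)
  rw [neg_div, stdN_neg, neg_div, stdN_neg]
  have e1 : S * ((s * q)⁻¹ * stdNormal (h / (s * q)) * (v⁻¹ * stdNormal (F / v))) = S / (s * q * v) * (stdNormal (h / (s * q)) * stdNormal (F / v)) := by field_simp
  rw [e1, show stdNormal Z * (c⁻¹ * stdNormal (u / c)) = c⁻¹ * (stdNormal Z * stdNormal (u / c)) by ring]
  exact this.trans (le_of_eq (by ring))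
theorem det_claim {C D s S A B W n p Z r rho q h : ℝ} (hC : 1 ≤ C) (hD : 0 ≤ D) (hs : 0 < s) (hs1 : s ≤ 1) (hB : 0 ≤ B) (hr1 : 1 ≤ rho)
    (hq : q = rho ^ 100) (hn : n = q ^ 2) (h1 : 0 ≤ S - A * s * q) (h2 : S - A * s * q ≤ C * q) (hZ : |Z| ≤ rho) (hr2 : C * (D + C + 3 * B) ≤ rho)
    (hp0 : 0 < p) (hp1 : p < 1) (hh : h = s * Z * q + r) (hA : n ≤ C * A) (hhb : |h| ≤ rho ^ 101) (hW : |W| ≤ D * rho ^ 201)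
    (h0 : A * h + B * (h ^ 2 - (1 - 2 * p) * h - n * s ^ 2) - S * Z + W = 0) : |r| ≤ rho ^ 3 := by
  have hr0 : 0 < rho := by linarith
  have hq0 : 0 < q := by rw [hq]; positivity
  have P : ∀ {i : ℕ}, i ≤ 202 → rho ^ i ≤ rho ^ 202 := fun hi => pow_le_pow_right₀ hr1 hi
  have hn2 : n = rho ^ 200 := by rw [hn, hq]; ring
  have e : A * r = -W + (S - A * s * q) * Z - B * (h ^ 2 - (1 - 2 * p) * h - n * s ^ 2) := by
    have : r = h - s * Z * q := by linarith
    rw [this]; linear_combination h0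
  have t1 : |(S - A * s * q) * Z| ≤ C * rho ^ 202 := by
    rw [abs_mul, abs_of_nonneg h1]
    calc _ ≤ C * q * rho := by gcongr
      _ = C * rho ^ 101 := by rw [hq]; ring
      _ ≤ _ := by have := P (i := 101) (by norm_num); gcongr
  have u1 : |h ^ 2| ≤ rho ^ 202 := by
    rw [abs_pow]
    calc _ ≤ (rho ^ 101) ^ 2 := by gcongr
      _ = _ := by ring
  have u2 : |(1 - 2 * p) * h| ≤ rho ^ 202 := by
    have a1 : |1 - 2 * p| ≤ 1 := by rw [abs_le]; constructor <;> linarith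
    rw [abs_mul]
    calc _ ≤ 1 * rho ^ 101 := by gcongr
      _ ≤ _ := by rw [one_mul]; exact P (by norm_num)
  have u3 : |n * s ^ 2| ≤ rho ^ 202 := by
    rw [abs_of_nonneg (by rw [hn]; positivity), hn2]
    calc _ ≤ rho ^ 200 * 1 := by gcongr; exact pow_le_one₀ hs.le hs1
      _ ≤ _ := by rw [mul_one]; exact P (by norm_num)
  have t2 : |h ^ 2 - (1 - 2 * p) * h - n * s ^ 2| ≤ 3 * rho ^ 202 := by
    rw [abs_le] at u1 u2 u3 ⊢; constructor <;> linarith [u1.1, u1.2, u2.1, u2.2, u3.1, u3.2]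
  have t3 : |W| ≤ D * rho ^ 202 := hW.trans (by have := P (i := 201) (by norm_num); gcongr)
  have t4 : |B * (h ^ 2 - (1 - 2 * p) * h - n * s ^ 2)| ≤ B * (3 * rho ^ 202) := by
    rw [abs_mul, abs_of_nonneg hB]; gcongr
  have t5 : |A * r| ≤ (D + C + 3 * B) * rho ^ 202 := by
    rw [e]; rw [abs_le] at t1 t3 t4 ⊢; constructor <;> linarith [t1.1, t1.2, t3.1, t3.2, t4.1, t4.2]
  have hA0 : 0 < A := by
    by_contra hcon
    push Not at hcon
    have := mul_nonpos_of_nonneg_of_nonpos (by linarith : 0 ≤ C) hcon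
    have : 0 < n := by rw [hn]; positivity
    linarith
  rw [abs_mul, abs_of_pos hA0] at t5
  have fin : rho ^ 200 * |r| ≤ rho ^ 200 * rho ^ 3 := by
    calc rho ^ 200 * |r| ≤ C * A * |r| := by rw [← hn2]; gcongr
      _ = C * (A * |r|) := by ring
      _ ≤ C * ((D + C + 3 * B) * rho ^ 202) := by gcongr
      _ = C * (D + C + 3 * B) * rho ^ 202 := by ring
      _ ≤ rho * rho ^ 202 := by gcongr
      _ = _ := by ring
  exact le_of_mul_le_mul_left fin (by positivity)
end Asm3
noncomputable section Asm4
variable {n k : ℕ} [NeZero n] {p : ℝ}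
variable (h0 : 0 < p) (h1 : p < 1)
theorem Ns_int (p : ℝ) (x : ZMod n → Bool) : ∃ N : ℤ, Blk.Ns p x = N - p * n := by
  refine ⟨((univ.filter fun u => x u = true).card : ℤ), ?_⟩
  unfold Blk.Ns xi
  rw [sum_sub_distrib, sum_const, card_univ, ZMod.card, sum_boole]
  push_cast; rw [nsmul_eq_mul]; ring
include h0 h1 in
theorem split_N (M : Finset ℤ) (Q B1 B2 : (ZMod n → Bool) → Prop) [DecidablePred Q] [DecidablePred B1] [DecidablePred B2]
    (hM : ∀ x, ∀ N : ℤ, Blk.Ns p x = N - p * n → Q x → ¬ B1 x → ¬ B2 x → N ∈ M) :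
    |Ex p (fun x : ZMod n → Bool => if Q x then (1 : ℝ) else 0) - ∑ m ∈ M, Ex p (fun x : ZMod n → Bool => if Blk.Ns p x = m - p * n ∧ Q x then (1 : ℝ) else 0)|
      ≤ Ex p (fun x : ZMod n → Bool => if B1 x then (1 : ℝ) else 0) + Ex p (fun x : ZMod n → Bool => if B2 x then (1 : ℝ) else 0) := by
  rw [← Ex_sum, ← Ex_sub, ← Ex_add]
  have key : ∀ x : ZMod n → Bool, ∃ N : ℤ, Blk.Ns p x = N - p * n ∧ (∑ m ∈ M, if Blk.Ns p x = m - p * n ∧ Q x then (1 : ℝ) else 0) = if N ∈ M ∧ Q x then 1 else 0 := by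
    intro x
    obtain ⟨N, hN⟩ := Ns_int (n := n) p x
    refine ⟨N, hN, ?_⟩
    have : ∀ m : ℤ, (Blk.Ns p x = m - p * n ∧ Q x) ↔ (N = m ∧ Q x) := by
      intro m; rw [hN]; constructor
      · rintro ⟨a, b⟩; exact ⟨by have : (N:ℝ) = m := by linarith
                                 exact_mod_cast this, b⟩
      · rintro ⟨a, b⟩; exact ⟨by rw [a], b⟩
    simp_rw [this]
    by_cases hQ : Q x
    · simp [hQ]
    · simp [hQ]
  rw [abs_of_nonneg]
  · refine Ex_mono h0.le h1.le fun x => ?_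
    obtain ⟨N, hN, hs⟩ := key x
    rw [hs]
    have := hM x N hN
    by_cases hQ : Q x <;> by_cases hB1 : B1 x <;> by_cases hB2 : B2 x <;> by_cases hNM : N ∈ M <;> simp [hQ, hB1, hB2, hNM] <;> first | (exact absurd (this hQ hB1 hB2) hNM) | norm_num
  · refine Ex_nonneg h0.le h1.le fun x => ?_
    obtain ⟨N, hN, hs⟩ := key x
    rw [hs]
    by_cases hQ : Q x <;> by_cases hNM : N ∈ M <;> simp [hQ, hNM]
theorem near_fin (y R : ℝ) (hR : 1 ≤ R) : ∃ M : Finset ℤ, (∀ m : ℤ, m ∈ M ↔ |m - y| ≤ R) ∧ (M.card : ℝ) ≤ 3 * R := by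
  refine ⟨Icc ⌈y - R⌉ ⌊y + R⌋, fun m => ?_, ?_⟩
  · rw [mem_Icc, Int.ceil_le, Int.le_floor, abs_le]; constructor <;> rintro ⟨a, b⟩ <;> constructor <;> linarith
  · rw [Int.card_Icc]
    have a := Int.floor_le (y + R)
    have b := Int.le_ceil (y - R)
    rcases le_total (⌊y + R⌋ + 1 - ⌈y - R⌉) 0 with h | h
    · rw [Int.toNat_of_nonpos h]; push_cast; linarith
    · have : (((⌊y + R⌋ + 1 - ⌈y - R⌉).toNat : ℤ) : ℝ) = ((⌊y + R⌋ + 1 - ⌈y - R⌉ : ℤ) : ℝ) := by rw [Int.toNat_of_nonneg h]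
      rw [Int.cast_natCast] at this
      rw [this]; push_cast; linarith
include h0 h1 in
theorem tails (hk : 3 ≤ k) : ∃ T : ℝ, 0 < T ∧ ∀ (n : ℕ) [NeZero n] (hg : n.gcd (k - 1).factorial = 1) (rho : ℝ), 1 ≤ rho → (n : ℝ) = (rho ^ 100) ^ 2 →
    (∀ Z : ℝ, 0 < Sg k n p → rho ≤ |Z| → Ex p (fun x : ZMod n → Bool => if (kAPcount k x : ℝ) = mu k n p + Sg k n p * Z then (1 : ℝ) else 0) ≤ T / rho ^ 512) ∧
    Ex p (fun x : ZMod n → Bool => if rho * rho ^ 100 ≤ |Blk.Ns p x| then (1 : ℝ) else 0) ≤ T / rho ^ 512 ∧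
    Ex p (fun x : ZMod n → Bool => if rho * (√(kap p k + CV k) * n) ≤ |(zb (n := n) p h0 h1 hk hg).W p x| then (1 : ℝ) else 0) ≤ T / rho ^ 512 := by
  have hkap := kap_pos h0 h1 hk
  have hCV := CV_pos hk
  have hs2 := s2_bd h0 h1
  refine ⟨hcC p 8 k + hcC p 8 1, add_pos (hcC_pos h0 h1 8 k) (hcC_pos h0 h1 8 1), ?_⟩
  intro n _ hg rho hr hn
  have hr0 : 0 < rho := by linarith
  have hn0 : (0:ℝ) < n := by rw [hn]; positivity
  have c1 := hcC_pos h0 h1 8 k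
  have c2 := hcC_pos h0 h1 8 1
  have snn : 0 ≤ Ex p (fun x : ZMod n → Bool => ((kAPcount k x : ℝ) - mu k n p) ^ 2) := Ex_nonneg h0.le h1.le fun x => sq_nonneg _
  refine ⟨fun Z hS hZ => ?_, ?_, ?_⟩
  · have := hyper_tail h0 h1 8 k (fun x : ZMod n → Bool => (kAPcount k x : ℝ) - mu k n p) (Deg_count h0 h1 hk hg) hS hr0 (by rw [Sg, sq_sqrt snn]) (fun x => (kAPcount k x : ℝ) = mu k n p + Sg k n p * Z)
      (by intro x hx; rw [hx, add_sub_cancel_left, abs_mul, abs_of_pos hS, mul_comm]; gcongr)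
    refine this.trans ?_
    norm_num; gcongr; linarith
  · have := hyper_tail h0 h1 8 1 (fun x : ZMod n → Bool => Blk.Ns p x) (Deg_Ns p) (v := rho ^ 100) (by positivity) hr0 (by rw [Ex_Ns_sq, ← hn]; nlinarith [hs2.2]) (fun x => rho * rho ^ 100 ≤ |Blk.Ns p x|) (fun x hx => hx)
    refine this.trans ?_
    norm_num; gcongr; linarith
  · have := hyper_tail h0 h1 8 k (fun x => (zb (n := n) p h0 h1 hk hg).W p x) (Deg_W h0 h1 hk hg) (v := √(kap p k + CV k) * n) (by positivity) hr0 (by rw [mul_pow, sq_sqrt (by linarith)]; exact W_sq_le h0 h1 hk hg) (fun x => rho * (√(kap p k + CV k) * n) ≤ |(zb (n := n) p h0 h1 hk hg).W p x|) (fun x hx => hx)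
    refine this.trans ?_
    norm_num; gcongr; linarith
end Asm4
noncomputable section Asm5
variable {k : ℕ} {p : ℝ}
theorem combine {M : Finset ℤ} {P S NZ Th x1 x2 x3 : ℝ} {f g : ℤ → ℝ} (hS : 0 ≤ S) (hN0 : 0 ≤ NZ) (hN1 : NZ ≤ 1) (h1 : |P - ∑ m ∈ M, f m| ≤ x1)
    (h2 : ∀ m ∈ M, |S * f m - NZ * g m| ≤ x2) (h3 : |Th - ∑ m ∈ M, g m| ≤ x3) : |S * P - NZ * Th| ≤ S * x1 + M.card * x2 + x3 := by
  have e : S * P - NZ * Th = S * (P - ∑ m ∈ M, f m) + (∑ m ∈ M, (S * f m - NZ * g m)) - NZ * (Th - ∑ m ∈ M, g m) := by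
    rw [sum_sub_distrib, ← mul_sum, ← mul_sum]; ring
  rw [e]
  refine (abs_sub _ _).trans (add_le_add ((abs_add_le _ _).trans (add_le_add ?_ ?_)) ?_)
  · rw [abs_mul, abs_of_nonneg hS]; gcongr
  · refine (abs_sum_le_sum_abs _ _).trans ((sum_le_sum h2).trans ?_)
    rw [sum_const, nsmul_eq_mul]
  · rw [abs_mul, abs_of_nonneg hN0]
    calc _ ≤ 1 * x3 := by gcongr
      _ = _ := one_mul _
theorem ax1 {Z r : ℝ} (hr : 1 ≤ r) (h : |Z| ≤ r) : |1 - Z ^ 2| ≤ r ^ 2 := by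
  have := sq_le_sq' (abs_le.mp h).1 (abs_le.mp h).2
  have := one_le_pow₀ (n := 2) hr
  have := sq_nonneg Z
  rw [abs_le]; constructor <;> linarith
theorem ax2 {t r : ℝ} (hr : 1 ≤ r) (h : r ≤ |t|) : r ≤ t ^ 2 := by
  rw [← sq_abs]; nlinarith
theorem ax3 {w t r : ℝ} (hr : 3 ≤ r) (hw : |w| ≤ r ^ 3 / 2) (h : r ^ 3 < |w - t|) : r ≤ |t| := by
  have := (abs_sub w t).trans' h.le
  have : 2 * r ≤ r ^ 3 := by nlinarith [sq_nonneg r]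
  linarith
set_option maxHeartbeats 1000000 in
theorem main_big (h0 : 0 < p) (h1 : p < 1) (hk : 3 ≤ k) : ∃ C : ℝ, 0 < C ∧ ∃ rho0 : ℝ, 1 ≤ rho0 ∧ ∀ (n : ℕ) [NeZero n] (hg : n.gcd (k - 1).factorial = 1) (rho : ℝ), rho0 ≤ rho →
    (n : ℝ) = rho ^ 200 → ∀ (z : ℤ) (Z : ℝ), Z = (z - mu k n p) / Sg k n p →
    |Sg k n p * Ex p (fun x : ZMod n → Bool => if (kAPcount k x : ℝ) = z then (1 : ℝ) else 0) - stdNormal Z * ∑' m : ℤ, (cK p k)⁻¹ * stdNormal ((p * n +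
      √(υ p) * Z * √n + (1 - p) * ((k : ℝ) - 1) * (1 - Z ^ 2) / 2 - m) / cK p k)| ≤ C / rho ^ 50 := by
  have hs2 := s2_bd h0 h1
  have hcp := cK_pos h0 h1 hk
  have hkap := kap_pos h0 h1 hk
  have hCV := CV_pos hk
  have hk0 : (3:ℝ) ≤ k := by exact_mod_cast hk
  obtain ⟨C1, hC1, n0, hn0, F⟩ := facts h0 h1 hk
  obtain ⟨C2, hC2, r2, hr2, L⟩ := loc_lim h0 h1 hk
  obtain ⟨C3, hC3, T⟩ := tails h0 h1 hk
  obtain ⟨C4, hC4, Th⟩ := theta hcp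
  set c := cK p k with hc
  set s := √(υ p) with hsd
  have hs : 0 < s := Real.sqrt_pos.mpr hs2.1
  have hss : s ^ 2 = υ p := sq_sqrt hs2.1.le
  have hs1 : s ≤ 1 := Real.sqrt_le_one.mpr hs2.2
  obtain ⟨C5, hC5, E5⟩ := exp_tail (c := 1 / (4 * c ^ 2)) (by positivity) 50
  obtain ⟨C6, hC6, E6⟩ := exp_tail (c := 1 / 2) (by norm_num) 50
  set B := BB k p with hB
  have hB0 : 0 ≤ B := by rw [hB]; unfold BB; have : (0:ℝ) ≤ (k:ℝ) - 1 := by linarith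
                         positivity
  set D := √(kap p k + CV k) with hD
  have hD0 : 0 ≤ D := Real.sqrt_nonneg _
  set C7 := C1 + c⁻¹ * s⁻¹ + c⁻¹ * ((C1 + 7 * B) * C1 + (1 + k) * C1) with hC7
  have hC10 : 0 < C1 := by linarith
  have hC70 : 0 < C7 := by positivity
  refine ⟨C1 * (2 * C3) + 3 * (C1 * C2 + C7) + C4 * C5 + C4 * C6, by positivity, n0 + r2 + C1 * (D + C1 + 3 * B) + k, ?_, ?_⟩
  · have : 0 ≤ C1 * (D + C1 + 3 * B) := by positivity
    linarith
  intro n _ hg rho hrho hn z Z hZd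
  have w1 : 0 ≤ C1 * (D + C1 + 3 * B) := by positivity
  have hr3 : 3 ≤ rho := by linarith
  have hr1 : 1 ≤ rho := by linarith
  have hr0 : 0 < rho := by linarith
  have hrk : (k:ℝ) ≤ rho := by linarith
  have hnr : rho ≤ n := by rw [hn]; exact le_self_pow₀ hr1 (by norm_num)
  have hq : √(n:ℝ) = rho ^ 100 := by rw [hn, show rho ^ 200 = (rho ^ 100) ^ 2 by ring, Real.sqrt_sq (by positivity)]
  have hn2 : (n:ℝ) = (rho ^ 100) ^ 2 := by rw [hn]; ring
  obtain ⟨f1, f2, f3, f4, f5, f6, f7, f8⟩ := F n hg (by linarith)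
  obtain ⟨-, L⟩ := L n hg rho (by linarith) hn
  obtain ⟨T1, T2, T3⟩ := T n hg rho hr1 hn2
  rw [hq] at f3 f5 f6 f8 ⊢
  set S := Sg k n p with hS
  set v := √(VV n h0 h1 hk hg) with hv
  have hz : (z:ℝ) = mu k n p + S * Z := by rw [hZd]; field_simp; ring
  obtain ⟨ths, tht⟩ := Th (p * n + s * Z * rho ^ 100 + (1 - p) * ((k : ℝ) - 1) * (1 - Z ^ 2) / 2)
  set y := p * n + s * Z * rho ^ 100 + (1 - p) * ((k : ℝ) - 1) * (1 - Z ^ 2) / 2 with hy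
  have f3' : S ≤ C1 * rho ^ 300 := by rw [hn] at f3; exact f3.trans (le_of_eq (by ring))
  have hpw : rho ^ 300 * (1 / rho ^ 512) ≤ 1 / rho ^ 50 := by
    rw [mul_one_div, div_le_div_iff₀ (by positivity) (by positivity), one_mul, ← pow_add]
    exact pow_le_pow_right₀ hr1 (by norm_num)
  have bigS : S * (C3 / rho ^ 512) ≤ C1 * C3 / rho ^ 50 := by
    calc _ ≤ C1 * rho ^ 300 * (C3 / rho ^ 512) := by gcongr
      _ = C1 * C3 * (rho ^ 300 * (1 / rho ^ 512)) := by ring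
      _ ≤ C1 * C3 * (1 / rho ^ 50) := by gcongr
      _ = _ := by ring
  have g1 : 0 < C1 * C3 / rho ^ 50 := by positivity
  have g2 : 0 < (C1 * C2 + C7) / rho ^ 50 := by positivity
  have g3 : 0 < C4 * C5 / rho ^ 50 := by positivity
  have g4 : 0 < C4 * C6 / rho ^ 50 := by positivity
  have esplit : (C1 * (2 * C3) + 3 * (C1 * C2 + C7) + C4 * C5 + C4 * C6) / rho ^ 50 = 2 * (C1 * C3 / rho ^ 50) + 3 * ((C1 * C2 + C7) / rho ^ 50) + C4 * C5 / rho ^ 50 + C4 * C6 / rho ^ 50 := by ring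
  rw [esplit]
  by_cases hZ : |Z| ≤ rho
  · obtain ⟨M, hM, hMc⟩ := near_fin (p * n + s * Z * rho ^ 100) (rho ^ 3) (one_le_pow₀ hr1)
    have hA := split_N h0 h1 M (fun x : ZMod n → Bool => (kAPcount k x : ℝ) = z) (fun x => rho * rho ^ 100 ≤ |Blk.Ns p x|) (fun x => rho * (D * n) ≤ |(zb (n := n) p h0 h1 hk hg).W p x|) (by
      intro x N hN hX hb1 hb2
      rw [hM]
      push Not at hb1 hb2
      have hdec := count_decomp h0 h1 hk hg x
      rw [hX, hz, ff_eq] at hdec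
      have := det_claim (C := C1) (D := D) (s := s) (S := S) (A := AA k n p) (B := B) (n := n) (p := p) (rho := rho) (h := Blk.Ns p x) (W := (zb (n := n) p h0 h1 hk hg).W p x) (r := N - (p * n + s * Z * rho ^ 100)) hC1 hD0 hs hs1 hB0 hr1 rfl hn2 f5 f6 hZ (by linarith) h0 h1 (by rw [hN]; ring) f2
        (hb1.le.trans (le_of_eq (by ring))) (hb2.le.trans (le_of_eq (by rw [hn]; ring))) (by rw [hss]; linarith)
      exact this)
    have hBt : ∀ m ∈ M, |S * Ex p (fun x : ZMod n → Bool => if Blk.Ns p x = m - p * n ∧ (kAPcount k x : ℝ) = z then (1 : ℝ) else 0) - stdNormal Z * (c⁻¹ * stdNormal ((y - m) / c))| ≤ C1 * C2 / rho ^ 90 + C7 / rho ^ 96 := by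
      intro m hm
      have hm := (hM m).mp hm
      have l := L m z
      have hrt : √((n:ℝ) * υ p) = s * rho ^ 100 := by
        rw [Real.sqrt_mul (by linarith), hq, mul_comm]
      rw [hrt] at l
      have t := term_approx (C := C1) (c := c) (s := s) (S := S) (A := AA k n p) (B := B) (v := v) (n := n) (p := p) (kk := k) (rho := rho) (h := m - p * n) (r := m - (p * n + s * Z * rho ^ 100)) hC1 hcp hs hs1 hB0 hr1 rfl hn2 f5 f6 hZ hm h0 h1
        (by rw [hB, hss]; unfold AA BB
            rw [show k - 1 = (k - 2) + 1 by omega, pow_succ]; ring) (by ring) (by linarith) f1 f7 f8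
      have e1 : AA k n p * (m - p * n) + B * ((m - p * n) ^ 2 - (1 - 2 * p) * (m - p * n) - n * s ^ 2) - S * Z = ff k n p (m - p * n) - z := by
        rw [ff_eq, hz, hss]; ring
      have e2 : -((m:ℝ) - (p * n + s * Z * rho ^ 100) + (1 - p) * (k - 1) * (Z ^ 2 - 1) / 2) = y - m := by rw [hy]; ring
      rw [e1, e2] at t
      have l' := mul_le_mul_of_nonneg_left l f4.le
      rw [← abs_of_pos f4, ← abs_mul, abs_of_pos f4, mul_sub] at l'
      refine (abs_sub_le _ _ _).trans (add_le_add (l'.trans ?_) t)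
      calc S * (C2 / rho ^ 390) ≤ C1 * rho ^ 300 * (C2 / rho ^ 390) := by gcongr
        _ = _ := by rw [show rho ^ 390 = rho ^ 300 * rho ^ 90 by ring]; field_simp
    have hCt := tht M (C5 / rho ^ 50) (by
      intro m hm
      rw [hM] at hm
      push Not at hm
      refine le_trans (exp_le_exp.mpr ?_) (E5 rho hr0)
      have b1 : |(1 - p) * ((k : ℝ) - 1) * (1 - Z ^ 2) / 2| ≤ rho ^ 3 / 2 := by
        rw [abs_div, abs_mul, abs_of_nonneg (mul_nonneg (by linarith) (by linarith)), abs_of_pos (by norm_num : (0:ℝ) < 2)]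
        gcongr
        have a1 : |1 - Z ^ 2| ≤ rho ^ 2 := ax1 hr1 hZ
        calc _ ≤ (1 * rho) * rho ^ 2 := by gcongr <;> linarith
          _ = _ := by ring
      have b2 : rho ≤ |y - m| := by
        have e : (m:ℝ) - (p * n + s * Z * rho ^ 100) = (1 - p) * ((k : ℝ) - 1) * (1 - Z ^ 2) / 2 - (y - m) := by rw [hy]; ring
        rw [e] at hm
        exact ax3 hr3 b1 hm
      have b3 : rho ≤ (y - m) ^ 2 := ax2 hr1 b2
      have : 0 < 1 / (4 * c ^ 2) := by positivity
      exact neg_le_neg (mul_le_mul_of_nonneg_left b3 this.le))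
    refine (combine f4.le (stdN_nonneg Z) ((le_abs_self _).trans (stdN_abs Z)) (hA.trans (add_le_add T2 T3)) hBt hCt).trans ?_
    have k1 : S * (C3 / rho ^ 512 + C3 / rho ^ 512) ≤ 2 * (C1 * C3 / rho ^ 50) := by rw [mul_add]; linarith
    have k2 : (M.card : ℝ) * (C1 * C2 / rho ^ 90 + C7 / rho ^ 96) ≤ 3 * ((C1 * C2 + C7) / rho ^ 50) := by
      have j1 : C1 * C2 / rho ^ 90 ≤ C1 * C2 / rho ^ 53 := by gcongr <;> norm_num [hr1]
      have j2 : C7 / rho ^ 96 ≤ C7 / rho ^ 53 := by gcongr <;> norm_num [hr1]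
      calc _ ≤ 3 * rho ^ 3 * (C1 * C2 / rho ^ 53 + C7 / rho ^ 53) := by gcongr
        _ = _ := by rw [show rho ^ 53 = rho ^ 3 * rho ^ 50 by ring]; field_simp
    have k3 : C4 * (C5 / rho ^ 50) = C4 * C5 / rho ^ 50 := by ring
    linarith
  · push Not at hZ
    have hP := T1 Z f4 hZ.le
    rw [← hz] at hP
    have hP0 : 0 ≤ Ex p (fun x : ZMod n → Bool => if (kAPcount k x : ℝ) = z then (1 : ℝ) else 0) := Ex_nonneg h0.le h1.le fun x => by split_ifs <;> norm_num
    have hth := tht ∅ 1 (by intro m _; apply exp_le_one_iff.mpr; have : 0 ≤ 1 / (4 * c ^ 2) * (y - m) ^ 2 := by positivity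
                            linarith)
    rw [sum_empty, sub_zero, mul_one] at hth
    have hNZ : stdNormal Z ≤ C6 / rho ^ 50 := by
      have a : stdNormal Z ≤ exp (-(1 / 2 * rho)) := by
        unfold stdNormal
        have h : (√(2 * π))⁻¹ ≤ 1 := by
          rw [inv_le_one₀ (by positivity)]; apply le_sqrt_of_sq_le; linarith [pi_gt_three]
        have b : exp (-(Z ^ 2) / 2) ≤ exp (-(1 / 2 * rho)) := by
          apply exp_le_exp.mpr
          have : rho ≤ Z ^ 2 := ax2 hr1 hZ.le
          linarith
        calc _ ≤ 1 * exp (-(1 / 2 * rho)) := by gcongr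
          _ = _ := one_mul _
      exact a.trans (E6 rho hr0)
    refine (abs_sub _ _).trans ?_
    rw [abs_mul, abs_mul, abs_of_pos f4, abs_of_nonneg hP0, abs_of_nonneg (stdN_nonneg Z)]
    have j1 := mul_le_mul_of_nonneg_left hP f4.le
    have j2 := mul_le_mul hNZ hth (abs_nonneg _) (by positivity)
    have k3 : C6 / rho ^ 50 * C4 = C4 * C6 / rho ^ 50 := by ring
    linarith
end Asm5
noncomputable section Fin
variable {k : ℕ} {p : ℝ}
variable (h0 : 0 < p) (h1 : p < 1) (hk : 3 ≤ k)
include h0 h1 hk in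
theorem lim_part : Filter.Tendsto
    (fun n : ℕ => kAPprimeSigma k p n * Real.sqrt (n * υ p) / kAPSigma k p n)
    (Filter.atTop ⊓ Filter.principal {n : ℕ | Nat.gcd n (Nat.factorial (k - 1)) = 1}) (nhds (cK p k)) := by
  obtain ⟨C, hC, n0, hn0, F⟩ := facts h0 h1 hk
  have hcp := cK_pos h0 h1 hk
  suffices h : Tendsto (fun n : ℕ => (kAPprimeSigma k p n * Real.sqrt (n * υ p) / kAPSigma k p n)⁻¹)
      (Filter.atTop ⊓ Filter.principal {n : ℕ | Nat.gcd n (Nat.factorial (k - 1)) = 1}) (nhds (cK p k)⁻¹) by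
    have := h.inv₀ (inv_ne_zero hcp.ne')
    simpa using this
  rw [tendsto_iff_norm_sub_tendsto_zero]
  have hlim : Tendsto (fun n : ℕ => C / (n:ℝ)) (Filter.atTop ⊓ Filter.principal {n : ℕ | Nat.gcd n (Nat.factorial (k - 1)) = 1}) (nhds 0) :=
    (tendsto_const_div_atTop_nhds_zero_nat C).mono_left inf_le_left
  refine squeeze_zero' (Eventually.of_forall fun _ => norm_nonneg _) ?_ hlim
  rw [eventually_inf_principal]
  filter_upwards [eventually_ge_atTop (max 1 ⌈n0⌉₊)] with n hn hg
  have hn1 : 1 ≤ n := (le_max_left _ _).trans hn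
  have hn2 : n0 ≤ n := (Nat.le_ceil n0).trans (by exact_mod_cast (le_max_right _ _).trans hn)
  haveI : NeZero n := ⟨by omega⟩
  have hg' : n.gcd (k - 1).factorial = 1 := hg
  obtain ⟨-, -, -, -, -, -, -, f⟩ := F n hg' hn2
  rw [norm_eq_abs]
  have e : (kAPprimeSigma k p n * Real.sqrt (n * υ p) / kAPSigma k p n)⁻¹ = Sg k n p / (√(υ p) * √n * √(VV n h0 h1 hk hg')) := by
    rw [sig_prime h0 h1 hk hg', sig_count h0 h1 hk hg', inv_div, Real.sqrt_mul (Nat.cast_nonneg n)]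
    show Sg k n p / _ = _
    congr 1
    show √(VV n h0 h1 hk hg') * _ = _
    ring
  rw [e]; exact f
include h0 h1 hk in
theorem main_part {ε : ℝ} (hε : 0 < ε) : ∃ C : ℝ, 0 < C ∧ ∀ (n : ℕ) [NeZero n] (hg : n.gcd (k - 1).factorial = 1) (z : ℤ) (Z : ℝ), Z = (z - mu k n p) / Sg k n p →
    |Sg k n p * Ex p (fun x : ZMod n → Bool => if (kAPcount k x : ℝ) = z then (1 : ℝ) else 0) - stdNormal Z * ∑' m : ℤ, (cK p k)⁻¹ * stdNormal ((p * n +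
      √(υ p) * Z * √n + (1 - p) * ((k : ℝ) - 1) * (1 - Z ^ 2) / 2 - m) / cK p k)| ≤ C * (n : ℝ) ^ (ε - 1 / 4) := by
  obtain ⟨C0, hC0, r0, hr0, H⟩ := main_big h0 h1 hk
  obtain ⟨S, hS, Th⟩ := theta (cK_pos h0 h1 hk)
  set N : ℕ := ⌈r0 ^ 200⌉₊ with hN
  have hN1 : (1:ℝ) ≤ N := (one_le_pow₀ hr0).trans (Nat.le_ceil _)
  have hsum : ∀ n, 0 ≤ kAPSigma k p n := fun n => by unfold kAPSigma; split_ifs <;> first | exact le_rfl | exact Real.sqrt_nonneg _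
  set Q : ℝ := ∑ n ∈ range (N + 1), kAPSigma k p n with hQ
  have hQ0 : 0 ≤ Q := sum_nonneg fun n _ => hsum n
  refine ⟨C0 + (Q + S) * N, by positivity, ?_⟩
  intro n _ hg z Z hZ
  have hn1 : (1:ℝ) ≤ n := by exact_mod_cast NeZero.one_le
  have hn0 : (0:ℝ) < n := by linarith
  have hmono : (n:ℝ) ^ (-(1/4):ℝ) ≤ (n:ℝ) ^ (ε - 1 / 4) := Real.rpow_le_rpow_of_exponent_le hn1 (by linarith)
  have hpos : 0 < (n:ℝ) ^ (-(1/4):ℝ) := Real.rpow_pos_of_pos hn0 _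
  refine le_trans ?_ (mul_le_mul_of_nonneg_left hmono (by positivity))
  by_cases hb : r0 ^ 200 ≤ n
  · have hr : r0 ≤ (n:ℝ) ^ (1 / 200 : ℝ) := by
      have := Real.rpow_le_rpow (by positivity) hb (show (0:ℝ) ≤ 1 / 200 by norm_num)
      rwa [← Real.rpow_natCast, ← Real.rpow_mul (by linarith), show ((200:ℕ):ℝ) * (1 / 200) = 1 by norm_num, Real.rpow_one] at this
    have := H n hg ((n:ℝ) ^ (1 / 200 : ℝ)) hr (by
      rw [← Real.rpow_natCast, ← Real.rpow_mul hn0.le, show (1 / 200 : ℝ) * ((200:ℕ):ℝ) = 1 by norm_num, Real.rpow_one]) z Z hZ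
    refine this.trans ?_
    have e : C0 / ((n:ℝ) ^ (1 / 200 : ℝ)) ^ 50 = C0 * (n:ℝ) ^ (-(1/4):ℝ) := by
      rw [← Real.rpow_natCast, ← Real.rpow_mul hn0.le, Real.rpow_neg hn0.le, div_eq_mul_inv]; norm_num
    rw [e]
    gcongr
    have : 0 ≤ (Q + S) * N := by positivity
    linarith
  · push Not at hb
    have hnN : (n:ℝ) ≤ N := hb.le.trans (Nat.le_ceil _)
    have hSg : Sg k n p ≤ Q := by
      have e : Sg k n p = kAPSigma k p n := (sig_count h0 h1 hk hg).symm
      rw [e]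
      exact single_le_sum (f := fun n => kAPSigma k p n) (fun i _ => hsum i) (mem_range.mpr (Nat.lt_succ_of_le (by exact_mod_cast hnN)))
    have hS0 : 0 ≤ Sg k n p := Real.sqrt_nonneg _
    have hP0 : 0 ≤ Ex p (fun x : ZMod n → Bool => if (kAPcount k x : ℝ) = z then (1 : ℝ) else 0) := Ex_nonneg h0.le h1.le fun x => by split_ifs <;> norm_num
    have hP1 : Ex p (fun x : ZMod n → Bool => if (kAPcount k x : ℝ) = z then (1 : ℝ) else 0) ≤ 1 := Ex_le_const h0.le h1.le fun x => by split_ifs <;> norm_num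
    have hth := (Th (p * n + √(υ p) * Z * √n + (1 - p) * ((k : ℝ) - 1) * (1 - Z ^ 2) / 2)).2 ∅ 1 (by
      intro m _; apply exp_le_one_iff.mpr; exact neg_nonpos.mpr (by positivity))
    rw [sum_empty, sub_zero, mul_one] at hth
    refine (abs_sub _ _).trans ?_
    rw [abs_mul, abs_mul, abs_of_nonneg hS0, abs_of_nonneg hP0]
    have a1 := mul_le_mul hSg hP1 hP0 hQ0
    have a2 := mul_le_mul (stdN_abs Z) hth (abs_nonneg _) (by norm_num)
    have a3 : 1 ≤ N * (n:ℝ) ^ (-(1/4):ℝ) := by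
      have : (n:ℝ) ^ (-1:ℝ) ≤ (n:ℝ) ^ (-(1/4):ℝ) := Real.rpow_le_rpow_of_exponent_le hn1 (by norm_num)
      rw [Real.rpow_neg_one] at this
      calc (1:ℝ) = n * (n:ℝ)⁻¹ := (mul_inv_cancel₀ hn0.ne').symm
        _ ≤ _ := by gcongr
    calc _ ≤ (Q + S) * 1 := by linarith
      _ ≤ (Q + S) * (N * (n:ℝ) ^ (-(1/4):ℝ)) := by gcongr
      _ ≤ _ := by have : 0 ≤ C0 * (n:ℝ) ^ (-(1/4):ℝ) := by positivity
                  linarith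
end Fin
end KAP
theorem kAP_local_limit_independent_model
    (k : ℕ) (hk : 3 ≤ k) (lam : ℝ) (hlam : lam ∈ Set.Ioo (0 : ℝ) (1 / 2)) :
    ∀ p ∈ Set.Ioo lam (1 - lam),
      ∃ Ckp : ℝ, 0 < Ckp ∧
        Filter.Tendsto
          (fun n : ℕ => kAPprimeSigma k p n * Real.sqrt (n * (p * (1 - p))) / kAPSigma k p n)
          (Filter.atTop ⊓ Filter.principal {n : ℕ | Nat.gcd n (Nat.factorial (k - 1)) = 1})
          (nhds Ckp) ∧
        ∀ ε : ℝ, 0 < ε → ∃ C : ℝ, 0 < C ∧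
          ∀ (n : ℕ) [NeZero n], Nat.gcd n (Nat.factorial (k - 1)) = 1 →
            let μ := bernoulliPi (ZMod n) p
            let X : (ZMod n → Bool) → ℝ := fun x => (kAPcount k x : ℝ)
            let μk := ∫ x, X x ∂μ
            let σk := Real.sqrt (∫ x, (X x - μk) ^ 2 ∂μ)
            ∀ zint : ℤ,
              |σk * (μ {x | X x = (zint : ℝ)}).toReal -
                  stdNormal (((zint : ℝ) - μk) / σk) *
                    ∑' mm : ℤ, Ckp⁻¹ *
                      stdNormal ((p * n +
                        Real.sqrt (p * (1 - p)) * (((zint : ℝ) - μk) / σk) * Real.sqrt n +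
                        (1 - p) * ((k : ℝ) - 1) * (1 - (((zint : ℝ) - μk) / σk) ^ 2) / 2 -
                        (mm : ℝ)) / Ckp)|
                ≤ C * (n : ℝ) ^ (ε - 1 / 4) := by
  intro p hp
  have h0 : 0 < p := hlam.1.trans hp.1
  have h1 : p < 1 := by have := hp.2; have := hlam.1; linarith
  refine ⟨KAP.cK p k, KAP.cK_pos h0 h1 hk, KAP.lim_part h0 h1 hk, fun ε hε => ?_⟩
  obtain ⟨C, hC, H⟩ := KAP.main_part h0 h1 hk hε
  refine ⟨C, hC, fun n _ hg => ?_⟩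
  intro μ X μk σk zint
  have e1 : μk = KAP.mu k n p := (KAP.bridge_int h0 h1 _).trans (KAP.Ex_count h0 h1 hk hg)
  have e2 : σk = KAP.Sg k n p := by
    show Real.sqrt _ = _
    rw [e1]
    exact congrArg Real.sqrt (KAP.bridge_int h0 h1 _)
  have e3 : (μ {x | X x = (zint : ℝ)}).toReal = KAP.Ex p (fun x : ZMod n → Bool => if (kAPcount k x : ℝ) = zint then (1 : ℝ) else 0) := KAP.bridge_set h0 h1 _
  rw [e1, e2, e3]
  exact H n hg zint _ rfl
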